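/- Let q ≥ 3 be an integer and let β(n) = β_s(q) − ξ(n) where ξ(n) > 0, ξ(n) → 0 and n^{2/3} ξ(n) → ∞ as n → ∞. Then there exists a constant α₂ = α₂(q) > 0 such that the Glauber dynamics with inverse temperature β(n) exhibits cutoff at time α₁(β(n),q) n log n + α₂ n/√(ξ(n)) with window w(n) = n + n^{1/2} ξ(n)^{−5/4}: for every ε ∈ (0,1/2) there exists γ = γ(ε) > 0 such that for all sufficiently large n, t_mix(ε)(n) ≤ α₁(β(n),q) n log n + α₂ n/√(ξ(n)) + γ w(n) and t_mix(1−ε)(n) ≥ α₁(β(n),q) n log n + α₂ n/√(ξ(n)) − γ w(n). -/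

import Mathlib

open Finset Filter

/-- The (unnormalized) Curie–Weiss Potts weight of a configuration
`σ : Fin n → Fin q` at inverse temperature `β`:
`exp((β/n) * Σ_{u,v} 1[σ u = σ v])`. -/
noncomputable def pottsWeight (q n : ℕ) (β : ℝ) (σ : Fin n → Fin q) : ℝ :=
  Real.exp ((β / (n : ℝ)) * ∑ u : Fin n, ∑ v : Fin n, if σ u = σ v then (1 : ℝ) else 0)

/-- The Curie–Weiss Potts probability measure `μ_n` on configurations. -/
noncomputable def pottsMeasure (q n : ℕ) (β : ℝ) (σ : Fin n → Fin q) : ℝ :=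
  pottsWeight q n β σ / ∑ τ : Fin n → Fin q, pottsWeight q n β τ

/-- The transition matrix `P_n` of the Glauber dynamics: pick a uniform vertex `u`
and resample its color according to the conditional Potts distribution given the
colors of all other vertices. -/
noncomputable def glauberKernel (q n : ℕ) (β : ℝ) :
    Matrix (Fin n → Fin q) (Fin n → Fin q) ℝ :=
  fun σ τ =>
    (1 / (n : ℝ)) * ∑ u : Fin n,
      if ∀ v : Fin n, v ≠ u → τ v = σ v then
        pottsMeasure q n β τ / ∑ k : Fin q, pottsMeasure q n β (Function.update σ u k)
      else 0

/-- Total-variation distance between two (probability) functions on a finite set: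
`max_{A ⊆ S} |ν(A) − ν'(A)|`. -/
noncomputable def tvDist {S : Type*} [Fintype S] (ν ν' : S → ℝ) : ℝ :=
  ⨆ A : Finset S, |∑ x ∈ A, ν x - ∑ x ∈ A, ν' x|

/-- Worst-case total-variation distance to stationarity after `t` steps:
`d_t(n) = max_{σ₀} ‖P_n^t(σ₀,·) − μ_n‖_TV`. -/
noncomputable def glauberDist (q n : ℕ) (β : ℝ) (t : ℕ) : ℝ :=
  ⨆ σ₀ : Fin n → Fin q,
    tvDist (fun τ => (glauberKernel q n β ^ t) σ₀ τ) (pottsMeasure q n β)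

/-- The `ε`-mixing time `t_mix(ε)(n) = inf {t : d_t(n) ≤ ε}`. -/
noncomputable def mixingTime (q n : ℕ) (β : ℝ) (ε : ℝ) : ℕ :=
  sInf {t : ℕ | glauberDist q n β t ≤ ε}

/-- The drift function `D_β(x) = −x + (1 + (q−1) e^{2β(1−qx)/(q−1)})⁻¹`. -/
noncomputable def Dfun (q : ℕ) (β x : ℝ) : ℝ :=
  -x + (1 + ((q : ℝ) - 1) * Real.exp (2 * β * (1 - (q : ℝ) * x) / ((q : ℝ) - 1)))⁻¹

/-- The dynamical (spinodal) critical inverse temperature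
`β_s(q) = sup {β ≥ 0 : D_β(x) ≠ 0 for all x ∈ (1/q,1)}`. -/
noncomputable def betaS (q : ℕ) : ℝ :=
  sSup {β : ℝ | 0 ≤ β ∧ ∀ x ∈ Set.Ioo (1 / (q : ℝ)) 1, Dfun q β x ≠ 0}

/-- The constant `α₁(β,q) = 1/(2(1 − 2β/q))`. -/
noncomputable def alpha1 (β : ℝ) (q : ℕ) : ℝ := 1 / (2 * (1 - 2 * β / (q : ℝ)))

/-- The static critical inverse temperature `β_c(q) = (q−1)log(q−1)/(q−2)`
for `q ≥ 3`, with `β_c(2) = 1`. -/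
noncomputable def betaC (q : ℕ) : ℝ :=
  if q = 2 then 1 else ((q : ℝ) - 1) * Real.log ((q : ℝ) - 1) / ((q : ℝ) - 2)


open Finset Filter

/-- number of vertices of colour `k`. -/
noncomputable def cn {q n : ℕ} (σ : Fin n → Fin q) (k : Fin q) : ℝ :=
  ∑ v, if σ v = k then (1 : ℝ) else 0

/-- number of vertices other than `u` of colour `k`. -/
noncomputable def cx {q n : ℕ} (σ : Fin n → Fin q) (u : Fin n) (k : Fin q) : ℝ :=
  cn σ k - if σ u = k then (1 : ℝ) else 0

/-- update probability. -/
noncomputable def prb (q n : ℕ) (β : ℝ) (σ : Fin n → Fin q) (u : Fin n) (k : Fin q) : ℝ :=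
  Real.exp (2 * β / n * cx σ u k) / ∑ l, Real.exp (2 * β / n * cx σ u l)

/-- The averaging operator of the dynamics. -/
noncomputable def PP (q n : ℕ) (β : ℝ) (f : (Fin n → Fin q) → ℝ) : (Fin n → Fin q) → ℝ :=
  fun σ => (1 / (n : ℝ)) * ∑ u, ∑ k, prb q n β σ u k * f (Function.update σ u k)

/-- integration against the Potts measure -/
noncomputable def MU (q n : ℕ) (β : ℝ) (f : (Fin n → Fin q) → ℝ) : ℝ :=
  ∑ σ, pottsMeasure q n β σ * f σ

lemma cn_update {q n : ℕ} (σ : Fin n → Fin q) (u : Fin n) (j k : Fin q) :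
    cn (Function.update σ u j) k = cx σ u k + if j = k then (1 : ℝ) else 0 := by
  unfold cx cn
  rw [← Finset.add_sum_erase _ _ (Finset.mem_univ u)]
  rw [← Finset.add_sum_erase univ (fun v => if σ v = k then (1:ℝ) else 0) (Finset.mem_univ u)]
  have : ∑ x ∈ univ.erase u, (if Function.update σ u j x = k then (1:ℝ) else 0)
      = ∑ x ∈ univ.erase u, (if σ x = k then (1:ℝ) else 0) := by
    apply Finset.sum_congr rfl
    intro x hx
    rw [Function.update_of_ne (Finset.ne_of_mem_erase hx)]
  rw [this]
  simp
  ring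

lemma cx_update_self {q n : ℕ} (σ : Fin n → Fin q) (u : Fin n) (j k : Fin q) :
    cx (Function.update σ u j) u k = cx σ u k := by
  have := cn_update σ u j k
  conv_lhs => unfold cx
  rw [this]; simp

lemma prb_update_self {q n : ℕ} (β : ℝ) (σ : Fin n → Fin q) (u : Fin n) (j k : Fin q) :
    prb q n β (Function.update σ u j) u k = prb q n β σ u k := by
  unfold prb; simp [cx_update_self]

lemma sum_pairs {q n : ℕ} (σ : Fin n → Fin q) :
    (∑ u : Fin n, ∑ v : Fin n, if σ u = σ v then (1 : ℝ) else 0) = ∑ k, cn σ k ^ 2 := by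
  have h : ∀ u v : Fin n, (if σ u = σ v then (1 : ℝ) else 0)
      = ∑ k, (if σ u = k then (1:ℝ) else 0) * (if σ v = k then (1:ℝ) else 0) := by
    intro u v
    simp [eq_comm]
  simp_rw [h]
  have : ∀ u : Fin n, ∑ v : Fin n, ∑ k, (if σ u = k then (1:ℝ) else 0) * (if σ v = k then (1:ℝ) else 0)
      = ∑ k, (if σ u = k then (1:ℝ) else 0) * cn σ k := by
    intro u
    rw [Finset.sum_comm]
    simp_rw [← Finset.mul_sum]
    rfl
  simp_rw [this]
  rw [Finset.sum_comm]
  simp_rw [← Finset.sum_mul, sq]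
  rfl

lemma weight_update {q n : ℕ} (β : ℝ) (σ : Fin n → Fin q) (u : Fin n) (k : Fin q) :
    pottsWeight q n β (Function.update σ u k)
      = Real.exp (β / n * (∑ l, cx σ u l ^ 2 + 1)) * Real.exp (2 * β / n * cx σ u k) := by
  unfold pottsWeight
  rw [sum_pairs, ← Real.exp_add]
  congr 1
  simp_rw [cn_update]
  have : ∀ l, (cx σ u l + if k = l then (1:ℝ) else 0) ^ 2
      = cx σ u l ^ 2 + (if k = l then (2 * cx σ u l + 1) else 0) := by
    intro l; split_ifs <;> ring
  simp_rw [this, Finset.sum_add_distrib]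
  simp
  ring

lemma Z_pos {q n : ℕ} (β : ℝ) (hq : 0 < q) : 0 < ∑ τ : Fin n → Fin q, pottsWeight q n β τ := by
  have : Nonempty (Fin q) := ⟨⟨0, hq⟩⟩
  apply Finset.sum_pos
  · intro i _; exact Real.exp_pos _
  · exact Finset.univ_nonempty

lemma pm_pos {q n : ℕ} (β : ℝ) (hq : 0 < q) (σ : Fin n → Fin q) : 0 < pottsMeasure q n β σ :=
  div_pos (Real.exp_pos _) (Z_pos β hq)

lemma pm_sum {q n : ℕ} (β : ℝ) (hq : 0 < q) : ∑ σ, pottsMeasure q n β σ = 1 := by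
  unfold pottsMeasure
  rw [← Finset.sum_div]
  exact div_self (Z_pos β hq).ne'

lemma den_pos {q n : ℕ} (β : ℝ) (hq : 0 < q) (σ : Fin n → Fin q) (u : Fin n) :
    0 < ∑ l, Real.exp (2 * β / n * cx σ u l) := by
  have : Nonempty (Fin q) := ⟨⟨0, hq⟩⟩
  exact Finset.sum_pos (fun i _ => Real.exp_pos _) Finset.univ_nonempty

lemma prb_eq {q n : ℕ} (β : ℝ) (hq : 0 < q) (σ : Fin n → Fin q) (u : Fin n) (k : Fin q) :
    pottsMeasure q n β (Function.update σ u k) /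
      ∑ l : Fin q, pottsMeasure q n β (Function.update σ u l) = prb q n β σ u k := by
  unfold pottsMeasure prb
  have hZ := (Z_pos (n := n) β hq).ne'
  rw [← Finset.sum_div, div_div_div_cancel_right₀ hZ]
  simp_rw [weight_update]
  rw [← Finset.mul_sum, mul_div_mul_left _ _ (Real.exp_pos _).ne']

lemma prb_pos {q n : ℕ} (β : ℝ) (hq : 0 < q) (σ : Fin n → Fin q) (u : Fin n) (k : Fin q) :
    0 < prb q n β σ u k := div_pos (Real.exp_pos _) (den_pos β hq σ u)

lemma prb_sum {q n : ℕ} (β : ℝ) (hq : 0 < q) (σ : Fin n → Fin q) (u : Fin n) :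
    ∑ k, prb q n β σ u k = 1 := by
  unfold prb
  rw [← Finset.sum_div]
  exact div_self (den_pos β hq σ u).ne'

lemma sum_agree {q n : ℕ} (σ : Fin n → Fin q) (u : Fin n) (g : (Fin n → Fin q) → ℝ) :
    (∑ τ : Fin n → Fin q, if ∀ v : Fin n, v ≠ u → τ v = σ v then g τ else 0)
      = ∑ k, g (Function.update σ u k) := by
  rw [← Finset.sum_filter]
  symm
  apply Finset.sum_nbij' (fun k => Function.update σ u k) (fun τ => τ u)
  · intro k _
    simp only [Finset.mem_filter, Finset.mem_univ, true_and]
    intro v hv; rw [Function.update_of_ne hv]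
  · intro τ _; simp
  · intro k _; simp
  · intro τ hτ
    simp only [Finset.mem_filter, Finset.mem_univ, true_and] at hτ
    funext v
    by_cases h : v = u
    · subst h; simp
    · rw [Function.update_of_ne h, hτ v h]
  · intro k _; rfl

lemma kernel_mulVec {q n : ℕ} (β : ℝ) (hq : 0 < q) (f : (Fin n → Fin q) → ℝ) :
    (glauberKernel q n β).mulVec f = PP q n β f := by
  funext σ
  unfold Matrix.mulVec dotProduct glauberKernel PP
  simp_rw [mul_assoc, Finset.sum_mul]
  rw [← Finset.mul_sum, Finset.sum_comm]
  congr 1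
  apply Finset.sum_congr rfl
  intro u _
  simp_rw [ite_mul, zero_mul]
  rw [sum_agree σ u (fun τ => pottsMeasure q n β τ /
      (∑ l : Fin q, pottsMeasure q n β (Function.update σ u l)) * f τ)]
  simp_rw [prb_eq β hq]

lemma kernel_pow_mulVec {q n : ℕ} (β : ℝ) (hq : 0 < q) (t : ℕ) (f : (Fin n → Fin q) → ℝ) :
    (glauberKernel q n β ^ t).mulVec f = (PP q n β)^[t] f := by
  induction t generalizing f with
  | zero => simp
  | succ t ih =>
    rw [pow_succ, ← Matrix.mulVec_mulVec, kernel_mulVec β hq, ih, Function.iterate_succ_apply]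

section
variable {q n : ℕ} {β : ℝ}

lemma PP_add (f g : (Fin n → Fin q) → ℝ) : PP q n β (fun σ => f σ + g σ) = fun σ => PP q n β f σ + PP q n β g σ := by
  funext σ; unfold PP
  simp_rw [mul_add, Finset.sum_add_distrib]; ring

lemma PP_smul (c : ℝ) (f : (Fin n → Fin q) → ℝ) : PP q n β (fun σ => c * f σ) = fun σ => c * PP q n β f σ := by
  funext σ; unfold PP
  have : ∀ u k, prb q n β σ u k * (c * f (Function.update σ u k)) = c * (prb q n β σ u k * f (Function.update σ u k)) := by
    intros; ring
  simp_rw [this, ← Finset.mul_sum]; ring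

lemma PP_sub (f g : (Fin n → Fin q) → ℝ) : PP q n β (fun σ => f σ - g σ) = fun σ => PP q n β f σ - PP q n β g σ := by
  have h1 : (fun σ => f σ - g σ) = fun σ => f σ + (-1) * g σ := by funext σ; ring
  rw [h1, PP_add f (fun σ => (-1) * g σ), PP_smul]; funext σ; ring

lemma PP_const (hq : 0 < q) (hn : 0 < n) (c : ℝ) : PP q n β (fun _ => c) = fun _ => c := by
  funext σ; unfold PP
  simp_rw [← Finset.sum_mul, prb_sum β hq]
  have : (n:ℝ) ≠ 0 := by positivity
  simp; field_simp

lemma PP_sum {ι : Type*} (s : Finset ι) (f : ι → (Fin n → Fin q) → ℝ) :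
    PP q n β (fun σ => ∑ i ∈ s, f i σ) = fun σ => ∑ i ∈ s, PP q n β (f i) σ := by
  classical
  induction s using Finset.induction_on with
  | empty => funext σ; simp [PP]
  | insert a s ha ih =>
    simp_rw [Finset.sum_insert ha]
    rw [PP_add (f a) (fun σ => ∑ i ∈ s, f i σ), ih]

/-- local monotonicity: only neighbours matter. -/
lemma PP_mono_at (hq : 0 < q) {f g : (Fin n → Fin q) → ℝ} (σ : Fin n → Fin q)
    (h : ∀ u k, f (Function.update σ u k) ≤ g (Function.update σ u k)) :
    PP q n β f σ ≤ PP q n β g σ := by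
  unfold PP
  apply mul_le_mul_of_nonneg_left _ (by positivity)
  apply Finset.sum_le_sum; intro u _
  apply Finset.sum_le_sum; intro k _
  exact mul_le_mul_of_nonneg_left (h u k) (prb_pos β hq σ u k).le

lemma PP_mono (hq : 0 < q) {f g : (Fin n → Fin q) → ℝ} (h : ∀ σ, f σ ≤ g σ) (σ : Fin n → Fin q) :
    PP q n β f σ ≤ PP q n β g σ := PP_mono_at hq σ (fun _ _ => h _)

lemma PP_le_const_at (hq : 0 < q) (hn : 0 < n) {f : (Fin n → Fin q) → ℝ} {c : ℝ} (σ : Fin n → Fin q)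
    (h : ∀ u k, f (Function.update σ u k) ≤ c) : PP q n β f σ ≤ c := by
  have := PP_mono_at (β := β) hq (f := f) (g := fun _ => c) σ h
  rwa [PP_const hq hn] at this

lemma PP_ge_const_at (hq : 0 < q) (hn : 0 < n) {f : (Fin n → Fin q) → ℝ} {c : ℝ} (σ : Fin n → Fin q)
    (h : ∀ u k, c ≤ f (Function.update σ u k)) : c ≤ PP q n β f σ := by
  have := PP_mono_at (β := β) hq (f := fun _ => c) (g := f) σ h
  rwa [PP_const hq hn] at this

lemma PPt_mono (hq : 0 < q) (t : ℕ) {f g : (Fin n → Fin q) → ℝ} (h : ∀ σ, f σ ≤ g σ) (σ : Fin n → Fin q) :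
    (PP q n β)^[t] f σ ≤ (PP q n β)^[t] g σ := by
  induction t generalizing f g with
  | zero => exact h σ
  | succ t ih => simp only [Function.iterate_succ_apply]; exact ih (fun σ => PP_mono hq h σ)

lemma PPt_add (t : ℕ) (f g : (Fin n → Fin q) → ℝ) :
    (PP q n β)^[t] (fun σ => f σ + g σ) = fun σ => (PP q n β)^[t] f σ + (PP q n β)^[t] g σ := by
  induction t generalizing f g with
  | zero => rfl
  | succ t ih => simp only [Function.iterate_succ_apply]; rw [PP_add, ih]

lemma PPt_smul (t : ℕ) (c : ℝ) (f : (Fin n → Fin q) → ℝ) :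
    (PP q n β)^[t] (fun σ => c * f σ) = fun σ => c * (PP q n β)^[t] f σ := by
  induction t generalizing f with
  | zero => rfl
  | succ t ih => simp only [Function.iterate_succ_apply]; rw [PP_smul, ih]

lemma PPt_const (hq : 0 < q) (hn : 0 < n) (t : ℕ) (c : ℝ) :
    (PP q n β)^[t] (fun _ => c) = fun _ => c := by
  induction t with
  | zero => rfl
  | succ t ih => simp only [Function.iterate_succ_apply]; rw [PP_const hq hn, ih]

lemma PPt_sub (t : ℕ) (f g : (Fin n → Fin q) → ℝ) :
    (PP q n β)^[t] (fun σ => f σ - g σ) = fun σ => (PP q n β)^[t] f σ - (PP q n β)^[t] g σ := by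
  have h1 : (fun σ => f σ - g σ) = fun σ => f σ + (-1) * g σ := by funext σ; ring
  rw [h1, PPt_add t f (fun σ => (-1) * g σ), PPt_smul]; funext σ; ring

lemma PPt_sum {ι : Type*} (t : ℕ) (s : Finset ι) (f : ι → (Fin n → Fin q) → ℝ) :
    (PP q n β)^[t] (fun σ => ∑ i ∈ s, f i σ) = fun σ => ∑ i ∈ s, (PP q n β)^[t] (f i) σ := by
  induction t generalizing f with
  | zero => rfl
  | succ t ih => simp only [Function.iterate_succ_apply]; rw [PP_sum, ih]

lemma PPt_succ' (t : ℕ) (f : (Fin n → Fin q) → ℝ) :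
    (PP q n β)^[t + 1] f = PP q n β ((PP q n β)^[t] f) := Function.iterate_succ_apply' _ _ _

lemma PPt_nonneg (hq : 0 < q) (hn : 0 < n) (t : ℕ) {f : (Fin n → Fin q) → ℝ} (h : ∀ σ, 0 ≤ f σ) (σ : Fin n → Fin q) :
    0 ≤ (PP q n β)^[t] f σ := by
  have := PPt_mono (β := β) hq t (f := fun _ => 0) (g := f) h σ
  rwa [PPt_const hq hn] at this

lemma PPt_le_const (hq : 0 < q) (hn : 0 < n) (t : ℕ) {f : (Fin n → Fin q) → ℝ} {c : ℝ} (h : ∀ σ, f σ ≤ c) (σ : Fin n → Fin q) :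
    (PP q n β)^[t] f σ ≤ c := by
  have := PPt_mono (β := β) hq t (f := f) (g := fun _ => c) h σ
  rwa [PPt_const hq hn] at this

/-- stationarity -/
lemma MU_PP (hq : 0 < q) (hn : 0 < n) (f : (Fin n → Fin q) → ℝ) :
    MU q n β (PP q n β f) = MU q n β f := by
  unfold MU
  -- symmetric form
  have key : ∀ u : Fin n, ∑ σ, pottsMeasure q n β σ * ∑ k, prb q n β σ u k * f (Function.update σ u k)
      = ∑ σ, pottsMeasure q n β σ * f σ := by
    intro u
    have e1 : ∀ σ : Fin n → Fin q, pottsMeasure q n β σ * ∑ k, prb q n β σ u k * f (Function.update σ u k)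
       = ∑ τ : Fin n → Fin q, if ∀ v : Fin n, v ≠ u → τ v = σ v then
          pottsMeasure q n β σ * (prb q n β σ u (τ u) * f τ) else 0 := by
      intro σ
      rw [sum_agree σ u (fun τ => pottsMeasure q n β σ * (prb q n β σ u (τ u) * f τ)), Finset.mul_sum]
      simp
    simp_rw [e1]
    rw [Finset.sum_comm]
    apply Finset.sum_congr rfl
    intro τ _
    have e2 : ∀ σ : Fin n → Fin q, (if ∀ v : Fin n, v ≠ u → τ v = σ v then
          pottsMeasure q n β σ * (prb q n β σ u (τ u) * f τ) else 0)
        = if ∀ v : Fin n, v ≠ u → σ v = τ v then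
          pottsMeasure q n β τ * (prb q n β τ u (σ u) * f τ) else 0 := by
      intro σ
      by_cases h : ∀ v : Fin n, v ≠ u → τ v = σ v
      · have h' : ∀ v : Fin n, v ≠ u → σ v = τ v := fun v hv => (h v hv).symm
        rw [if_pos h, if_pos h']
        have hu1 : Function.update σ u (τ u) = τ := by
          funext v; by_cases hv : v = u
          · subst hv; simp
          · rw [Function.update_of_ne hv, h v hv]
        have hu2 : Function.update τ u (σ u) = σ := by
          funext v; by_cases hv : v = u
          · subst hv; simp
          · rw [Function.update_of_ne hv, h v hv]
        have hu3 : ∀ l, Function.update σ u l = Function.update τ u l := by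
          intro l; rw [← hu1]; simp
        rw [← prb_eq β hq, ← prb_eq β hq, hu1, hu2]
        simp_rw [hu3]
        ring
      · have h' : ¬ ∀ v : Fin n, v ≠ u → σ v = τ v := fun h2 => h (fun v hv => (h2 v hv).symm)
        rw [if_neg h, if_neg h']
    simp_rw [e2]
    rw [sum_agree τ u (fun σ => pottsMeasure q n β τ * (prb q n β τ u (σ u) * f τ))]
    simp_rw [Function.update_self, ← Finset.mul_sum, ← Finset.sum_mul, prb_sum β hq, one_mul]
  unfold PP
  have : ∀ σ, pottsMeasure q n β σ * (1 / (n:ℝ) * ∑ u, ∑ k, prb q n β σ u k * f (Function.update σ u k))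
     = ∑ u, (1 / (n:ℝ)) * (pottsMeasure q n β σ * ∑ k, prb q n β σ u k * f (Function.update σ u k)) := by
    intro σ; rw [Finset.mul_sum, Finset.mul_sum]; apply Finset.sum_congr rfl; intros; ring
  simp_rw [this]
  rw [Finset.sum_comm]
  simp_rw [← Finset.mul_sum, key]
  have : (n:ℝ) ≠ 0 := by positivity
  simp; field_simp

lemma MU_PPt (hq : 0 < q) (hn : 0 < n) (t : ℕ) (f : (Fin n → Fin q) → ℝ) :
    MU q n β ((PP q n β)^[t] f) = MU q n β f := by
  induction t with
  | zero => rfl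
  | succ t ih => rw [PPt_succ', MU_PP hq hn, ih]

lemma MU_mono (hq : 0 < q) {f g : (Fin n → Fin q) → ℝ} (h : ∀ σ, f σ ≤ g σ) : MU q n β f ≤ MU q n β g :=
  Finset.sum_le_sum fun σ _ => mul_le_mul_of_nonneg_left (h σ) (pm_pos β hq σ).le

lemma MU_const (hq : 0 < q) (c : ℝ) : MU q n β (fun _ => c) = c := by
  unfold MU; rw [← Finset.sum_mul, pm_sum β hq, one_mul]

lemma MU_add (f g : (Fin n → Fin q) → ℝ) : MU q n β (fun σ => f σ + g σ) = MU q n β f + MU q n β g := by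
  unfold MU; simp_rw [mul_add, Finset.sum_add_distrib]

lemma MU_smul (c : ℝ) (f : (Fin n → Fin q) → ℝ) : MU q n β (fun σ => c * f σ) = c * MU q n β f := by
  unfold MU; rw [Finset.mul_sum]; apply Finset.sum_congr rfl; intros; ring

lemma tv_bdd (q n : ℕ) (ν ν' : (Fin n → Fin q) → ℝ) :
    BddAbove (Set.range fun A : Finset (Fin n → Fin q) => |∑ x ∈ A, ν x - ∑ x ∈ A, ν' x|) :=
  Set.Finite.bddAbove (Set.finite_range _)

open Classical in
lemma kernel_set (hq : 0 < q) (t : ℕ) (A : Finset (Fin n → Fin q)) (σ : Fin n → Fin q) :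
    ∑ τ ∈ A, (glauberKernel q n β ^ t) σ τ = (PP q n β)^[t] (fun τ => if τ ∈ A then 1 else 0) σ := by
  rw [← kernel_pow_mulVec β hq]
  simp [Matrix.mulVec, dotProduct]

open Classical in
lemma MU_set (A : Finset (Fin n → Fin q)) :
    ∑ τ ∈ A, pottsMeasure q n β τ = MU q n β (fun τ => if τ ∈ A then 1 else 0) := by
  simp [MU]

open Classical in
lemma glauberDist_le (hq : 0 < q) (t : ℕ) (ε : ℝ)
    (h : ∀ (f : (Fin n → Fin q) → ℝ), (∀ τ, 0 ≤ f τ) → (∀ τ, f τ ≤ 1) → ∀ σ,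
      |(PP q n β)^[t] f σ - MU q n β f| ≤ ε) : glauberDist q n β t ≤ ε := by
  have : Nonempty (Fin q) := ⟨⟨0, hq⟩⟩
  unfold glauberDist
  apply ciSup_le; intro σ
  unfold tvDist
  apply ciSup_le; intro A
  simp only []
  rw [kernel_set hq, MU_set]
  apply h
  · intro τ; split_ifs <;> norm_num
  · intro τ; split_ifs <;> norm_num

open Classical in
lemma le_glauberDist (hq : 0 < q) (t : ℕ) (A : Finset (Fin n → Fin q)) (σ : Fin n → Fin q) :
    (PP q n β)^[t] (fun τ => if τ ∈ A then 1 else 0) σ - MU q n β (fun τ => if τ ∈ A then 1 else 0)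
      ≤ glauberDist q n β t := by
  rw [← kernel_set hq, ← MU_set]
  refine (le_abs_self _).trans ?_
  refine (le_ciSup (tv_bdd q n (fun τ => (glauberKernel q n β ^ t) σ τ) (pottsMeasure q n β)) A).trans ?_
  exact le_ciSup (f := fun σ₀ => tvDist (fun τ => (glauberKernel q n β ^ t) σ₀ τ) (pottsMeasure q n β))
    (Set.Finite.bddAbove (Set.finite_range _)) σ

open Classical in
lemma abs_le_glauberDist (hq : 0 < q) (t : ℕ) (A : Finset (Fin n → Fin q)) (σ : Fin n → Fin q) :
    |(PP q n β)^[t] (fun τ => if τ ∈ A then 1 else 0) σ - MU q n β (fun τ => if τ ∈ A then 1 else 0)|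
      ≤ glauberDist q n β t := by
  rw [← kernel_set hq, ← MU_set]
  refine (le_ciSup (tv_bdd q n (fun τ => (glauberKernel q n β ^ t) σ τ) (pottsMeasure q n β)) A).trans ?_
  exact le_ciSup (f := fun σ₀ => tvDist (fun τ => (glauberKernel q n β ^ t) σ₀ τ) (pottsMeasure q n β))
    (Set.Finite.bddAbove (Set.finite_range _)) σ

open Classical in
lemma glauberDist_succ_le (hq : 0 < q) (hn : 0 < n) (t : ℕ) :
    glauberDist q n β (t + 1) ≤ glauberDist q n β t := by
  have : Nonempty (Fin q) := ⟨⟨0, hq⟩⟩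
  conv_lhs => unfold glauberDist
  apply ciSup_le; intro σ
  unfold tvDist
  apply ciSup_le; intro A
  simp only []
  rw [kernel_set hq, MU_set, PPt_succ']
  have h := fun τ => abs_le.mp (abs_le_glauberDist (β := β) hq t A τ)
  rw [abs_le]
  constructor
  · have := PP_ge_const_at (β := β) hq hn (f := (PP q n β)^[t] (fun τ => if τ ∈ A then 1 else 0))
      (c := MU q n β (fun τ => if τ ∈ A then 1 else 0) - glauberDist q n β t) σ
      (fun u k => by linarith [(h (Function.update σ u k)).1])
    linarith
  · have := PP_le_const_at (β := β) hq hn (f := (PP q n β)^[t] (fun τ => if τ ∈ A then 1 else 0))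
      (c := MU q n β (fun τ => if τ ∈ A then 1 else 0) + glauberDist q n β t) σ
      (fun u k => by linarith [(h (Function.update σ u k)).2])
    linarith

lemma glauberDist_anti (hq : 0 < q) (hn : 0 < n) : Antitone (glauberDist q n β) :=
  antitone_nat_of_succ_le (glauberDist_succ_le hq hn)

end

open Finset Filter

/-- weighted colour counts -/
noncomputable def cw {q n : ℕ} (c : Fin n → ℝ) (σ : Fin n → Fin q) (k : Fin q) : ℝ :=
  ∑ v, c v * if σ v = k then (1 : ℝ) else 0

/-- proportions -/
noncomputable def SS {q n : ℕ} (σ : Fin n → Fin q) (k : Fin q) : ℝ := cn σ k / n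

/-- softmax -/
noncomputable def soft {q : ℕ} (β : ℝ) (s : Fin q → ℝ) (k : Fin q) : ℝ :=
  Real.exp (2 * β * s k) / ∑ l, Real.exp (2 * β * s l)

/-- test function for lower bounds -/
noncomputable def gg (y : ℝ) : ℝ := Real.sqrt (1 + y ^ 2) - y

lemma gg_nonneg (y : ℝ) : 0 ≤ gg y := by
  unfold gg
  have : y ≤ Real.sqrt (1 + y ^ 2) := Real.le_sqrt_of_sq_le (by linarith)
  linarith

lemma gg_ge_one {y : ℝ} (h : y ≤ 0) : 1 ≤ gg y := by
  unfold gg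
  have : 1 ≤ Real.sqrt (1 + y ^ 2) := by
    rw [Real.one_le_sqrt]; nlinarith [sq_nonneg y]
  linarith

lemma gg_anti : Antitone gg := by
  intro x y h
  unfold gg
  have hx : |x| ≤ Real.sqrt (1 + x ^ 2) := Real.le_sqrt_of_sq_le (by rw [sq_abs]; linarith)
  have h1 : 0 < Real.sqrt (1 + x ^ 2) := Real.sqrt_pos.mpr (by positivity)
  have h2 : Real.sqrt (1 + y ^ 2) ≤ Real.sqrt (1 + x ^ 2) + (y - x) := by
    rw [Real.sqrt_le_left (by linarith)]
    have e := Real.sq_sqrt (show 0 ≤ 1 + x ^ 2 by positivity)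
    have := le_abs_self x
    nlinarith
  linarith

lemma gg_le {y : ℝ} (h : 0 < y) : gg y ≤ 1 / (2 * y) := by
  unfold gg
  have : Real.sqrt (1 + y ^ 2) ≤ y + 1 / (2 * y) := by
    rw [Real.sqrt_le_left (by positivity)]
    have : (y + 1 / (2 * y)) ^ 2 = y ^ 2 + 1 + (1 / (2 * y)) ^ 2 := by field_simp; ring
    rw [this]; nlinarith [sq_nonneg (1 / (2 * y))]
  linarith

lemma gg_le_abs (y : ℝ) : gg y ≤ 1 + 2 * |y| := by
  unfold gg
  have : Real.sqrt (1 + y ^ 2) ≤ 1 + |y| := by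
    rw [Real.sqrt_le_left (by positivity)]
    nlinarith [sq_abs y, abs_nonneg y]
  linarith [neg_abs_le y]

lemma gg_step (x y : ℝ) :
    gg y ≤ gg x + (x / Real.sqrt (1 + x ^ 2) - 1) * (y - x) + (y - x) ^ 2 / 2 := by
  unfold gg
  set s := Real.sqrt (1 + x ^ 2) with hs
  have h1 : 1 ≤ s := by rw [hs, Real.one_le_sqrt]; nlinarith [sq_nonneg x]
  have e : s ^ 2 = 1 + x ^ 2 := Real.sq_sqrt (by positivity)
  have e2 := Real.sq_sqrt (show 0 ≤ 1 + y ^ 2 by positivity)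
  have hy := Real.sqrt_nonneg (1 + y ^ 2)
  set r := Real.sqrt (1 + y ^ 2)
  have h2 : r ≤ s + x / s * (y - x) + (y - x) ^ 2 / 2 := by
    have h3 : r ≤ s + (r ^ 2 - s ^ 2) / (2 * s) := by
      have : s + (r ^ 2 - s ^ 2) / (2 * s) - r = (r - s) ^ 2 / (2 * s) := by field_simp; ring
      have : 0 ≤ (r - s) ^ 2 / (2 * s) := by positivity
      linarith
    have h4 : (r ^ 2 - s ^ 2) / (2 * s) = x / s * (y - x) + (y - x) ^ 2 / (2 * s) := by
      rw [e, e2]; field_simp; ring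
    have h5 : (y - x) ^ 2 / (2 * s) ≤ (y - x) ^ 2 / 2 := by
      apply div_le_div_of_nonneg_left (sq_nonneg _) (by norm_num) (by linarith)
    linarith
  linarith

section
variable {q n : ℕ} {β : ℝ}

lemma PP_affine (hq : 0 < q) (hn : 0 < n) (a b : ℝ) (f g : (Fin n → Fin q) → ℝ) (c : ℝ) (σ : Fin n → Fin q) :
    PP q n β (fun τ => a * f τ + b * g τ + c) σ = a * PP q n β f σ + b * PP q n β g σ + c := by
  rw [PP_add (fun τ => a * f τ + b * g τ) (fun _ => c), PP_add (fun τ => a * f τ) (fun τ => b * g τ),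
    PP_smul, PP_smul, PP_const hq hn]

lemma PP_exp (hq : 0 < q) (hn : 0 < n) (Y : (Fin n → Fin q) → ℝ) (σ : Fin n → Fin q) {η : ℝ} (hη : η ≤ 1)
    (h : ∀ u k, |Y (Function.update σ u k) - Y σ| ≤ η) :
    PP q n β (fun τ => Real.exp (Y τ)) σ ≤ Real.exp (Y σ) * (1 + (PP q n β Y σ - Y σ) + η ^ 2) := by
  have := PP_mono_at (β := β) hq (f := fun τ => Real.exp (Y τ))
    (g := fun τ => Real.exp (Y σ) * Y τ + 0 * Y τ + Real.exp (Y σ) * (1 - Y σ + η ^ 2)) σ (by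
      intro u k
      have h1 := h u k
      set z := Y (Function.update σ u k) - Y σ with hz
      have h2 := Real.abs_exp_sub_one_sub_id_le (h1.trans hη)
      have h3 : z ^ 2 ≤ η ^ 2 := by rw [← sq_abs]; exact pow_le_pow_left₀ (abs_nonneg _) h1 2
      have h4 : Real.exp z ≤ 1 + z + η ^ 2 := by linarith [(abs_le.mp h2).2]
      have h5 : Y (Function.update σ u k) = Y σ + z := by rw [hz]; ring
      rw [h5, Real.exp_add]
      nlinarith [Real.exp_pos (Y σ), mul_le_mul_of_nonneg_left h4 (Real.exp_pos (Y σ)).le])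
  rw [PP_affine hq hn] at this
  linarith

lemma PP_gg (hq : 0 < q) (hn : 0 < n) (Y : (Fin n → Fin q) → ℝ) (σ : Fin n → Fin q) (y : ℝ) {η b : ℝ} (hb : 0 ≤ b)
    (h : ∀ u k, |Y (Function.update σ u k) - y| ≤ η) (hd : -b ≤ PP q n β Y σ - y) :
    PP q n β (fun τ => gg (Y τ)) σ ≤ gg y + 2 * b + η ^ 2 / 2 := by
  set c := y / Real.sqrt (1 + y ^ 2) - 1 with hc
  have := PP_mono_at (β := β) hq (f := fun τ => gg (Y τ))
    (g := fun τ => c * Y τ + 0 * Y τ + (gg y - c * y + η ^ 2 / 2)) σ (by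
      intro u k
      have h1 := h u k
      have h3 : (Y (Function.update σ u k) - y) ^ 2 ≤ η ^ 2 := by
        rw [← sq_abs]; exact pow_le_pow_left₀ (abs_nonneg _) h1 2
      have h4 := gg_step y (Y (Function.update σ u k))
      rw [← hc] at h4
      linarith)
  rw [PP_affine hq hn] at this
  have hs : 0 < Real.sqrt (1 + y ^ 2) := Real.sqrt_pos.mpr (by positivity)
  have hy : |y| ≤ Real.sqrt (1 + y ^ 2) := Real.le_sqrt_of_sq_le (by rw [sq_abs]; linarith)
  have h1 : c ≤ 0 := by
    rw [hc, sub_nonpos, div_le_one hs]; exact (le_abs_self y).trans hy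
  have h2 : -2 ≤ c := by
    have : -1 ≤ y / Real.sqrt (1 + y ^ 2) := by
      rw [le_div_iff₀ hs]; linarith [neg_abs_le y]
    linarith
  nlinarith

lemma cw_update (c : Fin n → ℝ) (σ : Fin n → Fin q) (u : Fin n) (j k : Fin q) :
    cw c (Function.update σ u j) k
      = cw c σ k + c u * ((if j = k then (1 : ℝ) else 0) - if σ u = k then (1 : ℝ) else 0) := by
  unfold cw
  rw [← Finset.add_sum_erase _ _ (Finset.mem_univ u)]
  rw [← Finset.add_sum_erase univ (fun v => c v * if σ v = k then (1:ℝ) else 0) (Finset.mem_univ u)]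
  have : ∑ x ∈ univ.erase u, (c x * if Function.update σ u j x = k then (1:ℝ) else 0)
      = ∑ x ∈ univ.erase u, (c x * if σ x = k then (1:ℝ) else 0) := by
    apply Finset.sum_congr rfl
    intro x hx
    rw [Function.update_of_ne (Finset.ne_of_mem_erase hx)]
  rw [this, Function.update_self]
  split_ifs <;> ring

lemma PP_cw (hq : 0 < q) (hn : 0 < n) (c : Fin n → ℝ) (σ : Fin n → Fin q) (k : Fin q) :
    PP q n β (fun τ => cw c τ k) σ
      = cw c σ k + (1 / (n:ℝ)) * (∑ u, c u * prb q n β σ u k - cw c σ k) := by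
  unfold PP
  simp_rw [cw_update]
  have e : ∀ u, ∑ j, prb q n β σ u j * (cw c σ k + c u * ((if j = k then (1 : ℝ) else 0) - if σ u = k then (1 : ℝ) else 0))
      = cw c σ k + c u * prb q n β σ u k - c u * (if σ u = k then (1:ℝ) else 0) := by
    intro u
    have : ∀ j, prb q n β σ u j * (cw c σ k + c u * ((if j = k then (1 : ℝ) else 0) - if σ u = k then (1 : ℝ) else 0))
      = prb q n β σ u j * (cw c σ k - c u * (if σ u = k then (1:ℝ) else 0)) + c u * (if j = k then prb q n β σ u j else 0) := by
      intro j; split_ifs <;> ring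
    simp_rw [this, Finset.sum_add_distrib, ← Finset.sum_mul, ← Finset.mul_sum, prb_sum β hq]
    simp
    ring
  simp_rw [e, Finset.sum_sub_distrib, Finset.sum_add_distrib]
  have hn' : (n:ℝ) ≠ 0 := by positivity
  have : ∑ u, c u * (if σ u = k then (1:ℝ) else 0) = cw c σ k := rfl
  rw [this]
  simp
  field_simp
  ring

lemma cn_eq_cw (σ : Fin n → Fin q) (k : Fin q) : cn σ k = cw (fun _ => 1) σ k := by
  simp [cn, cw]

lemma cn_nonneg (σ : Fin n → Fin q) (k : Fin q) : 0 ≤ cn σ k := by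
  unfold cn; apply Finset.sum_nonneg; intros; split_ifs <;> norm_num

lemma cn_sum (σ : Fin n → Fin q) : ∑ k, cn σ k = n := by
  unfold cn; rw [Finset.sum_comm]; simp

lemma SS_nonneg (σ : Fin n → Fin q) (k : Fin q) : 0 ≤ SS σ k := div_nonneg (cn_nonneg _ _) (by positivity)

lemma SS_sum (hn : 0 < n) (σ : Fin n → Fin q) : ∑ k, SS σ k = 1 := by
  unfold SS; rw [← Finset.sum_div, cn_sum]; exact div_self (by positivity)

lemma SS_le_one (hn : 0 < n) (σ : Fin n → Fin q) (k : Fin q) : SS σ k ≤ 1 := by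
  rw [← SS_sum hn σ]
  exact Finset.single_le_sum (f := fun k => SS σ k) (fun i _ => SS_nonneg σ i) (Finset.mem_univ k)

lemma SS_update (σ : Fin n → Fin q) (u : Fin n) (j k : Fin q) :
    SS (Function.update σ u j) k
      = SS σ k + (1 / (n:ℝ)) * ((if j = k then (1 : ℝ) else 0) - if σ u = k then (1 : ℝ) else 0) := by
  unfold SS; rw [cn_eq_cw, cn_eq_cw, cw_update]; ring

lemma cn_update_abs (σ : Fin n → Fin q) (u : Fin n) (j k : Fin q) :
    |cn (Function.update σ u j) k - cn σ k| ≤ 1 := by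
  rw [cn_eq_cw, cn_eq_cw, cw_update]
  split_ifs <;> simp

lemma SS_update_abs (σ : Fin n → Fin q) (u : Fin n) (j k : Fin q) :
    |SS (Function.update σ u j) k - SS σ k| ≤ 1 / n := by
  have := cn_update_abs σ u j k
  unfold SS; rw [← sub_div, abs_div, abs_of_nonneg (show (0:ℝ) ≤ n by positivity)]
  exact div_le_div_of_nonneg_right this (by positivity)

lemma PP_SS (hq : 0 < q) (hn : 0 < n) (σ : Fin n → Fin q) (k : Fin q) :
    PP q n β (fun τ => SS τ k) σ
      = SS σ k + (1 / (n:ℝ)) * ((1 / (n:ℝ)) * ∑ u, prb q n β σ u k - SS σ k) := by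
  have : (fun τ : Fin n → Fin q => SS τ k) = fun τ => (1 / (n:ℝ)) * cw (fun _ => 1) τ k := by
    funext τ; unfold SS; rw [cn_eq_cw]; ring
  rw [this, PP_smul]
  show (1/(n:ℝ)) * PP q n β (fun τ => cw (fun _ => 1) τ k) σ = _
  rw [PP_cw hq hn]
  unfold SS; rw [cn_eq_cw]; simp only [one_mul]; ring

lemma exp_sub_one_le {x : ℝ} : Real.exp x - 1 ≤ x * Real.exp x := by
  have h := Real.add_one_le_exp (-x)
  have h2 : Real.exp (-x) * Real.exp x = 1 := by rw [← Real.exp_add]; simp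
  nlinarith [Real.exp_pos x]

/-- ratio bounds for softmax-like quotients -/
lemma ratio_abs {q : ℕ} (a b : Fin q → ℝ) (δ : ℝ) (hδ : 0 ≤ δ)
    (h1 : ∀ k, b k ≤ a k + δ) (h2 : ∀ k, a k ≤ b k + δ) (k : Fin q) :
    Real.exp (b k) / ∑ l, Real.exp (b l) ≤ Real.exp (2 * δ) * (Real.exp (a k) / ∑ l, Real.exp (a l)) := by
  have hA : 0 < ∑ l, Real.exp (a l) := Finset.sum_pos (fun i _ => Real.exp_pos _) ⟨k, Finset.mem_univ k⟩
  have hB : 0 < ∑ l, Real.exp (b l) := Finset.sum_pos (fun i _ => Real.exp_pos _) ⟨k, Finset.mem_univ k⟩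
  rw [← mul_div_assoc, div_le_div_iff₀ hB hA]
  have e1 : Real.exp (b k) ≤ Real.exp δ * Real.exp (a k) := by
    rw [← Real.exp_add]; exact Real.exp_le_exp.mpr (by linarith [h1 k])
  have e2 : ∑ l, Real.exp (a l) ≤ Real.exp δ * ∑ l, Real.exp (b l) := by
    rw [Finset.mul_sum]; apply Finset.sum_le_sum; intro l _
    rw [← Real.exp_add]; exact Real.exp_le_exp.mpr (by linarith [h2 l])
  calc Real.exp (b k) * ∑ l, Real.exp (a l) ≤ (Real.exp δ * Real.exp (a k)) * (Real.exp δ * ∑ l, Real.exp (b l)) :=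
        mul_le_mul e1 e2 hA.le (by positivity)
    _ = Real.exp (2 * δ) * Real.exp (a k) * ∑ l, Real.exp (b l) := by
        rw [two_mul, Real.exp_add]; ring

lemma quot_le_one {q : ℕ} (a : Fin q → ℝ) (k : Fin q) : Real.exp (a k) / ∑ l, Real.exp (a l) ≤ 1 := by
  have hA : 0 < ∑ l, Real.exp (a l) := Finset.sum_pos (fun i _ => Real.exp_pos _) ⟨k, Finset.mem_univ k⟩
  rw [div_le_one hA]
  exact Finset.single_le_sum (f := fun l => Real.exp (a l)) (fun i _ => (Real.exp_pos _).le) (Finset.mem_univ k)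

lemma quot_diff {q : ℕ} (a b : Fin q → ℝ) (δ : ℝ) (hδ : 0 ≤ δ)
    (h1 : ∀ k, b k ≤ a k + δ) (h2 : ∀ k, a k ≤ b k + δ) (k : Fin q) :
    |Real.exp (b k) / ∑ l, Real.exp (b l) - Real.exp (a k) / ∑ l, Real.exp (a l)| ≤ 2 * δ * Real.exp (2 * δ) := by
  have r1 := ratio_abs a b δ hδ h1 h2 k
  have r2 := ratio_abs b a δ hδ h2 h1 k
  have o1 := quot_le_one a k
  have o2 := quot_le_one b k
  have e := exp_sub_one_le (x := 2 * δ)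
  have e1 : 1 ≤ Real.exp (2 * δ) := Real.one_le_exp (by linarith)
  rw [abs_le]; constructor <;> nlinarith

lemma prb_le_one (hq : 0 < q) (σ : Fin n → Fin q) (u : Fin n) (k : Fin q) : prb q n β σ u k ≤ 1 :=
  quot_le_one (fun l => 2 * β / n * cx σ u l) k

lemma cx_nonneg (σ : Fin n → Fin q) (u : Fin n) (k : Fin q) : 0 ≤ cx σ u k := by
  have h := cn_update σ u k k
  have h2 := cn_update σ u (σ u) k
  rw [Function.update_eq_self] at h2
  unfold cx
  split_ifs with hk
  · unfold cn
    have := Finset.single_le_sum (f := fun v => if σ v = k then (1:ℝ) else 0) (fun i _ => by split_ifs <;> norm_num) (Finset.mem_univ u)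
    simp only [hk, if_true] at this
    linarith
  · simp [cn_nonneg]

lemma cx_le (σ : Fin n → Fin q) (u : Fin n) (k : Fin q) : cx σ u k ≤ cn σ k := by
  unfold cx; split_ifs <;> linarith

lemma cn_le (σ : Fin n → Fin q) (k : Fin q) : cn σ k ≤ n := by
  rw [← cn_sum σ]
  exact Finset.single_le_sum (f := fun k => cn σ k) (fun i _ => cn_nonneg σ i) (Finset.mem_univ k)

lemma prb_lower (hq : 0 < q) (hn : 0 < n) (hβ : 0 ≤ β) (hβq : 2 * β ≤ q) (σ : Fin n → Fin q) (u : Fin n) (k : Fin q) :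
    1 / (q * Real.exp q) ≤ prb q n β σ u k := by
  unfold prb
  have hn' : (0:ℝ) < n := by positivity
  have h1 : 1 ≤ Real.exp (2 * β / n * cx σ u k) := Real.one_le_exp (mul_nonneg (by positivity) (cx_nonneg _ _ _))
  have h2 : ∑ l, Real.exp (2 * β / n * cx σ u l) ≤ q * Real.exp q := by
    calc ∑ l, Real.exp (2 * β / n * cx σ u l) ≤ ∑ l : Fin q, Real.exp q := by
          apply Finset.sum_le_sum; intro l _
          apply Real.exp_le_exp.mpr
          calc 2 * β / n * cx σ u l ≤ 2 * β / n * n := by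
                apply mul_le_mul_of_nonneg_left ((cx_le _ _ _).trans (cn_le _ _)) (by positivity)
            _ = 2 * β := by field_simp
            _ ≤ q := hβq
      _ = q * Real.exp q := by simp
  exact div_le_div₀ (by positivity) h1 (den_pos β hq σ u) h2

lemma prb_soft (hn : 0 < n) (hβ : 0 ≤ β) (hβq : 2 * β ≤ q) (σ : Fin n → Fin q) (u : Fin n) (k : Fin q) :
    |prb q n β σ u k - soft β (SS σ) k| ≤ 2 * q * Real.exp (2 * q) / n := by
  have hn' : (1:ℝ) ≤ n := by exact_mod_cast hn
  have hδ : 0 ≤ 2 * β / n := by positivity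
  have hc : ∀ l, 2 * β * SS σ l = 2 * β / n * cn σ l := by intro l; unfold SS; ring
  have := quot_diff (fun l => 2 * β * SS σ l) (fun l => 2 * β / n * cx σ u l) (2 * β / n) hδ
    (by intro l; simp only [hc]; nlinarith [cx_le σ u l])
    (by
      intro l; simp only [hc]
      have : cn σ l ≤ cx σ u l + 1 := by unfold cx; split_ifs <;> linarith
      nlinarith) k
  unfold prb soft
  refine this.trans ?_
  have h1 : 2 * β / n ≤ q / n := by gcongr
  have h2 : 2 * β / n ≤ q := (div_le_self (by positivity) hn').trans hβq
  calc 2 * (2 * β / n) * Real.exp (2 * (2 * β / n)) ≤ 2 * (q / n) * Real.exp (2 * q) := by gcongr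
    _ = _ := by ring

lemma prb_nbr (hn : 0 < n) (hβ : 0 ≤ β) (hβq : 2 * β ≤ q) (σ : Fin n → Fin q) (v : Fin n) (j : Fin q) (u : Fin n) (k : Fin q) :
    |prb q n β (Function.update σ v j) u k - prb q n β σ u k| ≤ 2 * q * Real.exp (2 * q) / n := by
  by_cases huv : u = v
  · subst huv; rw [prb_update_self]; simp; positivity
  have hn' : (1:ℝ) ≤ n := by exact_mod_cast hn
  have hδ : 0 ≤ 2 * β / n := by positivity
  have hd : ∀ l, |cx (Function.update σ v j) u l - cx σ u l| ≤ 1 := by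
    intro l
    have := cn_update_abs σ v j l
    unfold cx; rw [Function.update_of_ne huv]
    convert this using 2; ring
  have := quot_diff (fun l => 2 * β / n * cx σ u l) (fun l => 2 * β / n * cx (Function.update σ v j) u l) (2 * β / n) hδ
    (by intro l; have := abs_le.mp (hd l); nlinarith)
    (by intro l; have := abs_le.mp (hd l); nlinarith) k
  unfold prb
  refine this.trans ?_
  have h1 : 2 * β / n ≤ q / n := by gcongr
  have h2 : 2 * β / n ≤ q := (div_le_self (by positivity) hn').trans hβq
  calc 2 * (2 * β / n) * Real.exp (2 * (2 * β / n)) ≤ 2 * (q / n) * Real.exp (2 * q) := by gcongr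
    _ = _ := by ring

lemma PP_SS_drift (hq : 0 < q) (hn : 0 < n) (hβ : 0 ≤ β) (hβq : 2 * β ≤ q) (σ : Fin n → Fin q) (k : Fin q) :
    |PP q n β (fun τ => SS τ k) σ - SS σ k - (1 / (n:ℝ)) * (soft β (SS σ) k - SS σ k)|
      ≤ 2 * q * Real.exp (2 * q) / n ^ 2 := by
  have hn' : (0:ℝ) < n := by positivity
  rw [PP_SS hq hn]
  have h : |∑ u, (prb q n β σ u k - soft β (SS σ) k)| ≤ n * (2 * q * Real.exp (2 * q) / n) := by
    calc _ ≤ ∑ u : Fin n, |prb q n β σ u k - soft β (SS σ) k| := Finset.abs_sum_le_sum_abs _ _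
      _ ≤ ∑ u : Fin n, 2 * q * Real.exp (2 * q) / n := Finset.sum_le_sum fun u _ => prb_soft hn hβ hβq σ u k
      _ = _ := by simp
  have e : SS σ k + 1 / (n:ℝ) * (1 / (n:ℝ) * ∑ u, prb q n β σ u k - SS σ k) - SS σ k - 1 / n * (soft β (SS σ) k - SS σ k)
     = (1 / (n:ℝ) ^ 2) * ∑ u, (prb q n β σ u k - soft β (SS σ) k) := by
    rw [Finset.sum_sub_distrib]; simp; field_simp; ring
  rw [e, abs_mul, abs_of_pos (by positivity)]
  calc 1 / (n:ℝ) ^ 2 * |∑ u, (prb q n β σ u k - soft β (SS σ) k)| ≤ 1 / (n:ℝ) ^ 2 * (n * (2 * q * Real.exp (2 * q) / n)) := by gcongr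
    _ = _ := by field_simp

/-- C^{1,1} functions of a proportion -/
lemma PP_C11 (hq : 0 < q) (hn : 0 < n) (φ ψ : ℝ → ℝ) (L : ℝ) (k : Fin q)
    (hφ : ∀ x ∈ Set.Icc (0:ℝ) 1, ∀ y ∈ Set.Icc (0:ℝ) 1, |φ y - φ x - ψ x * (y - x)| ≤ L * (y - x) ^ 2)
    (hL : 0 ≤ L) (σ : Fin n → Fin q) :
    |PP q n β (fun τ => φ (SS τ k)) σ - φ (SS σ k) - ψ (SS σ k) * (PP q n β (fun τ => SS τ k) σ - SS σ k)|
      ≤ L / n ^ 2 := by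
  have hb : ∀ τ : Fin n → Fin q, SS τ k ∈ Set.Icc (0:ℝ) 1 := fun τ => ⟨SS_nonneg τ k, SS_le_one hn τ k⟩
  have hd : ∀ u j, |φ (SS (Function.update σ u j) k) - φ (SS σ k) - ψ (SS σ k) * (SS (Function.update σ u j) k - SS σ k)| ≤ L / n ^ 2 := by
    intro u j
    refine (hφ _ (hb σ) _ (hb _)).trans ?_
    have h1 := SS_update_abs σ u j k
    have h3 : (SS (Function.update σ u j) k - SS σ k) ^ 2 ≤ (1 / (n:ℝ)) ^ 2 := by
      rw [← sq_abs]; exact pow_le_pow_left₀ (abs_nonneg _) h1 2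
    calc L * _ ≤ L * (1 / (n:ℝ)) ^ 2 := mul_le_mul_of_nonneg_left h3 hL
      _ = _ := by field_simp
  have e : PP q n β (fun τ => φ (SS τ k)) σ - φ (SS σ k) - ψ (SS σ k) * (PP q n β (fun τ => SS τ k) σ - SS σ k)
      = PP q n β (fun τ => 1 * φ (SS τ k) + (- ψ (SS σ k)) * SS τ k + (ψ (SS σ k) * SS σ k - φ (SS σ k))) σ := by
    rw [PP_affine hq hn]; ring
  rw [e, abs_le]
  constructor
  · apply PP_ge_const_at hq hn; intro u j
    linarith [(abs_le.mp (hd u j)).1]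
  · apply PP_le_const_at hq hn; intro u j
    linarith [(abs_le.mp (hd u j)).2]

end

open Finset Filter

/-- the mean field map -/
noncomputable def FF (q : ℕ) (β x : ℝ) : ℝ :=
  (1 + ((q : ℝ) - 1) * Real.exp (2 * β * (1 - (q : ℝ) * x) / ((q : ℝ) - 1)))⁻¹

lemma Dfun_eq (q : ℕ) (β x : ℝ) : Dfun q β x = -x + FF q β x := rfl

lemma exp_le_quad (x : ℝ) : Real.exp x ≤ 1 + x + x ^ 2 * Real.exp |x| := by
  have h1 := exp_sub_one_le (x := x)
  rcases le_total 0 x with h | h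
  · rw [abs_of_nonneg h]
    nlinarith
  · have h2 : 1 ≤ Real.exp |x| := Real.one_le_exp (abs_nonneg x)
    have h3 := Real.add_one_le_exp x
    nlinarith [sq_nonneg x]

section
variable {q n : ℕ} {β : ℝ}

lemma FF_eq (hq : 2 ≤ q) (x : ℝ) :
    FF q β x = Real.exp (2 * β * x) / (Real.exp (2 * β * x) + ((q:ℝ) - 1) * Real.exp (2 * β * ((1 - x) / ((q:ℝ) - 1)))) := by
  have hq' : (2:ℝ) ≤ q := by exact_mod_cast hq
  have h0 : (q:ℝ) - 1 ≠ 0 := by linarith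
  unfold FF
  have e : 2 * β * (1 - (q:ℝ) * x) / ((q:ℝ) - 1) = 2 * β * ((1 - x) / ((q:ℝ) - 1)) - 2 * β * x := by
    field_simp; ring
  rw [e, Real.exp_sub]
  have := Real.exp_pos (2 * β * x)
  have h2 := Real.exp_pos (2 * β * ((1 - x) / ((q:ℝ) - 1)))
  have h3 : 0 < Real.exp (2 * β * x) + ((q:ℝ) - 1) * Real.exp (2 * β * ((1 - x) / ((q:ℝ) - 1))) := by
    have : 0 ≤ (q:ℝ) - 1 := by linarith
    positivity
  generalize Real.exp (2 * β * ((1 - x) / ((q:ℝ) - 1))) = B at *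
  generalize Real.exp (2 * β * x) = A at *
  rw [show 1 + ((q:ℝ) - 1) * (B / A) = (A + ((q:ℝ) - 1) * B) / A by field_simp, inv_div]

lemma FF_pos (hq : 2 ≤ q) (x : ℝ) : 0 < FF q β x := by
  have hq' : (2:ℝ) ≤ q := by exact_mod_cast hq
  have : 0 ≤ (q:ℝ) - 1 := by linarith
  unfold FF; positivity

lemma FF_lt_one (hq : 2 ≤ q) (x : ℝ) : FF q β x < 1 := by
  have hq' : (2:ℝ) ≤ q := by exact_mod_cast hq
  have : 0 < (q:ℝ) - 1 := by linarith
  unfold FF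
  apply inv_lt_one_of_one_lt₀
  have := Real.exp_pos (2 * β * (1 - (q : ℝ) * x) / ((q : ℝ) - 1))
  nlinarith

lemma card_erase_real (hq : 2 ≤ q) (k : Fin q) : ((univ.erase k).card : ℝ) = (q:ℝ) - 1 := by
  rw [Finset.card_erase_of_mem (Finset.mem_univ k), Finset.card_univ, Fintype.card_fin, Nat.cast_sub (by omega)]
  simp

lemma sum_erase_dev (hq : 2 ≤ q) (s : Fin q → ℝ) (hs : ∑ l, s l = 1) (k : Fin q) :
    ∑ l ∈ univ.erase k, (s l - (1 - s k) / ((q:ℝ) - 1)) = 0 := by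
  have hq' : (2:ℝ) ≤ q := by exact_mod_cast hq
  have h0 : (q:ℝ) - 1 ≠ 0 := by linarith
  rw [Finset.sum_sub_distrib, Finset.sum_const, nsmul_eq_mul, card_erase_real hq]
  have := Finset.add_sum_erase univ s (Finset.mem_univ k)
  have e : ∑ l ∈ univ.erase k, s l = 1 - s k := by linarith
  rw [e]; field_simp; ring

lemma soft_le_FF (hq : 2 ≤ q) (s : Fin q → ℝ) (hs : ∑ l, s l = 1) (k : Fin q) :
    soft β s k ≤ FF q β (s k) := by
  have hq' : (2:ℝ) ≤ q := by exact_mod_cast hq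
  rw [FF_eq hq]
  unfold soft
  set m := (1 - s k) / ((q:ℝ) - 1) with hm
  rw [← Finset.add_sum_erase univ (fun l => Real.exp (2 * β * s l)) (Finset.mem_univ k)]
  have h1 : ((q:ℝ) - 1) * Real.exp (2 * β * m) ≤ ∑ l ∈ univ.erase k, Real.exp (2 * β * s l) := by
    have h : ∀ l ∈ univ.erase k, Real.exp (2 * β * m) + Real.exp (2 * β * m) * (2 * β) * (s l - m) ≤ Real.exp (2 * β * s l) := by
      intro l _
      have := Real.add_one_le_exp (2 * β * s l - 2 * β * m)
      have e : Real.exp (2 * β * s l) = Real.exp (2 * β * m) * Real.exp (2 * β * s l - 2 * β * m) := by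
        rw [← Real.exp_add]; ring_nf
      rw [e]
      nlinarith [Real.exp_pos (2 * β * m)]
    have h2 := Finset.sum_le_sum h
    rw [Finset.sum_add_distrib, ← Finset.mul_sum, sum_erase_dev hq s hs k, Finset.sum_const, nsmul_eq_mul,
      card_erase_real hq] at h2
    linarith
  have := Real.exp_pos (2 * β * s k)
  have h3 : 0 ≤ ((q:ℝ) - 1) * Real.exp (2 * β * m) := mul_nonneg (by linarith) (Real.exp_pos _).le
  apply div_le_div_of_nonneg_left this.le (by linarith) (by linarith)

/-- spread of the other colours -/
noncomputable def QQ (q : ℕ) (k : Fin q) (s : Fin q → ℝ) : ℝ :=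
  ∑ l ∈ univ.erase k, (s l - (1 - s k) / ((q:ℝ) - 1)) ^ 2

lemma QQ_nonneg (k : Fin q) (s : Fin q → ℝ) : 0 ≤ QQ q k s := Finset.sum_nonneg fun _ _ => sq_nonneg _

lemma QQ_le (hq : 2 ≤ q) (k : Fin q) (s : Fin q → ℝ) (hs : ∑ l, s l = 1) :
    QQ q k s ≤ ∑ l ∈ univ.erase k, ∑ j ∈ univ.erase k, (s l - s j) ^ 2 := by
  have hq' : (2:ℝ) ≤ q := by exact_mod_cast hq
  have h0 : 0 < (q:ℝ) - 1 := by linarith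
  unfold QQ
  apply Finset.sum_le_sum
  intro l _
  have h1 : ∑ j ∈ univ.erase k, (s l - s j) = ((q:ℝ) - 1) * (s l - (1 - s k) / ((q:ℝ) - 1)) := by
    have := sum_erase_dev hq s hs k
    rw [Finset.sum_sub_distrib, Finset.sum_const, nsmul_eq_mul, card_erase_real hq] at this ⊢
    have e : ((q:ℝ) - 1) * ((1 - s k) / ((q:ℝ) - 1)) = 1 - s k := by field_simp
    linarith
  have h2 := sq_sum_le_card_mul_sum_sq (s := univ.erase k) (f := fun j => s l - s j)
  rw [h1, card_erase_real hq] at h2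
  have h3 : ((q:ℝ) - 1) * (((q:ℝ) - 1) * (s l - (1 - s k) / ((q:ℝ) - 1)) ^ 2) ≤ ((q:ℝ) - 1) * ∑ j ∈ univ.erase k, (s l - s j) ^ 2 := by
    nlinarith
  have h4 := le_of_mul_le_mul_left h3 h0
  nlinarith [sq_nonneg (s l - (1 - s k) / ((q:ℝ) - 1))]

lemma soft_ge_FF (hq : 2 ≤ q) (hβ : 0 ≤ β) (hβq : 2 * β ≤ q) (s : Fin q → ℝ) (hs : ∑ l, s l = 1) (hs0 : ∀ l, 0 ≤ s l) (k : Fin q) :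
    FF q β (s k) - q ^ 2 * Real.exp (2 * q) * QQ q k s ≤ soft β s k := by
  have hq' : (2:ℝ) ≤ q := by exact_mod_cast hq
  have hs1 : ∀ l, s l ≤ 1 := fun l => by
    rw [← hs]; exact Finset.single_le_sum (f := s) (fun i _ => hs0 i) (Finset.mem_univ l)
  rw [FF_eq hq]
  unfold soft
  set m := (1 - s k) / ((q:ℝ) - 1) with hm
  have hm0 : 0 ≤ m := div_nonneg (by linarith [hs1 k]) (by linarith)
  have hm1 : m ≤ 1 := by rw [hm, div_le_one (by linarith)]; linarith [hs0 k]
  rw [← Finset.add_sum_erase univ (fun l => Real.exp (2 * β * s l)) (Finset.mem_univ k)]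
  set E := Real.exp (2 * β * s k) with hE
  have hE1 : 1 ≤ E := Real.one_le_exp (by have := hs0 k; positivity)
  set R := ∑ l ∈ univ.erase k, Real.exp (2 * β * s l) with hR
  set R0 := ((q:ℝ) - 1) * Real.exp (2 * β * m) with hR0
  have hR0p : 0 ≤ R0 := mul_nonneg (by linarith) (Real.exp_pos _).le
  have hRp : 0 ≤ R := Finset.sum_nonneg fun _ _ => (Real.exp_pos _).le
  have h1 : R ≤ R0 + q ^ 2 * Real.exp (2 * q) * QQ q k s := by
    have h : ∀ l ∈ univ.erase k, Real.exp (2 * β * s l) ≤ Real.exp (2 * β * m) + Real.exp (2 * β * m) * (2 * β) * (s l - m) +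
         (q ^ 2 * Real.exp (2 * q)) * (s l - m) ^ 2 := by
      intro l _
      have h2 := exp_le_quad (2 * β * (s l - m))
      have e : Real.exp (2 * β * s l) = Real.exp (2 * β * m) * Real.exp (2 * β * (s l - m)) := by
        rw [← Real.exp_add]; ring_nf
      have h3 : |2 * β * (s l - m)| ≤ q := by
        rw [abs_mul, abs_of_nonneg (by linarith)]
        have : |s l - m| ≤ 1 := by rw [abs_le]; constructor <;> linarith [hs0 l, hs1 l]
        nlinarith [abs_nonneg (s l - m)]
      have h4 : Real.exp |2 * β * (s l - m)| ≤ Real.exp q := Real.exp_le_exp.mpr h3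
      have h5 : Real.exp (2 * β * m) ≤ Real.exp q := Real.exp_le_exp.mpr (by nlinarith)
      have h6 : (2 * β * (s l - m)) ^ 2 ≤ q ^ 2 * (s l - m) ^ 2 := by
        rw [mul_pow]; gcongr
      rw [e]
      calc _ ≤ Real.exp (2 * β * m) * (1 + 2 * β * (s l - m) + (2 * β * (s l - m)) ^ 2 * Real.exp |2 * β * (s l - m)|) := by gcongr
        _ = Real.exp (2 * β * m) + Real.exp (2 * β * m) * (2 * β) * (s l - m) + Real.exp (2 * β * m) * ((2 * β * (s l - m)) ^ 2 * Real.exp |2 * β * (s l - m)|) := by ring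
        _ ≤ Real.exp (2 * β * m) + Real.exp (2 * β * m) * (2 * β) * (s l - m) + Real.exp q * ((q ^ 2 * (s l - m) ^ 2) * Real.exp q) := by gcongr
        _ = _ := by rw [two_mul (q:ℝ), Real.exp_add]; ring
    have h2 := Finset.sum_le_sum h
    rw [Finset.sum_add_distrib, Finset.sum_add_distrib, ← Finset.mul_sum, ← Finset.mul_sum, sum_erase_dev hq s hs k, Finset.sum_const, nsmul_eq_mul,
      card_erase_real hq] at h2
    unfold QQ
    linarith
  have h2 : E / (E + R0) - E / (E + R) ≤ |R - R0| ∨ R ≤ R0 := by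
    by_cases h : R ≤ R0
    · right; exact h
    left
    have e : E / (E + R0) - E / (E + R) = (R - R0) * (E / ((E + R0) * (E + R))) := by
      field_simp; ring
    rw [e]
    have : E / ((E + R0) * (E + R)) ≤ 1 := by
      rw [div_le_one (by positivity)]; nlinarith
    push Not at h
    rw [abs_of_pos (by linarith)]
    nlinarith
  have h3 : 0 ≤ q ^ 2 * Real.exp (2 * q) * QQ q k s := mul_nonneg (by positivity) (QQ_nonneg k s)
  rcases h2 with h2 | h2
  · by_cases h : R ≤ R0
    · have : E / (E + R0) ≤ E / (E + R) := div_le_div_of_nonneg_left (by linarith) (by linarith) (by linarith)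
      linarith
    · push Not at h
      rw [abs_of_pos (by linarith)] at h2
      linarith
  · have : E / (E + R0) ≤ E / (E + R) := div_le_div_of_nonneg_left (by linarith) (by linarith) (by linarith)
    linarith

lemma soft_den_pos (s : Fin q → ℝ) (k : Fin q) : 0 < ∑ l, Real.exp (2 * β * s l) :=
  Finset.sum_pos (fun i _ => Real.exp_pos _) ⟨k, Finset.mem_univ k⟩

lemma soft_nonneg (s : Fin q → ℝ) (k : Fin q) : 0 ≤ soft β s k :=
  div_nonneg (Real.exp_pos _).le (soft_den_pos s k).le

lemma soft_le_one (s : Fin q → ℝ) (k : Fin q) : soft β s k ≤ 1 := quot_le_one (fun l => 2 * β * s l) k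

lemma soft_sub_le (hβ : 0 ≤ β) (s : Fin q → ℝ) (j k : Fin q) (h : s k ≤ s j) :
    soft β s j - soft β s k ≤ soft β s j * (2 * β * (s j - s k)) := by
  unfold soft
  have hp := soft_den_pos (β := β) s k
  rw [← sub_div, div_mul_eq_mul_div]
  apply div_le_div_of_nonneg_right _ hp.le
  have := Real.add_one_le_exp (-(2 * β * (s j - s k)))
  have e : Real.exp (2 * β * s k) = Real.exp (2 * β * s j) * Real.exp (-(2 * β * (s j - s k))) := by
    rw [← Real.exp_add]; ring_nf
  rw [e]; nlinarith [Real.exp_pos (2 * β * s j)]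

lemma soft_pair (hβ : 0 ≤ β) (s : Fin q → ℝ) (j k : Fin q) {c : ℝ} (hj : 2 * β * soft β s j ≤ 1 - c) (hk : 2 * β * soft β s k ≤ 1 - c) :
    (s j - s k) * (soft β s j - soft β s k) ≤ (1 - c) * (s j - s k) ^ 2 := by
  rcases le_total (s k) (s j) with h | h
  · have := soft_sub_le hβ s j k h
    have h1 : (s j - s k) * (soft β s j - soft β s k) ≤ (s j - s k) * (soft β s j * (2 * β * (s j - s k))) :=
      mul_le_mul_of_nonneg_left this (by linarith)
    nlinarith [sq_nonneg (s j - s k)]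
  · have := soft_sub_le hβ s k j h
    have h1 : (s k - s j) * (soft β s k - soft β s j) ≤ (s k - s j) * (soft β s k * (2 * β * (s k - s j))) :=
      mul_le_mul_of_nonneg_left this (by linarith)
    nlinarith [sq_nonneg (s j - s k)]

/-- pair variable -/
noncomputable def WW {q n : ℕ} (j k : Fin q) (σ : Fin n → Fin q) : ℝ := (SS σ j - SS σ k) ^ 2

lemma Z_update_abs (σ : Fin n → Fin q) (u : Fin n) (i j k : Fin q) :
    |(SS (Function.update σ u i) j - SS (Function.update σ u i) k) - (SS σ j - SS σ k)| ≤ 2 / n := by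
  have h1 := abs_le.mp (SS_update_abs σ u i j)
  have h2 := abs_le.mp (SS_update_abs σ u i k)
  have e : (2:ℝ) / n = 1 / n + 1 / n := by ring
  rw [abs_le, e]; constructor <;> linarith

lemma PP_WW_le (hq : 0 < q) (hn : 0 < n) (j k : Fin q) (σ : Fin n → Fin q) :
    PP q n β (WW j k) σ ≤ WW j k σ + 2 * (SS σ j - SS σ k) *
      ((PP q n β (fun τ => SS τ j) σ - SS σ j) - (PP q n β (fun τ => SS τ k) σ - SS σ k)) + 4 / n ^ 2 := by
  set Z := SS σ j - SS σ k with hZ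
  have := PP_mono_at (β := β) hq (f := WW j k)
    (g := fun τ => (2 * Z) * SS τ j + (-(2 * Z)) * SS τ k + (- Z ^ 2 + 4 / n ^ 2)) σ (by
      intro u i
      have h := Z_update_abs σ u i j k
      rw [← hZ] at h
      unfold WW
      set Z' := SS (Function.update σ u i) j - SS (Function.update σ u i) k with hZ'
      have h3 : (Z' - Z) ^ 2 ≤ (2 / (n:ℝ)) ^ 2 := by
        rw [← sq_abs]; exact pow_le_pow_left₀ (abs_nonneg _) h 2
      have e : (2 / (n:ℝ)) ^ 2 = 4 / n ^ 2 := by ring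
      rw [e] at h3
      have : 2 * Z * SS (Function.update σ u i) j + -(2 * Z) * SS (Function.update σ u i) k = 2 * Z * Z' := by rw [hZ']; ring
      nlinarith)
  rw [PP_affine hq hn] at this
  have e : WW j k σ = Z ^ 2 := rfl
  have e2 : SS σ j = Z + SS σ k := by rw [hZ]; ring
  rw [e]
  rw [e2]
  linarith

lemma WW_nonneg (j k : Fin q) (σ : Fin n → Fin q) : 0 ≤ WW j k σ := sq_nonneg _

lemma Z_abs_le (hn : 0 < n) (j k : Fin q) (σ : Fin n → Fin q) : |SS σ j - SS σ k| ≤ 1 := by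
  rw [abs_le]; constructor <;> linarith [SS_nonneg σ j, SS_nonneg σ k, SS_le_one hn σ j, SS_le_one hn σ k]

lemma WW_le_one (hn : 0 < n) (j k : Fin q) (σ : Fin n → Fin q) : WW j k σ ≤ 1 := by
  unfold WW; rw [sq_le_one_iff_abs_le_one]; exact Z_abs_le hn j k σ

/-- constant -/
noncomputable def Cpair (q : ℕ) : ℝ := 8 * q * Real.exp (2 * q) + 4

lemma Cpair_pos : 0 < Cpair q := by unfold Cpair; positivity

lemma PP_WW_drift (hq : 0 < q) (hn : 0 < n) (hβ : 0 ≤ β) (hβq : 2 * β ≤ q) (j k : Fin q) (σ : Fin n → Fin q) {c : ℝ}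
    (hj : 2 * β * soft β (SS σ) j ≤ 1 - c) (hk : 2 * β * soft β (SS σ) k ≤ 1 - c) :
    PP q n β (WW j k) σ ≤ (1 - 2 * c / n) * WW j k σ + Cpair q / n ^ 2 := by
  have h1 := PP_WW_le (β := β) hq hn j k σ
  have hj2 := abs_le.mp (PP_SS_drift hq hn hβ hβq σ j)
  have hk2 := abs_le.mp (PP_SS_drift hq hn hβ hβq σ k)
  have h3 := soft_pair hβ (SS σ) j k hj hk
  have hZ := Z_abs_le hn j k σ
  set B := 2 * q * Real.exp (2 * q) / (n:ℝ) ^ 2 with hB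
  set X := PP q n β (fun τ => SS τ j) σ - SS σ j
  set Y := PP q n β (fun τ => SS τ k) σ - SS σ k
  set Z := SS σ j - SS σ k
  have hn' : (0:ℝ) < n := by positivity
  have h4 : 2 * Z * (X - Y) ≤ 2 * (1 / (n:ℝ)) * (Z * ((soft β (SS σ) j - soft β (SS σ) k) - Z)) + 4 * B := by
    have : |X - Y - 1 / (n:ℝ) * ((soft β (SS σ) j - soft β (SS σ) k) - Z)| ≤ 2 * B := by
      rw [abs_le]; constructor <;> simp only [Z] <;> linarith
    have h5 : Z * (X - Y - 1 / (n:ℝ) * ((soft β (SS σ) j - soft β (SS σ) k) - Z)) ≤ 2 * B := by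
      calc _ ≤ |Z * (X - Y - 1 / (n:ℝ) * ((soft β (SS σ) j - soft β (SS σ) k) - Z))| := le_abs_self _
        _ = |Z| * |(X - Y - 1 / (n:ℝ) * ((soft β (SS σ) j - soft β (SS σ) k) - Z))| := abs_mul _ _
        _ ≤ 1 * (2 * B) := by gcongr
        _ = _ := one_mul _
    nlinarith
  have h5 : Z * ((soft β (SS σ) j - soft β (SS σ) k) - Z) ≤ - c * Z ^ 2 := by nlinarith
  have h6 : 2 * (1 / (n:ℝ)) * (Z * ((soft β (SS σ) j - soft β (SS σ) k) - Z)) ≤ 2 * (1 / (n:ℝ)) * (- c * Z ^ 2) :=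
    mul_le_mul_of_nonneg_left h5 (by positivity)
  have e : WW j k σ = Z ^ 2 := rfl
  have e2 : Cpair q / (n:ℝ) ^ 2 = 4 * B + 4 / n ^ 2 := by rw [hB]; unfold Cpair; ring
  rw [e, e2] 
  rw [e] at h1
  have : (1 - 2 * c / (n:ℝ)) * Z ^ 2 = Z ^ 2 + 2 * (1 / (n:ℝ)) * (- c * Z ^ 2) := by ring
  linarith

lemma PP_WW_triv (hq : 0 < q) (hn : 0 < n) (j k : Fin q) (σ : Fin n → Fin q) :
    PP q n β (WW j k) σ ≤ WW j k σ + 8 / n := by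
  apply PP_le_const_at hq hn
  intro u i
  have h := Z_update_abs σ u i j k
  have hZ := Z_abs_le hn j k σ
  have hZ' := Z_abs_le hn j k (Function.update σ u i)
  unfold WW
  set Z' := SS (Function.update σ u i) j - SS (Function.update σ u i) k with hZ'
  set Z := SS σ j - SS σ k
  have h1 : Z' ^ 2 - Z ^ 2 ≤ |Z' - Z| * |Z' + Z| := by rw [← abs_mul]; refine le_trans (le_of_eq ?_) (le_abs_self _); ring
  have h2 : |Z' + Z| ≤ 2 := (abs_add_le _ _).trans (by linarith)
  have h3 : |Z' - Z| * |Z' + Z| ≤ 2 / n * 2 := by gcongr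
  have h4 : (2:ℝ) / n * 2 ≤ 8 / n := by rw [div_mul_eq_mul_div]; gcongr; norm_num
  linarith

/-- recurrence lemma -/
lemma recur_le {a : ℕ → ℝ} {δ e : ℝ} (hδ : 0 < δ) (hδ1 : δ ≤ 1) (he : 0 ≤ e) (T : ℕ)
    (h : ∀ t < T, a (t + 1) ≤ (1 - δ) * a t + e) : ∀ t ≤ T, a t ≤ (1 - δ) ^ t * a 0 + e / δ := by
  intro t
  induction t with
  | zero => intro _; simp; positivity
  | succ t ih =>
    intro ht
    have h1 := h t (by omega)
    have h2 := mul_le_mul_of_nonneg_left (ih (by omega)) (show 0 ≤ 1 - δ by linarith)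
    have h3 : (1 - δ) * (e / δ) + e = e / δ := by field_simp; ring
    rw [pow_succ]; nlinarith

/-- barrier -/
noncomputable def bar {q n : ℕ} (θ b : ℝ) (k : Fin q) (σ : Fin n → Fin q) : ℝ := min 1 (Real.exp (θ * (cn σ k - n * b)))

lemma bar_nonneg (θ b : ℝ) (k : Fin q) (σ : Fin n → Fin q) : 0 ≤ bar θ b k σ := le_min zero_le_one (Real.exp_pos _).le
lemma bar_le_one (θ b : ℝ) (k : Fin q) (σ : Fin n → Fin q) : bar θ b k σ ≤ 1 := min_le_left _ _
lemma bar_eq_one (hn : 0 < n) {θ b : ℝ} (hθ : 0 ≤ θ) (k : Fin q) (σ : Fin n → Fin q) (h : b ≤ SS σ k) : bar θ b k σ = 1 := by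
  unfold bar
  apply min_eq_left
  apply Real.one_le_exp
  apply mul_nonneg hθ
  unfold SS at h
  rw [le_div_iff₀ (by positivity)] at h
  linarith
lemma bar_le_exp (hn : 0 < n) {θ a b : ℝ} (hθ : 0 ≤ θ) (k : Fin q) (σ : Fin n → Fin q) (h : SS σ k ≤ a) :
    bar θ b k σ ≤ Real.exp (- (θ * (b - a) * n)) := by
  unfold bar
  refine (min_le_right _ _).trans (Real.exp_le_exp.mpr ?_)
  unfold SS at h
  rw [div_le_iff₀ (by positivity)] at h
  nlinarith
lemma bar_nbr {θ b : ℝ} (hθ : 0 ≤ θ) (k : Fin q) (σ : Fin n → Fin q) (u : Fin n) (j : Fin q) :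
    bar θ b k (Function.update σ u j) ≤ Real.exp θ * bar θ b k σ := by
  have h := abs_le.mp (cn_update_abs σ u j k)
  have h1 : 1 ≤ Real.exp θ := Real.one_le_exp hθ
  unfold bar
  rw [mul_min_of_nonneg _ _ (by positivity), ← Real.exp_add]
  apply min_le_min
  · linarith
  · apply Real.exp_le_exp.mpr; nlinarith

lemma PP_bar (hq : 2 ≤ q) (hn : 0 < n) (hβ : 0 ≤ β) (hβq : 2 * β ≤ q) {θ a b c : ℝ} (hθ : 0 < θ) (hθ1 : θ ≤ 1) (hab : a < b)
    (hc : 2 * θ ≤ c) (hnc : 4 * q * Real.exp (2 * q) ≤ c * n)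
    (hD : ∀ x ∈ Set.Icc a b, Dfun q β x ≤ -c) (k : Fin q) (σ : Fin n → Fin q) :
    PP q n β (bar θ b k) σ ≤ bar θ b k σ + Real.exp 1 * Real.exp (- (θ * (b - a) * n)) := by
  have hq0 : 0 < q := by omega
  have hn' : (0:ℝ) < n := by positivity
  by_cases hb : b ≤ SS σ k
  · rw [bar_eq_one hn hθ.le k σ hb]
    have : PP q n β (bar θ b k) σ ≤ 1 := PP_le_const_at hq0 hn σ (fun u j => bar_le_one _ _ _ _)
    have := Real.exp_pos (1:ℝ)
    have := Real.exp_pos (- (θ * (b - a) * n))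
    nlinarith [mul_pos ‹0 < Real.exp (1:ℝ)› ‹0 < Real.exp (- (θ * (b - a) * n))›]
  push Not at hb
  by_cases ha : SS σ k ≤ a
  · have h1 : PP q n β (bar θ b k) σ ≤ Real.exp θ * bar θ b k σ := PP_le_const_at hq0 hn σ (fun u j => bar_nbr hθ.le k σ u j)
    have h2 := bar_le_exp (b := b) hn hθ.le k σ ha
    have h3 : Real.exp θ ≤ Real.exp 1 := Real.exp_le_exp.mpr hθ1
    have h4 := bar_nonneg θ b k σ
    nlinarith [Real.exp_pos θ]
  push Not at ha
  have hY : bar θ b k σ = Real.exp (θ * (cn σ k - n * b)) := by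
    unfold bar; apply min_eq_right; rw [Real.exp_le_one_iff]
    unfold SS at hb; rw [div_lt_iff₀ hn'] at hb; nlinarith
  have h1 : PP q n β (bar θ b k) σ ≤ PP q n β (fun τ => Real.exp (θ * (cn τ k - n * b))) σ :=
    PP_mono hq0 (fun τ => min_le_right _ _) σ
  have h2 := PP_exp (β := β) hq0 hn (fun τ => θ * (cn τ k - n * b)) σ hθ1 (by
    intro u j
    have := cn_update_abs σ u j k
    rw [← mul_sub, abs_mul, abs_of_pos hθ]
    have e : cn (Function.update σ u j) k - n * b - (cn σ k - n * b) = cn (Function.update σ u j) k - cn σ k := by ring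
    rw [e]; nlinarith)
  have e1 : (fun τ : Fin n → Fin q => θ * (cn τ k - n * b)) = fun τ => (θ * n) * SS τ k + 0 * SS τ k + (- (θ * n * b)) := by
    funext τ; unfold SS; field_simp; ring
  have h3 : PP q n β (fun τ => θ * (cn τ k - n * b)) σ - θ * (cn σ k - n * b) = θ * n * (PP q n β (fun τ => SS τ k) σ - SS σ k) := by
    rw [e1, PP_affine hq0 hn]; unfold SS; field_simp; ring
  have h4 := abs_le.mp (PP_SS_drift hq0 hn hβ hβq σ k)
  have h5 := soft_le_FF (β := β) hq (SS σ) (SS_sum hn σ) k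
  have h6 := hD (SS σ k) ⟨ha.le, hb.le⟩
  rw [Dfun_eq] at h6
  have h7 : n * (PP q n β (fun τ => SS τ k) σ - SS σ k) ≤ - c / 2 := by
    have : PP q n β (fun τ => SS τ k) σ - SS σ k ≤ 1 / n * (-c) + 2 * q * Real.exp (2 * q) / n ^ 2 := by
      have : 1 / (n:ℝ) * (soft β (SS σ) k - SS σ k) ≤ 1 / n * (-c) := by gcongr; linarith
      linarith
    calc n * (PP q n β (fun τ => SS τ k) σ - SS σ k) ≤ n * (1 / n * (-c) + 2 * q * Real.exp (2 * q) / n ^ 2) := by gcongr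
      _ = -c + (2 * q * Real.exp (2 * q)) / n := by field_simp
      _ ≤ -c + c / 2 := by
        have : (2 * q * Real.exp (2 * q)) / (n:ℝ) ≤ c / 2 := by rw [div_le_iff₀ hn']; linarith
        linarith
      _ = _ := by ring
  rw [h3] at h2
  have h8 : 1 + θ * n * (PP q n β (fun τ => SS τ k) σ - SS σ k) + θ ^ 2 ≤ 1 := by nlinarith
  have h9 := Real.exp_pos (θ * (cn σ k - n * b))
  have : 0 < Real.exp 1 * Real.exp (- (θ * (b - a) * n)) := by positivity
  rw [hY]
  nlinarith [mul_le_mul_of_nonneg_left h8 h9.le]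

/-- iterating an additive-error inequality -/
lemma PPt_add_err (hq : 0 < q) (hn : 0 < n) {f : (Fin n → Fin q) → ℝ} {e : ℝ} (h : ∀ σ, PP q n β f σ ≤ f σ + e) (t : ℕ) (σ : Fin n → Fin q) :
    (PP q n β)^[t] f σ ≤ f σ + t * e := by
  induction t generalizing σ with
  | zero => simp
  | succ t ih =>
    rw [PPt_succ']
    have h1 := PP_mono (β := β) hq ih σ
    rw [PP_add f (fun _ => t * e), PP_const hq hn] at h1
    have := h σ
    push_cast
    linarith

end

open Finset Filter

section
variable {q n : ℕ} {β : ℝ}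

/-- one step expectation of an arbitrary function of the move -/
noncomputable def EE (q n : ℕ) (β : ℝ) (σ : Fin n → Fin q) (y : Fin n → Fin q → ℝ) : ℝ :=
  (1 / (n : ℝ)) * ∑ u, ∑ k, prb q n β σ u k * y u k

lemma EE_const (hq : 0 < q) (hn : 0 < n) (σ : Fin n → Fin q) (c : ℝ) : EE q n β σ (fun _ _ => c) = c := by
  have := congrFun (PP_const (β := β) hq hn c) σ
  exact this

lemma EE_lin (a b : ℝ) (σ : Fin n → Fin q) (y z : Fin n → Fin q → ℝ) :
    EE q n β σ (fun u k => a * y u k + b * z u k) = a * EE q n β σ y + b * EE q n β σ z := by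
  unfold EE
  have : ∀ u k, prb q n β σ u k * (a * y u k + b * z u k) = a * (prb q n β σ u k * y u k) + b * (prb q n β σ u k * z u k) := by
    intros; ring
  simp_rw [this, Finset.sum_add_distrib, ← Finset.mul_sum]; ring

lemma EE_mono (hq : 0 < q) (σ : Fin n → Fin q) {y z : Fin n → Fin q → ℝ} (h : ∀ u k, y u k ≤ z u k) :
    EE q n β σ y ≤ EE q n β σ z := by
  unfold EE
  apply mul_le_mul_of_nonneg_left _ (by positivity)
  apply Finset.sum_le_sum; intro u _
  apply Finset.sum_le_sum; intro k _
  exact mul_le_mul_of_nonneg_left (h u k) (prb_pos β hq σ u k).le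

lemma EE_nonneg (hq : 0 < q) (σ : Fin n → Fin q) {y : Fin n → Fin q → ℝ} (h : ∀ u k, 0 ≤ y u k) :
    0 ≤ EE q n β σ y := by
  unfold EE
  apply mul_nonneg (by positivity)
  apply Finset.sum_nonneg; intro u _
  apply Finset.sum_nonneg; intro k _
  exact mul_nonneg (prb_pos β hq σ u k).le (h u k)

lemma EE_var (hq : 0 < q) (hn : 0 < n) (σ : Fin n → Fin q) (y : Fin n → Fin q → ℝ) :
    EE q n β σ (fun u k => (y u k - EE q n β σ y) ^ 2) = EE q n β σ (fun u k => y u k ^ 2) - EE q n β σ y ^ 2 := by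
  set m := EE q n β σ y with hm
  have e : (fun u k => (y u k - m) ^ 2) = fun u k => 1 * (y u k ^ 2) + 1 * ((-2 * m) * y u k + m ^ 2 * (fun _ _ => 1 : Fin n → Fin q → ℝ) u k) := by
    funext u k; ring
  rw [e, EE_lin 1 1 σ (fun u k => y u k ^ 2) (fun u k => (-2 * m) * y u k + m ^ 2 * (fun _ _ => 1 : Fin n → Fin q → ℝ) u k), EE_lin, EE_const hq hn, ← hm]; ring

lemma EE_sq (hq : 0 < q) (hn : 0 < n) (σ : Fin n → Fin q) (y : Fin n → Fin q → ℝ) :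
    EE q n β σ y ^ 2 ≤ EE q n β σ (fun u k => y u k ^ 2) := by
  have h1 := EE_var (β := β) hq hn σ y
  have h2 := EE_nonneg (β := β) hq σ (y := fun u k => (y u k - EE q n β σ y) ^ 2) (fun _ _ => sq_nonneg _)
  linarith

lemma EE_lower (hq : 0 < q) (hn : 0 < n) (hβ : 0 ≤ β) (hβq : 2 * β ≤ q) (σ : Fin n → Fin q) {y : Fin n → Fin q → ℝ} (h : ∀ u k, 0 ≤ y u k) :
    (1 / (q * Real.exp q)) * (∑ u, ∑ k, y u k) ≤ n * EE q n β σ y := by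
  unfold EE
  have hn' : (0:ℝ) < n := by positivity
  rw [← mul_assoc, mul_one_div_cancel hn'.ne', one_mul, Finset.mul_sum]
  apply Finset.sum_le_sum; intro u _
  rw [Finset.mul_sum]
  apply Finset.sum_le_sum; intro k _
  exact mul_le_mul_of_nonneg_right (prb_lower hq hn hβ hβq σ u k) (h u k)

/-- squared gradient -/
noncomputable def GG {q n : ℕ} (f : (Fin n → Fin q) → ℝ) (σ : Fin n → Fin q) : ℝ :=
  ∑ v, ∑ j, (f (Function.update σ v j) - f σ) ^ 2

lemma GG_nonneg (f : (Fin n → Fin q) → ℝ) (σ : Fin n → Fin q) : 0 ≤ GG f σ :=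
  Finset.sum_nonneg fun _ _ => Finset.sum_nonneg fun _ _ => sq_nonneg _

lemma PP_diff (f : (Fin n → Fin q) → ℝ) (hq : 0 < q) (σ : Fin n → Fin q) (v : Fin n) (j : Fin q) :
    PP q n β f (Function.update σ v j) - PP q n β f σ =
      EE q n β σ (fun u k => f (Function.update (Function.update σ v j) u k) - f (Function.update σ u k))
      + (1 / (n:ℝ)) * ∑ u, ∑ k, (prb q n β (Function.update σ v j) u k - prb q n β σ u k) *
          (f (Function.update (Function.update σ v j) u k) - f (Function.update σ v j)) := by
  unfold PP EE
  rw [← mul_sub, ← mul_add, ← Finset.sum_sub_distrib, ← Finset.sum_add_distrib]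
  congr 1
  apply Finset.sum_congr rfl; intro u _
  have h1 := prb_sum β hq (Function.update σ v j) u
  have h2 := prb_sum β hq σ u
  have e : ∀ k, (prb q n β (Function.update σ v j) u k - prb q n β σ u k) *
          (f (Function.update (Function.update σ v j) u k) - f (Function.update σ v j))
      = (prb q n β (Function.update σ v j) u k - prb q n β σ u k) * f (Function.update (Function.update σ v j) u k)
        - (prb q n β (Function.update σ v j) u k - prb q n β σ u k) * f (Function.update σ v j) := by intro k; ring
  simp_rw [e]
  rw [Finset.sum_sub_distrib (s := univ) (f := fun k => (prb q n β (Function.update σ v j) u k - prb q n β σ u k) * f (Function.update (Function.update σ v j) u k)),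
    ← Finset.sum_mul, Finset.sum_sub_distrib (s := univ) (f := fun k => prb q n β (Function.update σ v j) u k), h1, h2, sub_self, zero_mul, sub_zero,
    ← Finset.sum_sub_distrib, ← Finset.sum_add_distrib]
  apply Finset.sum_congr rfl; intro k _
  ring

/-- smoothing constant -/
noncomputable def Ksm (q : ℕ) : ℝ := 1 + 2 * q * (2 * q * Real.exp (2 * q)) ^ 2 * (q * Real.exp q)

lemma GG_PP (hq : 0 < q) (hn : 0 < n) (hβ : 0 ≤ β) (hβq : 2 * β ≤ q) (f : (Fin n → Fin q) → ℝ) (σ : Fin n → Fin q) :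
    GG (PP q n β f) σ ≤ (1 + Ksm q / n) * PP q n β (GG f) σ := by
  have hn' : (0:ℝ) < n := by positivity
  have hn1 : (1:ℝ) ≤ n := by exact_mod_cast hn
  set δ := 2 * q * Real.exp (2 * q) / (n:ℝ) with hδ
  set A : Fin n → Fin q → ℝ := fun v j => EE q n β σ (fun u k => f (Function.update (Function.update σ v j) u k) - f (Function.update σ u k)) with hA
  set B : Fin n → Fin q → ℝ := fun v j => (1 / (n:ℝ)) * ∑ u, ∑ k, (prb q n β (Function.update σ v j) u k - prb q n β σ u k) *
          (f (Function.update (Function.update σ v j) u k) - f (Function.update σ v j)) with hB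
  have hA2 : ∑ v, ∑ j, A v j ^ 2 ≤ PP q n β (GG f) σ := by
    calc ∑ v, ∑ j, A v j ^ 2 ≤ ∑ v, ∑ j, EE q n β σ (fun u k => (f (Function.update (Function.update σ v j) u k) - f (Function.update σ u k)) ^ 2) :=
          Finset.sum_le_sum fun v _ => Finset.sum_le_sum fun j _ => EE_sq hq hn σ _
      _ = EE q n β σ (fun u k => ∑ v, ∑ j, (f (Function.update (Function.update σ v j) u k) - f (Function.update σ u k)) ^ 2) := by
          unfold EE
          simp_rw [← Finset.mul_sum]
          congr 1
          calc _ = ∑ v, ∑ u, ∑ j, ∑ k, prb q n β σ u k * (f (Function.update (Function.update σ v j) u k) - f (Function.update σ u k)) ^ 2 := by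
                apply Finset.sum_congr rfl; intro v _; rw [Finset.sum_comm]
            _ = ∑ u, ∑ v, ∑ j, ∑ k, prb q n β σ u k * (f (Function.update (Function.update σ v j) u k) - f (Function.update σ u k)) ^ 2 := Finset.sum_comm
            _ = ∑ u, ∑ v, ∑ k, ∑ j, prb q n β σ u k * (f (Function.update (Function.update σ v j) u k) - f (Function.update σ u k)) ^ 2 := by
                apply Finset.sum_congr rfl; intro u _; apply Finset.sum_congr rfl; intro v _; rw [Finset.sum_comm]
            _ = _ := by
                apply Finset.sum_congr rfl; intro u _; rw [Finset.sum_comm]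
                apply Finset.sum_congr rfl; intro k _; rw [Finset.mul_sum]
                apply Finset.sum_congr rfl; intro v _; rw [Finset.mul_sum]
      _ ≤ EE q n β σ (fun u k => GG f (Function.update σ u k)) := by
          apply EE_mono hq; intro u k
          unfold GG
          apply Finset.sum_le_sum; intro v _; apply Finset.sum_le_sum; intro j _
          by_cases h : v = u
          · subst h; rw [Function.update_idem]; simp; exact sq_nonneg _
          · rw [Function.update_comm h]
      _ = _ := rfl
  have hB1 : ∀ v j, B v j ^ 2 ≤ q * δ ^ 2 / n * GG f (Function.update σ v j) := by
    intro v j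
    have h1 : ∀ u k, |(prb q n β (Function.update σ v j) u k - prb q n β σ u k)| ≤ δ := fun u k => prb_nbr hn hβ hβq σ v j u k
    have h2 : |B v j| ≤ (1 / (n:ℝ)) * ∑ p : Fin n × Fin q, δ * |f (Function.update (Function.update σ v j) p.1 p.2) - f (Function.update σ v j)| := by
      rw [hB]; simp only []
      rw [abs_mul, abs_of_pos (by positivity)]
      apply mul_le_mul_of_nonneg_left _ (by positivity)
      rw [← Fintype.sum_prod_type' (f := fun u k => (prb q n β (Function.update σ v j) u k - prb q n β σ u k) *
          (f (Function.update (Function.update σ v j) u k) - f (Function.update σ v j)))]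
      refine (Finset.abs_sum_le_sum_abs _ _).trans ?_
      apply Finset.sum_le_sum; intro p _
      rw [abs_mul]; exact mul_le_mul_of_nonneg_right (h1 _ _) (abs_nonneg _)
    have h3 := sq_sum_le_card_mul_sum_sq (s := (univ : Finset (Fin n × Fin q))) (f := fun p => δ * |f (Function.update (Function.update σ v j) p.1 p.2) - f (Function.update σ v j)|)
    have h4 : ∑ p : Fin n × Fin q, (δ * |f (Function.update (Function.update σ v j) p.1 p.2) - f (Function.update σ v j)|) ^ 2 = δ ^ 2 * GG f (Function.update σ v j) := by
      unfold GG
      rw [← Fintype.sum_prod_type' (f := fun u k => (f (Function.update (Function.update σ v j) u k) - f (Function.update σ v j)) ^ 2), Finset.mul_sum]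
      apply Finset.sum_congr rfl; intro p _
      rw [mul_pow, sq_abs]
    have hc : ((univ : Finset (Fin n × Fin q)).card : ℝ) = n * q := by simp
    rw [h4, hc] at h3
    rw [← sq_abs]
    refine (pow_le_pow_left₀ (abs_nonneg _) h2 2).trans ?_
    rw [mul_pow]
    refine (mul_le_mul_of_nonneg_left h3 (by positivity)).trans (le_of_eq ?_)
    field_simp
  have hB2 : ∑ v, ∑ j, B v j ^ 2 ≤ q * δ ^ 2 * (q * Real.exp q) * PP q n β (GG f) σ := by
    calc ∑ v, ∑ j, B v j ^ 2 ≤ ∑ v, ∑ j, q * δ ^ 2 / n * GG f (Function.update σ v j) :=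
          Finset.sum_le_sum fun v _ => Finset.sum_le_sum fun j _ => hB1 v j
      _ = q * δ ^ 2 / n * ∑ v, ∑ j, GG f (Function.update σ v j) := by simp_rw [Finset.mul_sum]
      _ ≤ q * δ ^ 2 / n * ((q * Real.exp q) * (n * PP q n β (GG f) σ)) := by
          apply mul_le_mul_of_nonneg_left _ (by positivity)
          have := EE_lower (β := β) hq hn hβ hβq σ (y := fun v j => GG f (Function.update σ v j)) (fun _ _ => GG_nonneg _ _)
          have hc : (0:ℝ) < q * Real.exp q := by positivity
          rw [div_mul_eq_mul_div, one_mul, div_le_iff₀ hc] at this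
          have e : EE q n β σ (fun v j => GG f (Function.update σ v j)) = PP q n β (GG f) σ := rfl
          rw [e] at this; linarith
      _ = _ := by field_simp
  have hG : GG (PP q n β f) σ ≤ (1 + 1 / (n:ℝ)) * ∑ v, ∑ j, A v j ^ 2 + (1 + n) * ∑ v, ∑ j, B v j ^ 2 := by
    unfold GG
    simp_rw [Finset.mul_sum, ← Finset.sum_add_distrib]
    apply Finset.sum_le_sum; intro v _; apply Finset.sum_le_sum; intro j _
    rw [PP_diff f hq σ v j]
    show (A v j + B v j) ^ 2 ≤ _
    have : 0 ≤ (1 / (n:ℝ)) * (A v j - n * B v j) ^ 2 := by positivity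
    have e : (1 / (n:ℝ)) * (A v j - n * B v j) ^ 2 = (1 / n) * A v j ^ 2 - 2 * A v j * B v j + n * B v j ^ 2 := by field_simp; ring
    nlinarith
  have hP : 0 ≤ PP q n β (GG f) σ := PP_ge_const_at hq hn σ (fun _ _ => GG_nonneg _ _)
  have h1 : (1 + 1 / (n:ℝ)) * ∑ v, ∑ j, A v j ^ 2 ≤ (1 + 1 / (n:ℝ)) * PP q n β (GG f) σ := by gcongr
  have h2 : (1 + (n:ℝ)) * ∑ v, ∑ j, B v j ^ 2 ≤ (2 * n) * (q * δ ^ 2 * (q * Real.exp q) * PP q n β (GG f) σ) := by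
    have : 0 ≤ ∑ v, ∑ j, B v j ^ 2 := Finset.sum_nonneg fun _ _ => Finset.sum_nonneg fun _ _ => sq_nonneg _
    gcongr; linarith
  have e : (1 + Ksm q / n) * PP q n β (GG f) σ = (1 + 1 / (n:ℝ)) * PP q n β (GG f) σ + (2 * n) * (q * δ ^ 2 * (q * Real.exp q) * PP q n β (GG f) σ) := by
    rw [hδ]; unfold Ksm; field_simp; ring
  linarith

/-- variance constant -/
noncomputable def csm (q : ℕ) : ℝ := 1 / (2 * (1 + q) * (q * Real.exp q))

lemma PP_var (hq : 0 < q) (hn : 0 < n) (hβ : 0 ≤ β) (hβq : 2 * β ≤ q) (h : (Fin n → Fin q) → ℝ) (σ : Fin n → Fin q) :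
    PP q n β h σ ^ 2 + csm q / n * GG h σ ≤ PP q n β (fun τ => h τ ^ 2) σ := by
  have hn' : (0:ℝ) < n := by positivity
  have hc : (0:ℝ) < q * Real.exp q := by positivity
  set m := PP q n β h σ with hm
  have hv := EE_var (β := β) hq hn σ (fun u k => h (Function.update σ u k))
  have e0 : EE q n β σ (fun u k => h (Function.update σ u k)) = m := rfl
  have e1 : EE q n β σ (fun u k => h (Function.update σ u k) ^ 2) = PP q n β (fun τ => h τ ^ 2) σ := rfl
  rw [e0, e1] at hv
  set V := EE q n β σ (fun u k => (h (Function.update σ u k) - m) ^ 2) with hV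
  have l1 := EE_lower (β := β) hq hn hβ hβq σ (y := fun u k => (h (Function.update σ u k) - m) ^ 2) (fun _ _ => sq_nonneg _)
  rw [← hV, div_mul_eq_mul_div, one_mul, div_le_iff₀ hc] at l1
  have l2 : n * (h σ - m) ^ 2 ≤ ∑ u, ∑ k, (h (Function.update σ u k) - m) ^ 2 := by
    calc (n:ℝ) * (h σ - m) ^ 2 = ∑ u : Fin n, (h σ - m) ^ 2 := by simp
      _ ≤ _ := by
        apply Finset.sum_le_sum; intro u _
        have := Finset.single_le_sum (f := fun k => (h (Function.update σ u k) - m) ^ 2) (fun i _ => sq_nonneg _) (Finset.mem_univ (σ u))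
        simp only [Function.update_eq_self] at this
        exact this
  have l3 : GG h σ ≤ 2 * (∑ u, ∑ k, (h (Function.update σ u k) - m) ^ 2) + 2 * (n * q) * (h σ - m) ^ 2 := by
    calc GG h σ ≤ ∑ u : Fin n, ∑ k : Fin q, (2 * (h (Function.update σ u k) - m) ^ 2 + 2 * (h σ - m) ^ 2) := by
          unfold GG
          apply Finset.sum_le_sum; intro u _; apply Finset.sum_le_sum; intro k _
          nlinarith [sq_nonneg ((h (Function.update σ u k) - m) + (h σ - m))]
      _ = _ := by
        simp_rw [Finset.sum_add_distrib, ← Finset.mul_sum]; simp; ring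
  have l4 : GG h σ ≤ 2 * (1 + q) * (n * V * (q * Real.exp q)) := by
    have : (q:ℝ) * (n * (h σ - m) ^ 2) ≤ q * (n * V * (q * Real.exp q)) := mul_le_mul_of_nonneg_left (by linarith) (by positivity)
    nlinarith
  have l5 : csm q / n * GG h σ ≤ V := by
    calc csm q / n * GG h σ ≤ csm q / n * (2 * (1 + q) * (n * V * (q * Real.exp q))) := by
          apply mul_le_mul_of_nonneg_left l4; unfold csm; positivity
      _ = V := by unfold csm; field_simp
  linarith

lemma csm_pos (hq : 0 < q) : 0 < csm q := by unfold csm; positivity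
lemma Ksm_pos : 0 < Ksm q := by unfold Ksm; positivity

lemma smooth_ind (hq : 0 < q) (hn : 0 < n) (hβ : 0 ≤ β) (hβq : 2 * β ≤ q) (f : (Fin n → Fin q) → ℝ) (t : ℕ) (σ : Fin n → Fin q) :
    ((PP q n β)^[t+1] f σ) ^ 2 + csm q / n * (t + 1) / (1 + Ksm q / n) ^ t * GG ((PP q n β)^[t] f) σ
      ≤ (PP q n β)^[t+1] (fun τ => f τ ^ 2) σ := by
  have hn' : (0:ℝ) < n := by positivity
  have hK := Ksm_pos (q := q)
  have hc := csm_pos hq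
  induction t generalizing σ with
  | zero => simpa using PP_var hq hn hβ hβq f σ
  | succ t ih =>
    have h1 := PP_mono (β := β) hq ih σ
    rw [PP_add (fun σ => ((PP q n β)^[t+1] f σ) ^ 2), PP_smul] at h1
    rw [← PPt_succ'] at h1
    have h2 := PP_var hq hn hβ hβq ((PP q n β)^[t+1] f) σ
    rw [← PPt_succ'] at h2
    have h3 := GG_PP hq hn hβ hβq ((PP q n β)^[t] f) σ
    rw [← PPt_succ'] at h3
    set M := 1 + Ksm q / n with hM
    have hM1 : 1 ≤ M := by rw [hM]; have : 0 ≤ Ksm q / n := by positivity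
                           linarith
    set X := GG ((PP q n β)^[t+1] f) σ with hX
    have hX0 : 0 ≤ X := GG_nonneg _ _
    have h4 : csm q / n * (t + 1) / M ^ (t + 1) * X ≤ csm q / n * (t + 1) / M ^ t * PP q n β (GG ((PP q n β)^[t] f)) σ := by
      rw [pow_succ, ← div_div, div_mul_eq_mul_div, mul_div_assoc]
      apply mul_le_mul_of_nonneg_left _ (by positivity)
      rw [div_le_iff₀ (by positivity)]; linarith
    have h5 : csm q / n / M ^ (t + 1) * X ≤ csm q / n * X := by
      apply mul_le_mul_of_nonneg_right _ hX0
      apply div_le_self (by positivity) (one_le_pow₀ hM1)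
    have e : csm q / n * ((t + 1 : ℕ) + 1) / M ^ (t + 1) * X = csm q / n * (t + 1) / M ^ (t + 1) * X + csm q / n / M ^ (t + 1) * X := by
      push_cast; ring
    rw [e]
    linarith

/-- the smoothing estimate -/
lemma smooth (hq : 0 < q) (hn : 0 < n) (hβ : 0 ≤ β) (hβq : 2 * β ≤ q) (f : (Fin n → Fin q) → ℝ) (hf0 : ∀ τ, 0 ≤ f τ) (hf : ∀ τ, f τ ≤ 1) (σ : Fin n → Fin q) :
    GG ((PP q n β)^[n] f) σ ≤ Real.exp (Ksm q) / csm q := by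
  have hn' : (0:ℝ) < n := by positivity
  have hK := Ksm_pos (q := q)
  have hc := csm_pos hq
  have h1 := smooth_ind hq hn hβ hβq f n σ
  have h2 : (PP q n β)^[n+1] (fun τ => f τ ^ 2) σ ≤ 1 := PPt_le_const hq hn _ (fun τ => by nlinarith [hf0 τ, hf τ]) σ
  have h3 := sq_nonneg ((PP q n β)^[n+1] f σ)
  set X := GG ((PP q n β)^[n] f) σ with hX
  have hX0 : 0 ≤ X := GG_nonneg _ _
  have h4 : (1 + Ksm q / n) ^ n ≤ Real.exp (Ksm q) := by
    have : 1 + Ksm q / n ≤ Real.exp (Ksm q / n) := by linarith [Real.add_one_le_exp (Ksm q / n)]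
    calc (1 + Ksm q / n) ^ n ≤ Real.exp (Ksm q / n) ^ n := pow_le_pow_left₀ (by positivity) this n
      _ = _ := by rw [← Real.exp_nat_mul]; congr 1; field_simp
  have h5 : csm q / Real.exp (Ksm q) ≤ csm q / n * (n + 1) / (1 + Ksm q / n) ^ n := by
    apply div_le_div₀ (by positivity) _ (by positivity) h4
    rw [div_mul_eq_mul_div, le_div_iff₀ hn']; nlinarith
  have h6 : csm q / Real.exp (Ksm q) * X ≤ 1 := by
    have := mul_le_mul_of_nonneg_right h5 hX0
    linarith
  rw [le_div_iff₀ hc]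
  rw [div_mul_eq_mul_div, div_le_one (by positivity)] at h6
  linarith

end

open Finset Filter

section
variable {q n : ℕ} {β : ℝ}

lemma cn_perm (σ : Fin n → Fin q) (π : Equiv.Perm (Fin n)) (k : Fin q) : cn (σ ∘ π) k = cn σ k := by
  unfold cn
  exact Equiv.sum_comp π (fun v => if σ v = k then (1:ℝ) else 0)

lemma cx_perm (σ : Fin n → Fin q) (π : Equiv.Perm (Fin n)) (u : Fin n) (k : Fin q) : cx (σ ∘ π) u k = cx σ (π u) k := by
  unfold cx; rw [cn_perm]; rfl

lemma prb_perm (σ : Fin n → Fin q) (π : Equiv.Perm (Fin n)) (u : Fin n) (k : Fin q) :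
    prb q n β (σ ∘ π) u k = prb q n β σ (π u) k := by
  unfold prb; simp_rw [cx_perm]

lemma update_perm (σ : Fin n → Fin q) (π : Equiv.Perm (Fin n)) (u : Fin n) (k : Fin q) :
    Function.update σ (π u) k ∘ π = Function.update (σ ∘ π) u k := by
  funext v
  by_cases h : v = u
  · subst h; simp
  · have h2 : π v ≠ π u := fun e => h (π.injective e)
    simp [Function.update_of_ne h, Function.update_of_ne h2]

lemma PP_perm (f : (Fin n → Fin q) → ℝ) (π : Equiv.Perm (Fin n)) (σ : Fin n → Fin q) :
    PP q n β (fun τ => f (τ ∘ π)) σ = PP q n β f (σ ∘ π) := by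
  unfold PP
  congr 1
  rw [← Equiv.sum_comp π]
  apply Finset.sum_congr rfl; intro u _
  apply Finset.sum_congr rfl; intro k _
  rw [prb_perm, ← update_perm]

lemma PPt_perm (t : ℕ) (f : (Fin n → Fin q) → ℝ) (π : Equiv.Perm (Fin n)) (σ : Fin n → Fin q) :
    (PP q n β)^[t] (fun τ => f (τ ∘ π)) σ = (PP q n β)^[t] f (σ ∘ π) := by
  induction t generalizing f with
  | zero => rfl
  | succ t ih =>
    simp only [Function.iterate_succ_apply]
    have : PP q n β (fun τ => f (τ ∘ π)) = fun τ => PP q n β f (τ ∘ π) := by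
      funext τ; exact PP_perm f π τ
    rw [this, ih]

lemma pm_perm (σ : Fin n → Fin q) (π : Equiv.Perm (Fin n)) : pottsMeasure q n β (σ ∘ π) = pottsMeasure q n β σ := by
  unfold pottsMeasure pottsWeight
  simp_rw [sum_pairs, cn_perm]

lemma MU_perm (f : (Fin n → Fin q) → ℝ) (π : Equiv.Perm (Fin n)) : MU q n β (fun τ => f (τ ∘ π)) = MU q n β f := by
  unfold MU
  rw [← Equiv.sum_comp (Equiv.arrowCongr π (Equiv.refl (Fin q)))]
  apply Finset.sum_congr rfl
  intro σ _
  have e : (Equiv.arrowCongr π (Equiv.refl (Fin q))) σ = σ ∘ (π.symm) := rfl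
  rw [e, pm_perm]
  have e2 : (σ ∘ π.symm) ∘ π = σ := by funext v; simp
  show _ * f ((σ ∘ π.symm) ∘ π) = _
  rw [e2]

/-- stabilizer -/
def Gam (σ0 : Fin n → Fin q) : Finset (Equiv.Perm (Fin n)) := univ.filter (fun π => σ0 ∘ π = σ0)

/-- symmetrization -/
noncomputable def symz (σ0 : Fin n → Fin q) (f : (Fin n → Fin q) → ℝ) : (Fin n → Fin q) → ℝ :=
  fun τ => (1 / ((Gam σ0).card : ℝ)) * ∑ π ∈ Gam σ0, f (τ ∘ π)

lemma Gam_pos (σ0 : Fin n → Fin q) : 0 < (Gam σ0).card := by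
  apply Finset.card_pos.mpr
  exact ⟨1, by simp [Gam]⟩

lemma symz_PPt (t : ℕ) (σ0 : Fin n → Fin q) (f : (Fin n → Fin q) → ℝ) :
    (PP q n β)^[t] (symz σ0 f) σ0 = (PP q n β)^[t] f σ0 := by
  unfold symz
  rw [PPt_smul, PPt_sum]
  simp_rw [PPt_perm]
  have h := Gam_pos σ0
  have : ∑ π ∈ Gam σ0, (PP q n β)^[t] f (σ0 ∘ π) = ∑ π ∈ Gam σ0, (PP q n β)^[t] f σ0 := by
    apply Finset.sum_congr rfl
    intro π hπ
    simp only [Gam, Finset.mem_filter, Finset.mem_univ, true_and] at hπ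
    rw [hπ]
  rw [this]; simp
  rw [← mul_assoc, inv_mul_cancel₀ (by positivity), one_mul]

lemma symz_MU (σ0 : Fin n → Fin q) (f : (Fin n → Fin q) → ℝ) : MU q n β (symz σ0 f) = MU q n β f := by
  unfold symz
  rw [MU_smul]
  have : MU q n β (fun τ => ∑ π ∈ Gam σ0, f (τ ∘ π)) = ∑ π ∈ Gam σ0, MU q n β (fun τ => f (τ ∘ π)) := by
    unfold MU; rw [Finset.sum_comm]; apply Finset.sum_congr rfl; intro σ _; rw [Finset.mul_sum]
  rw [this]
  have h := Gam_pos σ0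
  simp_rw [MU_perm]; simp
  rw [← mul_assoc, inv_mul_cancel₀ (by positivity), one_mul]

lemma symz_nonneg (σ0 : Fin n → Fin q) (f : (Fin n → Fin q) → ℝ) (h : ∀ τ, 0 ≤ f τ) (τ : Fin n → Fin q) : 0 ≤ symz σ0 f τ := by
  unfold symz; apply mul_nonneg (by positivity); exact Finset.sum_nonneg fun _ _ => h _

lemma symz_le (σ0 : Fin n → Fin q) (f : (Fin n → Fin q) → ℝ) (h : ∀ τ, f τ ≤ 1) (τ : Fin n → Fin q) : symz σ0 f τ ≤ 1 := by
  unfold symz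
  have := Gam_pos σ0
  have h1 : ∑ π ∈ Gam σ0, f (τ ∘ π) ≤ (Gam σ0).card := by
    calc _ ≤ ∑ π ∈ Gam σ0, (1:ℝ) := Finset.sum_le_sum fun _ _ => h _
      _ = _ := by simp
  rw [one_div, inv_mul_le_iff₀ (by positivity)]; linarith

lemma symz_inv (σ0 : Fin n → Fin q) (f : (Fin n → Fin q) → ℝ) (ρ : Equiv.Perm (Fin n)) (hρ : σ0 ∘ ρ = σ0) (τ : Fin n → Fin q) :
    symz σ0 f (τ ∘ ρ) = symz σ0 f τ := by
  unfold symz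
  congr 1
  apply Finset.sum_bij' (fun π _ => ρ * π) (fun π _ => ρ⁻¹ * π)
  · intro π hπ
    simp only [Gam, Finset.mem_filter, Finset.mem_univ, true_and] at hπ ⊢
    rw [Equiv.Perm.coe_mul, ← Function.comp_assoc, hρ, hπ]
  · intro π hπ
    simp only [Gam, Finset.mem_filter, Finset.mem_univ, true_and] at hπ ⊢
    rw [Equiv.Perm.coe_mul, ← Function.comp_assoc]
    have : σ0 ∘ (ρ⁻¹ : Equiv.Perm (Fin n)) = σ0 := by
      conv_lhs => rw [← hρ]
      rw [Function.comp_assoc]; funext v; simp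
    rw [this, hπ]
  · intro π _; simp
  · intro π _; simp
  · intro π _; rfl

lemma symz_grad (hq : 0 < q) (hn : 0 < n) (hβ : 0 ≤ β) (hβq : 2 * β ≤ q) (f : (Fin n → Fin q) → ℝ) (hf0 : ∀ τ, 0 ≤ f τ) (hf : ∀ τ, f τ ≤ 1)
    (σ0 x : Fin n → Fin q) (u : Fin n) (j : Fin q) :
    cw (fun v => if σ0 v = σ0 u then 1 else 0) x (x u) *
      ((PP q n β)^[n] (symz σ0 f) (Function.update x u j) - (PP q n β)^[n] (symz σ0 f) x) ^ 2 ≤ Real.exp (Ksm q) / csm q := by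
  refine le_trans ?_ (smooth hq hn hβ hβq (symz σ0 f) (symz_nonneg σ0 f hf0) (symz_le σ0 f hf) x)
  set H := (PP q n β)^[n] (symz σ0 f) with hH
  have hinv : ∀ ρ : Equiv.Perm (Fin n), σ0 ∘ ρ = σ0 → ∀ τ, H (τ ∘ ρ) = H τ := by
    intro ρ hρ τ
    rw [hH, ← PPt_perm]
    congr 1
    have : (fun τ => symz σ0 f (τ ∘ ρ)) = symz σ0 f := by funext τ; exact symz_inv σ0 f ρ hρ τ
    rw [this]
  unfold cw GG
  rw [Finset.sum_mul]
  apply Finset.sum_le_sum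
  intro v _
  refine le_trans ?_ (Finset.single_le_sum (f := fun j => (H (Function.update x v j) - H x) ^ 2) (fun i _ => sq_nonneg _) (Finset.mem_univ j))
  by_cases h1 : σ0 v = σ0 u
  · by_cases h2 : x v = x u
    · simp only [h1, h2, if_true, one_mul]
      have hs : ∀ y : Fin n → Fin q, y v = y u → y ∘ (Equiv.swap u v) = y := by
        intro y hy; funext w
        simp only [Function.comp]
        rcases eq_or_ne w u with h | h
        · subst h; simp [hy]
        rcases eq_or_ne w v with h' | h'
        · subst h'; simp [hy]
        rw [Equiv.swap_apply_of_ne_of_ne h h']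
      have e := hinv (Equiv.swap u v) (hs σ0 h1) (Function.update x u j)
      have e2 := update_perm x (Equiv.swap u v) v j
      rw [Equiv.swap_apply_right, hs x h2] at e2
      rw [e2] at e
      rw [e]
    · simp [h2, sq_nonneg]
  · simp [h1, sq_nonneg]

end

open Finset Filter

section
variable {q n : ℕ} {β : ℝ}

lemma tv_one (p p' h : Fin q → ℝ) (hs : ∑ k, p k = ∑ k, p' k) (j : Fin q) (w : ℝ)
    (h1 : ∀ k, k ≠ j → p' k ≤ p k) (hw : ∀ k, |h k - h j| ≤ w) :
    |∑ k, (p' k - p k) * h k| ≤ (p' j - p j) * w := by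
  have e : ∑ k, (p' k - p k) * h k = ∑ k ∈ univ.erase j, (p' k - p k) * (h k - h j) := by
    have e1 : ∑ k, (p' k - p k) * h k = ∑ k, (p' k - p k) * (h k - h j) := by
      have : ∀ k, (p' k - p k) * (h k - h j) = (p' k - p k) * h k - (p' k - p k) * h j := by intro k; ring
      simp_rw [this]
      rw [Finset.sum_sub_distrib (f := fun k => (p' k - p k) * h k), ← Finset.sum_mul, Finset.sum_sub_distrib (f := p'), hs]; ring
    rw [e1, ← Finset.add_sum_erase _ _ (Finset.mem_univ j)]; simp
  have e2 : ∑ k ∈ univ.erase j, (p k - p' k) = p' j - p j := by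
    have a1 := Finset.add_sum_erase univ p (Finset.mem_univ j)
    have a2 := Finset.add_sum_erase univ p' (Finset.mem_univ j)
    rw [Finset.sum_sub_distrib]; linarith
  rw [e, ← e2, Finset.sum_mul]
  refine (Finset.abs_sum_le_sum_abs _ _).trans (Finset.sum_le_sum ?_)
  intro k hk
  have := h1 k (Finset.ne_of_mem_erase hk)
  rw [abs_mul, abs_of_nonpos (by linarith)]
  have := hw k
  nlinarith [abs_nonneg (h k - h j)]

lemma prb_tv (hβ : 0 ≤ β) (hq : 0 < q) (σ : Fin n → Fin q) (v : Fin n) (j : Fin q) (u : Fin n) (huv : u ≠ v) (h : Fin q → ℝ) {M w : ℝ}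
    (hM : ∀ k, prb q n β σ u k ≤ M) (hw0 : 0 ≤ w) (hw : ∀ k l, |h k - h l| ≤ w) :
    |∑ k, (prb q n β (Function.update σ v j) u k - prb q n β σ u k) * h k| ≤ (Real.exp (2 * β / n) - 1) * M * w := by
  set r := Real.exp (2 * β / n) with hr
  have hr1 : 1 ≤ r := Real.one_le_exp (by positivity)
  have hM0 : 0 ≤ M := (prb_pos β hq σ u ⟨0, hq⟩).le.trans (hM _)
  by_cases hij : σ v = j
  · rw [← hij, Function.update_eq_self]; simp
    exact mul_nonneg (mul_nonneg (by linarith) hM0) hw0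
  have hcx : ∀ k, cx (Function.update σ v j) u k = cx σ u k + ((if j = k then (1:ℝ) else 0) - if σ v = k then (1:ℝ) else 0) := by
    intro k
    unfold cx; rw [Function.update_of_ne huv, cn_eq_cw, cn_eq_cw, cw_update]; ring
  have s1 := prb_sum β hq σ u
  have s2 := prb_sum β hq (Function.update σ v j) u
  set a : Fin q → ℝ := fun k => Real.exp (2 * β / n * cx σ u k) with ha
  set a' : Fin q → ℝ := fun k => Real.exp (2 * β / n * cx (Function.update σ v j) u k) with ha'
  have hp : ∀ k, prb q n β σ u k = a k / ∑ l, a l := fun k => rfl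
  have hp' : ∀ k, prb q n β (Function.update σ v j) u k = a' k / ∑ l, a' l := fun k => rfl
  have ap : ∀ k, 0 < a k := fun k => Real.exp_pos _
  have ap' : ∀ k, 0 < a' k := fun k => Real.exp_pos _
  have hZ : 0 < ∑ l, a l := Finset.sum_pos (fun i _ => ap i) ⟨j, Finset.mem_univ j⟩
  have hZ' : 0 < ∑ l, a' l := Finset.sum_pos (fun i _ => ap' i) ⟨j, Finset.mem_univ j⟩
  have aj : a' j = r * a j := by
    simp only [ha', ha, hr, hcx, if_true, hij, if_false, ← Real.exp_add]; ring_nf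
  have ai : a (σ v) = r * a' (σ v) := by
    simp only [ha', ha, hr, hcx, if_true, Ne.symm hij, if_false, ← Real.exp_add]; ring_nf
  have ale : ∀ k, k ≠ j → a' k ≤ a k := by
    intro k hk
    simp only [ha', ha, hcx, Ne.symm hk, if_false]
    apply Real.exp_le_exp.mpr
    apply mul_le_mul_of_nonneg_left _ (by positivity)
    split_ifs <;> linarith
  have age : ∀ k, k ≠ σ v → a k ≤ a' k := by
    intro k hk
    simp only [ha', ha, hcx, Ne.symm hk, if_false]
    apply Real.exp_le_exp.mpr
    apply mul_le_mul_of_nonneg_left _ (by positivity)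
    split_ifs <;> linarith
  rcases le_total (∑ l, a l) (∑ l, a' l) with hz | hz
  · refine (tv_one _ _ h (s1.trans s2.symm) j w ?_ (fun k => hw k j)).trans ?_
    · intro k hk
      rw [hp, hp']
      exact div_le_div₀ (ap k).le (ale k hk) hZ hz
    · apply mul_le_mul_of_nonneg_right _ hw0
      have : prb q n β (Function.update σ v j) u j ≤ r * prb q n β σ u j := by
        rw [hp, hp', aj, ← mul_div_assoc]
        exact div_le_div_of_nonneg_left (by have := ap j; positivity) hZ hz
      nlinarith [hM j]
  · have := tv_one _ _ h (s2.trans s1.symm) (σ v) w (by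
      intro k hk
      rw [hp, hp']
      exact div_le_div₀ (ap' k).le (age k hk) hZ' hz) (fun k => hw k (σ v))
    have e : ∑ k, (prb q n β σ u k - prb q n β (Function.update σ v j) u k) * h k = - ∑ k, (prb q n β (Function.update σ v j) u k - prb q n β σ u k) * h k := by
      rw [← Finset.sum_neg_distrib]; apply Finset.sum_congr rfl; intro k _; ring
    rw [e, abs_neg] at this
    refine this.trans ?_
    apply mul_le_mul_of_nonneg_right _ hw0
    have h2 : prb q n β σ u (σ v) ≤ r * prb q n β (Function.update σ v j) u (σ v) := by
      rw [hp, hp', ai, ← mul_div_assoc]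
      exact div_le_div_of_nonneg_left (by have := ap' (σ v); positivity) hZ' hz
    have h3 := prb_pos β hq (Function.update σ v j) u (σ v)
    have h4 : prb q n β (Function.update σ v j) u (σ v) ≤ prb q n β σ u (σ v) := by
      rw [hp, hp']
      by_contra hcon
      push Not at hcon
      have h5 : ∑ k, prb q n β σ u k < ∑ k, prb q n β (Function.update σ v j) u k := by
        apply Finset.sum_lt_sum
        · intro k _
          by_cases hk : k = σ v
          · subst hk; rw [hp, hp']; exact hcon.le
          · rw [hp, hp']; exact div_le_div₀ (ap' k).le (age k hk) hZ' hz
        · exact ⟨σ v, Finset.mem_univ _, by rw [hp, hp']; exact hcon⟩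
      rw [s1, s2] at h5; exact lt_irrefl _ h5
    nlinarith [hM (σ v)]

/-- the gradient recursion step -/
lemma grad_step (hβ : 0 ≤ β) (hq : 0 < q) (hn : 0 < n) (H w : (Fin n → Fin q) → ℝ)
    (hw : ∀ x u j, |H (Function.update x u j) - H x| ≤ w x) (x : Fin n → Fin q) (v : Fin n) (j : Fin q) {M wmin wmax : ℝ}
    (hM : ∀ u k, prb q n β x u k ≤ M) (hmin : ∀ u k, wmin ≤ w (Function.update x u k))
    (hmax : ∀ u k, w (Function.update (Function.update x v j) u k) ≤ wmax) :
    |PP q n β H (Function.update x v j) - PP q n β H x| ≤ PP q n β w x - (1 / (n:ℝ)) * wmin + (Real.exp (2 * β / n) - 1) * M * wmax := by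
  have hn' : (0:ℝ) < n := by positivity
  have hw0 : ∀ x, 0 ≤ w x := fun x => (abs_nonneg _).trans (hw x ⟨0, hn⟩ ⟨0, hq⟩)
  have hmax0 : 0 ≤ wmax := (hw0 _).trans (hmax ⟨0, hn⟩ ⟨0, hq⟩)
  have hM0 : 0 ≤ M := (prb_pos β hq x ⟨0, hn⟩ ⟨0, hq⟩).le.trans (hM _ _)
  have hr1 : 1 ≤ Real.exp (2 * β / n) := Real.one_le_exp (by positivity)
  rw [PP_diff H hq]
  have e : ∀ u, ∑ k, (prb q n β (Function.update x v j) u k - prb q n β x u k) *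
      (H (Function.update (Function.update x v j) u k) - H (Function.update x v j))
      = ∑ k, (prb q n β (Function.update x v j) u k - prb q n β x u k) * (fun k => H (Function.update (Function.update x v j) u k) - H (Function.update x v j)) k := fun u => rfl
  have hB : |(1 / (n:ℝ)) * ∑ u, ∑ k, (prb q n β (Function.update x v j) u k - prb q n β x u k) *
      (H (Function.update (Function.update x v j) u k) - H (Function.update x v j))| ≤ (Real.exp (2 * β / n) - 1) * M * wmax := by
    rw [abs_mul, abs_of_pos (by positivity)]
    have : |∑ u, ∑ k, (prb q n β (Function.update x v j) u k - prb q n β x u k) *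
      (H (Function.update (Function.update x v j) u k) - H (Function.update x v j))| ≤ ∑ u : Fin n, (Real.exp (2 * β / n) - 1) * M * wmax := by
      refine (Finset.abs_sum_le_sum_abs _ _).trans (Finset.sum_le_sum ?_)
      intro u _
      by_cases huv : u = v
      · subst huv; simp only [prb_update_self, sub_self, zero_mul, Finset.sum_const_zero, abs_zero]
        exact mul_nonneg (mul_nonneg (by linarith) hM0) hmax0
      rw [e]
      apply prb_tv hβ hq x v j u huv _ (hM u) hmax0
      intro k l
      have h1 := hw (Function.update (Function.update x v j) u l) u k
      rw [Function.update_idem] at h1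
      rw [sub_sub_sub_cancel_right]
      exact h1.trans (hmax u l)
    calc _ ≤ 1 / (n:ℝ) * ∑ u : Fin n, (Real.exp (2 * β / n) - 1) * M * wmax := by gcongr
      _ = _ := by simp; field_simp
  have hA : |EE q n β x (fun u k => H (Function.update (Function.update x v j) u k) - H (Function.update x u k))| ≤ PP q n β w x - (1 / (n:ℝ)) * wmin := by
    have h0 : ∀ u, |∑ k, prb q n β x u k * (H (Function.update (Function.update x v j) u k) - H (Function.update x u k))|
        ≤ (∑ k, prb q n β x u k * w (Function.update x u k)) - if u = v then wmin else 0 := by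
      intro u
      by_cases huv : u = v
      · subst huv; simp only [Function.update_idem, sub_self, mul_zero, Finset.sum_const_zero, abs_zero, if_true]
        rw [sub_nonneg]
        calc wmin = ∑ k, prb q n β x u k * wmin := by rw [← Finset.sum_mul, prb_sum β hq, one_mul]
          _ ≤ _ := Finset.sum_le_sum fun k _ => mul_le_mul_of_nonneg_left (hmin u k) (prb_pos β hq x u k).le
      · simp only [huv, if_false, sub_zero]
        refine (Finset.abs_sum_le_sum_abs _ _).trans (Finset.sum_le_sum ?_)
        intro k _
        rw [abs_mul, abs_of_pos (prb_pos β hq x u k)]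
        apply mul_le_mul_of_nonneg_left _ (prb_pos β hq x u k).le
        rw [Function.update_comm (Ne.symm huv)]
        exact hw _ _ _
    unfold EE PP
    rw [abs_mul, abs_of_pos (by positivity), ← mul_sub]
    apply mul_le_mul_of_nonneg_left _ (by positivity)
    refine (Finset.abs_sum_le_sum_abs _ _).trans ((Finset.sum_le_sum (fun u _ => h0 u)).trans (le_of_eq ?_))
    rw [Finset.sum_sub_distrib]; simp
  exact (abs_add_le _ _).trans (add_le_add hA hB)

/-- path lemma -/
lemma path_bound (g : (Fin n → Fin q) → ℝ) {M B : ℝ} (hB : 0 ≤ B)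
    (hg : ∀ x, (∀ k, cn x k ≤ M + 1) → ∀ u j, |g (Function.update x u j) - g x| ≤ B)
    (y : Fin n → Fin q) (hy : ∀ k, cn y k ≤ M) :
    ∀ (d : ℕ) (x : Fin n → Fin q), (univ.filter (fun v => x v ≠ y v)).card = d →
      (∃ m, cn x m ≤ M + 1 ∧ ∀ k, k ≠ m → cn x k ≤ M) → |g x - g y| ≤ d * B := by
  intro d
  induction d with
  | zero =>
    intro x hx _
    rw [Finset.card_eq_zero, Finset.filter_eq_empty_iff] at hx
    have : x = y := by funext v; have := hx (Finset.mem_univ v); simpa using this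
    rw [this]; simp
  | succ d ih =>
    intro x hx ⟨m, hm, hmk⟩
    have key : ∃ u, x u ≠ y u ∧ (cn x m ≤ M ∨ x u = m) := by
      by_cases hc : cn x m ≤ M
      · have : (univ.filter (fun v => x v ≠ y v)).Nonempty := by rw [← Finset.card_pos, hx]; omega
        obtain ⟨u, hu⟩ := this
        exact ⟨u, (Finset.mem_filter.mp hu).2, Or.inl hc⟩
      · by_contra hcon
        push Not at hcon
        push Not at hc
        have : cn x m ≤ cn y m := by
          unfold cn
          apply Finset.sum_le_sum
          intro u _
          by_cases h : x u = m
          · by_cases h2 : x u = y u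
            · rw [h2]
            · exact absurd h (hcon u h2).2
          · simp only [h, if_false]; split_ifs <;> norm_num
        linarith [hy m]
    obtain ⟨u, hu, hu2⟩ := key
    set x' := Function.update x u (y u) with hx'
    have hcn : ∀ k, cn x' k = cn x k + ((if y u = k then (1:ℝ) else 0) - if x u = k then (1:ℝ) else 0) := by
      intro k; rw [cn_eq_cw, cn_eq_cw, cw_update]; ring
    have h1 : ∀ k, cn x k ≤ M + 1 := by
      intro k
      by_cases h : k = m
      · rw [h]; exact hm
      · linarith [hmk k h]
    have h2 : ∃ m, cn x' m ≤ M + 1 ∧ ∀ k, k ≠ m → cn x' k ≤ M := by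
      refine ⟨y u, ?_, ?_⟩
      · rw [hcn]
        simp only [if_true, hu, if_false]
        by_cases h : y u = m
        · rcases hu2 with h3 | h3
          · rw [h]; linarith
          · exact absurd (h3.trans h.symm) hu
        · linarith [hmk _ h]
      · intro k hk
        rw [hcn]
        simp only [Ne.symm hk, if_false]
        by_cases h : k = m
        · subst h
          rcases hu2 with h3 | h3
          · split_ifs <;> linarith
          · simp only [h3, if_true]; linarith
        · have := hmk k h
          split_ifs <;> linarith
    have h3 : (univ.filter (fun v => x' v ≠ y v)).card = d := by
      have : univ.filter (fun v => x' v ≠ y v) = (univ.filter (fun v => x v ≠ y v)).erase u := by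
        ext v
        simp only [Finset.mem_filter, Finset.mem_univ, true_and, Finset.mem_erase]
        by_cases h : v = u
        · subst h; simp [hx']
        · rw [hx', Function.update_of_ne h]; simp [h]
      rw [this, Finset.card_erase_of_mem (by simp [hu]), hx]; rfl
    have h4 := ih x' h3 h2
    have h5 := hg x h1 u (y u)
    rw [← hx'] at h5
    push_cast
    calc |g x - g y| = |(g x' - g y) - (g x' - g x)| := by ring_nf
      _ ≤ |g x' - g y| + |g x' - g x| := abs_sub _ _
      _ ≤ _ := by linarith

lemma soft_le_osc (hβ : 0 ≤ β) (s : Fin q → ℝ) (k : Fin q) {O : ℝ} (hO : ∀ l, s k - s l ≤ O) :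
    soft β s k ≤ (1 / q) * Real.exp (2 * β * O) := by
  have hq : 0 < q := k.pos
  unfold soft
  rw [div_le_iff₀ (soft_den_pos s k)]
  have h1 : (q:ℝ) * Real.exp (2 * β * (s k - O)) ≤ ∑ l, Real.exp (2 * β * s l) := by
    calc (q:ℝ) * Real.exp (2 * β * (s k - O)) = ∑ l : Fin q, Real.exp (2 * β * (s k - O)) := by simp
      _ ≤ _ := by
        apply Finset.sum_le_sum; intro l _
        apply Real.exp_le_exp.mpr
        apply mul_le_mul_of_nonneg_left _ (by linarith)
        linarith [hO l]
  calc Real.exp (2 * β * s k) = 1 / q * Real.exp (2 * β * O) * (q * Real.exp (2 * β * (s k - O))) := by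
        rw [show 2 * β * s k = 2 * β * O + 2 * β * (s k - O) by ring, Real.exp_add]; field_simp
    _ ≤ _ := by gcongr

lemma soft_le_lin (hβ : 0 ≤ β) (hβq : 2 * β ≤ q) (s : Fin q → ℝ) (k : Fin q) {O : ℝ} (hO : ∀ l, s k - s l ≤ O) (hO1 : O ≤ 1) :
    soft β s k ≤ (1 / q) + Real.exp q * O := by
  have hq : 0 < q := k.pos
  have hO0 : 0 ≤ O := by have := hO k; linarith
  refine (soft_le_osc hβ s k hO).trans ?_
  have h := exp_sub_one_le (x := 2 * β * O)
  have h2 : 2 * β * O ≤ q * O := by gcongr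
  have h3 : 2 * β * O ≤ q := by nlinarith
  have h4 : Real.exp (2 * β * O) ≤ 1 + q * O * Real.exp q := by
    have : 2 * β * O * Real.exp (2 * β * O) ≤ q * O * Real.exp q := by gcongr
    linarith
  calc (1 / (q:ℝ)) * Real.exp (2 * β * O) ≤ (1 / q) * (1 + q * O * Real.exp q) := by gcongr
    _ = _ := by field_simp

end

open Finset Filter

noncomputable def rt {q n : ℕ} (j k : Fin q) (σ : Fin n → Fin q) : ℝ := Real.sqrt (WW j k σ + 1 / n)

noncomputable def sS {q n : ℕ} (σ : Fin n → Fin q) : ℝ := ∑ j : Fin q, ∑ k : Fin q, rt j k σ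

noncomputable def bb {q n : ℕ} (θ b : ℝ) (σ : Fin n → Fin q) : ℝ := ∑ k : Fin q, bar θ b k σ

noncomputable def nn {q n : ℕ} (σ0 : Fin n → Fin q) (a b : Fin q) (σ : Fin n → Fin q) : ℝ :=
  cw (fun v => if σ0 v = a then (1:ℝ) else 0) σ b

noncomputable def b2 {q n : ℕ} (c : ℝ) (σ0 : Fin n → Fin q) (σ : Fin n → Fin q) : ℝ :=
  ∑ a : Fin q, ∑ b : Fin q, Real.exp (-c * nn σ0 a b σ + c * (c * n))

section
variable {q n : ℕ} {β : ℝ}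

lemma rt_pos (hn : 0 < n) (j k : Fin q) (σ : Fin n → Fin q) : 0 < rt j k σ := by
  unfold rt; apply Real.sqrt_pos.mpr
  have := WW_nonneg j k σ
  positivity

lemma rt_sq (hn : 0 < n) (j k : Fin q) (σ : Fin n → Fin q) : rt j k σ ^ 2 = WW j k σ + 1 / n := by
  unfold rt; apply Real.sq_sqrt
  have := WW_nonneg j k σ
  positivity

lemma rt_ge (j k : Fin q) (σ : Fin n → Fin q) : 1 / Real.sqrt n ≤ rt j k σ := by
  unfold rt
  rw [show (1:ℝ) / Real.sqrt n = Real.sqrt (1 / n) by rw [Real.sqrt_div zero_le_one, Real.sqrt_one]]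
  apply Real.sqrt_le_sqrt
  linarith [WW_nonneg j k σ]

lemma rt_le (j k : Fin q) (σ : Fin n → Fin q) : rt j k σ ≤ |SS σ j - SS σ k| + 1 / Real.sqrt n := by
  unfold rt WW
  rw [show (1:ℝ) / Real.sqrt n = Real.sqrt (1 / n) by rw [Real.sqrt_div zero_le_one, Real.sqrt_one],
    ← Real.sqrt_sq_eq_abs]
  have e1 := Real.sq_sqrt (show (0:ℝ) ≤ (SS σ j - SS σ k) ^ 2 by positivity)
  have e2 := Real.sq_sqrt (show (0:ℝ) ≤ 1 / n by positivity)
  have p1 := Real.sqrt_nonneg ((SS σ j - SS σ k) ^ 2)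
  have p2 := Real.sqrt_nonneg (1 / (n:ℝ))
  apply Real.sqrt_le_iff.mpr
  constructor
  · linarith
  · nlinarith [mul_nonneg p1 p2]

lemma Z_le_rt (j k : Fin q) (σ : Fin n → Fin q) : SS σ j - SS σ k ≤ rt j k σ := by
  unfold rt WW
  refine (le_abs_self _).trans ?_
  rw [← Real.sqrt_sq_eq_abs]
  apply Real.sqrt_le_sqrt
  have : (0:ℝ) ≤ 1 / n := by positivity
  linarith

lemma rt_nbr (hn : 0 < n) (j k : Fin q) (σ : Fin n → Fin q) (u : Fin n) (i : Fin q) :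
    |rt j k (Function.update σ u i) - rt j k σ| ≤ 2 / n := by
  have h := Z_update_abs σ u i j k
  have p1 := rt_pos hn j k σ
  have p2 := rt_pos hn j k (Function.update σ u i)
  have s1 := rt_sq hn j k σ
  have s2 := rt_sq hn j k (Function.update σ u i)
  unfold WW at s1 s2
  have l1 : |SS σ j - SS σ k| ≤ rt j k σ := by
    apply abs_le_of_sq_le_sq _ p1.le
    rw [s1]; have : (0:ℝ) ≤ 1 / n := by positivity
    linarith
  have l2 : |SS (Function.update σ u i) j - SS (Function.update σ u i) k| ≤ rt j k (Function.update σ u i) := by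
    apply abs_le_of_sq_le_sq _ p2.le
    rw [s2]; have : (0:ℝ) ≤ 1 / n := by positivity
    linarith
  set x := SS σ j - SS σ k
  set y := SS (Function.update σ u i) j - SS (Function.update σ u i) k
  set r := rt j k σ
  set r' := rt j k (Function.update σ u i)
  have e : (r' - r) * (r' + r) = (y - x) * (y + x) := by nlinarith
  have e2 : |r' - r| * (r' + r) = |y - x| * |y + x| := by
    rw [← abs_of_pos (show 0 < r' + r by linarith), ← abs_mul, e, abs_mul]
  have h3 : |y + x| ≤ r' + r := (abs_add_le _ _).trans (by linarith)
  refine le_trans ?_ h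
  by_contra hc
  push Not at hc
  nlinarith [abs_nonneg (y - x)]

lemma PP_rt (hq : 0 < q) (hn : 0 < n) (hβ : 0 ≤ β) (hβq : 2 * β ≤ q) (j k : Fin q) (σ : Fin n → Fin q) {c : ℝ}
    (hc0 : 0 ≤ c) (hc1 : c ≤ 1)
    (hj : 2 * β * soft β (SS σ) j ≤ 1 - c) (hk : 2 * β * soft β (SS σ) k ≤ 1 - c) :
    PP q n β (rt j k) σ ≤ (1 - c / n) * rt j k σ + (Cpair q / 2 + 1) * (1 / n * (1 / Real.sqrt n)) := by
  have hn' : (0:ℝ) < n := by positivity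
  have hd := PP_WW_drift hq hn hβ hβq j k σ hj hk
  have p := rt_pos hn j k σ
  have s := rt_sq hn j k σ
  have g := rt_ge j k σ
  have hC := Cpair_pos (q := q)
  set r := rt j k σ with hr
  have h1 : PP q n β (rt j k) σ ≤ PP q n β (fun τ => (1 / (2 * r)) * WW j k τ + 0 * WW j k τ + (r / 2 + 1 / n / (2 * r))) σ := by
    apply PP_mono hq
    intro τ
    have s' := rt_sq hn j k τ
    have : rt j k τ = rt j k τ := rfl
    have e : (1 / (2 * r)) * WW j k τ + 0 * WW j k τ + (r / 2 + 1 / n / (2 * r)) = (rt j k τ ^ 2 + r ^ 2) / (2 * r) := by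
      rw [s']; field_simp; ring
    rw [e, le_div_iff₀ (by positivity)]
    nlinarith [sq_nonneg (rt j k τ - r)]
  rw [PP_affine hq hn] at h1
  have h2 : (1 / (2 * r)) * PP q n β (WW j k) σ ≤ (1 / (2 * r)) * ((1 - 2 * c / n) * WW j k σ + Cpair q / n ^ 2) := by gcongr
  have hW : WW j k σ = r ^ 2 - 1 / n := by linarith
  rw [hW] at h2
  have e3 : (1 / (2 * r)) * ((1 - 2 * c / n) * (r ^ 2 - 1 / n) + Cpair q / n ^ 2) + (r / 2 + 1 / n / (2 * r))
     = (1 - c / n) * r + (Cpair q / 2 + c) * (1 / n * (1 / (n * r))) := by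
    field_simp; ring
  have hsq : 0 < Real.sqrt n := Real.sqrt_pos.mpr hn'
  have h4 : 1 / (n * r) ≤ 1 / Real.sqrt n := by
    apply one_div_le_one_div_of_le hsq
    rw [div_le_iff₀ hsq] at g
    have := Real.mul_self_sqrt hn'.le
    nlinarith
  have h5 : (Cpair q / 2 + c) * (1 / n * (1 / (n * r))) ≤ (Cpair q / 2 + 1) * (1 / n * (1 / Real.sqrt n)) := by gcongr
  linarith

lemma sS_nonneg (hn : 0 < n) (σ : Fin n → Fin q) : 0 ≤ sS σ :=
  Finset.sum_nonneg fun j _ => Finset.sum_nonneg fun k _ => (rt_pos hn j k σ).le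

lemma rt_le_sS (hn : 0 < n) (j k : Fin q) (σ : Fin n → Fin q) : rt j k σ ≤ sS σ := by
  unfold sS
  have h1 := Finset.single_le_sum (f := fun k => rt j k σ) (fun i _ => (rt_pos hn j i σ).le) (Finset.mem_univ k)
  have h2 := Finset.single_le_sum (f := fun j => ∑ k, rt j k σ) (fun i _ => Finset.sum_nonneg fun k _ => (rt_pos hn i k σ).le) (Finset.mem_univ j)
  exact h1.trans h2

lemma sum2_const (c : ℝ) : ∑ _j : Fin q, ∑ _k : Fin q, c = (q:ℝ) ^ 2 * c := by
  simp; ring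

lemma sS_nbr (hn : 0 < n) (σ : Fin n → Fin q) (u : Fin n) (i : Fin q) :
    |sS (Function.update σ u i) - sS σ| ≤ q ^ 2 * (2 / n) := by
  unfold sS
  rw [← Finset.sum_sub_distrib, ← sum2_const]
  refine (Finset.abs_sum_le_sum_abs _ _).trans (Finset.sum_le_sum fun j _ => ?_)
  rw [← Finset.sum_sub_distrib]
  exact (Finset.abs_sum_le_sum_abs _ _).trans (Finset.sum_le_sum fun k _ => rt_nbr hn j k σ u i)

lemma PP_sS (hq : 0 < q) (hn : 0 < n) (hβ : 0 ≤ β) (hβq : 2 * β ≤ q) (σ : Fin n → Fin q) {c : ℝ}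
    (hc0 : 0 ≤ c) (hc1 : c ≤ 1)
    (hs : ∀ j, 2 * β * soft β (SS σ) j ≤ 1 - c) :
    PP q n β sS σ ≤ (1 - c / n) * sS σ + q ^ 2 * ((Cpair q / 2 + 1) * (1 / n * (1 / Real.sqrt n))) := by
  have e : (sS : (Fin n → Fin q) → ℝ) = fun σ => ∑ j : Fin q, ∑ k : Fin q, rt j k σ := rfl
  rw [e, PP_sum]
  simp only
  rw [← sum2_const, Finset.mul_sum, ← Finset.sum_add_distrib]
  refine Finset.sum_le_sum fun j _ => ?_
  rw [PP_sum]
  simp only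
  rw [Finset.mul_sum, ← Finset.sum_add_distrib]
  exact Finset.sum_le_sum fun k _ => PP_rt hq hn hβ hβq j k σ hc0 hc1 (hs j) (hs k)

lemma sS_le (σ : Fin n → Fin q) {O : ℝ} (h : ∀ j k, SS σ j - SS σ k ≤ O) : sS σ ≤ q ^ 2 * (O + 1 / Real.sqrt n) := by
  unfold sS
  rw [← sum2_const]
  refine Finset.sum_le_sum fun j _ => Finset.sum_le_sum fun k _ => ?_
  refine (rt_le j k σ).trans ?_
  have : |SS σ j - SS σ k| ≤ O := abs_le.mpr ⟨by linarith [h k j], h j k⟩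
  linarith

lemma osc_le (hn : 0 < n) (σ : Fin n → Fin q) {r : ℝ} (h : ∀ k, SS σ k ≤ 1 / q + r) (j k : Fin q) : SS σ j - SS σ k ≤ q * r := by
  have hq : 0 < q := k.pos
  have hs := SS_sum hn σ
  rw [← Finset.add_sum_erase _ _ (Finset.mem_univ k)] at hs
  have : ∑ l ∈ univ.erase k, SS σ l ≤ ∑ l ∈ univ.erase k, (1 / (q:ℝ) + r) := Finset.sum_le_sum fun l _ => h l
  rw [Finset.sum_const, nsmul_eq_mul, Finset.card_erase_of_mem (Finset.mem_univ k), Finset.card_univ, Fintype.card_fin, Nat.cast_sub (by omega)] at this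
  have hq' : (0:ℝ) < q := by positivity
  have e : ((q:ℝ) - (1:ℕ)) * (1 / q + r) = 1 - 1 / q + (q - 1) * r := by push_cast; field_simp
  rw [e] at this
  have := h j
  linarith

lemma bb_nonneg (θ b : ℝ) (σ : Fin n → Fin q) : 0 ≤ bb θ b σ := Finset.sum_nonneg fun k _ => bar_nonneg θ b k σ

lemma bb_nbr {θ b : ℝ} (hθ : 0 ≤ θ) (σ : Fin n → Fin q) (u : Fin n) (j : Fin q) :
    bb θ b (Function.update σ u j) ≤ Real.exp θ * bb θ b σ := by
  unfold bb; rw [Finset.mul_sum]; exact Finset.sum_le_sum fun k _ => bar_nbr hθ k σ u j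

lemma bb_ge_one (hn : 0 < n) {θ b : ℝ} (hθ : 0 ≤ θ) (σ : Fin n → Fin q) (h : ∃ k, b ≤ SS σ k) : 1 ≤ bb θ b σ := by
  obtain ⟨k, hk⟩ := h
  rw [← bar_eq_one hn hθ k σ hk]
  exact Finset.single_le_sum (f := fun k => bar θ b k σ) (fun i _ => bar_nonneg θ b i σ) (Finset.mem_univ k)

lemma bb_le_exp (hn : 0 < n) {θ a b : ℝ} (hθ : 0 ≤ θ) (σ : Fin n → Fin q) (h : ∀ k, SS σ k ≤ a) :
    bb θ b σ ≤ q * Real.exp (- (θ * (b - a) * n)) := by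
  unfold bb
  calc _ ≤ ∑ k : Fin q, Real.exp (- (θ * (b - a) * n)) := Finset.sum_le_sum fun k _ => bar_le_exp hn hθ k σ (h k)
    _ = _ := by simp

lemma PP_bb (hq : 2 ≤ q) (hn : 0 < n) (hβ : 0 ≤ β) (hβq : 2 * β ≤ q) {θ a b c : ℝ} (hθ : 0 < θ) (hθ1 : θ ≤ 1) (hab : a < b)
    (hc : 2 * θ ≤ c) (hnc : 4 * q * Real.exp (2 * q) ≤ c * n)
    (hD : ∀ x ∈ Set.Icc a b, Dfun q β x ≤ -c) (σ : Fin n → Fin q) :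
    PP q n β (bb θ b) σ ≤ bb θ b σ + q * (Real.exp 1 * Real.exp (- (θ * (b - a) * n))) := by
  have e : (bb θ b : (Fin n → Fin q) → ℝ) = fun σ => ∑ k, bar θ b k σ := rfl
  rw [e, PP_sum]
  simp only
  calc _ ≤ ∑ k : Fin q, (bar θ b k σ + Real.exp 1 * Real.exp (- (θ * (b - a) * n))) :=
        Finset.sum_le_sum fun k _ => PP_bar hq hn hβ hβq hθ hθ1 hab hc hnc hD k σ
    _ = _ := by rw [Finset.sum_add_distrib]; simp

lemma nn_nonneg (σ0 : Fin n → Fin q) (a b : Fin q) (σ : Fin n → Fin q) : 0 ≤ nn σ0 a b σ := by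
  unfold nn cw; apply Finset.sum_nonneg; intro v _; split_ifs <;> norm_num <;> split_ifs <;> norm_num

lemma nn_nbr (σ0 : Fin n → Fin q) (a b : Fin q) (σ : Fin n → Fin q) (u : Fin n) (j : Fin q) :
    |nn σ0 a b (Function.update σ u j) - nn σ0 a b σ| ≤ 1 := by
  unfold nn; rw [cw_update, abs_le]; split_ifs <;> norm_num

lemma b2_pos_term (c : ℝ) (σ0 σ : Fin n → Fin q) (a b : Fin q) :
    Real.exp (-c * nn σ0 a b σ + c * (c * n)) ≤ b2 c σ0 σ := by
  unfold b2
  have h1 := Finset.single_le_sum (f := fun b => Real.exp (-c * nn σ0 a b σ + c * (c * n))) (fun i _ => (Real.exp_pos _).le) (Finset.mem_univ b)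
  have h2 := Finset.single_le_sum (f := fun a => ∑ b, Real.exp (-c * nn σ0 a b σ + c * (c * n))) (fun i _ => Finset.sum_nonneg fun k _ => (Real.exp_pos _).le) (Finset.mem_univ a)
  exact h1.trans h2

lemma b2_nonneg (c : ℝ) (σ0 σ : Fin n → Fin q) : 0 ≤ b2 c σ0 σ :=
  Finset.sum_nonneg fun a _ => Finset.sum_nonneg fun b _ => (Real.exp_pos _).le

lemma b2_nbr {c : ℝ} (hc : 0 ≤ c) (σ0 σ : Fin n → Fin q) (u : Fin n) (j : Fin q) :
    b2 c σ0 (Function.update σ u j) ≤ Real.exp c * b2 c σ0 σ := by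
  unfold b2
  rw [Finset.mul_sum]
  refine Finset.sum_le_sum fun a _ => ?_
  rw [Finset.mul_sum]
  refine Finset.sum_le_sum fun b _ => ?_
  rw [← Real.exp_add]
  apply Real.exp_le_exp.mpr
  have := abs_le.mp (nn_nbr σ0 a b σ u j)
  nlinarith

lemma b2_le {c : ℝ} (hc : 0 ≤ c) (σ0 σ : Fin n → Fin q) : b2 c σ0 σ ≤ q ^ 2 * Real.exp (c ^ 2 * n) := by
  unfold b2
  rw [← sum2_const]
  refine Finset.sum_le_sum fun a _ => Finset.sum_le_sum fun b _ => ?_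
  apply Real.exp_le_exp.mpr
  have := nn_nonneg σ0 a b σ
  nlinarith [mul_nonneg hc this]

lemma PP_b2 (hq : 0 < q) (hn : 0 < n) (hβ : 0 ≤ β) (hβq : 2 * β ≤ q) {c : ℝ} (hc : 0 < c) (hc1 : c ≤ 1 / 4) (σ0 σ : Fin n → Fin q)
    (h0 : ∀ a, 4 * c * n ≤ 1 / (q * Real.exp q) * cn σ0 a) :
    PP q n β (b2 c σ0) σ ≤ (1 - c ^ 2) * b2 c σ0 σ + q ^ 2 * (Real.exp 1 * Real.exp (- (c ^ 2 * n))) := by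
  have hn' : (0:ℝ) < n := by positivity
  have e : (b2 c σ0 : (Fin n → Fin q) → ℝ) = fun σ => ∑ a : Fin q, ∑ b : Fin q, Real.exp (-c * nn σ0 a b σ + c * (c * n)) := rfl
  rw [e, PP_sum]
  simp only
  rw [← sum2_const, Finset.mul_sum, ← Finset.sum_add_distrib]
  refine Finset.sum_le_sum fun a _ => ?_
  rw [PP_sum]
  simp only
  rw [Finset.mul_sum, ← Finset.sum_add_distrib]
  refine Finset.sum_le_sum fun b _ => ?_
  by_cases hN : nn σ0 a b σ ≤ 2 * c * n
  · have h1 := PP_exp (β := β) hq hn (fun τ => -c * nn σ0 a b τ + c * (c * n)) σ (η := c) (by linarith) (by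
      intro u k
      have := nn_nbr σ0 a b σ u k
      rw [show -c * nn σ0 a b (Function.update σ u k) + c * (c * n) - (-c * nn σ0 a b σ + c * (c * n)) = -c * (nn σ0 a b (Function.update σ u k) - nn σ0 a b σ) by ring, abs_mul, abs_neg, abs_of_pos hc]
      nlinarith)
    have h2 : PP q n β (fun τ => -c * nn σ0 a b τ + c * (c * n)) σ = -c * PP q n β (nn σ0 a b) σ + c * (c * n) := by
      have := PP_affine (β := β) hq hn (-c) 0 (nn σ0 a b) (nn σ0 a b) (c * (c * n)) σ
      simpa using this
    have h3 : PP q n β (nn σ0 a b) σ = _ := PP_cw hq hn (fun v => if σ0 v = a then (1:ℝ) else 0) σ b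
    have h4 : 1 / (q * Real.exp q) * cn σ0 a ≤ ∑ u, (if σ0 u = a then (1:ℝ) else 0) * prb q n β σ u b := by
      unfold cn
      rw [Finset.mul_sum]
      refine Finset.sum_le_sum fun u _ => ?_
      rw [mul_comm]
      apply mul_le_mul_of_nonneg_left (prb_lower hq hn hβ hβq σ u b)
      split_ifs <;> norm_num
    have h5 : 2 * c ≤ PP q n β (nn σ0 a b) σ - nn σ0 a b σ := by
      rw [h3]
      have : nn σ0 a b σ = cw (fun v => if σ0 v = a then (1:ℝ) else 0) σ b := rfl
      rw [← this]
      have h6 := h0 a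
      have : 2 * c * n ≤ (∑ u, (if σ0 u = a then (1:ℝ) else 0) * prb q n β σ u b) - nn σ0 a b σ := by linarith
      have : 2 * c ≤ (1 / (n:ℝ)) * ((∑ u, (if σ0 u = a then (1:ℝ) else 0) * prb q n β σ u b) - nn σ0 a b σ) := by
        rw [one_div, inv_mul_eq_div, le_div_iff₀ hn']; exact this
      linarith
    rw [h2] at h1
    refine h1.trans ?_
    have hp := Real.exp_pos (-c * nn σ0 a b σ + c * (c * n))
    have : 0 ≤ Real.exp 1 * Real.exp (- (c ^ 2 * n)) := by positivity
    have h7 : 1 + (-c * PP q n β (nn σ0 a b) σ + c * (c * n) - (-c * nn σ0 a b σ + c * (c * n))) + c ^ 2 ≤ 1 - c ^ 2 := by nlinarith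
    nlinarith
  · push Not at hN
    have : PP q n β (fun τ => Real.exp (-c * nn σ0 a b τ + c * (c * n))) σ ≤ Real.exp 1 * Real.exp (- (c ^ 2 * n)) := by
      apply PP_le_const_at hq hn
      intro u k
      rw [← Real.exp_add]
      apply Real.exp_le_exp.mpr
      have := abs_le.mp (nn_nbr σ0 a b σ u k)
      nlinarith
    have hp := Real.exp_pos (-c * nn σ0 a b σ + c * (c * n))
    have : 0 ≤ 1 - c ^ 2 := by nlinarith
    have := mul_nonneg this hp.le
    linarith

lemma arith7 {x d s A c C1 C2 C3 κ : ℝ} (hx : 0 ≤ x) (hxd : x ≤ d) (hd1 : d ≤ 1) (hs : 0 ≤ s) (hA : 0 < A) (hC1 : 0 ≤ C1) (hC2 : 0 ≤ C2)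
    (hC3 : 0 ≤ C3) (hκ : 0 ≤ κ) (hκ1 : κ ≤ 1) (hAc : A * c = 2 * C3) (hAs : A * s ≤ 1) :
    (1 + A * ((1 - c * x) * s + C1 * (x * d))) - x * (1 + A * (s - C2 * x)) + x * (1 - κ + C3 * s + C3 * x) * (1 + A * (s + 2 * C2 * x))
    ≤ (1 - κ * x + (A * C1 + 3 * A * C2 + 2 * C2 * C3 + 2 * C3 + 2 * A * C2 * C3) * (x * d)) * (1 + A * s) := by
  have hd : 0 ≤ d := hx.trans hxd
  have hxx : x * x ≤ x * d := by gcongr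
  have hAs0 : 0 ≤ A * s := by positivity
  have e1 : A * c * (x * s) = 2 * C3 * (x * s) := by rw [hAc]
  -- pieces
  have p1 : x * (C3 * s) * (A * s) ≤ x * (C3 * s) := by
    have : 0 ≤ x * (C3 * s) := by positivity
    nlinarith
  have p2 : x * x * (A * C2) * (3 - 2 * κ) ≤ 3 * A * C2 * (x * d) := by
    have h1 : 0 ≤ A * C2 := by positivity
    have h2 : x * x * (A * C2) ≤ x * d * (A * C2) := by gcongr
    have h3 : 0 ≤ x * x * (A * C2) := by positivity
    nlinarith
  have p3 : x * x * (2 * C2 * C3) * (A * s) ≤ 2 * C2 * C3 * (x * d) := by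
    have h1 : 0 ≤ 2 * C2 * C3 := by positivity
    have h2 : x * x * (2 * C2 * C3) ≤ x * d * (2 * C2 * C3) := by gcongr
    have h3 : 0 ≤ x * x * (2 * C2 * C3) := by positivity
    nlinarith
  have p4 : x * x * C3 * (1 + A * s) ≤ 2 * C3 * (x * d) := by
    have h2 : x * x * C3 ≤ x * d * C3 := by gcongr
    have h3 : 0 ≤ x * x * C3 := by positivity
    nlinarith
  have p5 : x * x * (2 * A * C2 * C3) * x ≤ 2 * A * C2 * C3 * (x * d) := by
    have h1 : 0 ≤ 2 * A * C2 * C3 := by positivity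
    have h2 : x * x * (2 * A * C2 * C3) ≤ x * d * (2 * A * C2 * C3) := by gcongr
    have h3 : 0 ≤ x * x * (2 * A * C2 * C3) := by positivity
    nlinarith
  have p6 : 0 ≤ (A * C1 + 3 * A * C2 + 2 * C2 * C3 + 2 * C3 + 2 * A * C2 * C3) * (x * d) * (A * s) := by positivity
  nlinarith
end

open Finset Filter

noncomputable def C3q (q : ℕ) : ℝ :=
  q * Real.exp q + 2 * q ^ 2 * Real.exp (2 * q) + 3 * q ^ 2 * (1 + Real.exp q + 2 * q * Real.exp (2 * q))

noncomputable def Aq (q : ℕ) (κ0 : ℝ) : ℝ := 4 * C3q q / κ0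

/-- constant in the contraction rate -/
noncomputable def Crate (q : ℕ) (κ0 : ℝ) : ℝ :=
  Aq q κ0 * (q ^ 2 * (Cpair q / 2 + 1)) + 3 * Aq q κ0 * (2 * q ^ 2) + 2 * (2 * q ^ 2) * C3q q + 2 * C3q q
    + 2 * Aq q κ0 * (2 * q ^ 2) * C3q q

noncomputable def Kq (q : ℕ) : ℝ := Real.exp 2 * (1 + 2 * C3q q)

/-- smallness conditions on the width of the good region. -/
def rhoOK (q : ℕ) (κ0 ρ : ℝ) : Prop :=
  0 < ρ ∧ q * ρ ≤ 1 ∧ q ^ 2 * Real.exp q * ρ ≤ κ0 / 2 ∧ Aq q κ0 * (q ^ 3 * ρ) ≤ 1 / 2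

/-- largeness conditions on n. -/
def nOK (q n : ℕ) (κ0 : ℝ) : Prop :=
  q ≤ n ∧ Aq q κ0 * (q ^ 2 * (1 / Real.sqrt n)) ≤ 1 / 2

section
variable {q n : ℕ} {β κ0 ρ : ℝ}

lemma C3q_pos (hq : 0 < q) : 0 < C3q q := by unfold C3q; positivity

lemma C3q_ge (hq : 0 < q) : 1 ≤ C3q q := by
  unfold C3q
  have h1 : (1:ℝ) ≤ q := by exact_mod_cast hq
  have h2 : 0 ≤ q * Real.exp q + 2 * q ^ 2 * Real.exp (2 * q) := by positivity
  have h3 : 0 ≤ Real.exp q + 2 * q * Real.exp (2 * q) := by positivity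
  nlinarith

lemma Aq_ge (hq : 0 < q) (hκ : 0 < κ0) (hκ1 : κ0 ≤ 1) : 1 ≤ Aq q κ0 := by
  unfold Aq
  rw [le_div_iff₀ hκ]
  linarith [C3q_ge hq]

lemma Crate_nonneg (hq : 0 < q) (hκ : 0 < κ0) (hκ1 : κ0 ≤ 1) : 0 ≤ Crate q κ0 := by
  have h1 := Aq_ge hq hκ hκ1
  have h2 := C3q_pos hq
  have h3 := Cpair_pos (q := q)
  unfold Crate; positivity

lemma Kq_ge (hq : 0 < q) : 1 ≤ Kq q := by
  unfold Kq
  have := C3q_pos hq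
  have h2 := Real.one_le_exp (show (0:ℝ) ≤ 2 by norm_num)
  nlinarith

set_option maxHeartbeats 1000000 in
lemma reg_facts (hq : 0 < q) (hn : 0 < n) (hβ : 0 ≤ β) (hκ : 0 < κ0) (hκ1 : κ0 ≤ 1) (hβκ : 2 * β / q ≤ 1 - κ0)
    (hρ : rhoOK q κ0 ρ) (hN : nOK q n κ0) (σ : Fin n → Fin q) (hσ : ∀ k, SS σ k ≤ 1 / q + ρ) :
    Aq q κ0 * sS σ ≤ 1 ∧ (∀ j, 2 * β * soft β (SS σ) j ≤ 1 - κ0 / 2) ∧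
    ∃ M, 0 ≤ M ∧ (∀ u k, prb q n β σ u k ≤ M) ∧
      (Real.exp (2 * β / n) - 1) * M ≤ (1 / n) * (2 * β / q + C3q q * sS σ + C3q q * (1 / n)) := by
  obtain ⟨hρ0, hρ1, hρ2, hρ3⟩ := hρ
  obtain ⟨hqn, hN2⟩ := hN
  have hn' : (0:ℝ) < n := by positivity
  have hq' : (0:ℝ) < q := by positivity
  have hq1 : (1:ℝ) ≤ q := by exact_mod_cast hq
  have hβq : 2 * β ≤ q := by
    rw [div_le_iff₀ hq'] at hβκ; linarith only [hβκ, mul_pos hκ hq']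
  have hA := Aq_ge hq hκ hκ1
  have ho := osc_le hn σ hσ
  have hs := sS_le σ ho
  have hs0 := sS_nonneg hn σ
  have hAs : Aq q κ0 * sS σ ≤ 1 := by
    calc Aq q κ0 * sS σ ≤ Aq q κ0 * (q ^ 2 * (q * ρ + 1 / Real.sqrt n)) := by gcongr
      _ = Aq q κ0 * (q ^ 3 * ρ) + Aq q κ0 * (q ^ 2 * (1 / Real.sqrt n)) := by ring
      _ ≤ 1 := by linarith
  have hs1 : sS σ ≤ 1 := (le_mul_of_one_le_left hs0 (by linarith only [hA])).trans hAs
  refine ⟨hAs, ?_, ?_⟩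
  · intro j
    have h1 := soft_le_lin hβ hβq (SS σ) j (ho j) hρ1
    have h2 : 2 * β * soft β (SS σ) j ≤ 2 * β * (1 / q + Real.exp q * (q * ρ)) := by gcongr
    have h3 : 2 * β * (Real.exp q * (q * ρ)) ≤ q * (Real.exp q * (q * ρ)) := by gcongr
    have e : 2 * β * (1 / q) = 2 * β / q := by ring
    linarith only [h2, h3, hβκ, hρ2, e]
  · refine ⟨1 / q + Real.exp q * sS σ + 2 * q * Real.exp (2 * q) / n, by positivity, ?_, ?_⟩
    · intro u k
      have h1 := soft_le_lin hβ hβq (SS σ) k (O := sS σ) (fun l => (Z_le_rt k l σ).trans (rt_le_sS hn k l σ)) hs1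
      have h2 := abs_le.mp (prb_soft hn hβ hβq σ u k)
      linarith
    · set M := 1 / (q:ℝ) + Real.exp q * sS σ + 2 * q * Real.exp (2 * q) / n with hM
      have hn1 : (1:ℝ) ≤ n := by exact_mod_cast hn
      have hx0 : 0 ≤ 2 * β / n := by positivity
      have hxq : 2 * β / n ≤ q / n := by gcongr
      have hx1 : 2 * β / n ≤ 1 := hxq.trans (by rw [div_le_one hn']; exact_mod_cast hqn)
      have he : Real.exp (2 * β / n) ≤ 3 := (Real.exp_le_exp.mpr hx1).trans (by linarith [Real.exp_one_lt_d9])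
      have h1 := exp_sub_one_le (x := 2 * β / n)
      have h2 : Real.exp (2 * β / n) - 1 ≤ 2 * β / n + 3 * (q / n) ^ 2 := by
        have h3 : 2 * β / n * Real.exp (2 * β / n) ≤ 2 * β / n * (1 + 2 * β / n * 3) := by
          apply mul_le_mul_of_nonneg_left _ hx0
          have : 2 * β / n * Real.exp (2 * β / n) ≤ 2 * β / n * 3 := by gcongr
          linarith
        have h4 : (2 * β / n) ^ 2 ≤ (q / n) ^ 2 := by gcongr
        linarith only [h1, h3, h4]
      have hM1 : M ≤ 1 + Real.exp q + 2 * q * Real.exp (2 * q) := by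
        have a1 : 1 / (q:ℝ) ≤ 1 := by rw [div_le_one hq']; exact hq1
        have a2 : Real.exp q * sS σ ≤ Real.exp q * 1 := by gcongr
        have a3 : 2 * q * Real.exp (2 * q) / n ≤ 2 * q * Real.exp (2 * q) := div_le_self (by positivity) hn1
        linarith
      have hM0 : 0 ≤ M := by positivity
      calc (Real.exp (2 * β / n) - 1) * M ≤ (2 * β / n + 3 * (q / n) ^ 2) * M := by gcongr
        _ = 1 / n * (2 * β * M + 3 * q ^ 2 * M * (1 / n)) := by field_simp
        _ ≤ _ := by
          apply mul_le_mul_of_nonneg_left _ (by positivity)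
          have b1 : 2 * β * M ≤ 2 * β / q + q * Real.exp q * sS σ + 2 * q ^ 2 * Real.exp (2 * q) * (1 / n) := by
            have : 2 * β * M = 2 * β / q + 2 * β * (Real.exp q * sS σ) + 2 * β * (2 * q * Real.exp (2 * q) * (1 / n)) := by
              rw [hM]; ring
            rw [this]
            have c1 : 2 * β * (Real.exp q * sS σ) ≤ q * (Real.exp q * sS σ) := by gcongr
            have c2 : 2 * β * (2 * q * Real.exp (2 * q) * (1 / n)) ≤ q * (2 * q * Real.exp (2 * q) * (1 / n)) := by gcongr
            linarith only [c1, c2]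
          have b2 : 3 * q ^ 2 * M * (1 / n) ≤ 3 * q ^ 2 * (1 + Real.exp q + 2 * q * Real.exp (2 * q)) * (1 / n) := by gcongr
          have b3 : q * Real.exp q * sS σ ≤ C3q q * sS σ := by
            apply mul_le_mul_of_nonneg_right _ hs0
            unfold C3q
            have : 0 ≤ 2 * q ^ 2 * Real.exp (2 * q) + 3 * q ^ 2 * (1 + Real.exp q + 2 * q * Real.exp (2 * q)) := by positivity
            linarith
          have b4 : 2 * q ^ 2 * Real.exp (2 * q) * (1 / n) + 3 * q ^ 2 * (1 + Real.exp q + 2 * q * Real.exp (2 * q)) * (1 / n) ≤ C3q q * (1 / (n:ℝ)) := by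
            rw [← add_mul]
            apply mul_le_mul_of_nonneg_right _ (by positivity)
            unfold C3q
            have : 0 ≤ q * Real.exp q := by positivity
            linarith
          linarith

/-- gradient weight -/
noncomputable def wt {q n : ℕ} (A l θ b G E R c : ℝ) (σ0 σ : Fin n → Fin q) : ℝ :=
  l * (1 + A * sS σ) + (G * bb θ b σ + E) + R * b2 c σ0 σ

lemma wt_nbr_up (hn : 0 < n) {A l θ b G E R c : ℝ} (hA : 0 ≤ A) (hl : 0 ≤ l) (hθ : 0 ≤ θ) (hG : 0 ≤ G) (hR : 0 ≤ R) (hc : 0 ≤ c)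
    (σ0 σ : Fin n → Fin q) (v u : Fin n) (j k : Fin q) :
    wt A l θ b G E R c σ0 (Function.update (Function.update σ v j) u k) ≤
      l * (1 + A * (sS σ + 2 * (2 * q ^ 2) * (1 / n))) + (G * (Real.exp θ * (Real.exp θ * bb θ b σ)) + E) + R * (Real.exp c * (Real.exp c * b2 c σ0 σ)) := by
  unfold wt
  have h1 : sS (Function.update (Function.update σ v j) u k) ≤ sS σ + 2 * (2 * q ^ 2) * (1 / n) := by
    have a1 := (abs_le.mp (sS_nbr hn (Function.update σ v j) u k)).2
    have a2 := (abs_le.mp (sS_nbr hn σ v j)).2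
    have e : 2 * (2 * (q:ℝ) ^ 2) * (1 / n) = q ^ 2 * (2 / n) + q ^ 2 * (2 / n) := by ring
    linarith
  have h2 : bb θ b (Function.update (Function.update σ v j) u k) ≤ Real.exp θ * (Real.exp θ * bb θ b σ) :=
    (bb_nbr hθ _ u k).trans (by gcongr; exact bb_nbr hθ σ v j)
  have h3 : b2 c σ0 (Function.update (Function.update σ v j) u k) ≤ Real.exp c * (Real.exp c * b2 c σ0 σ) :=
    (b2_nbr hc _ _ u k).trans (by gcongr; exact b2_nbr hc σ0 σ v j)
  gcongr

lemma PP_wt (hq : 0 < q) (hn : 0 < n) {A l θ b G E R c : ℝ} (σ0 σ : Fin n → Fin q) :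
    PP q n β (wt A l θ b G E R c σ0) σ = l * (1 + A * PP q n β sS σ) + (G * PP q n β (bb θ b) σ + E) + R * PP q n β (b2 c σ0) σ := by
  have e : wt A l θ b G E R c σ0 = fun σ => (G * bb θ b σ + R * b2 c σ0 σ + (l + E)) + (l * A) * sS σ := by
    funext σ; unfold wt; ring
  rw [e, PP_add (fun σ => (G * bb θ b σ + R * b2 c σ0 σ + (l + E))) (fun σ => (l * A) * sS σ), PP_smul]
  show PP q n β (fun σ => (G * bb θ b σ + R * b2 c σ0 σ + (l + E))) σ + _ = _
  rw [PP_affine hq hn]; ring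

set_option maxHeartbeats 1000000 in
lemma grad_onestep (hq : 2 ≤ q) (hn : 0 < n) (hβ : 0 ≤ β) (hκ : 0 < κ0) (hκ1 : κ0 ≤ 1) (hβκ : 2 * β / q ≤ 1 - κ0)
    (hρ : rhoOK q κ0 ρ) (hN : nOK q n κ0) {θ a b cD c l G E R : ℝ} (hθ : 0 < θ) (hθ1 : θ ≤ 1) (hab : a < b) (hbρ : b ≤ 1 / q + ρ)
    (hcD : 2 * θ ≤ cD) (hnc : 4 * q * Real.exp (2 * q) ≤ cD * n) (hD : ∀ x ∈ Set.Icc a b, Dfun q β x ≤ -cD)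
    (hc : 0 < c) (hc1 : c ≤ 1 / 4) (σ0 : Fin n → Fin q) (h0 : ∀ a, 4 * c * n ≤ 1 / (q * Real.exp q) * cn σ0 a)
    (hl : 0 ≤ l) (hG : 1 ≤ G) (hE : 0 ≤ E) (hR : 0 ≤ R)
    (H : (Fin n → Fin q) → ℝ) (H0 : ∀ x, 0 ≤ H x) (H1 : ∀ x, H x ≤ 1)
    (hw : ∀ x u j, |H (Function.update x u j) - H x| ≤ wt (Aq q κ0) l θ b G E R c σ0 x) :
    ∀ x u j, |PP q n β H (Function.update x u j) - PP q n β H x| ≤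
      wt (Aq q κ0) (l * (1 - (1 - 2 * β / q) * (1 / n) + Crate q κ0 * (1 / n * (1 / Real.sqrt n)))) θ b (G * (1 + Kq q / n))
        (E * (1 + Kq q / n) + (G * (q * (Real.exp 1 * Real.exp (- (θ * (b - a) * n)))) + R * (q ^ 2 * (Real.exp 1 * Real.exp (- (c ^ 2 * n))))))
        (R * (1 - c ^ 2 + Kq q / n)) c σ0 x := by
  intro x v j
  have hq0 : 0 < q := by omega
  have hn' : (0:ℝ) < n := by positivity
  have hq' : (0:ℝ) < q := by positivity
  have hA := Aq_ge hq0 hκ hκ1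
  have hA0 : 0 < Aq q κ0 := by linarith
  have hC3 := C3q_pos hq0
  have hCr := Crate_nonneg hq0 hκ hκ1
  have hK := Kq_ge hq0
  have hs0 := sS_nonneg hn x
  have hβq : 2 * β ≤ q := by rw [div_le_iff₀ hq'] at hβκ; linarith only [hβκ, mul_pos hκ hq']
  have hβq0 : 0 ≤ 2 * β / q := by positivity
  have hn1 : (1:ℝ) ≤ n := by exact_mod_cast hn
  have hx1 : 1 / (n:ℝ) ≤ 1 := by rw [div_le_one hn']; exact hn1
  have hbb := bb_nonneg θ b x
  have hb2 := b2_nonneg c σ0 x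
  have hc2 : c ^ 2 ≤ 1 := by nlinarith only [hc, hc1]
  have herr : 0 ≤ (G * (q * (Real.exp 1 * Real.exp (- (θ * (b - a) * n)))) + R * (q ^ 2 * (Real.exp 1 * Real.exp (- (c ^ 2 * n))))) := by positivity
  have hKn : 0 ≤ Kq q / n := by positivity
  by_cases hreg : ∀ k, SS x k ≤ b
  · obtain ⟨hAs, hsoft, M, hM0, hM, hτ⟩ := reg_facts hq0 hn hβ hκ hκ1 hβκ hρ hN x (fun k => (hreg k).trans hbρ)
    have hg := grad_step hβ hq0 hn H _ hw x v j (M := M)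
      (wmin := l * (1 + Aq q κ0 * (sS x - 2 * q ^ 2 * (1 / n)))) (wmax := _) hM (by
        intro u k
        unfold wt
        have a1 := (abs_le.mp (sS_nbr hn x u k)).1
        have a2 := bb_nonneg θ b (Function.update x u k)
        have a3 := b2_nonneg c σ0 (Function.update x u k)
        have e : 2 * (q:ℝ) ^ 2 * (1 / n) = q ^ 2 * (2 / n) := by ring
        have a4 : l * (1 + Aq q κ0 * (sS x - 2 * q ^ 2 * (1 / n))) ≤ l * (1 + Aq q κ0 * sS (Function.update x u k)) := by
          gcongr; linarith
        have : 0 ≤ G * bb θ b (Function.update x u k) := by positivity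
        have : 0 ≤ R * b2 c σ0 (Function.update x u k) := by positivity
        linarith) (fun u k => wt_nbr_up hn hA0.le hl hθ.le (by linarith) hR hc.le σ0 x v u j k)
    refine hg.trans ?_
    rw [PP_wt hq0 hn]
    have d1 := PP_sS hq0 hn hβ hβq x (by linarith) (by linarith) hsoft
    have d2 := PP_bb hq hn hβ hβq hθ hθ1 hab hcD hnc hD x
    have d3 := PP_b2 hq0 hn hβ hβq hc hc1 σ0 x h0
    set τ := (Real.exp (2 * β / n) - 1) * M with hτd
    have hτ0 : 0 ≤ τ := by
      apply mul_nonneg _ hM0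
      have := Real.one_le_exp (show 0 ≤ 2 * β / n by positivity)
      linarith
    have hs1 : sS x ≤ 1 := (le_mul_of_one_le_left hs0 (by linarith only [hA])).trans hAs
    have hτK : τ * Real.exp 2 ≤ Kq q / n := by
      unfold Kq
      have : τ ≤ 1 / n * (1 + 2 * C3q q) := by
        refine hτ.trans ?_
        apply mul_le_mul_of_nonneg_left _ (by positivity)
        have : C3q q * sS x ≤ C3q q * 1 := by gcongr
        have : C3q q * (1 / n) ≤ C3q q * 1 := by gcongr
        linarith
      calc τ * Real.exp 2 ≤ 1 / n * (1 + 2 * C3q q) * Real.exp 2 := by gcongr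
        _ = _ := by ring
    have hτE : τ ≤ Kq q / n := by
      have := Real.one_le_exp (show (0:ℝ) ≤ 2 by norm_num)
      exact (le_mul_of_one_le_right hτ0 this).trans hτK
    have hexp : ∀ z : ℝ, z ≤ 1 → Real.exp z * Real.exp z ≤ Real.exp 2 := by
      intro z hz; rw [← Real.exp_add]; exact Real.exp_le_exp.mpr (by linarith)
    have hbbτ : τ * (Real.exp θ * (Real.exp θ * bb θ b x)) ≤ Kq q / n * bb θ b x := by
      have h1 := hexp θ hθ1
      calc τ * (Real.exp θ * (Real.exp θ * bb θ b x)) = τ * (Real.exp θ * Real.exp θ) * bb θ b x := by ring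
        _ ≤ τ * Real.exp 2 * bb θ b x := by gcongr
        _ ≤ _ := by gcongr
    have hb2τ : τ * (Real.exp c * (Real.exp c * b2 c σ0 x)) ≤ Kq q / n * b2 c σ0 x := by
      have h1 := hexp c (by linarith)
      calc τ * (Real.exp c * (Real.exp c * b2 c σ0 x)) = τ * (Real.exp c * Real.exp c) * b2 c σ0 x := by ring
        _ ≤ τ * Real.exp 2 * b2 c σ0 x := by gcongr
        _ ≤ _ := by gcongr
    have hsq : (1:ℝ) ≤ Real.sqrt n := by rw [Real.one_le_sqrt]; exact hn1
    have hxd : 1 / (n:ℝ) ≤ 1 / Real.sqrt n := by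
      apply one_div_le_one_div_of_le (by linarith)
      have := Real.mul_self_sqrt hn'.le
      linarith only [this, mul_le_mul_of_nonneg_left hsq (Real.sqrt_nonneg n)]
    have hAc : Aq q κ0 * (κ0 / 2) = 2 * C3q q := by unfold Aq; field_simp; ring
    have har := arith7 (x := 1 / (n:ℝ)) (d := 1 / Real.sqrt n) (s := sS x) (A := Aq q κ0) (c := κ0 / 2) (C1 := q ^ 2 * (Cpair q / 2 + 1))
      (C2 := 2 * (q:ℝ) ^ 2) (C3 := C3q q) (κ := 1 - 2 * β / q) (by positivity) hxd (by rw [div_le_one (by linarith)]; exact hsq) hs0 hA0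
      (by have := Cpair_pos (q := q); positivity) (by positivity) hC3.le (by linarith) (by linarith) hAc hAs
    have hCe : Aq q κ0 * (q ^ 2 * (Cpair q / 2 + 1)) + 3 * Aq q κ0 * (2 * q ^ 2) + 2 * (2 * q ^ 2) * C3q q + 2 * C3q q
      + 2 * Aq q κ0 * (2 * q ^ 2) * C3q q = Crate q κ0 := rfl
    rw [hCe] at har
    have l1 : (1 + Aq q κ0 * PP q n β sS x) - 1 / n * (1 + Aq q κ0 * (sS x - 2 * q ^ 2 * (1 / n)))
        + τ * (1 + Aq q κ0 * (sS x + 2 * (2 * q ^ 2) * (1 / n))) ≤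
        (1 - (1 - 2 * β / q) * (1 / n) + Crate q κ0 * (1 / n * (1 / Real.sqrt n))) * (1 + Aq q κ0 * sS x) := by
      refine le_trans ?_ har
      have t1 : Aq q κ0 * PP q n β sS x ≤ Aq q κ0 * ((1 - κ0 / 2 * (1 / n)) * sS x + q ^ 2 * (Cpair q / 2 + 1) * (1 / n * (1 / Real.sqrt n))) := by
        gcongr
        refine d1.trans (le_of_eq ?_); ring
      have t2 : τ * (1 + Aq q κ0 * (sS x + 2 * (2 * q ^ 2) * (1 / n))) ≤
          1 / n * (1 - (1 - 2 * β / q) + C3q q * sS x + C3q q * (1 / n)) * (1 + Aq q κ0 * (sS x + 2 * (2 * q ^ 2) * (1 / n))) := by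
        apply mul_le_mul_of_nonneg_right _ (by positivity)
        refine hτ.trans (le_of_eq ?_); ring
      linarith
    have l2 := mul_le_mul_of_nonneg_left l1 hl
    have l3 := mul_le_mul_of_nonneg_left d2 (show 0 ≤ G by linarith)
    have l4 := mul_le_mul_of_nonneg_left d3 hR
    have l5 := mul_le_mul_of_nonneg_left hbbτ (show 0 ≤ G by linarith)
    have l6 := mul_le_mul_of_nonneg_left hb2τ hR
    have l7 := mul_le_mul_of_nonneg_right hτE hE
    unfold wt
    linear_combination l2 + l3 + l4 + l5 + l6 + l7
  · push Not at hreg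
    obtain ⟨k, hk⟩ := hreg
    have h1 : |PP q n β H (Function.update x v j) - PP q n β H x| ≤ 1 := by
      have a1 := PPt_nonneg (β := β) hq0 hn 1 H0
      have a2 := PPt_le_const (β := β) hq0 hn 1 H1
      simp only [Function.iterate_one] at a1 a2
      rw [abs_le]; constructor <;> linarith [a1 x, a2 x, a1 (Function.update x v j), a2 (Function.update x v j)]
    refine h1.trans ?_
    have h2 := bb_ge_one hn hθ.le x ⟨k, hk.le⟩
    unfold wt
    have h3 : 0 ≤ 1 - (1 - 2 * β / q) * (1 / n) + Crate q κ0 * (1 / n * (1 / Real.sqrt n)) := by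
      have r1 : 0 ≤ Crate q κ0 * (1 / n * (1 / Real.sqrt n)) := by positivity
      have r2 : 0 ≤ 1 / (n:ℝ) := by positivity
      linarith only [r1, mul_nonneg hβq0 r2, hx1]
    have h4 : 0 ≤ l * (1 - (1 - 2 * β / q) * (1 / n) + Crate q κ0 * (1 / n * (1 / Real.sqrt n))) * (1 + Aq q κ0 * sS x) := by positivity
    have h5 : 0 ≤ R * (1 - c ^ 2 + Kq q / n) * b2 c σ0 x := by
      have : 0 ≤ 1 - c ^ 2 + Kq q / n := by linarith
      positivity
    have h6 : 1 ≤ G * (1 + Kq q / n) := one_le_mul_of_one_le_of_one_le hG (by linarith only [hKn])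
    have h7 : 1 ≤ G * (1 + Kq q / n) * bb θ b x := one_le_mul_of_one_le_of_one_le h6 h2
    have h8 : 0 ≤ E * (1 + Kq q / n) := by positivity
    linarith
end

open Finset Filter

section
variable {q n : ℕ} {β κ0 ρ : ℝ}

lemma wt_mono_E {A l θ b G E E' R c : ℝ} (h : E ≤ E') (σ0 σ : Fin n → Fin q) : wt A l θ b G E R c σ0 σ ≤ wt A l θ b G E' R c σ0 σ := by
  unfold wt; linarith

lemma grad_iter (hq : 2 ≤ q) (hn : 0 < n) (hβ : 0 ≤ β) (hκ : 0 < κ0) (hκ1 : κ0 ≤ 1) (hβκ : 2 * β / q ≤ 1 - κ0)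
    (hρ : rhoOK q κ0 ρ) (hN : nOK q n κ0) {θ a b cD c : ℝ} (hθ : 0 < θ) (hθ1 : θ ≤ 1) (hab : a < b) (hbρ : b ≤ 1 / q + ρ)
    (hcD : 2 * θ ≤ cD) (hnc : 4 * q * Real.exp (2 * q) ≤ cD * n) (hD : ∀ x ∈ Set.Icc a b, Dfun q β x ≤ -cD)
    (hc : 0 < c) (hc1 : c ≤ 1 / 4) (hKc : Kq q / n ≤ c ^ 2) (σ0 : Fin n → Fin q) (h0 : ∀ a, 4 * c * n ≤ 1 / (q * Real.exp q) * cn σ0 a)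
    (f : (Fin n → Fin q) → ℝ) (f0 : ∀ x, 0 ≤ f x) (f1 : ∀ x, f x ≤ 1) (t : ℕ) :
    ∀ x u j, |(PP q n β)^[t] ((PP q n β)^[n] (symz σ0 f)) (Function.update x u j) - (PP q n β)^[t] ((PP q n β)^[n] (symz σ0 f)) x| ≤
      wt (Aq q κ0) (Real.sqrt (Real.exp (Ksm q) / csm q / (c * n)) * (1 - (1 - 2 * β / q) * (1 / n) + Crate q κ0 * (1 / n * (1 / Real.sqrt n))) ^ t)
        θ b ((1 + Kq q / n) ^ t)
        ((1 + Kq q / n) ^ t * (t * (q * (Real.exp 1 * Real.exp (- (θ * (b - a) * n))) + q ^ 2 * (Real.exp 1 * Real.exp (- (c ^ 2 * n))))))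
        ((1 - c ^ 2 + Kq q / n) ^ t) c σ0 x := by
  have hq0 : 0 < q := by omega
  have hn' : (0:ℝ) < n := by positivity
  have hq' : (0:ℝ) < q := by positivity
  have hA := Aq_ge hq0 hκ hκ1
  have hCr := Crate_nonneg hq0 hκ hκ1
  have hK := Kq_ge hq0
  have hn1 : (1:ℝ) ≤ n := by exact_mod_cast hn
  have hx1 : 1 / (n:ℝ) ≤ 1 := by rw [div_le_one hn']; exact hn1
  have hβq0 : 0 ≤ 2 * β / q := by positivity
  have hβq : 2 * β ≤ q := by rw [div_le_iff₀ hq'] at hβκ; linarith only [hβκ, mul_pos hκ hq']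
  have hr0 : 0 ≤ 1 - (1 - 2 * β / q) * (1 / n) + Crate q κ0 * (1 / n * (1 / Real.sqrt n)) := by
    have r1 : 0 ≤ Crate q κ0 * (1 / n * (1 / Real.sqrt n)) := by positivity
    have r2 : 0 ≤ 1 / (n:ℝ) := by positivity
    linarith only [r1, mul_nonneg hβq0 r2, hx1]
  have hKn : 0 ≤ Kq q / n := by positivity
  have hR0 : 0 ≤ 1 - c ^ 2 + Kq q / n := by nlinarith only [hKn, hc, hc1]
  have hR1 : 1 - c ^ 2 + Kq q / n ≤ 1 := by linarith
  have S0 := symz_nonneg σ0 f f0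
  have S1 := symz_le σ0 f f1
  induction t with
  | zero =>
    intro x u j
    simp only [Function.iterate_zero, id, pow_zero, mul_one, one_mul, Nat.cast_zero, zero_mul]
    have hs0 := sS_nonneg hn x
    have hbb := bb_nonneg θ b x
    have hb2 := b2_nonneg c σ0 x
    unfold wt
    have hg := symz_grad hq0 hn hβ hβq f f0 f1 σ0 x u j
    set H := (PP q n β)^[n] (symz σ0 f) with hH
    set Q := Real.exp (Ksm q) / csm q with hQ
    by_cases hN : c * n ≤ nn σ0 (σ0 u) (x u) x
    · have h1 : |H (Function.update x u j) - H x| ≤ Real.sqrt (Q / (c * n)) := by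
        apply Real.abs_le_sqrt
        rw [le_div_iff₀ (by positivity)]
        refine le_trans ?_ hg
        rw [mul_comm]
        exact mul_le_mul_of_nonneg_right hN (sq_nonneg _)
      have : 0 ≤ Real.sqrt (Q / (c * n)) * (Aq q κ0 * sS x) := by positivity
      linarith only [h1, this, hb2, hbb]
    · push Not at hN
      have h1 : |H (Function.update x u j) - H x| ≤ 1 := by
        have a1 := PPt_nonneg (β := β) hq0 hn n S0
        have a2 := PPt_le_const (β := β) hq0 hn n S1
        rw [abs_le]; constructor <;> linarith [a1 x, a2 x, a1 (Function.update x u j), a2 (Function.update x u j)]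
      have h2 : 1 ≤ b2 c σ0 x := by
        refine le_trans ?_ (b2_pos_term c σ0 x (σ0 u) (x u))
        apply Real.one_le_exp
        linarith only [mul_le_mul_of_nonneg_left hN.le hc.le]
      have : 0 ≤ Real.sqrt (Q / (c * n)) * (1 + Aq q κ0 * sS x) := by positivity
      linarith
  | succ t ih =>
    intro x u j
    rw [PPt_succ']
    have hG : 1 ≤ (1 + Kq q / n) ^ t := one_le_pow₀ (by linarith)
    refine (grad_onestep hq hn hβ hκ hκ1 hβκ hρ hN hθ hθ1 hab hbρ hcD hnc hD hc hc1 σ0 h0 (by positivity) hG (by positivity)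
      (pow_nonneg hR0 t) _ (PPt_nonneg hq0 hn t (PPt_nonneg hq0 hn n S0)) (PPt_le_const hq0 hn t (PPt_le_const hq0 hn n S1)) ih x u j).trans ?_
    rw [mul_assoc, ← pow_succ, ← pow_succ, ← pow_succ]
    apply wt_mono_E
    set eb := q * (Real.exp 1 * Real.exp (- (θ * (b - a) * n)))
    set e2 := q ^ 2 * (Real.exp 1 * Real.exp (- (c ^ 2 * n)))
    have heb : 0 ≤ eb := by positivity
    have he2 : 0 ≤ e2 := by positivity
    have hRt : (1 - c ^ 2 + Kq q / n) ^ t ≤ (1 + Kq q / n) ^ (t+1) := (pow_le_one₀ hR0 hR1).trans (one_le_pow₀ (by linarith))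
    have hGt : (1 + Kq q / n) ^ t ≤ (1 + Kq q / n) ^ (t+1) := pow_le_pow_right₀ (by linarith) (by omega)
    push_cast
    have := mul_le_mul_of_nonneg_right hRt he2
    have := mul_le_mul_of_nonneg_right hGt heb
    have e : (1 + Kq q / n) ^ t * (t * (eb + e2)) * (1 + Kq q / n) = (1 + Kq q / n) ^ (t + 1) * (t * (eb + e2)) := by ring
    rw [e]
    linarith

lemma tend_exp (p : ℕ) (K d : ℝ) (hd : 0 < d) : Tendsto (fun n : ℕ => (n:ℝ) ^ p * Real.exp (K * Real.sqrt n - d * n)) atTop (nhds 0) := by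
  have h1 : Tendsto (fun n : ℕ => Real.exp (K ^ 2 / (2 * d)) * ((n:ℝ) ^ p * Real.exp (- (d / 2 * n)))) atTop (nhds 0) := by
    rw [show (0:ℝ) = Real.exp (K ^ 2 / (2 * d)) * 0 by simp]
    apply Tendsto.const_mul
    have := (Real.tendsto_pow_mul_exp_neg_atTop_nhds_zero p).comp ((tendsto_natCast_atTop_atTop (R := ℝ)).const_mul_atTop (show 0 < d / 2 by linarith))
    have h2 := this.const_mul ((2 / d) ^ p)
    rw [mul_zero] at h2
    refine h2.congr ?_
    intro n
    simp only [Function.comp]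
    rw [← mul_assoc, ← mul_pow, ← mul_assoc]
    have : 2 / d * (d / 2) = 1 := by field_simp
    rw [this, one_mul]
  refine squeeze_zero (fun n => by positivity) (fun n => ?_) h1
  have : K * Real.sqrt n - d * n ≤ K ^ 2 / (2 * d) + - (d / 2 * n) := by
    have h := Real.sq_sqrt (show (0:ℝ) ≤ n by positivity)
    have h3 : 0 ≤ (d * Real.sqrt n - K) ^ 2 / (2 * d) := by positivity
    have e : (d * Real.sqrt n - K) ^ 2 / (2 * d) = d / 2 * Real.sqrt n ^ 2 - K * Real.sqrt n + K ^ 2 / (2 * d) := by field_simp; ring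
    rw [e, h] at h3
    linarith
  calc _ ≤ (n:ℝ) ^ p * Real.exp (K ^ 2 / (2 * d) + - (d / 2 * n)) := by gcongr
    _ = _ := by rw [Real.exp_add]; ring

lemma ev_small (p : ℕ) (K d C : ℝ) (hd : 0 < d) {ε : ℝ} (hε : 0 < ε) :
    ∀ᶠ n : ℕ in atTop, C * ((n:ℝ) ^ p * Real.exp (K * Real.sqrt n - d * n)) ≤ ε := by
  have := (tend_exp p K d hd).const_mul C
  rw [mul_zero] at this
  exact this.eventually_le_const hε

lemma MU_abs_sub (hq : 0 < q) (g : (Fin n → Fin q) → ℝ) (y : ℝ) : |y - MU q n β g| ≤ MU q n β (fun σ => |y - g σ|) := by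
  have : y - MU q n β g = ∑ σ, pottsMeasure q n β σ * (y - g σ) := by
    simp_rw [mul_sub]
    rw [Finset.sum_sub_distrib, ← Finset.sum_mul, pm_sum β hq, one_mul]; rfl
  rw [this]
  refine (Finset.abs_sum_le_sum_abs _ _).trans (Finset.sum_le_sum fun σ _ => ?_)
  rw [abs_mul, abs_of_pos (pm_pos β hq σ)]

lemma cn_SS (hn : 0 < n) (σ : Fin n → Fin q) (k : Fin q) : cn σ k = n * SS σ k := by
  unfold SS; field_simp

open Classical in
lemma path_MU (hq : 0 < q) (hn : 0 < n) (g : (Fin n → Fin q) → ℝ) (g0 : ∀ x, 0 ≤ g x) (g1 : ∀ x, g x ≤ 1) {a B : ℝ} (hB : 0 ≤ B)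
    (hg : ∀ x, (∀ k, SS x k ≤ a + 1 / n) → ∀ u j, |g (Function.update x u j) - g x| ≤ B)
    (σ0 : Fin n → Fin q) (h0 : ∀ k, SS σ0 k ≤ a) :
    |g σ0 - MU q n β g| ≤ n * B + MU q n β (fun σ => if ∃ k, a < SS σ k then 1 else 0) := by
  have hn' : (0:ℝ) < n := by positivity
  refine (MU_abs_sub hq g (g σ0)).trans ?_
  rw [← MU_const (n := n) (β := β) hq (n * B), ← MU_add]
  apply MU_mono hq
  intro y
  by_cases hy : ∃ k, a < SS y k
  · rw [if_pos hy]
    have : |g σ0 - g y| ≤ 1 := by rw [abs_le]; constructor <;> linarith [g0 y, g1 y, g0 σ0, g1 σ0]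
    have : 0 ≤ n * B := by positivity
    linarith
  · rw [if_neg hy, add_zero]
    push Not at hy
    have h1 := path_bound g (M := n * a) hB (fun x hx => hg x (fun k => by
      have := hx k
      rw [cn_SS hn] at this
      have e : (n:ℝ) * a + 1 = n * (a + 1 / n) := by field_simp
      rw [e] at this
      exact le_of_mul_le_mul_left this hn')) y (fun k => by rw [cn_SS hn]; gcongr; exact hy k) _ σ0 rfl
      ⟨⟨0, hq⟩, by rw [cn_SS hn]; have := h0 ⟨0, hq⟩; nlinarith, fun k _ => by rw [cn_SS hn]; gcongr; exact h0 k⟩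
    refine h1.trans ?_
    gcongr
    calc (univ.filter (fun v => σ0 v ≠ y v)).card ≤ (univ : Finset (Fin n)).card := Finset.card_filter_le _ _
      _ = n := by simp

lemma SS_lower (hn : 0 < n) (σ : Fin n → Fin q) {r : ℝ} (h : ∀ k, SS σ k ≤ 1 / q + r) (k : Fin q) : 1 / q - q * r ≤ SS σ k := by
  have hq : 0 < q := k.pos
  have h1 : ∃ j, 1 / (q:ℝ) ≤ SS σ j := by
    by_contra hc
    push Not at hc
    have : ∑ j, SS σ j < ∑ j : Fin q, 1 / (q:ℝ) := Finset.sum_lt_sum_of_nonempty ⟨k, Finset.mem_univ k⟩ (fun j _ => hc j)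
    rw [SS_sum hn] at this
    simp at this
    have hq' : (q:ℝ) ≠ 0 := by positivity
    rw [mul_inv_cancel₀ hq'] at this
    exact lt_irrefl _ this
  obtain ⟨j, hj⟩ := h1
  linarith [osc_le hn σ h j k]

set_option maxHeartbeats 4000000 in
open Classical in
lemma U2 (hq : 2 ≤ q) (hκ : 0 < κ0) (hκ1 : κ0 ≤ 1) (hρ : rhoOK q κ0 ρ) {a b cD : ℝ} (hab : a < b) (hbρ : b ≤ 1 / q + ρ) (hcD : 0 < cD) {ε : ℝ} (hε : 0 < ε) :
    ∃ γ : ℝ, 0 < γ ∧ ∀ᶠ n : ℕ in atTop, ∀ β : ℝ, 0 ≤ β → 2 * β / q ≤ 1 - κ0 → (∀ x ∈ Set.Icc a b, Dfun q β x ≤ -cD) →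
      ∀ f : (Fin n → Fin q) → ℝ, (∀ x, 0 ≤ f x) → (∀ x, f x ≤ 1) → ∀ σ0 : Fin n → Fin q, (∀ k, SS σ0 k ≤ a) →
      ∀ t : ℕ, alpha1 β q * n * Real.log n + γ * n ≤ t → (t:ℝ) ≤ n * Real.sqrt n →
      |(PP q n β)^[t] f σ0 - MU q n β f| ≤ ε + MU q n β (fun σ => if ∃ k, a < SS σ k then 1 else 0) := by
  have hq0 : 0 < q := by omega
  have hq' : (0:ℝ) < q := by positivity
  have hq2 : (2:ℝ) ≤ q := by exact_mod_cast hq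
  have hA := Aq_ge hq0 hκ hκ1
  have hCr := Crate_nonneg hq0 hκ hκ1
  have hK := Kq_ge hq0
  set θ := min 1 (cD / 2) with hθd
  have hθ : 0 < θ := lt_min one_pos (by linarith)
  have hθ1 : θ ≤ 1 := min_le_left _ _
  have hθc : 2 * θ ≤ cD := by have := min_le_right 1 (cD / 2); linarith
  set c := 1 / (8 * q ^ 2 * Real.exp q) with hcd
  have hc : 0 < c := by positivity
  have hc1 : c ≤ 1 / 4 := by
    rw [hcd]
    apply one_div_le_one_div_of_le (by norm_num)
    have := Real.one_le_exp hq'.le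
    nlinarith [sq_nonneg (q:ℝ)]
  set Q := Real.exp (Ksm q) / csm q with hQ
  have hQ0 : 0 < Q := div_pos (Real.exp_pos _) (csm_pos hq0)
  set L := 2 * Real.sqrt (Q / c) * Real.exp (Crate q κ0) with hL
  have hL0 : 0 < L := by positivity
  -- choose γ
  obtain ⟨γ0, hγ0⟩ : ∃ γ0 : ℝ, 0 < γ0 ∧ L * Real.exp (- (κ0 * γ0)) ≤ ε / 4 := by
    refine ⟨max 1 (Real.log (4 * L / ε) / κ0), by positivity, ?_⟩
    have h1 : Real.log (4 * L / ε) ≤ κ0 * max 1 (Real.log (4 * L / ε) / κ0) := by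
      have := le_max_right 1 (Real.log (4 * L / ε) / κ0)
      rw [div_le_iff₀ hκ] at this
      linarith
    have h2 : Real.exp (- (κ0 * max 1 (Real.log (4 * L / ε) / κ0))) ≤ Real.exp (- Real.log (4 * L / ε)) := Real.exp_le_exp.mpr (by linarith)
    rw [Real.exp_neg (Real.log _), Real.exp_log (by positivity)] at h2
    calc _ ≤ L * (4 * L / ε)⁻¹ := by gcongr
      _ = ε / 4 := by field_simp
  obtain ⟨hγ0p, hγ0⟩ := hγ0
  refine ⟨γ0 + 1, by linarith, ?_⟩
  have hba : 0 < b - a := by linarith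
  have d1 : 0 < θ * (b - a) := by positivity
  have d2 : 0 < c ^ 2 := by positivity
  have ev1 := ev_small 1 (Kq q) (θ * (b - a)) (q * Real.exp 1) d1 (show 0 < ε / 4 by linarith)
  have ev2 := ev_small 3 (Kq q) (θ * (b - a)) (q * Real.exp 1) d1 (show 0 < ε / 8 by linarith)
  have ev3 := ev_small 3 (Kq q) (c ^ 2) (q ^ 2 * Real.exp 1) d2 (show 0 < ε / 8 by linarith)
  have ev4 := ev_small 1 0 (c ^ 2) (q ^ 2) d2 (show 0 < ε / 4 by linarith)
  have nat := tendsto_natCast_atTop_atTop (R := ℝ)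
  have ev5 : ∀ᶠ n : ℕ in atTop, 8 ≤ Real.log n := (Real.tendsto_log_atTop.comp nat).eventually_ge_atTop 8
  have ev6 : ∀ᶠ n : ℕ in atTop, 2 * Kq q / c ^ 2 ≤ (n:ℝ) := nat.eventually_ge_atTop _
  have ev7 : ∀ᶠ n : ℕ in atTop, 4 * q * Real.exp (2 * q) / cD ≤ (n:ℝ) := nat.eventually_ge_atTop _
  have ev8 : ∀ᶠ n : ℕ in atTop, 1 / (b - a) ≤ (n:ℝ) := nat.eventually_ge_atTop _
  have ev9 : ∀ᶠ n : ℕ in atTop, (2 * Aq q κ0 * q ^ 2) ^ 2 ≤ (n:ℝ) := nat.eventually_ge_atTop _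
  filter_upwards [ev1, ev2, ev3, ev4, ev5, ev6, ev7, ev8, ev9, eventually_ge_atTop q] with n ev1 ev2 ev3 ev4 ev5 ev6 ev7 ev8 ev9 evq
  intro β hβ hβκ hD f f0 f1 σ0 hσ0 t ht1 ht2
  have hn : 0 < n := by omega
  have hn' : (0:ℝ) < n := by positivity
  have hn1 : (1:ℝ) ≤ n := by exact_mod_cast hn
  have hsn : 0 < Real.sqrt n := Real.sqrt_pos.mpr hn'
  have hss := Real.mul_self_sqrt hn'.le
  have hs1 : 1 ≤ Real.sqrt n := by rw [Real.one_le_sqrt]; exact hn1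
  have hN : nOK q n κ0 := by
    refine ⟨evq, ?_⟩
    have h1 : 2 * Aq q κ0 * q ^ 2 ≤ Real.sqrt n := Real.le_sqrt_of_sq_le ev9
    rw [← mul_assoc, mul_one_div, div_le_iff₀ hsn]
    linarith
  have hKc : Kq q / n ≤ c ^ 2 / 2 := by
    rw [div_le_iff₀ d2] at ev6
    rw [div_le_iff₀ hn']
    linarith
  have hnc : 4 * q * Real.exp (2 * q) ≤ cD * n := by
    rw [div_le_iff₀ hcD] at ev7; linarith
  have ha1 : a + 1 / n ≤ b := by
    rw [div_le_iff₀ hba] at ev8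
    have : 1 / (n:ℝ) ≤ b - a := by rw [div_le_iff₀ hn']; linarith
    linarith
  have h0 : ∀ k, 4 * c * n ≤ 1 / (q * Real.exp q) * cn σ0 k := by
    intro k
    have h1 := SS_lower hn σ0 (r := ρ) (fun k => (hσ0 k).trans (by linarith)) k
    have h2 : 1 / (2 * q) ≤ SS σ0 k := by
      refine le_trans ?_ h1
      obtain ⟨r0, r1, r2, r3⟩ := hρ
      have h3 : (q:ℝ) ^ 3 * ρ ≤ 1 / 2 := by
        have h6 : 0 ≤ (q:ℝ) ^ 3 * ρ := by positivity
        have h7 : 1 * ((q:ℝ) ^ 3 * ρ) ≤ Aq q κ0 * ((q:ℝ) ^ 3 * ρ) := by gcongr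
        linarith only [h7, r3]
      have h4 : q * ρ ≤ 1 / (2 * q) := by
        rw [le_div_iff₀ (by positivity)]
        have h6 : 0 ≤ (q:ℝ) ^ 2 * ρ := by positivity
        have h7 : 2 * ((q:ℝ) ^ 2 * ρ) ≤ q * ((q:ℝ) ^ 2 * ρ) := by gcongr
        linarith only [h7, h3]
      have e : 1 / (q:ℝ) = 1 / (2 * q) + 1 / (2 * q) := by field_simp; norm_num
      linarith
    rw [cn_SS hn]
    calc 4 * c * n = 1 / (q * Real.exp q) * (n * (1 / (2 * q))) := by rw [hcd]; field_simp; norm_num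
      _ ≤ _ := by gcongr
  -- κ
  set κ := 1 - 2 * β / q with hκd
  have hβq0 : 0 ≤ 2 * β / q := by positivity
  have hκκ : κ0 ≤ κ := by linarith
  have hκ1' : κ ≤ 1 := by linarith
  have hκp : 0 < κ := by linarith
  have hal : alpha1 β q = 1 / (2 * κ) := rfl
  have hlog0 : 0 < Real.log n := by linarith
  -- split time
  have hnt : n ≤ t := by
    have : (n:ℝ) ≤ t := by
      refine le_trans ?_ ht1
      have h7 : 0 ≤ alpha1 β q * n * Real.log n := by rw [hal]; positivity
      have h8 : 0 ≤ γ0 * n := by positivity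
      linarith only [h7, h8]
    exact_mod_cast this
  obtain ⟨t', rfl⟩ := Nat.exists_eq_add_of_le hnt
  push_cast at ht1 ht2
  have ht1' : 1 / (2 * κ) * n * Real.log n + γ0 * n ≤ t' := by rw [hal] at ht1; linarith
  have ht2' : (t':ℝ) ≤ n * Real.sqrt n := by linarith
  rw [← symz_PPt, ← symz_MU σ0 f, ← MU_PPt hq0 hn (n + t') (symz σ0 f), add_comm n t', Function.iterate_add_apply]
  set g := (PP q n β)^[t'] ((PP q n β)^[n] (symz σ0 f)) with hg
  have S0 := symz_nonneg σ0 f f0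
  have S1 := symz_le σ0 f f1
  set B := (Real.sqrt (Q / (c * n)) * (1 - κ * (1 / n) + Crate q κ0 * (1 / n * (1 / Real.sqrt n))) ^ t') * 2
    + ((1 + Kq q / n) ^ t' * (q * Real.exp (- (θ * (b - (a + 1 / n)) * n)))
     + (1 + Kq q / n) ^ t' * (t' * (q * (Real.exp 1 * Real.exp (- (θ * (b - a) * n))) + q ^ 2 * (Real.exp 1 * Real.exp (- (c ^ 2 * n))))))
    + (1 - c ^ 2 + Kq q / n) ^ t' * (q ^ 2 * Real.exp (c ^ 2 * n)) with hB
  have hKn : 0 ≤ Kq q / n := by positivity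
  have hc2 : c ^ 2 ≤ 1 := pow_le_one₀ hc.le (by linarith only [hc1])
  have hr0 : 0 ≤ 1 - κ * (1 / n) + Crate q κ0 * (1 / n * (1 / Real.sqrt n)) := by
    have : 0 ≤ Crate q κ0 * (1 / n * (1 / Real.sqrt n)) := by positivity
    have h3 : 1 / (n:ℝ) ≤ 1 := by rw [div_le_one hn']; exact hn1
    have h4 : 0 ≤ 1 / (n:ℝ) := by positivity
    have h5 : κ * (1 / n) ≤ 1 * 1 := mul_le_mul hκ1' h3 h4 (by norm_num)
    linarith
  have hR0 : 0 ≤ 1 - c ^ 2 + Kq q / n := by linarith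
  have hBg : ∀ x, (∀ k, SS x k ≤ a + 1 / n) → ∀ u j, |g (Function.update x u j) - g x| ≤ B := by
    intro x hx u j
    refine (grad_iter hq hn hβ hκ hκ1 hβκ hρ hN hθ hθ1 hab hbρ hθc hnc hD hc hc1 (by linarith) σ0 h0 f f0 f1 t' x u j).trans ?_
    obtain ⟨hAs, -, -⟩ := reg_facts hq0 hn hβ hκ hκ1 hβκ hρ hN x (fun k => (hx k).trans (ha1.trans hbρ))
    have hb := bb_le_exp hn hθ.le (b := b) x hx
    have hb2 := b2_le hc.le σ0 x
    unfold wt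
    rw [hB]
    gcongr
    linarith
  have hB0 : 0 ≤ B := by rw [hB]; positivity
  refine (path_MU hq0 hn g (PPt_nonneg hq0 hn t' (PPt_nonneg hq0 hn n S0)) (PPt_le_const hq0 hn t' (PPt_le_const hq0 hn n S1)) hB0 hBg σ0 hσ0).trans ?_
  gcongr
  -- n * B ≤ ε
  have hG : (1 + Kq q / n) ^ t' ≤ Real.exp (Kq q * Real.sqrt n) := by
    calc (1 + Kq q / n) ^ t' ≤ (Real.exp (Kq q / n)) ^ t' := by gcongr; rw [add_comm]; exact Real.add_one_le_exp _
      _ = Real.exp (t' * (Kq q / n)) := by rw [← Real.exp_nat_mul]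
      _ ≤ _ := by
        apply Real.exp_le_exp.mpr
        calc t' * (Kq q / n) ≤ n * Real.sqrt n * (Kq q / n) := by gcongr
          _ = _ := by field_simp
  have T1 : n * ((Real.sqrt (Q / (c * n)) * (1 - κ * (1 / n) + Crate q κ0 * (1 / n * (1 / Real.sqrt n))) ^ t') * 2) ≤ ε / 4 := by
    have h1 : (1 - κ * (1 / n) + Crate q κ0 * (1 / n * (1 / Real.sqrt n))) ^ t' ≤ 1 / Real.sqrt n * (Real.exp (Crate q κ0) * Real.exp (- (κ0 * γ0))) := by
      calc (1 - κ * (1 / n) + Crate q κ0 * (1 / n * (1 / Real.sqrt n))) ^ t'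
          ≤ (Real.exp (- κ * (1 / n) + Crate q κ0 * (1 / n * (1 / Real.sqrt n)))) ^ t' := by
            gcongr
            have := Real.add_one_le_exp (- κ * (1 / n) + Crate q κ0 * (1 / n * (1 / Real.sqrt n)))
            linarith
        _ = Real.exp (t' * (- κ * (1 / n) + Crate q κ0 * (1 / n * (1 / Real.sqrt n)))) := by rw [← Real.exp_nat_mul]
        _ ≤ Real.exp (- (Real.log n / 2) + (Crate q κ0 + - (κ0 * γ0))) := by
            apply Real.exp_le_exp.mpr
            have a1 : t' * (Crate q κ0 * (1 / n * (1 / Real.sqrt n))) ≤ n * Real.sqrt n * (Crate q κ0 * (1 / n * (1 / Real.sqrt n))) := by gcongr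
            have a2 : n * Real.sqrt n * (Crate q κ0 * (1 / n * (1 / Real.sqrt n))) = Crate q κ0 := by field_simp
            have a3 : κ * (1 / n) * (1 / (2 * κ) * n * Real.log n + γ0 * n) ≤ κ * (1 / n) * t' := by gcongr
            have a4 : κ * (1 / n) * (1 / (2 * κ) * n * Real.log n + γ0 * n) = Real.log n / 2 + κ * γ0 := by field_simp
            have a5 : κ0 * γ0 ≤ κ * γ0 := by gcongr
            have a6 : t' * (- κ * (1 / n) + Crate q κ0 * (1 / n * (1 / Real.sqrt n))) = - (κ * (1 / n) * t') + t' * (Crate q κ0 * (1 / n * (1 / Real.sqrt n))) := by ring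
            rw [a6]
            rw [a4] at a3
            rw [a2] at a1
            linarith only [a1, a3, a5]
        _ = _ := by
            rw [Real.exp_add, Real.exp_add]
            congr 1
            rw [Real.exp_neg, one_div]
            congr 1
            rw [Real.exp_half, Real.exp_log hn']
    have e1 : Real.sqrt (Q / (c * n)) = Real.sqrt (Q / c) / Real.sqrt n := by
      rw [← Real.sqrt_div (div_pos hQ0 hc).le (n:ℝ), ← div_div]
    rw [e1]
    calc n * (Real.sqrt (Q / c) / Real.sqrt n * (1 - κ * (1 / n) + Crate q κ0 * (1 / n * (1 / Real.sqrt n))) ^ t' * 2)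
        ≤ n * (Real.sqrt (Q / c) / Real.sqrt n * (1 / Real.sqrt n * (Real.exp (Crate q κ0) * Real.exp (- (κ0 * γ0)))) * 2) := by gcongr
      _ = (n / (Real.sqrt n * Real.sqrt n)) * (L * Real.exp (- (κ0 * γ0))) := by rw [hL]; field_simp
      _ = L * Real.exp (- (κ0 * γ0)) := by rw [hss, div_self hn'.ne', one_mul]
      _ ≤ _ := hγ0
  have T2 : n * ((1 + Kq q / n) ^ t' * (q * Real.exp (- (θ * (b - (a + 1 / n)) * n)))) ≤ ε / 4 := by
    refine le_trans ?_ ev1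
    have e : Real.exp (- (θ * (b - (a + 1 / n)) * n)) ≤ Real.exp 1 * Real.exp (- (θ * (b - a) * n)) := by
      rw [← Real.exp_add]; apply Real.exp_le_exp.mpr
      have : θ * (b - (a + 1 / n)) * n = θ * (b - a) * n - θ := by field_simp; ring
      rw [this]; linarith
    calc _ ≤ n * (Real.exp (Kq q * Real.sqrt n) * (q * (Real.exp 1 * Real.exp (- (θ * (b - a) * n))))) := by gcongr
      _ = _ := by
        have e2 : Real.exp (Kq q * Real.sqrt n - θ * (b - a) * n) = Real.exp (Kq q * Real.sqrt n) * Real.exp (- (θ * (b - a) * n)) := by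
          rw [← Real.exp_add, ← sub_eq_add_neg]
        rw [e2]; ring
  have htn : n * (t':ℝ) ≤ n ^ 3 := by
    have : Real.sqrt n ≤ n := by
      calc Real.sqrt n = Real.sqrt n * 1 := (mul_one _).symm
        _ ≤ Real.sqrt n * Real.sqrt n := by gcongr
        _ = n := hss
    calc n * (t':ℝ) ≤ n * (n * n) := by gcongr; exact ht2'.trans (by gcongr)
      _ = _ := by ring
  have T3 : n * ((1 + Kq q / n) ^ t' * (t' * (q * (Real.exp 1 * Real.exp (- (θ * (b - a) * n))) + q ^ 2 * (Real.exp 1 * Real.exp (- (c ^ 2 * n)))))) ≤ ε / 4 := by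
    calc _ = n * t' * ((1 + Kq q / n) ^ t' * ((q * (Real.exp 1 * Real.exp (- (θ * (b - a) * n))) + q ^ 2 * (Real.exp 1 * Real.exp (- (c ^ 2 * n)))))) := by ring
      _ ≤ n ^ 3 * (Real.exp (Kq q * Real.sqrt n) * ((q * (Real.exp 1 * Real.exp (- (θ * (b - a) * n))) + q ^ 2 * (Real.exp 1 * Real.exp (- (c ^ 2 * n)))))) := by gcongr
      _ = q * Real.exp 1 * (n ^ 3 * Real.exp (Kq q * Real.sqrt n - θ * (b - a) * n)) + q ^ 2 * Real.exp 1 * (n ^ 3 * Real.exp (Kq q * Real.sqrt n - c ^ 2 * n)) := by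
          have e2 : Real.exp (Kq q * Real.sqrt n - θ * (b - a) * n) = Real.exp (Kq q * Real.sqrt n) * Real.exp (- (θ * (b - a) * n)) := by
            rw [← Real.exp_add, ← sub_eq_add_neg]
          have e3 : Real.exp (Kq q * Real.sqrt n - c ^ 2 * n) = Real.exp (Kq q * Real.sqrt n) * Real.exp (- (c ^ 2 * n)) := by
            rw [← Real.exp_add, ← sub_eq_add_neg]
          rw [e2, e3]; ring
      _ ≤ _ := by linarith
  have T4 : n * ((1 - c ^ 2 + Kq q / n) ^ t' * (q ^ 2 * Real.exp (c ^ 2 * n))) ≤ ε / 4 := by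
    refine le_trans ?_ ev4
    have h1 : (1 - c ^ 2 + Kq q / n) ^ t' ≤ Real.exp (- (2 * c ^ 2 * n)) := by
      calc (1 - c ^ 2 + Kq q / n) ^ t' ≤ (Real.exp (- (c ^ 2 / 2))) ^ t' := by
            gcongr
            have := Real.add_one_le_exp (- (c ^ 2 / 2))
            linarith
        _ = Real.exp (t' * (- (c ^ 2 / 2))) := by rw [← Real.exp_nat_mul]
        _ ≤ _ := by
          apply Real.exp_le_exp.mpr
          have : 4 * (n:ℝ) ≤ t' := by
            refine le_trans ?_ ht1'
            have h2 : 1 / 2 ≤ 1 / (2 * κ) := one_div_le_one_div_of_le (by positivity) (by linarith)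
            have h3 : 1 / 2 * n * 8 ≤ 1 / (2 * κ) * n * Real.log n := by gcongr
            have : 0 ≤ γ0 * n := by positivity
            linarith only [this, h3]
          have h5 : c ^ 2 / 2 * (4 * (n:ℝ)) ≤ c ^ 2 / 2 * t' := by gcongr
          linarith only [h5]
    calc _ ≤ n * (Real.exp (- (2 * c ^ 2 * n)) * (q ^ 2 * Real.exp (c ^ 2 * n))) := by gcongr
      _ = q ^ 2 * (n ^ 1 * (Real.exp (- (2 * c ^ 2 * n)) * Real.exp (c ^ 2 * n))) := by ring
      _ = _ := by rw [← Real.exp_add]; ring_nf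
  rw [hB]
  linarith
end

open Finset Filter
section
variable {q : ℕ} {β : ℝ}

/-- the logistic function -/
noncomputable def lgs (q : ℕ) (z : ℝ) : ℝ := (1 + ((q : ℝ) - 1) * Real.exp (-z))⁻¹

lemma qr_pos (hq : 3 ≤ q) : (0:ℝ) < q ∧ (3:ℝ) ≤ q ∧ (0:ℝ) < q - 1 := by
  have : (3:ℝ) ≤ q := by exact_mod_cast hq
  exact ⟨by linarith, this, by linarith⟩

lemma lgs_pos (hq : 3 ≤ q) (z : ℝ) : 0 < lgs q z := by
  have := (qr_pos hq).2.2
  unfold lgs; positivity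

lemma lgs_lt_one (hq : 3 ≤ q) (z : ℝ) : lgs q z < 1 := by
  have := (qr_pos hq).2.2
  unfold lgs
  exact inv_lt_one_of_one_lt₀ (by have : 0 < ((q:ℝ) - 1) * Real.exp (-z) := by positivity
                                  linarith)

lemma Dfun_lgs (hq : 3 ≤ q) (β x : ℝ) : Dfun q β x = lgs q (2 * β * (q * x - 1) / (q - 1)) - x := by
  unfold Dfun lgs
  rw [show 2 * β * (1 - (q:ℝ) * x) / (q - 1) = -(2 * β * (q * x - 1) / (q - 1)) by ring]
  ring

lemma lgs_deriv (hq : 3 ≤ q) (z : ℝ) : HasDerivAt (lgs q) (lgs q z - lgs q z ^ 2) z := by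
  have hr := (qr_pos hq).2.2
  have hp : 0 < 1 + ((q:ℝ) - 1) * Real.exp (-z) := by positivity
  have h1 : HasDerivAt (fun z => 1 + ((q:ℝ) - 1) * Real.exp (-z)) (((q:ℝ) - 1) * (Real.exp (-z) * (-1))) z := by
    have := ((hasDerivAt_id z).neg.exp.const_mul ((q:ℝ) - 1)).const_add 1
    simpa using this
  have h2 := h1.inv hp.ne'
  refine h2.congr_deriv ?_
  unfold lgs
  field_simp
  ring

lemma lgs_cont (hq : 3 ≤ q) : Continuous (lgs q) :=
  continuous_iff_continuousAt.mpr fun z => (lgs_deriv hq z).continuousAt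

lemma lgs_strictMono (hq : 3 ≤ q) : StrictMono (lgs q) := by
  refine strictMono_of_deriv_pos fun z => ?_
  rw [(lgs_deriv hq z).deriv]
  nlinarith [lgs_pos hq z, lgs_lt_one hq z]

lemma lgs_zero (hq : 3 ≤ q) : lgs q 0 = 1 / q := by
  unfold lgs; simp

lemma lgs_var_bd (hq : 3 ≤ q) (z : ℝ) : 0 ≤ lgs q z - lgs q z ^ 2 ∧ lgs q z - lgs q z ^ 2 ≤ 1 / 4 := by
  constructor
  · nlinarith [lgs_pos hq z, lgs_lt_one hq z]
  · nlinarith [sq_nonneg (lgs q z - 1 / 2)]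

/-- mean value: Lipschitz bound for a function with bounded derivative -/
lemma mvt_abs {f f' : ℝ → ℝ} {C : ℝ} (x y : ℝ) (h : ∀ z ∈ Set.uIcc x y, HasDerivAt f (f' z) z) (hC : ∀ z ∈ Set.uIcc x y, |f' z| ≤ C) :
    |f y - f x| ≤ C * |y - x| := by
  have := (convex_uIcc x y).norm_image_sub_le_of_norm_hasDerivWithin_le (f := f) (f' := f') (C := C)
    (fun z hz => (h z hz).hasDerivWithinAt) hC Set.left_mem_uIcc Set.right_mem_uIcc
  simpa [Real.norm_eq_abs] using this

lemma lgs_lip (hq : 3 ≤ q) (x y : ℝ) : |lgs q y - lgs q x| ≤ 1 / 4 * |y - x| :=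
  mvt_abs x y (fun z _ => lgs_deriv hq z) (fun z _ => by
    have := lgs_var_bd hq z
    rw [abs_of_nonneg this.1]; exact this.2)

/-- G-form -/
lemma lgs_eq_iff (hq : 3 ≤ q) {x z : ℝ} (h0 : 0 < x) (h1 : x < 1) (h : lgs q z = x) :
    Real.log x - Real.log (1 - x) + Real.log ((q:ℝ) - 1) - z = 0 := by
  have hr := (qr_pos hq).2.2
  have hx : 0 < 1 - x := by linarith
  have e : ((q:ℝ) - 1) * Real.exp (-z) = (1 - x) / x := by
    unfold lgs at h
    have : 1 + ((q:ℝ) - 1) * Real.exp (-z) = x⁻¹ := by rw [← h, inv_inv]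
    field_simp at this ⊢
    linarith
  have := congrArg Real.log e
  rw [Real.log_mul hr.ne' (Real.exp_pos _).ne', Real.log_exp, Real.log_div hx.ne' h0.ne'] at this
  linarith

lemma one_mem_S (hq : 3 ≤ q) : ∀ x ∈ Set.Ioo (1 / (q : ℝ)) 1, Dfun q 1 x ≠ 0 := by
  intro x hx
  obtain ⟨q0, q3, r0⟩ := qr_pos hq
  have hx1 := hx.1
  rw [div_lt_iff₀ q0] at hx1
  have h := lgs_lip hq 0 (2 * 1 * (q * x - 1) / (q - 1))
  rw [lgs_zero hq, sub_zero, abs_of_nonneg (a := 2 * 1 * (q * x - 1) / (q - 1)) (div_nonneg (by linarith) r0.le)] at h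
  have h2 := (abs_le.mp h).2
  rw [Dfun_lgs hq]
  have h3 : 1 / 4 * (2 * 1 * (q * x - 1) / (q - 1)) < x - 1 / q := by
    have : x - 1 / (q:ℝ) = (q * x - 1) / q := by field_simp
    rw [this, show 1 / 4 * (2 * 1 * ((q:ℝ) * x - 1) / (q - 1)) = (q * x - 1) / (2 * (q - 1)) by field_simp; norm_num]
    apply div_lt_div_of_pos_left <;> linarith
  linarith

lemma Dfun_one_neg (hq : 3 ≤ q) (β : ℝ) : Dfun q β 1 < 0 := by
  rw [Dfun_lgs hq]; linarith [lgs_lt_one hq (2 * β * (q * 1 - 1) / (q - 1))]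

lemma Dfun_cont (hq : 3 ≤ q) (β : ℝ) : Continuous (Dfun q β) := by
  have := lgs_cont hq
  have e : Dfun q β = fun x => lgs q (2 * β * (q * x - 1) / (q - 1)) - x := funext (Dfun_lgs hq β)
  rw [e]; fun_prop

lemma Dfun_mono (hq : 3 ≤ q) {β β' x : ℝ} (h : β ≤ β') (hx : 1 / (q:ℝ) ≤ x) : Dfun q β x ≤ Dfun q β' x := by
  obtain ⟨q0, q3, r0⟩ := qr_pos hq
  rw [div_le_iff₀ q0] at hx
  rw [Dfun_lgs hq, Dfun_lgs hq]
  have : lgs q (2 * β * (q * x - 1) / (q - 1)) ≤ lgs q (2 * β' * (q * x - 1) / (q - 1)) := by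
    apply (lgs_strictMono hq).monotone
    have : 0 ≤ q * x - 1 := by linarith
    gcongr
  linarith

lemma root_of_nonneg (hq : 3 ≤ q) {β x : ℝ} (hx : x ∈ Set.Ioo (1 / (q : ℝ)) 1) (h : 0 ≤ Dfun q β x) :
    ∃ y ∈ Set.Ioo (1 / (q : ℝ)) 1, Dfun q β y = 0 := by
  obtain ⟨y, hy, hy0⟩ := intermediate_value_Icc' hx.2.le (Dfun_cont hq β).continuousOn ⟨(Dfun_one_neg hq β).le, h⟩
  refine ⟨y, ⟨lt_of_lt_of_le hx.1 hy.1, lt_of_le_of_ne hy.2 ?_⟩, hy0⟩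
  rintro rfl
  linarith [Dfun_one_neg hq β]

lemma S_neg (hq : 3 ≤ q) {β : ℝ} (h : ∀ x ∈ Set.Ioo (1 / (q : ℝ)) 1, Dfun q β x ≠ 0) :
    ∀ x ∈ Set.Ioo (1 / (q : ℝ)) 1, Dfun q β x < 0 := by
  intro x hx
  by_contra hh
  push Not at hh
  obtain ⟨y, hy, hy0⟩ := root_of_nonneg hq hx hh
  exact h y hy hy0

/-- `2 y log y < y² - 1` for `y > 1` -/
lemma log_lt_aux {y : ℝ} (hy : 1 < y) : Real.log y < (y - 1 / y) / 2 := by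
  have h : StrictMonoOn (fun y : ℝ => (y - 1 / y) / 2 - Real.log y) (Set.Ici 1) := by
    refine strictMonoOn_of_deriv_pos (convex_Ici 1) ?_ ?_
    · refine ContinuousOn.sub ?_ ?_
      · refine ContinuousOn.div_const ?_ _
        exact continuousOn_id.sub (ContinuousOn.div continuousOn_const continuousOn_id fun x hx => by
          have : (1:ℝ) ≤ x := hx
          simp; linarith)
      · exact Real.continuousOn_log.mono fun x hx => by
          have : (1:ℝ) ≤ x := hx
          simp; linarith
    · intro x hx
      rw [interior_Ici] at hx
      have hx1 : (1:ℝ) < x := hx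
      have hx0 : x ≠ 0 := by linarith
      have : HasDerivAt (fun y : ℝ => (y - 1 / y) / 2 - Real.log y) ((1 - (-(x ^ 2)⁻¹)) / 2 - x⁻¹) x := by
        have h1 := hasDerivAt_inv hx0
        have h2 := (((hasDerivAt_id x).fun_sub h1).div_const 2).fun_sub (Real.hasDerivAt_log hx0)
        simpa [one_div] using h2
      rw [this.deriv]
      have : (1 - (-(x ^ 2)⁻¹)) / 2 - x⁻¹ = (x - 1) ^ 2 / (2 * x ^ 2) := by field_simp; ring
      rw [this]
      have : 0 < x - 1 := by linarith
      positivity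
  have := h (Set.mem_Ici.mpr le_rfl) (Set.mem_Ici.mpr hy.le) hy
  simp at this
  simp only [one_div]; linarith

lemma S_bdd (hq : 3 ≤ q) : ∃ b : ℝ, 2 * b < q ∧ ∀ β, (∀ x ∈ Set.Ioo (1 / (q : ℝ)) 1, Dfun q β x ≠ 0) → β ≤ b := by
  obtain ⟨q0, q3, r0⟩ := qr_pos hq
  have hq2 : (0:ℝ) < q - 2 := by linarith
  refine ⟨(q - 1) * Real.log (q - 1) / (q - 2), ?_, ?_⟩
  · have h := log_lt_aux (y := (q:ℝ) - 1) (by linarith)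
    rw [← mul_div_assoc, div_lt_iff₀ hq2]
    have h2 : (q - 1) * Real.log (q - 1) < (q - 1) * (((q:ℝ) - 1 - 1 / (q - 1)) / 2) := by gcongr
    have h3 : ((q:ℝ) - 1) * (((q:ℝ) - 1 - 1 / (q - 1)) / 2) = (q * (q - 2)) / 2 := by field_simp; ring
    linarith
  · intro β hβ
    by_contra hh
    push Not at hh
    have hm : (1 / 2 : ℝ) ∈ Set.Ioo (1 / (q : ℝ)) 1 := ⟨by apply one_div_lt_one_div_of_lt <;> linarith, by norm_num⟩
    have h1 := S_neg hq hβ _ hm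
    have h2 := Dfun_mono hq hh.le hm.1.le
    have h3 : Dfun q ((q - 1) * Real.log (q - 1) / (q - 2)) (1 / 2) = 0 := by
      rw [Dfun_lgs hq, show 2 * (((q:ℝ) - 1) * Real.log (q - 1) / (q - 2)) * (q * (1 / 2) - 1) / (q - 1) = Real.log (q - 1) by field_simp]
      unfold lgs
      rw [Real.exp_neg, Real.exp_log r0]
      field_simp
      norm_num
    linarith

lemma betaS_facts (hq : 3 ≤ q) : 1 ≤ betaS q ∧ 2 * betaS q < q := by
  obtain ⟨b, hb, hb2⟩ := S_bdd hq
  unfold betaS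
  constructor
  · exact le_csSup ⟨b, fun β hβ => hb2 β hβ.2⟩ ⟨zero_le_one, one_mem_S hq⟩
  · have : sSup {β : ℝ | 0 ≤ β ∧ ∀ x ∈ Set.Ioo (1 / (q : ℝ)) 1, Dfun q β x ≠ 0} ≤ b := csSup_le ⟨1, zero_le_one, one_mem_S hq⟩ fun β hβ => hb2 β hβ.2
    linarith

lemma Dfun_deriv (hq : 3 ≤ q) (β x : ℝ) : HasDerivAt (Dfun q β)
    (2 * β * q / (q - 1) * (lgs q (2 * β * (q * x - 1) / (q - 1)) - lgs q (2 * β * (q * x - 1) / (q - 1)) ^ 2) - 1) x := by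
  have e : Dfun q β = fun x => lgs q (2 * β * (q * x - 1) / (q - 1)) - x := funext (Dfun_lgs hq β)
  rw [e]
  have h1 : HasDerivAt (fun x : ℝ => 2 * β * (q * x - 1) / (q - 1)) (2 * β * q / (q - 1)) x := by
    have := ((((hasDerivAt_id x).const_mul (q:ℝ)).sub_const 1).const_mul (2 * β)).div_const ((q:ℝ) - 1)
    simpa using this
  have := ((lgs_deriv hq _).comp x h1).sub (hasDerivAt_id x)
  refine this.congr_deriv ?_
  ring

lemma Dfun_lip_beta (hq : 3 ≤ q) (β β' : ℝ) {x : ℝ} (h0 : 1 / (q:ℝ) ≤ x) (h1 : x ≤ 1) : |Dfun q β' x - Dfun q β x| ≤ |β' - β| := by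
  obtain ⟨q0, q3, r0⟩ := qr_pos hq
  rw [div_le_iff₀ q0] at h0
  rw [Dfun_lgs hq, Dfun_lgs hq]
  have h := lgs_lip hq (2 * β * (q * x - 1) / (q - 1)) (2 * β' * (q * x - 1) / (q - 1))
  rw [show lgs q (2 * β' * (q * x - 1) / (q - 1)) - x - (lgs q (2 * β * (q * x - 1) / (q - 1)) - x) = lgs q (2 * β' * (q * x - 1) / (q - 1)) - lgs q (2 * β * (q * x - 1) / (q - 1)) by ring]
  refine h.trans ?_
  rw [show 2 * β' * (q * x - 1) / (q - 1) - 2 * β * (q * x - 1) / (q - 1) = (β' - β) * (2 * ((q * x - 1) / (q - 1))) by ring, abs_mul]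
  have h2 : 0 ≤ ((q:ℝ) * x - 1) / (q - 1) := div_nonneg (by linarith) r0.le
  have h3 : ((q:ℝ) * x - 1) / (q - 1) ≤ 1 := by rw [div_le_one r0]; nlinarith
  rw [abs_of_nonneg (a := 2 * ((q * x - 1) / (q - 1))) (by linarith)]
  nlinarith [abs_nonneg (β' - β)]

lemma Dfun_at (hq : 3 ≤ q) (β : ℝ) : Dfun q β (1 / q) = 0 := by
  obtain ⟨q0, q3, r0⟩ := qr_pos hq
  rw [Dfun_lgs hq]
  rw [show 2 * β * ((q:ℝ) * (1 / q) - 1) / (q - 1) = 0 by field_simp; simp, lgs_zero hq, sub_self]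

/-- near `1/q` the drift is uniformly negative. -/
lemma D_near (hq : 3 ≤ q) {b1 : ℝ} (hb0 : 0 ≤ b1) (hb : 2 * b1 < q) : ∃ ρ0 > 0, ∀ β, 0 ≤ β → β ≤ b1 → ∀ x, 1 / (q:ℝ) < x → x ≤ 1 / q + ρ0 → Dfun q β x < 0 := by
  obtain ⟨q0, q3, r0⟩ := qr_pos hq
  have hd := Dfun_deriv hq b1 (1 / q)
  rw [show 2 * b1 * ((q:ℝ) * (1 / q) - 1) / (q - 1) = 0 by field_simp; simp, lgs_zero hq] at hd
  have hneg : 2 * b1 * q / (q - 1) * (1 / (q:ℝ) - (1 / q) ^ 2) - 1 < 0 := by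
    have : 2 * b1 * q / (q - 1) * (1 / (q:ℝ) - (1 / q) ^ 2) = 2 * b1 / q := by field_simp
    rw [this, sub_neg, div_lt_one q0]; exact hb
  have h1 := hd.tendsto_slope
  have h2 := h1.eventually_lt_const hneg
  have h3 : ∀ᶠ x in nhdsWithin (1 / (q:ℝ)) (Set.Ioi (1 / (q:ℝ))), slope (Dfun q b1) (1 / q) x < 0 :=
    h2.filter_mono (nhdsWithin_mono _ fun x hx => ne_of_gt hx)
  obtain ⟨u, hu, hu2⟩ := (mem_nhdsGT_iff_exists_Ioc_subset).mp h3
  refine ⟨u - 1 / q, sub_pos.mpr hu, fun β hβ hβb x hx hxu => ?_⟩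
  refine lt_of_le_of_lt (Dfun_mono hq hβb hx.le) ?_
  have h4 : slope (Dfun q b1) (1 / q) x < 0 := hu2 ⟨hx, by linarith⟩
  rw [slope_def_field, Dfun_at hq, sub_zero, div_lt_iff₀ (sub_pos.mpr hx)] at h4
  linarith

lemma bs_nonpos (hq : 3 ≤ q) : ∀ x ∈ Set.Ioo (1 / (q : ℝ)) 1, Dfun q (betaS q) x ≤ 0 := by
  intro x hx
  by_contra hh
  push Not at hh
  set d := Dfun q (betaS q) x
  obtain ⟨β, hβ, hβ2⟩ := exists_lt_of_lt_csSup (s := {β : ℝ | 0 ≤ β ∧ ∀ x ∈ Set.Ioo (1 / (q : ℝ)) 1, Dfun q β x ≠ 0}) ⟨1, zero_le_one, one_mem_S hq⟩ (b := betaS q - d) (by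
    change betaS q - d < betaS q; linarith)
  obtain ⟨b, hb, hb2⟩ := S_bdd hq
  have h0 : β ≤ betaS q := le_csSup ⟨b, fun β hβ => hb2 β hβ.2⟩ hβ
  have h1 := S_neg hq hβ.2 x hx
  have h2 := Dfun_lip_beta hq β (betaS q) hx.1.le hx.2.le
  rw [abs_of_nonneg (a := betaS q - β) (by linarith)] at h2
  have := (abs_le.mp h2).2
  change d - _ ≤ _ at this
  linarith

lemma bs_root (hq : 3 ≤ q) : ∃ s ∈ Set.Ioo (1 / (q : ℝ)) 1, Dfun q (betaS q) s = 0 := by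
  by_contra hno
  push Not at hno
  obtain ⟨q0, q3, r0⟩ := qr_pos hq
  obtain ⟨b1, b2⟩ := betaS_facts hq
  obtain ⟨ρ0, hρ0, hρ⟩ := D_near hq (b1 := (betaS q + q / 2) / 2) (by linarith) (by linarith)
  have hneg := S_neg hq hno
  have hq1 : 1 / (q:ℝ) < 1 := by rw [div_lt_one q0]; linarith
  set x0 := min (1 / (q:ℝ) + ρ0) 1
  obtain ⟨y, hy, hymax⟩ := isCompact_Icc.exists_isMaxOn (s := Set.Icc x0 1) ⟨1, min_le_right _ _, le_rfl⟩ (Dfun_cont hq (betaS q)).continuousOn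
  have hx0 : 1 / (q:ℝ) < x0 := lt_min (by linarith) hq1
  have hy0 : Dfun q (betaS q) y < 0 := by
    rcases eq_or_lt_of_le hy.2 with h | h
    · rw [h]; exact Dfun_one_neg hq _
    · exact hneg y ⟨lt_of_lt_of_le hx0 hy.1, h⟩
  set m := min (- Dfun q (betaS q) y) (q / 2 - betaS q) with hm
  have hm0 : 0 < m := lt_min (by linarith) (by linarith)
  have hm1 : m ≤ - Dfun q (betaS q) y := min_le_left _ _
  have hm2 : m ≤ q / 2 - betaS q := min_le_right _ _
  obtain ⟨b, hb, hb2⟩ := S_bdd hq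
  have : betaS q + m / 2 ≤ betaS q := by
    refine le_csSup ⟨b, fun β hβ => hb2 β hβ.2⟩ ⟨by linarith, fun x hx => ne_of_lt ?_⟩
    by_cases hxx : x ≤ 1 / q + ρ0
    · exact hρ _ (by linarith) (by linarith) x hx.1 hxx
    · push Not at hxx
      have h1 : Dfun q (betaS q) x ≤ Dfun q (betaS q) y := hymax ⟨(min_le_left _ _).trans hxx.le, hx.2.le⟩
      have h2 := Dfun_lip_beta hq (betaS q) (betaS q + m / 2) hx.1.le hx.2.le
      rw [abs_of_nonneg (a := betaS q + m / 2 - betaS q) (by linarith)] at h2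
      have := (abs_le.mp h2).2
      linarith
  linarith

lemma root_props (hq : 3 ≤ q) {s : ℝ} (hs : s ∈ Set.Ioo (1 / (q : ℝ)) 1) (h : Dfun q (betaS q) s = 0) :
    1 / 2 < s ∧ 2 * betaS q * q / (q - 1) * (s - s ^ 2) = 1 := by
  obtain ⟨q0, q3, r0⟩ := qr_pos hq
  obtain ⟨b1, b2⟩ := betaS_facts hq
  have hL : lgs q (2 * betaS q * (q * s - 1) / (q - 1)) = s := by
    rw [Dfun_lgs hq] at h; linarith
  have hloc : IsLocalMax (Dfun q (betaS q)) s := by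
    filter_upwards [Ioo_mem_nhds hs.1 hs.2] with x hx
    rw [h]; exact bs_nonpos hq x hx
  have hd := hloc.hasDerivAt_eq_zero (Dfun_deriv hq (betaS q) s)
  rw [hL] at hd
  have h1 : 2 * betaS q * q / (q - 1) * (s - s ^ 2) = 1 := by linarith
  refine ⟨?_, h1⟩
  by_contra hh
  push Not at hh
  have hs0 : 0 < s := lt_trans (by positivity) hs.1
  set α := 2 * betaS q * q / (q - 1) with hα
  have hα0 : 0 < α := by positivity
  -- G
  have hG : StrictMonoOn (fun x : ℝ => Real.log x - Real.log (1 - x) + Real.log ((q:ℝ) - 1) - α * (x - 1 / q)) (Set.Icc (1 / (q:ℝ)) s) := by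
    have hder : ∀ x, 0 < x → x < 1 → HasDerivAt (fun x : ℝ => Real.log x - Real.log (1 - x) + Real.log ((q:ℝ) - 1) - α * (x - 1 / q)) (x⁻¹ - (-1) / (1 - x) - α * 1) x := by
      intro x hx0 hx1
      have e1 := Real.hasDerivAt_log hx0.ne'
      have e2 := ((hasDerivAt_id x).const_sub 1).log (by simp; linarith)
      have e3 := ((hasDerivAt_id x).sub_const (1 / (q:ℝ))).const_mul α
      exact ((e1.fun_sub e2).add_const _).fun_sub e3
    have hin : ∀ x ∈ Set.Icc (1 / (q:ℝ)) s, 0 < x ∧ x < 1 := fun x hx => ⟨lt_of_lt_of_le (by positivity) hx.1, lt_of_le_of_lt hx.2 hs.2⟩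
    refine strictMonoOn_of_deriv_pos (convex_Icc _ _) (fun x hx => ((hder x (hin x hx).1 (hin x hx).2).continuousAt).continuousWithinAt) ?_
    intro x hx
    rw [interior_Icc] at hx
    obtain ⟨hx0, hx1⟩ := hin x ⟨hx.1.le, hx.2.le⟩
    rw [(hder x hx0 hx1).deriv]
    have hx1' : 0 < 1 - x := by linarith
    have e : x⁻¹ - (-1) / (1 - x) - α * 1 = (1 - α * (x - x ^ 2)) / (x * (1 - x)) := by field_simp; ring
    rw [e]
    apply div_pos _ (by positivity)
    have : x - x ^ 2 < s - s ^ 2 := by nlinarith [hx.2]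
    nlinarith
  have hgg := hG ⟨le_rfl, hs.1.le⟩ ⟨hs.1.le, le_rfl⟩ hs.1
  have e1 := lgs_eq_iff hq hs0 hs.2 hL
  have e2 := lgs_eq_iff hq (x := 1 / q) (by positivity) (by rw [div_lt_one q0]; linarith) (lgs_zero hq)
  have e3 : α * (s - 1 / q) = 2 * betaS q * (q * s - 1) / (q - 1) := by rw [hα]; field_simp
  simp only [e3, sub_self, mul_zero] at hgg
  linarith

/-- the critical point -/
lemma crit (hq : 3 ≤ q) : ∃ s : ℝ, 1 / 2 < s ∧ s < 1 ∧ Dfun q (betaS q) s = 0 ∧ 2 * betaS q * q / (q - 1) * (s - s ^ 2) = 1 ∧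
    ∀ x, 1 / (q:ℝ) < x → x ≤ 1 → x ≠ s → Dfun q (betaS q) x < 0 := by
  obtain ⟨s, hs, h0⟩ := bs_root hq
  obtain ⟨h1, h2⟩ := root_props hq hs h0
  refine ⟨s, h1, hs.2, h0, h2, fun x hx hx1 hne => ?_⟩
  rcases eq_or_lt_of_le hx1 with h | h
  · rw [h]; exact Dfun_one_neg hq _
  refine lt_of_le_of_ne (bs_nonpos hq x ⟨hx, h⟩) fun hx0 => ?_
  obtain ⟨h3, h4⟩ := root_props hq ⟨hx, h⟩ hx0
  have hα : 2 * betaS q * q / (q - 1) ≠ 0 := by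
    intro hh; rw [hh] at h2; linarith
  have : x - x ^ 2 = s - s ^ 2 := mul_left_cancel₀ hα (h4.trans h2.symm)
  have h5 : (x - s) * (1 - x - s) = 0 := by linarith
  rcases mul_eq_zero.mp h5 with h6 | h6
  · exact hne (by linarith)
  · linarith
end

open Finset Filter
section
variable {q : ℕ} {β : ℝ}

lemma pow_int {g g' : ℝ → ℝ} {C : ℝ} {k : ℕ} (h0 : g 0 = 0) (hd : ∀ h, HasDerivAt g (g' h) h) (hC0 : 0 ≤ C) (hC : ∀ h, |g' h| ≤ C * |h| ^ k) (h : ℝ) :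
    |g h| ≤ C * |h| ^ (k + 1) := by
  have := mvt_abs (f := g) (f' := g') (C := C * |h| ^ k) 0 h (fun z _ => hd z) (fun z hz => by
    refine (hC z).trans ?_
    have : |z| ≤ |h| := by
      have := Set.abs_sub_left_of_mem_uIcc hz
      simpa using this
    gcongr)
  rw [h0, sub_zero, sub_zero] at this
  rw [pow_succ, ← mul_assoc]; exact this

lemma lgs_taylor (hq : 3 ≤ q) (z0 s h : ℝ) (hs : lgs q z0 = s) :
    |lgs q (z0 + h) - (s + (s - s ^ 2) * h + (1 - 2 * s) * (s - s ^ 2) * h ^ 2 / 2 + (1 - 6 * s + 6 * s ^ 2) * (s - s ^ 2) * h ^ 3 / 6)| ≤ 100 * |h| ^ 4 := by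
  have hL : ∀ h, HasDerivAt (fun h => lgs q (z0 + h)) (lgs q (z0 + h) - lgs q (z0 + h) ^ 2) h := by
    intro h
    have := (lgs_deriv hq (z0 + h)).comp_const_add z0 h
    exact this
  have hh : ∀ h : ℝ, HasDerivAt (fun h : ℝ => h) 1 h := fun h => hasDerivAt_id h
  have hL0 : lgs q (z0 + 0) = s := by rw [add_zero, hs]
  set M : ℝ → ℝ := fun h => lgs q (z0 + h) with hM
  have M0 : M 0 = s := hL0
  have Mp : ∀ h, 0 < M h := fun h => lgs_pos hq _
  have M1 : ∀ h, M h < 1 := fun h => lgs_lt_one hq _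
  have d3 : ∀ h, |(1 - 6 * M h + 6 * M h ^ 2) * (M h - M h ^ 2) - (1 - 6 * s + 6 * s ^ 2) * (s - s ^ 2)| ≤ 100 * |h| ^ (0 + 1) := by
    apply pow_int (g' := fun h => ((-6) * (M h - M h ^ 2) + 6 * (2 * M h * (M h - M h ^ 2))) * (M h - M h ^ 2) + (1 - 6 * M h + 6 * M h ^ 2) * ((M h - M h ^ 2) - 2 * M h * (M h - M h ^ 2)))
    · simp [M0]
    · intro h
      have a1 := hL h
      have a2 : HasDerivAt (fun h => M h ^ 2) (2 * M h * (M h - M h ^ 2)) h := by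
        refine (a1.pow 2).congr_deriv ?_
        simp [hM]
      have a3 := ((((a1.const_mul 6).const_sub 1).fun_add (a2.const_mul 6)).fun_mul (a1.fun_sub a2)).sub_const ((1 - 6 * s + 6 * s ^ 2) * (s - s ^ 2))
      refine a3.congr_deriv ?_
      simp only [hM]; ring
    · norm_num
    · intro h
      have p := Mp h
      have p1 := M1 h
      generalize M h = m at p p1
      have q0 : 0 ≤ m - m ^ 2 := by nlinarith
      have q1 : m - m ^ 2 ≤ 1 := by nlinarith
      rw [pow_zero, mul_one]
      have r1 : |(-6) * (m - m ^ 2) + 6 * (2 * m * (m - m ^ 2))| ≤ 18 := by rw [abs_le]; constructor <;> nlinarith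
      have r2 : |1 - 6 * m + 6 * m ^ 2| ≤ 13 := by rw [abs_le]; constructor <;> nlinarith
      have r3 : |(m - m ^ 2) - 2 * m * (m - m ^ 2)| ≤ 3 := by rw [abs_le]; constructor <;> nlinarith
      calc _ ≤ |((-6) * (m - m ^ 2) + 6 * (2 * m * (m - m ^ 2))) * (m - m ^ 2)| + |(1 - 6 * m + 6 * m ^ 2) * ((m - m ^ 2) - 2 * m * (m - m ^ 2))| := abs_add_le _ _
        _ ≤ 18 * 1 + 13 * 3 := by
          rw [abs_mul, abs_mul, abs_of_nonneg q0]
          gcongr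
        _ ≤ 100 := by norm_num
  have d2 : ∀ h, |(1 - 2 * M h) * (M h - M h ^ 2) - (1 - 2 * s) * (s - s ^ 2) - (1 - 6 * s + 6 * s ^ 2) * (s - s ^ 2) * h| ≤ 100 * |h| ^ (0 + 1 + 1) := by
    apply pow_int _ _ (by norm_num) d3
    · simp [M0]
    · intro h
      have a1 := hL h
      have a2 : HasDerivAt (fun h => M h ^ 2) (2 * M h * (M h - M h ^ 2)) h := by
        refine (a1.pow 2).congr_deriv ?_
        simp [hM]
      have a3 := ((((a1.const_mul 2).const_sub 1).fun_mul (a1.fun_sub a2)).sub_const ((1 - 2 * s) * (s - s ^ 2))).fun_sub ((hh h).const_mul ((1 - 6 * s + 6 * s ^ 2) * (s - s ^ 2)))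
      refine a3.congr_deriv ?_
      simp only [hM]; ring
  have d1 : ∀ h, |(M h - M h ^ 2) - (s - s ^ 2) - (1 - 2 * s) * (s - s ^ 2) * h - (1 - 6 * s + 6 * s ^ 2) * (s - s ^ 2) / 2 * h ^ 2| ≤ 100 * |h| ^ (0 + 1 + 1 + 1) := by
    apply pow_int _ _ (by norm_num) d2
    · simp [M0]
    · intro h
      have a1 := hL h
      have a2 : HasDerivAt (fun h => M h ^ 2) (2 * M h * (M h - M h ^ 2)) h := by
        refine (a1.pow 2).congr_deriv ?_
        simp [hM]
      have a3 := (((a1.fun_sub a2).sub_const (s - s ^ 2)).fun_sub ((hh h).const_mul ((1 - 2 * s) * (s - s ^ 2)))).fun_sub (((hh h).fun_pow 2).const_mul ((1 - 6 * s + 6 * s ^ 2) * (s - s ^ 2) / 2))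
      refine a3.congr_deriv ?_
      simp only [hM]; push_cast; ring
  have d0 : |M h - s - (s - s ^ 2) * h - (1 - 2 * s) * (s - s ^ 2) / 2 * h ^ 2 - (1 - 6 * s + 6 * s ^ 2) * (s - s ^ 2) / 6 * h ^ 3| ≤ 100 * |h| ^ (0 + 1 + 1 + 1 + 1) := by
    apply pow_int (g := fun h => M h - s - (s - s ^ 2) * h - (1 - 2 * s) * (s - s ^ 2) / 2 * h ^ 2 - (1 - 6 * s + 6 * s ^ 2) * (s - s ^ 2) / 6 * h ^ 3) _ _ (by norm_num) d1
    · simp [M0]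
    · intro h
      have a1 := hL h
      have a3 := (((a1.sub_const s).fun_sub ((hh h).const_mul (s - s ^ 2))).fun_sub (((hh h).fun_pow 2).const_mul ((1 - 2 * s) * (s - s ^ 2) / 2))).fun_sub (((hh h).fun_pow 3).const_mul ((1 - 6 * s + 6 * s ^ 2) * (s - s ^ 2) / 6))
      refine a3.congr_deriv ?_
      simp only [hM]; push_cast; ring
  refine le_trans (le_of_eq ?_) (d0.trans (le_of_eq ?_))
  · congr 1; ring
  · norm_num

/-- algebraic core of the expansion of the drift -/
lemma core_expand {al P g l2 l3 : ℝ} : ∃ C : ℝ, 0 ≤ C ∧ ∀ ξ y : ℝ, 0 ≤ ξ → ξ ≤ 1 → |y| ≤ 1 →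
    |l2 / 2 * ((P * ξ + g * ξ * y) ^ 2 - 2 * al * g * ξ * y ^ 2) + l3 / 6 * ((al * y - P * ξ - g * ξ * y) ^ 3 - al ^ 3 * y ^ 3)|
      + 100 * |al * y - P * ξ - g * ξ * y| ^ 4 ≤ C * (ξ + y ^ 2) ^ 2 := by
  set p := |P| + |g| with hp
  have p0 : 0 ≤ p := by positivity
  refine ⟨|l2| / 2 * (p ^ 2 + 2 * |al| * |g|) + |l3| / 6 * (3 * |al| ^ 2 * p + 3 * |al| * p ^ 2 + p ^ 3) + 100 * (8 * (|al| ^ 4 + p ^ 4)), by positivity, ?_⟩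
  intro ξ y h0 h1 hy
  set T := (ξ + y ^ 2) ^ 2 with hT
  have ysq : y ^ 2 ≤ 1 := by rw [← sq_abs]; exact pow_le_one₀ (abs_nonneg _) hy
  have y0 := sq_nonneg y
  have t1 : ξ ^ 2 ≤ T := by nlinarith
  have t2 : ξ * y ^ 2 ≤ T := by nlinarith
  have t3 : (y ^ 2) ^ 2 ≤ T := by nlinarith
  have T0 : 0 ≤ T := sq_nonneg _
  set m := P + g * y with hm
  have m1 : |m| ≤ p := by
    calc |m| ≤ |P| + |g * y| := abs_add_le _ _
      _ ≤ |P| + |g| * 1 := by rw [abs_mul]; gcongr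
      _ = p := by rw [hp]; ring
  have ax : |ξ| = ξ := abs_of_nonneg h0
  have e1 : |(P * ξ + g * ξ * y) ^ 2 - 2 * al * g * ξ * y ^ 2| ≤ (p ^ 2 + 2 * |al| * |g|) * T := by
    rw [show (P * ξ + g * ξ * y) ^ 2 - 2 * al * g * ξ * y ^ 2 = m ^ 2 * ξ ^ 2 - 2 * al * g * (ξ * y ^ 2) by rw [hm]; ring]
    calc _ ≤ |m ^ 2 * ξ ^ 2| + |2 * al * g * (ξ * y ^ 2)| := abs_sub _ _
      _ = |m| ^ 2 * ξ ^ 2 + 2 * |al| * |g| * (ξ * y ^ 2) := by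
        simp only [abs_mul, abs_pow, ax, sq_abs, abs_two]
      _ ≤ p ^ 2 * T + 2 * |al| * |g| * T := by gcongr
      _ = _ := by ring
  have e2 : |(al * y - P * ξ - g * ξ * y) ^ 3 - al ^ 3 * y ^ 3| ≤ (3 * |al| ^ 2 * p + 3 * |al| * p ^ 2 + p ^ 3) * T := by
    rw [show (al * y - P * ξ - g * ξ * y) ^ 3 - al ^ 3 * y ^ 3 = -(3 * al ^ 2 * m * (ξ * y ^ 2)) + 3 * al * m ^ 2 * (ξ ^ 2 * y) + -(m ^ 3 * (ξ ^ 2 * ξ)) by rw [hm]; ring]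
    calc _ ≤ |-(3 * al ^ 2 * m * (ξ * y ^ 2))| + |3 * al * m ^ 2 * (ξ ^ 2 * y)| + |-(m ^ 3 * (ξ ^ 2 * ξ))| := abs_add_three _ _ _
      _ = 3 * |al| ^ 2 * |m| * (ξ * y ^ 2) + 3 * |al| * |m| ^ 2 * (ξ ^ 2 * |y|) + |m| ^ 3 * (ξ ^ 2 * ξ) := by
        rw [abs_neg, abs_neg]
        simp only [abs_mul, abs_pow, ax, sq_abs, Nat.abs_ofNat]
      _ ≤ 3 * |al| ^ 2 * p * T + 3 * |al| * p ^ 2 * (T * 1) + p ^ 3 * (T * 1) := by gcongr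
      _ = _ := by ring
  have e3 : |al * y - P * ξ - g * ξ * y| ^ 4 ≤ 8 * (|al| ^ 4 + p ^ 4) * T := by
    have h4 : ∀ u v : ℝ, (u - v) ^ 4 ≤ 8 * (u ^ 4 + v ^ 4) := by
      intro u v
      nlinarith [sq_nonneg (u + v), sq_nonneg (u ^ 2 - v ^ 2), sq_nonneg (u - v), sq_nonneg ((u-v)^2), sq_nonneg (u * v), mul_nonneg (sq_nonneg (u + v)) (sq_nonneg (u + v)), mul_nonneg (sq_nonneg (u - v)) (sq_nonneg (u + v))]
    rw [show al * y - P * ξ - g * ξ * y = al * y - m * ξ by rw [hm]; ring, ← abs_pow, abs_of_nonneg (by positivity)]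
    calc _ ≤ 8 * ((al * y) ^ 4 + (m * ξ) ^ 4) := h4 _ _
      _ = 8 * (|al| ^ 4 * (y ^ 2) ^ 2 + |m| ^ 4 * (ξ ^ 2 * ξ ^ 2)) := by
        rw [show |al| ^ 4 = al ^ 4 by rw [← abs_pow]; exact abs_of_nonneg (by positivity), show |m| ^ 4 = m ^ 4 by rw [← abs_pow]; exact abs_of_nonneg (by positivity)]; ring
      _ ≤ 8 * (|al| ^ 4 * T + p ^ 4 * (T * 1)) := by
        have : ξ ^ 2 ≤ 1 := pow_le_one₀ h0 h1
        gcongr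
      _ = _ := by ring
  calc _ ≤ (|l2 / 2 * ((P * ξ + g * ξ * y) ^ 2 - 2 * al * g * ξ * y ^ 2)| + |l3 / 6 * ((al * y - P * ξ - g * ξ * y) ^ 3 - al ^ 3 * y ^ 3)|)
      + 100 * |al * y - P * ξ - g * ξ * y| ^ 4 := by gcongr; exact abs_add_le _ _
    _ = |l2| / 2 * |(P * ξ + g * ξ * y) ^ 2 - 2 * al * g * ξ * y ^ 2| + |l3| / 6 * |(al * y - P * ξ - g * ξ * y) ^ 3 - al ^ 3 * y ^ 3|
      + 100 * |al * y - P * ξ - g * ξ * y| ^ 4 := by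
        rw [abs_mul, abs_mul, abs_div, abs_div, abs_two, show |(6:ℝ)| = 6 by norm_num]
    _ ≤ |l2| / 2 * ((p ^ 2 + 2 * |al| * |g|) * T) + |l3| / 6 * ((3 * |al| ^ 2 * p + 3 * |al| * p ^ 2 + p ^ 3) * T) + 100 * (8 * (|al| ^ 4 + p ^ 4) * T) := by gcongr
    _ = _ := by ring

/-- the critical point structure: everything about the drift near the critical point. -/
lemma expand (hq : 3 ≤ q) {s : ℝ} (hs : 1 / 2 < s) (hs1 : s < 1) (h0 : Dfun q (betaS q) s = 0)
    (h1 : 2 * betaS q * q / (q - 1) * (s - s ^ 2) = 1) :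
    ∃ a b c1 c3 C : ℝ, 0 < a ∧ 0 < b ∧ 0 ≤ C ∧ ∀ ξ y : ℝ, 0 ≤ ξ → ξ ≤ 1 → |y| ≤ 1 →
      |- Dfun q (betaS q - ξ) (s + y) - (a * ξ + b * y ^ 2 + (c1 * ξ * y + c3 * y ^ 3))| ≤ C * (ξ + y ^ 2) ^ 2 := by
  obtain ⟨q0, q3, r0⟩ := qr_pos hq
  set al := 2 * betaS q * q / (q - 1) with hal
  set P := 2 * (q * s - 1) / ((q:ℝ) - 1) with hP
  set g := 2 * (q:ℝ) / (q - 1) with hg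
  set l2 := (1 - 2 * s) * (s - s ^ 2) with hl2
  set l3 := (1 - 6 * s + 6 * s ^ 2) * (s - s ^ 2) with hl3
  have hss : 0 < s - s ^ 2 := by nlinarith
  have hP0 : 0 < P := by
    apply div_pos _ r0
    nlinarith
  have hal0 : al ≠ 0 := by intro hh; rw [hh] at h1; linarith
  obtain ⟨C, hC0, hC⟩ := core_expand (al := al) (P := P) (g := g) (l2 := l2) (l3 := l3)
  refine ⟨(s - s ^ 2) * P, - (l2 / 2 * al ^ 2), (s - s ^ 2) * g + l2 * al * P, - (l3 / 6 * al ^ 3), C, by positivity, ?_, hC0, ?_⟩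
  · have : 0 < - l2 := by rw [hl2]; nlinarith
    have := sq_pos_of_ne_zero hal0
    nlinarith
  intro ξ y hξ hξ1 hy
  have hL : lgs q (2 * betaS q * (q * s - 1) / (q - 1)) = s := by
    rw [Dfun_lgs hq] at h0; linarith
  have ht := lgs_taylor hq _ s (al * y - P * ξ - g * ξ * y) hL
  have ez : 2 * betaS q * (q * s - 1) / (q - 1) + (al * y - P * ξ - g * ξ * y) = 2 * (betaS q - ξ) * (q * (s + y) - 1) / (q - 1) := by
    rw [hal, hP, hg]; ring
  rw [ez] at ht
  rw [Dfun_lgs hq]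
  refine le_trans ?_ (hC ξ y hξ hξ1 hy)
  set h := al * y - P * ξ - g * ξ * y with hh
  set Lz := lgs q (2 * (betaS q - ξ) * (q * (s + y) - 1) / (q - 1))
  have e : -(Lz - (s + y)) - ((s - s ^ 2) * P * ξ + -(l2 / 2 * al ^ 2) * y ^ 2 + (((s - s ^ 2) * g + l2 * al * P) * ξ * y + -(l3 / 6 * al ^ 3) * y ^ 3))
    = -(l2 / 2 * ((P * ξ + g * ξ * y) ^ 2 - 2 * al * g * ξ * y ^ 2) + l3 / 6 * (h ^ 3 - al ^ 3 * y ^ 3))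
      - (Lz - (s + (s - s ^ 2) * h + l2 * h ^ 2 / 2 + l3 * h ^ 3 / 6)) := by
    rw [hh]
    linear_combination (- y) * h1
  rw [e]
  refine (abs_sub _ _).trans ?_
  rw [abs_neg]
  gcongr
end

open Finset Filter
section
variable {q : ℕ} {β : ℝ}

lemma D_gap (hq : 3 ≤ q) {b0 : ℝ} (hb0 : 1 / (q:ℝ) < b0) : ∃ c > 0, ∀ ξ x : ℝ, 0 ≤ ξ → ξ ≤ 1 → b0 ≤ x → x ≤ 1 →
    c * ξ ≤ Dfun q (betaS q) x - Dfun q (betaS q - ξ) x := by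
  obtain ⟨q0, q3, r0⟩ := qr_pos hq
  obtain ⟨b1, b2⟩ := betaS_facts hq
  have hb : 0 < q * b0 - 1 := by rw [div_lt_iff₀ q0] at hb0; linarith
  have hl : 0 < 1 - lgs q q := by linarith [lgs_lt_one hq (q:ℝ)]
  refine ⟨1 / q * (1 - lgs q q) * (2 * (q * b0 - 1) / (q - 1)), by positivity, ?_⟩
  intro ξ x h0 h1 hx hx1
  rw [Dfun_lgs hq, Dfun_lgs hq]
  have hqx : q * b0 - 1 ≤ q * x - 1 := by
    have : (q:ℝ) * b0 ≤ q * x := by gcongr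
    linarith
  have hqx0 : 0 < q * x - 1 := by linarith
  set z1 := 2 * betaS q * (q * x - 1) / (q - 1) with hz1
  set z2 := 2 * (betaS q - ξ) * (q * x - 1) / (q - 1) with hz2
  have hz20 : 0 ≤ z2 := div_nonneg (mul_nonneg (by linarith) hqx0.le) r0.le
  have hzz : z2 ≤ z1 := by rw [hz1, hz2]; gcongr; linarith
  have hz1q : z1 ≤ q := by
    rw [hz1, div_le_iff₀ r0]
    have : q * x - 1 ≤ q - 1 := by nlinarith
    nlinarith
  have hmv := (convex_Icc 0 (q:ℝ)).mul_sub_le_image_sub_of_le_deriv (f := lgs q) (C := 1 / q * (1 - lgs q q)) (lgs_cont hq).continuousOn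
    (fun z _ => (lgs_deriv hq z).differentiableAt.differentiableWithinAt) (fun z hz => by
      rw [interior_Icc] at hz
      rw [(lgs_deriv hq z).deriv]
      have e1 : 1 / (q:ℝ) ≤ lgs q z := by rw [← lgs_zero hq]; exact (lgs_strictMono hq).monotone hz.1.le
      have e2 : lgs q z ≤ lgs q q := (lgs_strictMono hq).monotone hz.2.le
      calc _ ≤ lgs q z * (1 - lgs q z) := by
            apply mul_le_mul e1 (by linarith) hl.le (lgs_pos hq z).le
        _ = _ := by ring) z2 ⟨hz20, hzz.trans hz1q⟩ z1 ⟨hz20.trans hzz, hz1q⟩ hzz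
  have : 2 * (q * b0 - 1) / (q - 1) * ξ ≤ z1 - z2 := by
    have : z1 - z2 = 2 * (q * x - 1) / (q - 1) * ξ := by rw [hz1, hz2]; ring
    rw [this]; gcongr
  have h3 : 1 / (q:ℝ) * (1 - lgs q q) * (2 * (q * b0 - 1) / (q - 1) * ξ) ≤ 1 / (q:ℝ) * (1 - lgs q q) * (z1 - z2) := by gcongr
  linarith

lemma D_lower (hq : 3 ≤ q) {s a b c1 c3 C : ℝ} (hs : 1 / 2 < s) (hs1 : s < 1)
    (hneg : ∀ x, 1 / (q:ℝ) < x → x ≤ 1 → x ≠ s → Dfun q (betaS q) x < 0)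
    (hb : 0 < b) (hC : 0 ≤ C)
    (hexp : ∀ ξ y : ℝ, 0 ≤ ξ → ξ ≤ 1 → |y| ≤ 1 →
      |- Dfun q (betaS q - ξ) (s + y) - (a * ξ + b * y ^ 2 + (c1 * ξ * y + c3 * y ^ 3))| ≤ C * (ξ + y ^ 2) ^ 2)
    {b0 : ℝ} (hb0 : 1 / (q:ℝ) < b0) (hb1 : b0 < s) :
    ∃ c > 0, ∀ ξ x : ℝ, 0 ≤ ξ → ξ ≤ 1 → b0 ≤ x → x ≤ 1 → c * (ξ + (x - s) ^ 2) ≤ - Dfun q (betaS q - ξ) x := by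
  obtain ⟨cg, hcg, hgap⟩ := D_gap hq hb0
  -- quadratic lower bound at criticality
  have hquad : ∃ c > 0, ∀ x : ℝ, b0 ≤ x → x ≤ 1 → c * (x - s) ^ 2 ≤ - Dfun q (betaS q) x := by
    set δ := min 1 (b / (2 * (|c3| + C + 1))) with hδ
    have hden : 0 < 2 * (|c3| + C + 1) := by positivity
    have hδ0 : 0 < δ := lt_min one_pos (by positivity)
    have hδ1 : δ ≤ 1 := min_le_left _ _
    have hδ2 : (|c3| + C) * δ ≤ b / 2 := by
      have : δ ≤ b / (2 * (|c3| + C + 1)) := min_le_right _ _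
      rw [le_div_iff₀ hden] at this
      nlinarith
    have hnear : ∀ x, |x - s| ≤ δ → b / 2 * (x - s) ^ 2 ≤ - Dfun q (betaS q) x := by
      intro x hx
      have h := hexp 0 (x - s) le_rfl zero_le_one (hx.trans hδ1)
      rw [sub_zero, add_sub_cancel] at h
      have h2 := (abs_le.mp h).1
      set y := x - s
      have e1 : |y| ^ 2 = y ^ 2 := sq_abs y
      have e2 : - (|c3| * (δ * y ^ 2)) ≤ c3 * y ^ 3 := by
        have : |c3 * y ^ 3| ≤ |c3| * (δ * y ^ 2) := by
          rw [abs_mul, abs_pow, pow_succ, e1, mul_comm (y ^ 2)]; gcongr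
        linarith [(abs_le.mp this).1]
      have e3 : C * (0 + y ^ 2) ^ 2 ≤ C * (δ * y ^ 2) := by
        have : y ^ 2 ≤ δ := by
          rw [← e1, sq]
          calc |y| * |y| ≤ δ * 1 := by gcongr; exact hx.trans hδ1
            _ = δ := mul_one _
        have : (0 + y ^ 2) ^ 2 ≤ δ * y ^ 2 := by rw [zero_add, sq (y ^ 2)]; gcongr
        gcongr
      have e4 := mul_le_mul_of_nonneg_right hδ2 (sq_nonneg y)
      nlinarith
    obtain ⟨y, hy, hymax⟩ := (isCompact_Icc.inter_right (isClosed_le continuous_const (continuous_abs.comp (continuous_id.sub continuous_const)) : IsClosed {x : ℝ | min δ (1 - s) ≤ |x - s|})).exists_isMaxOn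
      (s := Set.Icc b0 1 ∩ {x : ℝ | min δ (1 - s) ≤ |x - s|}) ⟨1, ⟨by linarith, le_rfl⟩, by
        show min δ (1 - s) ≤ |1 - s|
        rw [abs_of_pos (by linarith)]; exact min_le_right _ _⟩ (Dfun_cont hq (betaS q)).continuousOn
    have hy0 : Dfun q (betaS q) y < 0 := by
      refine hneg y (lt_of_lt_of_le hb0 hy.1.1) hy.1.2 ?_
      rintro rfl
      have := hy.2
      simp at this
      rcases this with h | h <;> linarith
    refine ⟨min (b / 2) (- Dfun q (betaS q) y), lt_min (by positivity) (by linarith), fun x hx hx1 => ?_⟩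
    by_cases hc : |x - s| ≤ δ
    · refine le_trans ?_ (hnear x hc)
      gcongr; exact min_le_left _ _
    · push Not at hc
      have h1 : Dfun q (betaS q) x ≤ Dfun q (betaS q) y := hymax ⟨⟨hx, hx1⟩, (min_le_left _ _).trans hc.le⟩
      have h2 : (x - s) ^ 2 ≤ 1 := by
        have : 0 < 1 / (q:ℝ) := by have := (qr_pos hq).1; positivity
        nlinarith
      calc _ ≤ (- Dfun q (betaS q) y) * 1 := by
            apply mul_le_mul (min_le_right _ _) h2 (sq_nonneg _) (by linarith)
        _ ≤ _ := by linarith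
  obtain ⟨c, hc, hq2⟩ := hquad
  refine ⟨min c cg, lt_min hc hcg, fun ξ x h0 h1 hx hx1 => ?_⟩
  have e1 := hq2 x hx hx1
  have e2 := hgap ξ x h0 h1 hx hx1
  have e3 : min c cg * ξ ≤ cg * ξ := by gcongr; exact min_le_right _ _
  have e4 : min c cg * (x - s) ^ 2 ≤ c * (x - s) ^ 2 := by gcongr; exact min_le_left _ _
  linarith

lemma D_lip (hq : 3 ≤ q) {s : ℝ} (hs : 1 / 2 < s) (hs1 : s < 1) (h0 : Dfun q (betaS q) s = 0)
    (h1 : 2 * betaS q * q / (q - 1) * (s - s ^ 2) = 1) :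
    ∃ C > 0, ∀ ξ x y : ℝ, 0 ≤ ξ → ξ ≤ 1 → x ∈ Set.Icc (0:ℝ) 1 → y ∈ Set.Icc (0:ℝ) 1 →
      |Dfun q (betaS q - ξ) y - Dfun q (betaS q - ξ) x| ≤ C * (|x - s| + |y - s| + ξ) * |y - x| := by
  obtain ⟨q0, q3, r0⟩ := qr_pos hq
  obtain ⟨b1, b2⟩ := betaS_facts hq
  set al := 2 * betaS q * q / (q - 1) with hal
  set g := 2 * (q:ℝ) / (q - 1) with hg
  have hg0 : 0 < g := by positivity
  have hal0 : 0 < al := by positivity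
  refine ⟨g + al * (al + g), by positivity, fun ξ x y hξ hξ1 hx hy => ?_⟩
  refine mvt_abs x y (fun z _ => Dfun_deriv hq (betaS q - ξ) z) ?_
  intro z hz
  have hL : lgs q (2 * betaS q * (q * s - 1) / (q - 1)) = s := by
    rw [Dfun_lgs hq] at h0; linarith
  have hz01 : z ∈ Set.Icc (0:ℝ) 1 := Set.uIcc_subset_Icc hx hy hz
  have hzs : |z - s| ≤ |x - s| + |y - s| := by
    rcases Set.mem_uIcc.mp hz with ⟨u, v⟩ | ⟨u, v⟩
    · rw [abs_le]; constructor
      · linarith [neg_abs_le (x - s), abs_nonneg (y - s)]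
      · linarith [le_abs_self (y - s), abs_nonneg (x - s)]
    · rw [abs_le]; constructor
      · linarith [neg_abs_le (y - s), abs_nonneg (x - s)]
      · linarith [le_abs_self (x - s), abs_nonneg (y - s)]
  set l := lgs q (2 * (betaS q - ξ) * (q * z - 1) / (q - 1)) with hl
  have l0 := lgs_pos hq (2 * (betaS q - ξ) * (q * z - 1) / (q - 1))
  have l1 := lgs_lt_one hq (2 * (betaS q - ξ) * (q * z - 1) / (q - 1))
  rw [← hl] at l0 l1
  have hls : |l - s| ≤ al * |z - s| + g * ξ := by
    have := lgs_lip hq (2 * betaS q * (q * s - 1) / (q - 1)) (2 * (betaS q - ξ) * (q * z - 1) / (q - 1))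
    rw [hL, ← hl] at this
    refine this.trans ?_
    have e : 2 * (betaS q - ξ) * (q * z - 1) / (q - 1) - 2 * betaS q * (q * s - 1) / (q - 1) = al * (z - s) - (2 * (q * z - 1) / (q - 1)) * ξ := by
      rw [hal]; field_simp; ring
    rw [e]
    have e2 : |2 * (q * z - 1) / ((q:ℝ) - 1)| ≤ g := by
      rw [abs_div, abs_of_pos r0, hg]
      gcongr
      rw [abs_le]; constructor <;> nlinarith [hz01.1, hz01.2]
    have e3 : |al * (z - s) - (2 * (q * z - 1) / (q - 1)) * ξ| ≤ al * |z - s| + g * ξ := by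
      refine (abs_sub _ _).trans ?_
      rw [abs_mul, abs_mul, abs_of_pos hal0, abs_of_nonneg hξ]
      gcongr
    linarith [abs_nonneg (al * (z - s) - (2 * (q * z - 1) / (q - 1)) * ξ)]
  have hv : |(l - l ^ 2) - (s - s ^ 2)| ≤ |l - s| := by
    rw [show (l - l ^ 2) - (s - s ^ 2) = (l - s) * (1 - l - s) by ring, abs_mul]
    have : |1 - l - s| ≤ 1 := by rw [abs_le]; constructor <;> linarith
    exact mul_le_of_le_one_right (abs_nonneg _) this
  have hll : |l - l ^ 2| ≤ 1 := by rw [abs_le]; constructor <;> nlinarith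
  have e5 : 2 * (betaS q - ξ) * q / (q - 1) * (l - l ^ 2) - 1 = al * ((l - l ^ 2) - (s - s ^ 2)) - g * ξ * (l - l ^ 2) := by
    have e6 : 2 * (betaS q - ξ) * q / (q - 1) = al - g * ξ := by rw [hal, hg]; ring
    rw [e6]; linear_combination h1
  rw [e5]
  refine (abs_sub _ _).trans ?_
  rw [abs_mul, abs_mul, abs_mul, abs_of_pos hal0, abs_of_pos hg0, abs_of_nonneg hξ]
  have n1 := abs_nonneg (x - s)
  have n2 := abs_nonneg (y - s)
  calc _ ≤ al * (al * |z - s| + g * ξ) + g * ξ * 1 := by gcongr; exact hv.trans hls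
    _ ≤ al * (al * (|x - s| + |y - s|) + g * ξ) + g * ξ * 1 := by gcongr
    _ ≤ _ := by
      have : 0 ≤ al * g * (|x - s| + |y - s|) := by positivity
      have : 0 ≤ g * (|x - s| + |y - s|) := by positivity
      have : 0 ≤ al * al * ξ := by positivity
      nlinarith
end

open Finset Filter
section
variable {q : ℕ} {β : ℝ}

lemma arctan_gap {t : ℝ} (ht : 0 < t) : Real.pi / 2 - 1 / t ≤ Real.arctan t ∧ Real.arctan t ≤ Real.pi / 2 := by
  refine ⟨?_, (Real.arctan_lt_pi_div_two t).le⟩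
  have h := Real.arctan_inv_of_pos ht
  have h2 : Real.arctan t⁻¹ ≤ t⁻¹ := by
    have := Real.le_tan (Real.arctan_nonneg.mpr (inv_nonneg.mpr ht.le)) (Real.arctan_lt_pi_div_two t⁻¹)
    rwa [Real.tan_arctan] at this
  rw [one_div]; linarith

lemma int_arctan {p r δ : ℝ} (hp : 0 < p) (hr : 0 < r) (hδ : 0 < δ) :
    |(∫ y in (-δ)..δ, 1 / (p ^ 2 + r ^ 2 * y ^ 2)) - Real.pi / (p * r)| ≤ 2 / (r ^ 2 * δ) := by
  have hpos : ∀ y : ℝ, 0 < p ^ 2 + r ^ 2 * y ^ 2 := fun y => by positivity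
  have hd : ∀ y : ℝ, HasDerivAt (fun y => Real.arctan (r * y / p) / (p * r)) (1 / (p ^ 2 + r ^ 2 * y ^ 2)) y := by
    intro y
    have h1 : HasDerivAt (fun y : ℝ => r * y / p) (r / p) y := by
      simpa using ((hasDerivAt_id y).const_mul r).div_const p
    refine (h1.arctan.div_const (p * r)).congr_deriv ?_
    have := hpos y
    field_simp
  have hI := intervalIntegral.integral_eq_sub_of_hasDerivAt (a := -δ) (b := δ) (fun y _ => hd y) (by
    apply Continuous.intervalIntegrable
    exact continuous_const.div (by fun_prop) fun y => (hpos y).ne')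
  rw [hI]
  have e : r * (-δ) / p = - (r * δ / p) := by ring
  rw [e, Real.arctan_neg]
  obtain ⟨h1, h2⟩ := arctan_gap (t := r * δ / p) (by positivity)
  have e2 : Real.arctan (r * δ / p) / (p * r) - -Real.arctan (r * δ / p) / (p * r) - Real.pi / (p * r) = - (2 / (p * r) * (Real.pi / 2 - Real.arctan (r * δ / p))) := by
    field_simp; ring
  rw [e2, abs_neg, abs_of_nonneg (mul_nonneg (by positivity) (by linarith))]
  calc _ ≤ 2 / (p * r) * (1 / (r * δ / p)) := by gcongr; linarith
    _ = _ := by field_simp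

lemma int_odd {f : ℝ → ℝ} (hf : ∀ y, f (-y) = - f y) (δ : ℝ) : ∫ y in (-δ)..δ, f y = 0 := by
  have h := intervalIntegral.integral_comp_neg (a := -δ) (b := δ) f
  rw [neg_neg] at h
  simp only [hf] at h
  rw [intervalIntegral.integral_neg] at h
  linarith

/-- pointwise comparison -/
lemma inv_compare {u A e1 e2 w y c cA C C' : ℝ} (hu : u = A + (e1 + e2)) (hw : 0 < w) (hc : 0 < c) (hcA : 0 < cA)
    (hC : 0 ≤ C) (hC' : 0 ≤ C')
    (huw : c * w ≤ u) (hAw : cA * w ≤ A) (h1 : |e1| ≤ C' * (|y| * w)) (h2 : |e2| ≤ C * w ^ 2) (hy : |y| ^ 2 ≤ w) (hy1 : |y| ≤ 1) :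
    |1 / u - (1 / A - e1 / A ^ 2)| ≤ C / (c * cA) + (C' ^ 2 + C * C') / (c * cA ^ 2) := by
  have hu0 : 0 < u := lt_of_lt_of_le (by positivity) huw
  have hA0 : 0 < A := lt_of_lt_of_le (by positivity) hAw
  have e : 1 / u - (1 / A - e1 / A ^ 2) = - (e2 / (u * A)) + e1 * (e1 + e2) / (u * A ^ 2) := by
    field_simp
    rw [hu]; ring
  rw [e]
  refine (abs_add_le _ _).trans ?_
  rw [abs_neg, abs_div, abs_div, abs_of_pos (show 0 < u * A by positivity), abs_of_pos (show 0 < u * A ^ 2 by positivity)]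
  have k1 : c * w * (cA * w) ≤ u * A := by gcongr
  have k2 : c * w * (cA * w) ^ 2 ≤ u * A ^ 2 := by gcongr
  have k3 : |e1 * (e1 + e2)| ≤ (C' ^ 2 + C * C') * w ^ 3 := by
    rw [abs_mul]
    calc |e1| * |e1 + e2| ≤ (C' * (|y| * w)) * (C' * (|y| * w) + C * w ^ 2) := by
          gcongr; exact (abs_add_le _ _).trans (add_le_add h1 h2)
      _ = C' ^ 2 * (|y| ^ 2 * w ^ 2) + C * C' * (|y| * w ^ 3) := by ring
      _ ≤ C' ^ 2 * (w * w ^ 2) + C * C' * (1 * w ^ 3) := by gcongr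
      _ = _ := by ring
  gcongr ?_ + ?_
  · calc |e2| / (u * A) ≤ C * w ^ 2 / (c * w * (cA * w)) := by gcongr
      _ = _ := by field_simp
  · calc _ ≤ (C' ^ 2 + C * C') * w ^ 3 / (c * w * (cA * w) ^ 2) := by gcongr
      _ = _ := by field_simp

/-- Lipschitz bound for the reciprocal. -/
lemma psi_lip {s c M ξ x y U V : ℝ} (hc : 0 < c) (hM : 0 < M) (hξ : 0 < ξ) (hsξ1 : Real.sqrt ξ ≤ 1)
    (ux : c * (ξ + (x - s) ^ 2) ≤ U) (uy : c * (ξ + (y - s) ^ 2) ≤ V)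
    (e2 : |U - V| ≤ M * (|x - s| + |y - s| + ξ) * |y - x|) :
    |1 / V - 1 / U| ≤ (3 * M / c ^ 2) / (ξ * Real.sqrt ξ) * |y - x| := by
  have hsξ : 0 < Real.sqrt ξ := Real.sqrt_pos.mpr hξ
  have hsξ2 : Real.sqrt ξ * Real.sqrt ξ = ξ := Real.mul_self_sqrt hξ.le
  have hx' : 0 < U := lt_of_lt_of_le (by positivity) ux
  have hy' : 0 < V := lt_of_lt_of_le (by positivity) uy
  have e1 : 1 / V - 1 / U = (U - V) / (U * V) := by field_simp
  have half : ∀ z, |z - s| * Real.sqrt ξ ≤ ξ + (z - s) ^ 2 := by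
    intro z
    rw [← sq_abs (z - s)]
    nlinarith [sq_nonneg (|z - s| - Real.sqrt ξ), abs_nonneg (z - s)]
  have e3 : (|x - s| + |y - s| + ξ) * (c ^ 2 * (ξ * Real.sqrt ξ)) ≤ 3 * (U * V) := by
    have hx2 := half x
    have hy2 := half y
    have wx : ξ ≤ ξ + (x - s) ^ 2 := by linarith [sq_nonneg (x - s)]
    have wy : ξ ≤ ξ + (y - s) ^ 2 := by linarith [sq_nonneg (y - s)]
    set X := ξ + (x - s) ^ 2
    set Y := ξ + (y - s) ^ 2
    have X0 : 0 < X := by linarith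
    have Y0 : 0 < Y := by linarith
    have f1 : |x - s| * Real.sqrt ξ * ξ ≤ X * Y := by gcongr
    have f2 : |y - s| * Real.sqrt ξ * ξ ≤ Y * X := by gcongr
    have f3 : ξ * (ξ * Real.sqrt ξ) ≤ X * (Y * 1) := by gcongr
    have f4 : c * X * (c * Y) ≤ U * V := by gcongr
    have f5 : (|x - s| + |y - s| + ξ) * (ξ * Real.sqrt ξ) ≤ 3 * (X * Y) := by linarith only [f1, f2, f3]
    have f6 := mul_le_mul_of_nonneg_left f5 (sq_nonneg c)
    linarith only [f4, f6]
  rw [e1, abs_div, abs_of_pos (show 0 < U * V by positivity)]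
  rw [div_le_iff₀ (by positivity)]
  refine e2.trans ?_
  rw [mul_comm M, mul_assoc]
  have e4 : |x - s| + |y - s| + ξ ≤ 3 * (U * V) / (c ^ 2 * (ξ * Real.sqrt ξ)) := by rw [le_div_iff₀ (by positivity)]; exact e3
  calc _ ≤ 3 * (U * V) / (c ^ 2 * (ξ * Real.sqrt ξ)) * (M * |y - x|) := by gcongr
    _ = _ := by field_simp

set_option maxHeartbeats 2000000 in
/-- The time function. -/
lemma phase_fn (hq : 3 ≤ q) : ∃ α₂ : ℝ, 0 < α₂ ∧ ∀ b0 : ℝ, 1 / (q:ℝ) < b0 → b0 < 1 / 2 → ∃ K : ℝ, 1 ≤ K ∧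
    ∀ ξ : ℝ, 0 < ξ → ξ ≤ 1 → ∃ φ ψ : ℝ → ℝ,
      (∀ x, 0 < ψ x ∧ ψ x ≤ K / ξ) ∧
      (∀ x ∈ Set.Icc (0:ℝ) 1, ∀ y ∈ Set.Icc (0:ℝ) 1, |φ y - φ x - ψ x * (y - x)| ≤ K / (ξ * Real.sqrt ξ) * (y - x) ^ 2) ∧
      (∀ x, ψ x * (- Dfun q (betaS q - ξ) x) ≤ 1) ∧
      (∀ x, b0 ≤ x → x ≤ 1 → ψ x * (- Dfun q (betaS q - ξ) x) = 1) ∧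
      φ b0 = 0 ∧ Monotone φ ∧ (∀ x y, x ≤ y → φ y - φ x ≤ K / ξ * (y - x)) ∧
      |φ 1 - α₂ / Real.sqrt ξ| ≤ K := by
  obtain ⟨s, hs, hs1, h0, hα, hneg⟩ := crit hq
  obtain ⟨a, b, c1, c3, C, ha, hb, hC, hexp⟩ := expand hq hs hs1 h0 hα
  obtain ⟨CL, hCL, hlip⟩ := D_lip hq hs hs1 h0 hα
  refine ⟨Real.pi / (Real.sqrt a * Real.sqrt b), by positivity, fun b0 hb0 hb2 => ?_⟩
  obtain ⟨c, hc, hlow⟩ := D_lower hq hs hs1 hneg hb hC hexp hb0 (by linarith)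
  obtain ⟨q0, -, -⟩ := qr_pos hq
  have hb00 : 0 < b0 := lt_trans (by positivity) hb0
  set δ := min (s - b0) (1 - s) with hδ
  have hδ0 : 0 < δ := lt_min (by linarith) (by linarith)
  have hδ1 : δ ≤ s - b0 := min_le_left _ _
  have hδ2 : δ ≤ 1 - s := min_le_right _ _
  set cA := min a b with hcA
  have hcA0 : 0 < cA := lt_min ha hb
  set C' := |c1| + |c3| with hC'
  set K1 := C / (c * cA) + (C' ^ 2 + C * C') / (c * cA ^ 2) with hK1
  have hK10 : 0 ≤ K1 := by positivity
  set M := CL + 2 * c with hM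
  have hM0 : 0 < M := by positivity
  set K := 1 + 1 / c + 3 * M / c ^ 2 + (2 / (c * δ ^ 2) + 2 * K1 + 2 / (b * δ)) with hK
  have hKa : 0 ≤ 1 / c := by positivity
  have hKb : 0 ≤ 3 * M / c ^ 2 := by positivity
  have hKc : 0 ≤ 2 / (c * δ ^ 2) + 2 * K1 + 2 / (b * δ) := by positivity
  refine ⟨K, by linarith, fun ξ hξ hξ1 => ?_⟩
  set D := Dfun q (betaS q - ξ) with hD
  set u : ℝ → ℝ := fun x => max (- D x) (c * (ξ + (x - s) ^ 2)) with hu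
  have hDc : Continuous D := Dfun_cont hq _
  have huc : Continuous u := by rw [hu]; fun_prop
  have hul : ∀ x, c * (ξ + (x - s) ^ 2) ≤ u x := fun x => le_max_right _ _
  have hup : ∀ x, 0 < u x := fun x => lt_of_lt_of_le (by positivity) (hul x)
  have huD : ∀ x, b0 ≤ x → x ≤ 1 → u x = - D x := fun x h1 h2 => max_eq_left (hlow ξ x hξ.le hξ1 h1 h2)
  set ψ : ℝ → ℝ := fun x => 1 / u x with hψ
  have hψc : Continuous ψ := continuous_const.div huc fun x => (hup x).ne'
  have hψp : ∀ x, 0 < ψ x := fun x => by have := hup x; positivity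
  have hψle : ∀ x, ψ x ≤ 1 / c / ξ := fun x => by
    rw [div_div]
    have : c * ξ ≤ u x := by
      refine le_trans ?_ (hul x)
      linarith only [mul_nonneg hc.le (sq_nonneg (x - s))]
    exact one_div_le_one_div_of_le (by positivity) this
  have hInt : ∀ x y, IntervalIntegrable ψ MeasureTheory.volume x y := fun x y => hψc.intervalIntegrable x y
  have hKξ : 1 / c / ξ ≤ K / ξ := by gcongr; linarith
  have hsξ : 0 < Real.sqrt ξ := Real.sqrt_pos.mpr hξ
  have hsξ2 : Real.sqrt ξ * Real.sqrt ξ = ξ := Real.mul_self_sqrt hξ.le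
  have hsξ1 : Real.sqrt ξ ≤ 1 := Real.sqrt_le_one.mpr hξ1
  set φ : ℝ → ℝ := fun x => ∫ y in b0..x, ψ y with hφ
  have hφd : ∀ x y, φ y - φ x = ∫ z in x..y, ψ z := fun x y => by
    have := intervalIntegral.integral_add_adjacent_intervals (hInt b0 x) (hInt x y)
    simp only [hφ]; linarith
  -- Lipschitz of ψ
  have hψlip : ∀ x ∈ Set.Icc (0:ℝ) 1, ∀ y ∈ Set.Icc (0:ℝ) 1, |ψ y - ψ x| ≤ (3 * M / c ^ 2) / (ξ * Real.sqrt ξ) * |y - x| := by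
    intro x hx y hy
    have e2 : |u x - u y| ≤ M * (|x - s| + |y - s| + ξ) * |y - x| := by
      have nx := abs_nonneg (x - s)
      have ny := abs_nonneg (y - s)
      refine (abs_max_sub_max_le_max _ _ _ _).trans (max_le ?_ ?_)
      · have := hlip ξ x y hξ.le hξ1 hx hy
        rw [show - D x - - D y = D y - D x by ring]
        refine this.trans ?_
        gcongr
        linarith
      · rw [show c * (ξ + (x - s) ^ 2) - c * (ξ + (y - s) ^ 2) = - (c * ((x - s) + (y - s)) * (y - x)) by ring, abs_neg, abs_mul, abs_mul, abs_of_pos hc]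
        have : |x - s + (y - s)| ≤ |x - s| + |y - s| + ξ := (abs_add_le _ _).trans (by linarith)
        gcongr
        linarith
    exact psi_lip hc hM0 hξ hsξ1 (hul x) (hul y) e2
  refine ⟨φ, ψ, fun x => ⟨hψp x, (hψle x).trans hKξ⟩, ?_, ?_, ?_, ?_, ?_, ?_, ?_⟩
  · intro x hx y hy
    have e : φ y - φ x - ψ x * (y - x) = ∫ z in x..y, (ψ z - ψ x) := by
      rw [intervalIntegral.integral_sub (hInt x y) (by simp), ← hφd x y, intervalIntegral.integral_const, smul_eq_mul]; ring
    rw [e]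
    have := intervalIntegral.norm_integral_le_of_norm_le_const (a := x) (b := y) (f := fun z => ψ z - ψ x) (C := (3 * M / c ^ 2) / (ξ * Real.sqrt ξ) * |y - x|) (by
      intro z hz
      have hz' : z ∈ Set.uIcc x y := Set.uIoc_subset_uIcc hz
      rw [Real.norm_eq_abs]
      refine (hψlip x hx z (Set.uIcc_subset_Icc hx hy hz')).trans ?_
      have : |z - x| ≤ |y - x| := Set.abs_sub_left_of_mem_uIcc hz'
      gcongr)
    rw [Real.norm_eq_abs] at this
    refine this.trans ?_
    rw [mul_assoc, ← sq, sq_abs]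
    gcongr
    linarith
  · intro x
    have : - D x ≤ u x := le_max_left _ _
    calc ψ x * (- D x) ≤ ψ x * u x := by have := (hψp x).le; gcongr
      _ = 1 := by simp only [hψ]; exact one_div_mul_cancel (hup x).ne'
  · intro x h1 h2
    rw [← huD x h1 h2]; exact one_div_mul_cancel (hup x).ne'
  · simp [hφ]
  · intro x y hxy
    have := intervalIntegral.integral_nonneg (μ := MeasureTheory.volume) hxy (fun z _ => (hψp z).le)
    rw [← hφd] at this; linarith
  · intro x y hxy
    rw [hφd]
    have := intervalIntegral.norm_integral_le_of_norm_le_const (a := x) (b := y) (f := ψ) (C := K / ξ) (by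
      intro z _
      rw [Real.norm_eq_abs, abs_of_pos (hψp z)]; exact (hψle z).trans hKξ)
    rw [abs_of_nonneg (sub_nonneg.mpr hxy)] at this
    exact (le_abs_self _).trans this
  · -- the asymptotics
    have split : φ 1 = (∫ z in b0..(s - δ), ψ z) + (∫ z in (s - δ)..(s + δ), ψ z) + ∫ z in (s + δ)..1, ψ z := by
      rw [intervalIntegral.integral_add_adjacent_intervals (hInt _ _) (hInt _ _), intervalIntegral.integral_add_adjacent_intervals (hInt _ _) (hInt _ _)]
    have outer : ∀ x y, b0 ≤ x → x ≤ y → y ≤ 1 → (∀ z ∈ Set.Icc x y, δ ≤ |z - s|) → |∫ z in x..y, ψ z| ≤ 1 / (c * δ ^ 2) := by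
      intro x y hx hxy hy hz
      have := intervalIntegral.norm_integral_le_of_norm_le_const (a := x) (b := y) (f := ψ) (C := 1 / (c * δ ^ 2)) (by
        intro z hz'
        have hz2 : z ∈ Set.Icc x y := by
          rw [Set.uIoc_of_le hxy] at hz'; exact ⟨hz'.1.le, hz'.2⟩
        rw [Real.norm_eq_abs, abs_of_pos (hψp z)]
        apply one_div_le_one_div_of_le (by positivity)
        refine le_trans ?_ (hul z)
        have h3 := hz z hz2
        have h4 : δ ^ 2 ≤ (z - s) ^ 2 := by rw [← sq_abs (z - s)]; gcongr
        gcongr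
        linarith)
      rw [Real.norm_eq_abs, abs_of_nonneg (sub_nonneg.mpr hxy)] at this
      refine this.trans (mul_le_of_le_one_right (by positivity) (by linarith))
    have o1 := outer b0 (s - δ) le_rfl (by linarith) (by linarith) (fun z hz => by
      rw [abs_sub_comm]; exact le_trans (by linarith [hz.2]) (le_abs_self _))
    have o2 := outer (s + δ) 1 (by linarith) (by linarith) le_rfl (fun z hz => le_trans (by linarith [hz.1]) (le_abs_self _))
    have shift : (∫ z in (s - δ)..(s + δ), ψ z) = ∫ y in (-δ)..δ, ψ (s + y) := by
      rw [intervalIntegral.integral_comp_add_left (fun z => ψ z) s]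
      rfl
    set p := Real.sqrt a * Real.sqrt ξ with hp
    set r := Real.sqrt b with hr
    have hp0 : 0 < p := by positivity
    have hr0 : 0 < r := by positivity
    have hp2 : p ^ 2 = a * ξ := by rw [hp, mul_pow, Real.sq_sqrt ha.le, Real.sq_sqrt hξ.le]
    have hr2 : r ^ 2 = b := Real.sq_sqrt hb.le
    have hA : ∀ y : ℝ, 0 < p ^ 2 + r ^ 2 * y ^ 2 := fun y => by positivity
    set A : ℝ → ℝ := fun y => p ^ 2 + r ^ 2 * y ^ 2 with hAd
    set e1 : ℝ → ℝ := fun y => c1 * ξ * y + c3 * y ^ 3 with he1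
    have cA1 : Continuous fun y => 1 / A y := continuous_const.div (by rw [hAd]; fun_prop) fun y => (hA y).ne'
    have cA2 : Continuous fun y => e1 y / A y ^ 2 := Continuous.div (by rw [he1]; fun_prop) (by rw [hAd]; fun_prop) fun y => (pow_pos (hA y) 2).ne'
    have cψ : Continuous fun y => ψ (s + y) := by fun_prop
    have mid : |∫ y in (-δ)..δ, (ψ (s + y) - (1 / A y - e1 y / A y ^ 2))| ≤ K1 * (2 * δ) := by
      have := intervalIntegral.norm_integral_le_of_norm_le_const (a := -δ) (b := δ) (f := fun y => ψ (s + y) - (1 / A y - e1 y / A y ^ 2)) (C := K1) (by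
        intro y hy
        rw [Set.uIoc_of_le (by linarith)] at hy
        have hy1 : |y| ≤ δ := abs_le.mpr ⟨hy.1.le, hy.2⟩
        have hy2 : |y| ≤ 1 := by linarith
        rw [Real.norm_eq_abs]
        have hx1 : b0 ≤ s + y := by linarith [hy.1]
        have hx2 : s + y ≤ 1 := by linarith [hy.2]
        refine inv_compare (u := u (s + y)) (A := A y) (e1 := e1 y) (e2 := - D (s + y) - (a * ξ + b * y ^ 2 + (c1 * ξ * y + c3 * y ^ 3))) (w := ξ + y ^ 2) (y := y) ?_ (by positivity) hc hcA0 hC (by positivity) ?_ ?_ ?_ ?_ ?_ hy2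
        · rw [huD _ hx1 hx2, hAd, he1]
          simp only [hp2, hr2]; ring
        · have := hul (s + y)
          rwa [add_sub_cancel_left] at this
        · simp only [hAd, hp2, hr2]
          have : cA * ξ ≤ a * ξ := by gcongr; exact min_le_left _ _
          have : cA * y ^ 2 ≤ b * y ^ 2 := by gcongr; exact min_le_right _ _
          linarith
        · simp only [he1]
          refine (abs_add_le _ _).trans ?_
          rw [abs_mul, abs_mul, abs_mul, abs_pow, abs_of_pos hξ, hC']
          have y0 := abs_nonneg y
          have z1 : 0 ≤ |c1| * (|y| * |y| ^ 2) := by positivity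
          have z2 : 0 ≤ |c3| * (|y| * ξ) := by positivity
          rw [← sq_abs y]
          linarith
        · exact hexp ξ y hξ.le hξ1 hy2
        · rw [sq_abs]; linarith)
      rw [Real.norm_eq_abs, show δ - -δ = 2 * δ by ring, abs_of_pos (show 0 < 2 * δ by linarith)] at this
      exact this
    rw [intervalIntegral.integral_sub (cψ.intervalIntegrable _ _) ((show Continuous fun y => 1 / A y - e1 y / A y ^ 2 from cA1.sub cA2).intervalIntegrable _ _),
      intervalIntegral.integral_sub (cA1.intervalIntegrable _ _) (cA2.intervalIntegrable _ _),
      int_odd (f := fun y => e1 y / A y ^ 2) (fun y => by simp only [he1, hAd]; ring), sub_zero] at mid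
    have ar := int_arctan hp0 hr0 hδ0
    change |(∫ y in (-δ)..δ, 1 / A y) - _| ≤ _ at ar
    rw [hr2] at ar
    have e9 : Real.pi / (Real.sqrt a * Real.sqrt b) / Real.sqrt ξ = Real.pi / (p * r) := by
      rw [hp, hr]; field_simp
    rw [e9, split, shift]
    have t1 : K1 * (2 * δ) ≤ 2 * K1 := by linarith only [mul_le_mul_of_nonneg_left (show δ ≤ 1 by linarith only [hδ2, hb00, hδ1, hδ0]) hK10]
    rw [abs_le] at o1 o2 mid ar ⊢
    have e10 : 2 / (c * δ ^ 2) = 1 / (c * δ ^ 2) + 1 / (c * δ ^ 2) := by ring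
    constructor <;> linarith only [o1.1, o1.2, o2.1, o2.2, mid.1, mid.2, ar.1, ar.2, t1, e10, hK, hKa, hKb, hKc]
end

/-- Properties of the time function used later. -/
structure PH (q : ℕ) (b0 K α₂ ξ : ℝ) (φ ψ : ℝ → ℝ) : Prop where
  psi : ∀ x, 0 < ψ x ∧ ψ x ≤ K / ξ
  c11 : ∀ x ∈ Set.Icc (0:ℝ) 1, ∀ y ∈ Set.Icc (0:ℝ) 1, |φ y - φ x - ψ x * (y - x)| ≤ K / (ξ * Real.sqrt ξ) * (y - x) ^ 2
  le1 : ∀ x, ψ x * (- Dfun q (betaS q - ξ) x) ≤ 1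
  eq1 : ∀ x, b0 ≤ x → x ≤ 1 → ψ x * (- Dfun q (betaS q - ξ) x) = 1
  zero : φ b0 = 0
  mono : Monotone φ
  lip : ∀ x y, x ≤ y → φ y - φ x ≤ K / ξ * (y - x)
  asym : |φ 1 - α₂ / Real.sqrt ξ| ≤ K

lemma phase_PH {q : ℕ} (hq : 3 ≤ q) : ∃ α₂ : ℝ, 0 < α₂ ∧ ∀ b0 : ℝ, 1 / (q:ℝ) < b0 → b0 < 1 / 2 → ∃ K : ℝ, 1 ≤ K ∧
    ∀ ξ : ℝ, 0 < ξ → ξ ≤ 1 → ∃ φ ψ : ℝ → ℝ, PH q b0 K α₂ ξ φ ψ := by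
  obtain ⟨α₂, h, H⟩ := phase_fn hq
  refine ⟨α₂, h, fun b0 h0 h1 => ?_⟩
  obtain ⟨K, hK, H⟩ := H b0 h0 h1
  refine ⟨K, hK, fun ξ h0 h1 => ?_⟩
  obtain ⟨φ, ψ, p1, p2, p3, p4, p5, p6, p7, p8⟩ := H ξ h0 h1
  exact ⟨φ, ψ, p1, p2, p3, p4, p5, p6, p7, p8⟩

lemma PH.step {q : ℕ} {b0 K α₂ ξ : ℝ} {φ ψ : ℝ → ℝ} (h : PH q b0 K α₂ ξ φ ψ) (x y : ℝ) : |φ y - φ x| ≤ K / ξ * |y - x| := by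
  rcases le_total x y with hxy | hxy
  · rw [abs_of_nonneg (sub_nonneg.mpr (h.mono hxy)), abs_of_nonneg (sub_nonneg.mpr hxy)]; exact h.lip x y hxy
  · rw [abs_sub_comm, abs_sub_comm y, abs_of_nonneg (sub_nonneg.mpr (h.mono hxy)), abs_of_nonneg (sub_nonneg.mpr hxy)]; exact h.lip y x hxy

open Finset Filter
section
variable {q n : ℕ} {β : ℝ}

/-- One-step upper drift for the exponential of the time function. -/
lemma PP_phase {b0 K α₂ ξ : ℝ} {φ ψ : ℝ → ℝ} (hq : 3 ≤ q) (hn : 0 < n) (hK : 1 ≤ K) (hξ : 0 < ξ) (hξ1 : ξ ≤ 1)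
    (h : PH q b0 K α₂ ξ φ ψ) (hβ : 0 ≤ betaS q - ξ) {lam e : ℝ} (hl : 0 ≤ lam) (hstep : lam * (K / ξ * (1 / n)) ≤ 1)
    (he : (2 * q * Real.exp (2 * q) * K + K + K ^ 2) * (1 / (n * (ξ * Real.sqrt ξ)) + lam / (n * ξ ^ 2)) ≤ e)
    (k : Fin q) (σ : Fin n → Fin q) (hσ : b0 ≤ SS σ k) :
    PP q n (betaS q - ξ) (fun τ => Real.exp (lam * φ (SS τ k))) σ ≤ Real.exp (-(lam / n * (1 - e))) * Real.exp (lam * φ (SS σ k)) := by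
  have hq0 : 0 < q := by omega
  have hn' : (0:ℝ) < n := by positivity
  have hs : 0 < Real.sqrt ξ := Real.sqrt_pos.mpr hξ
  have hs1 : Real.sqrt ξ ≤ 1 := Real.sqrt_le_one.mpr hξ1
  have hβq : 2 * (betaS q - ξ) ≤ q := by linarith [(betaS_facts hq).2]
  have hstep' : ∀ u j, |lam * φ (SS (Function.update σ u j) k) - lam * φ (SS σ k)| ≤ lam * (K / ξ * (1 / n)) := by
    intro u j
    rw [← mul_sub, abs_mul, abs_of_nonneg hl]
    refine mul_le_mul_of_nonneg_left ((h.step _ _).trans ?_) hl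
    exact mul_le_mul_of_nonneg_left (SS_update_abs σ u j k) (by positivity)
  have h1 := PP_exp (β := betaS q - ξ) hq0 hn (fun τ => lam * φ (SS τ k)) σ hstep hstep'
  refine h1.trans ?_
  rw [mul_comm]
  refine mul_le_mul_of_nonneg_right ?_ (Real.exp_pos _).le
  have h2 := (abs_le.mp (PP_C11 (β := betaS q - ξ) hq0 hn φ ψ (K / (ξ * Real.sqrt ξ)) k h.c11 (by positivity) σ)).2
  have h3 := (abs_le.mp (PP_SS_drift hq0 hn hβ hβq σ k)).2
  have h4 := soft_le_FF (β := betaS q - ξ) (by omega) (SS σ) (SS_sum hn σ) k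
  have h5 := h.eq1 _ hσ (SS_le_one hn σ k)
  have h6 := h.psi (SS σ k)
  rw [PP_smul]
  have hD : Dfun q (betaS q - ξ) (SS σ k) = - SS σ k + FF q (betaS q - ξ) (SS σ k) := Dfun_eq _ _ _
  set x := SS σ k
  set p := PP q n (betaS q - ξ) (fun τ => SS τ k) σ - x
  set G := 2 * q * Real.exp (2 * q) with hG
  have hG0 : 0 ≤ G := by positivity
  have h7 : p ≤ 1 / n * Dfun q (betaS q - ξ) x + G / n ^ 2 := by
    have : 1 / (n:ℝ) * (soft (betaS q - ξ) (SS σ) k - x) ≤ 1 / n * Dfun q (betaS q - ξ) x := by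
      apply mul_le_mul_of_nonneg_left _ (by positivity); linarith only [h4, hD]
    linarith only [this, h3]
  have h8 : ψ x * p ≤ - (1 / n) + K / ξ * (G / n ^ 2) := by
    calc ψ x * p ≤ ψ x * (1 / n * Dfun q (betaS q - ξ) x + G / n ^ 2) := mul_le_mul_of_nonneg_left h7 h6.1.le
      _ = - (1 / n) * (ψ x * - Dfun q (betaS q - ξ) x) + ψ x * (G / n ^ 2) := by ring
      _ ≤ _ := by rw [h5, mul_one]; gcongr; exact h6.2
  have h9 : K / ξ * (G / n ^ 2) ≤ G * K / (ξ * Real.sqrt ξ) / n ^ 2 := by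
    rw [show K / ξ * (G / n ^ 2) = G * K / ξ / n ^ 2 by ring]
    gcongr
    exact mul_le_of_le_one_right hξ.le hs1
  have h10 : PP q n (betaS q - ξ) (fun τ => φ (SS τ k)) σ - φ x ≤ - (1 / n) + (G * K + K) / (ξ * Real.sqrt ξ) / n ^ 2 := by
    have : (G * K + K) / (ξ * Real.sqrt ξ) / n ^ 2 = G * K / (ξ * Real.sqrt ξ) / n ^ 2 + K / (ξ * Real.sqrt ξ) / n ^ 2 := by ring
    linarith only [h2, h8, h9, this]
  have h11 := mul_le_mul_of_nonneg_left h10 hl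
  have hexp := Real.add_one_le_exp (-(lam / n * (1 - e)))
  refine le_trans ?_ hexp
  have h12 : lam * ((G * K + K) / (ξ * Real.sqrt ξ) / n ^ 2) + (lam * (K / ξ * (1 / n))) ^ 2 ≤ lam / n * e := by
    refine le_trans ?_ (mul_le_mul_of_nonneg_left he (by positivity))
    have e1 : lam / n * ((G * K + K + K ^ 2) * (1 / (n * (ξ * Real.sqrt ξ)) + lam / (n * ξ ^ 2)))
      = lam * ((G * K + K) / (ξ * Real.sqrt ξ) / n ^ 2) + (lam * (K / ξ * (1 / n))) ^ 2
        + (lam / n * (K ^ 2 * (1 / (n * (ξ * Real.sqrt ξ)))) + lam / n * ((G * K + K) * (lam / (n * ξ ^ 2)))) := by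
      field_simp; ring
    rw [e1]
    have : 0 ≤ lam / n * (K ^ 2 * (1 / (n * (ξ * Real.sqrt ξ)))) + lam / n * ((G * K + K) * (lam / (n * ξ ^ 2))) := by positivity
    linarith only [this]
  have h13 : lam / n * (1 - e) = lam * (1 / n) - lam / n * e := by ring
  rw [h13]
  linarith only [h11, h12]

open Classical in
/-- Probability of not having entered the neighbourhood of the uniform vector. -/
lemma exit_core {b0 K α₂ ξ a cD θ : ℝ} {φ ψ : ℝ → ℝ} (hq : 3 ≤ q) (hn : 0 < n) (hK : 1 ≤ K) (hξ : 0 < ξ) (hξ1 : ξ ≤ 1)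
    (h : PH q b0 K α₂ ξ φ ψ) (hβ : 0 ≤ betaS q - ξ) {lam e : ℝ} (hl : 0 ≤ lam) (hstep : lam * (K / ξ * (1 / n)) ≤ 1)
    (he : (2 * q * Real.exp (2 * q) * K + K + K ^ 2) * (1 / (n * (ξ * Real.sqrt ξ)) + lam / (n * ξ ^ 2)) ≤ e)
    (hθ : 0 < θ) (hθ1 : θ ≤ 1) (hab : b0 < a) (hc : 2 * θ ≤ cD) (hnc : 4 * q * Real.exp (2 * q) ≤ cD * n)
    (hD : ∀ x ∈ Set.Icc b0 a, Dfun q (betaS q - ξ) x ≤ -cD) (t : ℕ) (σ : Fin n → Fin q) :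
    (PP q n (betaS q - ξ))^[t] (fun σ => if ∃ k, a < SS σ k then 1 else 0) σ ≤
      q * ((1 + 3 * t) * Real.exp (-(θ * (a - b0) * n)) + Real.exp (lam * (φ 1 - t / n * (1 - e)))) := by
  have hq0 : 0 < q := by omega
  have hβq : 2 * (betaS q - ξ) ≤ q := by linarith [(betaS_facts hq).2]
  set E := Real.exp (-(θ * (a - b0) * n)) with hE
  have hE0 : 0 < E := Real.exp_pos _
  have e3 : Real.exp 1 ≤ 3 := by have := Real.exp_one_lt_d9; linarith
  set r := Real.exp (-(lam / n * (1 - e))) with hr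
  have one : ∀ k : Fin q, ∀ t : ℕ, ∀ σ, (PP q n (betaS q - ξ))^[t] (fun σ => if a < SS σ k then 1 else 0) σ ≤
      (1 + 3 * t) * E + r ^ t * Real.exp (lam * φ (SS σ k)) := by
    intro k t
    have hW : ∀ (t : ℕ) σ, 0 ≤ r ^ t * Real.exp (lam * φ (SS (n := n) σ k)) := fun t σ => by positivity
    have trap : ∀ t : ℕ, ∀ σ, SS σ k ≤ b0 → (PP q n (betaS q - ξ))^[t] (fun σ => if a < SS σ k then 1 else 0) σ ≤ (1 + 3 * t) * E := by
      intro t σ hσ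
      have h1 : (PP q n (betaS q - ξ))^[t] (fun σ => if a < SS σ k then 1 else 0) σ ≤ (PP q n (betaS q - ξ))^[t] (bar θ a k) σ := by
        apply PPt_mono hq0
        intro τ
        split_ifs with hτ
        · rw [bar_eq_one hn hθ.le k τ hτ.le]
        · exact bar_nonneg _ _ _ _
      have h2 := PPt_add_err hq0 hn (fun τ => PP_bar (by omega) hn hβ hβq hθ hθ1 hab hc hnc hD k τ) t σ
      have h3 := bar_le_exp (b := a) hn hθ.le k σ hσ
      have h4 : (t:ℝ) * (Real.exp 1 * E) ≤ t * (3 * E) := by gcongr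
      linarith only [h1, h2, h3, h4]
    induction t with
    | zero =>
      intro σ
      by_cases hσ : SS σ k ≤ b0
      · have := trap 0 σ hσ
        have := hW 0 σ
        linarith
      · push Not at hσ
        have : 1 ≤ Real.exp (lam * φ (SS σ k)) := by
          apply Real.one_le_exp
          apply mul_nonneg hl
          rw [← h.zero]; exact h.mono hσ.le
        simp only [Function.iterate_zero, id, pow_zero, one_mul]
        split_ifs
        · push_cast; linarith
        · push_cast; linarith
    | succ t ih =>
      intro σ
      by_cases hσ : SS σ k ≤ b0
      · have h1 := trap (t + 1) σ hσ
        have h2 := hW (t + 1) σ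
        linarith
      · push Not at hσ
        rw [PPt_succ']
        have h1 := PP_mono (β := betaS q - ξ) hq0 ih σ
        rw [PP_add (fun _ => (1 + 3 * (t:ℝ)) * E) (fun σ => r ^ t * Real.exp (lam * φ (SS σ k))), PP_const hq0 hn, PP_smul] at h1
        have h2 := PP_phase hq hn hK hξ hξ1 h hβ hl hstep he k σ hσ.le
        have h3 := mul_le_mul_of_nonneg_left h2 (show 0 ≤ r ^ t by positivity)
        rw [← mul_assoc, ← pow_succ] at h3
        push_cast
        linarith only [h1, h3, hE0]
  have h1 : (PP q n (betaS q - ξ))^[t] (fun σ => if ∃ k, a < SS σ k then 1 else 0) σ ≤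
      (PP q n (betaS q - ξ))^[t] (fun σ => ∑ k : Fin q, if a < SS σ k then 1 else 0) σ := by
    apply PPt_mono hq0
    intro τ
    split_ifs with hτ
    · obtain ⟨k, hk⟩ := hτ
      have := Finset.single_le_sum (f := fun k : Fin q => if a < SS τ k then (1:ℝ) else 0) (fun i _ => by split_ifs <;> norm_num) (Finset.mem_univ k)
      simp only [hk, if_true] at this
      exact this
    · exact Finset.sum_nonneg fun i _ => by split_ifs <;> norm_num
  rw [PPt_sum] at h1
  refine h1.trans ?_
  calc _ ≤ ∑ k : Fin q, ((1 + 3 * (t:ℝ)) * E + Real.exp (lam * (φ 1 - t / n * (1 - e)))) := by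
        apply Finset.sum_le_sum
        intro k _
        refine (one k t σ).trans ?_
        gcongr
        rw [hr, ← Real.exp_nat_mul, ← Real.exp_add, Real.exp_le_exp]
        have := mul_le_mul_of_nonneg_left (h.mono (SS_le_one hn σ k)) hl
        have e1 : lam * (φ 1 - t / n * (1 - e)) = lam * φ 1 + t * -(lam / n * (1 - e)) := by ring
        linarith only [this, e1]
    _ = _ := by simp [mul_add]


/-- The window. -/
noncomputable def winw (n : ℕ) (ξ : ℝ) : ℝ := (n:ℝ) + (n : ℝ) ^ ((1 : ℝ) / 2) * ξ ^ (-(5 : ℝ) / 4)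

lemma win {ξ : ℝ} (hn : 0 < n) (hξ : 0 < ξ) (hξ1 : ξ ≤ 1) (hN : 1 ≤ n * (ξ * Real.sqrt ξ)) :
    (n:ℝ) ≤ winw n ξ ∧ ((n:ℝ) / winw n ξ / (n * ξ ^ 2)) ^ 2 * (n * (ξ * Real.sqrt ξ)) ≤ 1 ∧
    ((n:ℝ) / winw n ξ) ^ 2 ≤ n * ξ ^ 2 * Real.sqrt ξ ∧ winw n ξ ≤ 2 * n ^ 2 := by
  have hn' : (0:ℝ) < n := by positivity
  have hn1 : (1:ℝ) ≤ n := by exact_mod_cast hn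
  set h := Real.sqrt ξ with hh
  have h0 : 0 < h := Real.sqrt_pos.mpr hξ
  have h2 : h * h = ξ := Real.mul_self_sqrt hξ.le
  have h1 : h ≤ 1 := Real.sqrt_le_one.mpr hξ1
  set v := (n : ℝ) ^ ((1 : ℝ) / 2) * ξ ^ (-(5 : ℝ) / 4) with hv
  have hv0 : 0 < v := by positivity
  have hv2 : v ^ 2 * (ξ ^ 2 * h) = n := by
    have e1 : h = ξ ^ ((1:ℝ) / 2) := Real.sqrt_eq_rpow ξ
    have e2 : ((n : ℝ) ^ ((1 : ℝ) / 2)) ^ 2 = n := by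
      rw [← Real.rpow_natCast, ← Real.rpow_mul hn'.le]; norm_num
    have e3 : (ξ ^ (-(5 : ℝ) / 4)) ^ 2 * (ξ ^ 2 * h) = 1 := by
      rw [e1, ← Real.rpow_natCast, ← Real.rpow_mul hξ.le, ← Real.rpow_natCast ξ 2, ← Real.rpow_add hξ, ← Real.rpow_add hξ]; norm_num
    rw [hv, mul_pow, e2, mul_assoc, e3, mul_one]
  have hw : winw n ξ = n + v := rfl
  rw [hw]
  have key : ((n:ℝ) / (n + v)) ^ 2 ≤ n * ξ ^ 2 * h := by
    rw [div_pow, div_le_iff₀ (by positivity)]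
    have : v ^ 2 ≤ (n + v) ^ 2 := by gcongr; linarith
    calc (n:ℝ) ^ 2 = n * (v ^ 2 * (ξ ^ 2 * h)) := by rw [hv2]; ring
      _ = n * ξ ^ 2 * h * v ^ 2 := by ring
      _ ≤ _ := by gcongr
  refine ⟨by linarith, ?_, key, ?_⟩
  · rw [div_pow, div_mul_eq_mul_div, div_le_one (by positivity)]
    calc _ ≤ n * ξ ^ 2 * h * (n * (ξ * h)) := by gcongr
      _ = (n:ℝ) ^ 2 * ξ ^ 3 * (h * h) := by ring
      _ = _ := by rw [h2]; ring
  · have k1 : 1 ≤ n * ξ := by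
      refine hN.trans ?_
      gcongr; exact mul_le_of_le_one_right hξ.le h1
    have k2 : v ≤ n ^ 2 := by
      have : v ^ 2 ≤ (n ^ 2 : ℝ) ^ 2 := by
        calc v ^ 2 = v ^ 2 * 1 * 1 := by ring
          _ ≤ v ^ 2 * (n * ξ) * (n * (ξ * h)) := by gcongr
          _ = v ^ 2 * (ξ ^ 2 * h) * n ^ 2 := by ring
          _ = n ^ 3 * 1 := by rw [hv2]; ring
          _ ≤ n ^ 3 * n := by gcongr
          _ = _ := by ring
      exact le_of_sq_le_sq this (by positivity)
    have : (n:ℝ) ≤ n ^ 2 := by rw [sq]; exact le_mul_of_one_le_left hn'.le hn1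
    linarith

lemma win2 {ξ C1 K : ℝ} (hn : 0 < n) (hξ : 0 < ξ) (hξ1 : ξ ≤ 1) (hC : 0 ≤ C1) (hK : 1 ≤ K)
    (hN : (4 * C1 + K) ^ 2 ≤ n * (ξ * Real.sqrt ξ)) :
    C1 * (1 / (n * (ξ * Real.sqrt ξ)) + (n / winw n ξ) / (n * ξ ^ 2)) ≤ 1 / 2 ∧
    (n / winw n ξ) * (K / ξ * (1 / n)) ≤ 1 ∧
    (n / winw n ξ) * (C1 * (1 / (n * (ξ * Real.sqrt ξ)) + (n / winw n ξ) / (n * ξ ^ 2))) / Real.sqrt ξ ≤ 2 * C1 := by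
  have hA1 : 1 ≤ 4 * C1 + K := by linarith
  have hN1 : 1 ≤ n * (ξ * Real.sqrt ξ) := (one_le_pow₀ hA1).trans hN
  obtain ⟨w1, w2, w3, w4⟩ := win hn hξ hξ1 hN1
  have hn' : (0:ℝ) < n := by positivity
  have hs : 0 < Real.sqrt ξ := Real.sqrt_pos.mpr hξ
  have h2 : Real.sqrt ξ * Real.sqrt ξ = ξ := Real.mul_self_sqrt hξ.le
  set h := Real.sqrt ξ
  set lam := (n:ℝ) / winw n ξ with hlam
  have hw0 : 0 < winw n ξ := by linarith
  have l0 : 0 < lam := by positivity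
  have l1 : lam ≤ 1 := (div_le_one hw0).mpr w1
  set N := (n:ℝ) * (ξ * h) with hNd
  have N0 : 0 < N := by linarith
  set z := lam / (n * ξ ^ 2) with hz
  have z0 : 0 < z := by positivity
  have zA : z * (4 * C1 + K) ≤ 1 := by
    have : (z * (4 * C1 + K)) ^ 2 ≤ 1 ^ 2 := by
      rw [mul_pow, one_pow]
      exact (mul_le_mul_of_nonneg_left hN (sq_nonneg _)).trans w2
    exact le_of_sq_le_sq this zero_le_one
  have z1 : z ≤ 1 := by
    refine le_trans ?_ zA
    exact le_mul_of_one_le_right z0.le hA1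
  have hNA : 4 * C1 + K ≤ N := by
    refine le_trans ?_ hN
    rw [sq]; exact le_mul_of_one_le_left (by linarith) hA1
  refine ⟨?_, ?_, ?_⟩
  · have a1 : C1 * (1 / N) ≤ 1 / 4 := by
      rw [mul_one_div, div_le_iff₀ N0]; linarith
    have a2 : C1 * z ≤ 1 / 4 := by nlinarith
    linarith
  · have : lam * (K / ξ * (1 / n)) = K * (z * ξ) := by rw [hz]; field_simp
    rw [this]
    have : z * ξ ≤ z := mul_le_of_le_one_right z0.le hξ1
    nlinarith
  · have e1 : lam * (C1 * (1 / N + z)) / h = C1 * (lam / (n * ξ * (h * h)) + lam ^ 2 / (n * ξ ^ 2 * h)) := by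
      rw [hNd, hz]; field_simp
    rw [e1, h2]
    have a1 : lam / (n * ξ * ξ) ≤ 1 := by rw [mul_assoc, ← sq]; exact z1
    have a2 : lam ^ 2 / (n * ξ ^ 2 * h) ≤ 1 := by rw [div_le_one (by positivity)]; exact w3
    calc _ ≤ C1 * (1 + 1) := by gcongr
      _ = _ := by ring

open Classical in
/-- Phase one upper bound. -/
lemma U1 (hq : 3 ≤ q) {b0 a cD α₂ K : ℝ} (hα : 0 < α₂) (hK : 1 ≤ K)
    (H : ∀ ξ : ℝ, 0 < ξ → ξ ≤ 1 → ∃ φ ψ : ℝ → ℝ, PH q b0 K α₂ ξ φ ψ) (hab : b0 < a) (hcD : 0 < cD)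
    (hD : ∀ ξ : ℝ, 0 < ξ → ∀ x ∈ Set.Icc b0 a, Dfun q (betaS q - ξ) x ≤ -cD) {ε : ℝ} (hε : 0 < ε) :
    ∃ γ : ℝ, 0 < γ ∧ ∃ N0 : ℝ, 1 ≤ N0 ∧ ∀ᶠ n : ℕ in atTop, ∀ ξ : ℝ, 0 < ξ → ξ ≤ 1 → 0 ≤ betaS q - ξ → N0 ≤ n * (ξ * Real.sqrt ξ) →
      (∀ (t : ℕ) (σ : Fin n → Fin q), α₂ * n / Real.sqrt ξ + γ * winw n ξ ≤ t → (t:ℝ) ≤ n ^ 4 →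
        (PP q n (betaS q - ξ))^[t] (fun σ => if ∃ k, a < SS σ k then 1 else 0) σ ≤ ε) ∧
      MU q n (betaS q - ξ) (fun σ => if ∃ k, a < SS σ k then 1 else 0) ≤ 1 / n := by
  have hq0 : 0 < q := by omega
  have hq' : (0:ℝ) < q := by positivity
  set C1 := 2 * q * Real.exp (2 * q) * K + K + K ^ 2 with hC1
  have hC10 : 0 < C1 := by positivity
  set θ := min 1 (cD / 2) with hθd
  have hθ : 0 < θ := lt_min one_pos (by linarith)
  have hθ1 : θ ≤ 1 := min_le_left _ _
  have hθc : 2 * θ ≤ cD := by have := min_le_right 1 (cD / 2); linarith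
  set d := θ * (a - b0) with hd
  have hd0 : 0 < d := mul_pos hθ (by linarith)
  set Lg := |Real.log (2 * q / ε)| with hLg
  have hL0 : 0 ≤ Lg := abs_nonneg _
  refine ⟨2 * (K + 2 * α₂ * C1 + Lg + 1), by positivity, (4 * C1 + K) ^ 2, one_le_pow₀ (by linarith), ?_⟩
  have ev1 := ev_small 4 0 d (4 * q) hd0 (half_pos hε)
  have ev2 := ev_small 5 0 d (4 * q) hd0 (half_pos (one_pos (α := ℝ)))
  have ev3 := ev_small 1 0 (1 / 8) q (by norm_num) (half_pos (one_pos (α := ℝ)))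
  have ev4 : ∀ᶠ n : ℕ in atTop, 4 * q * Real.exp (2 * q) / cD + 4 * (K + α₂) + 1 ≤ (n:ℝ) :=
    tendsto_natCast_atTop_atTop.eventually_ge_atTop _
  filter_upwards [ev1, ev2, ev3, ev4] with n ev1 ev2 ev3 ev4
  intro ξ hξ hξ1 hβ hN
  rw [zero_mul, zero_sub] at ev1 ev2 ev3
  have p1 : 0 ≤ 4 * q * Real.exp (2 * q) / cD := by positivity
  have hn1 : (1:ℝ) ≤ n := by linarith
  have hn : 0 < n := by exact_mod_cast (show (0:ℝ) < n by linarith)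
  have hn' : (0:ℝ) < n := by linarith
  have hnc : 4 * q * Real.exp (2 * q) ≤ cD * n := by
    rw [mul_comm cD, ← div_le_iff₀ hcD]; linarith
  obtain ⟨φ, ψ, h⟩ := H ξ hξ hξ1
  have hA1 : 1 ≤ 4 * C1 + K := by linarith
  have hN1 : 1 ≤ n * (ξ * Real.sqrt ξ) := (one_le_pow₀ hA1).trans hN
  obtain ⟨w1, -, -, w4⟩ := win hn hξ hξ1 hN1
  obtain ⟨x1, x2, x3⟩ := win2 hn hξ hξ1 hC10.le hK hN
  have hw0 : 0 < winw n ξ := by linarith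
  set lam := (n:ℝ) / winw n ξ with hlam
  have l0 : 0 < lam := by positivity
  have l1 : lam ≤ 1 := (div_le_one hw0).mpr w1
  have lw : lam * (winw n ξ / n) = 1 := by rw [hlam]; field_simp
  set e := C1 * (1 / (n * (ξ * Real.sqrt ξ)) + lam / (n * ξ ^ 2)) with he
  have e0 : 0 ≤ e := by positivity
  set hh := Real.sqrt ξ with hhd
  have hs : 0 < hh := Real.sqrt_pos.mpr hξ
  have core := fun t σ => exit_core (n := n) hq hn hK hξ hξ1 h hβ l0.le x2 (le_of_eq he.symm) hθ hθ1 hab hθc hnc (hD ξ hξ) t σ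
  rw [← hd] at core
  set E := Real.exp (-(d * n)) with hE
  have hE0 : 0 < E := Real.exp_pos _
  have hEt : ∀ t : ℕ, (t:ℝ) ≤ n ^ 4 → q * ((1 + 3 * t) * E) ≤ 4 * q * (n ^ 4 * E) := by
    intro t ht
    have : (1:ℝ) ≤ n ^ 4 := one_le_pow₀ hn1
    calc q * ((1 + 3 * t) * E) ≤ q * ((n ^ 4 + 3 * n ^ 4) * E) := by gcongr
      _ = _ := by ring
  have hφ := (abs_le.mp h.asym).2
  constructor
  · intro t σ ht ht4
    refine (core t σ).trans ?_
    have g1 := hEt t ht4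
    have g2 : lam * (φ 1 - t / n * (1 - e)) ≤ - Lg := by
      have k1 : α₂ / hh + 2 * (K + 2 * α₂ * C1 + Lg + 1) * (winw n ξ / n) ≤ t / n := by
        rw [le_div_iff₀ hn']
        refine le_trans (le_of_eq ?_) ht
        field_simp
      have k2 : (α₂ / hh + 2 * (K + 2 * α₂ * C1 + Lg + 1) * (winw n ξ / n)) * (1 - e) ≤ t / n * (1 - e) :=
        mul_le_mul_of_nonneg_right k1 (by linarith)
      have k3 : 2 * (K + 2 * α₂ * C1 + Lg + 1) * (winw n ξ / n) * (1 / 2) ≤ 2 * (K + 2 * α₂ * C1 + Lg + 1) * (winw n ξ / n) * (1 - e) := by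
        apply mul_le_mul_of_nonneg_left _ (by positivity); linarith
      have k4 : φ 1 - t / n * (1 - e) ≤ K + α₂ * (e / hh) - (K + 2 * α₂ * C1 + Lg + 1) * (winw n ξ / n) := by
        have : α₂ / hh * (1 - e) = α₂ / hh - α₂ * (e / hh) := by ring
        linarith only [k2, k3, this, hφ]
      have k5 := mul_le_mul_of_nonneg_left k4 l0.le
      have k6 : lam * (K + α₂ * (e / hh) - (K + 2 * α₂ * C1 + Lg + 1) * (winw n ξ / n)) = lam * K + α₂ * (lam * e / hh) - (K + 2 * α₂ * C1 + Lg + 1) * (lam * (winw n ξ / n)) := by ring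
      rw [k6, lw] at k5
      have k7 := mul_le_mul_of_nonneg_left x3 hα.le
      have k8 : lam * K ≤ K := mul_le_of_le_one_left (by linarith) l1
      linarith only [k5, k7, k8]
    have g3 : q * Real.exp (lam * (φ 1 - t / n * (1 - e))) ≤ ε / 2 := by
      have : Real.exp (lam * (φ 1 - t / n * (1 - e))) ≤ ε / (2 * q) := by
        calc _ ≤ Real.exp (- Real.log (2 * q / ε)) := Real.exp_le_exp.mpr (g2.trans (neg_le_neg (le_abs_self _)))
          _ = _ := by rw [Real.exp_neg, Real.exp_log (by positivity), inv_div]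
      calc _ ≤ q * (ε / (2 * q)) := by gcongr
        _ = _ := by field_simp
    rw [mul_add]
    linarith only [g1, g3, ev1]
  · have hst : MU q n (betaS q - ξ) (fun σ => if ∃ k, a < SS σ k then 1 else 0) ≤ MU q n (betaS q - ξ) (fun _ =>
        4 * q * (n ^ 4 * E) + q * Real.exp (- (1 / 8 * n))) := by
      rw [← MU_PPt (β := betaS q - ξ) hq0 hn (n ^ 4)]
      apply MU_mono hq0
      intro σ
      refine (core (n ^ 4) σ).trans ?_
      rw [mul_add]
      have g1 := hEt (n ^ 4) (by push_cast; exact le_rfl)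
      refine add_le_add g1 ?_
      refine mul_le_mul_of_nonneg_left (Real.exp_le_exp.mpr ?_) hq'.le
      have k1 : 1 / hh ≤ n := by
        rw [div_le_iff₀ hs]
        refine hN1.trans ?_
        gcongr; exact mul_le_of_le_one_left hs.le hξ1
      have k2 : α₂ / hh ≤ α₂ * n := by rw [← mul_one_div]; gcongr
      have k3 : ((n ^ 4 : ℕ) : ℝ) / n = n ^ 3 := by push_cast; field_simp
      have k4 : (n:ℝ) ^ 3 * (1 / 2) ≤ n ^ 3 * (1 - e) := mul_le_mul_of_nonneg_left (by linarith) (by positivity)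
      have k5 : K + α₂ * n ≤ (n:ℝ) ^ 3 * (1 / 4) := by
        have a1 : 4 * (K + α₂) ≤ (n:ℝ) := by linarith
        calc K + α₂ * n ≤ K * n + α₂ * n := by have : K ≤ K * n := le_mul_of_one_le_right (by linarith) hn1
                                               linarith
          _ = 4 * (K + α₂) * n * (1 / 4) := by ring
          _ ≤ n * n * (1 / 4) := by gcongr
          _ ≤ n * n * n * (1 / 4) := by gcongr; exact le_mul_of_one_le_right (by positivity) hn1
          _ = _ := by ring
      have k6 : 1 ≤ lam * (2 * n) := by
        rw [hlam, div_mul_eq_mul_div, le_div_iff₀ hw0]; linarith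
      rw [k3]
      have k7 : φ 1 - (n:ℝ) ^ 3 * (1 - e) ≤ - (n ^ 3 * (1 / 4)) := by linarith only [k2, k4, k5, hφ]
      have k8 := mul_le_mul_of_nonneg_left k7 l0.le
      have k9 : (n:ℝ) ^ 2 * (1 / 8) ≤ lam * (n ^ 3 * (1 / 4)) := by
        have := mul_le_mul_of_nonneg_right k6 (show 0 ≤ (n:ℝ) ^ 2 * (1 / 8) by positivity)
        linarith only [this]
      have k10 : (n:ℝ) ≤ n ^ 2 := by rw [sq]; exact le_mul_of_one_le_left hn'.le hn1
      linarith only [k8, k9, k10]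
    rw [MU_const hq0] at hst
    refine hst.trans ?_
    rw [le_div_iff₀ hn']
    rw [pow_one] at ev3
    have : (4 * q * ((n:ℝ) ^ 4 * E) + q * Real.exp (- (1 / 8 * n))) * n = 4 * q * (n ^ 5 * E) + q * (n * Real.exp (- (1 / 8 * n))) := by ring
    rw [this]
    linarith only [ev2, ev3]
end

open Finset Filter
section
variable {q n : ℕ} {β : ℝ}

lemma FF_lgs (hq : 3 ≤ q) (β x : ℝ) : FF q β x = lgs q (2 * β * (q * x - 1) / (q - 1)) := by
  have h1 := Dfun_lgs hq β x
  have h2 := Dfun_eq q β x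
  linarith

lemma soft_small (hq : 3 ≤ q) (hn : 0 < n) (hβ : 0 ≤ β) {κ0 a : ℝ} (hβκ : 2 * β / q ≤ 1 - κ0) (ha : q * (a - 1 / q) ≤ κ0 / 2)
    (ha0 : 1 / (q:ℝ) ≤ a) (hκ : 0 < κ0) (hD : Dfun q β a ≤ 0) (σ : Fin n → Fin q) (j : Fin q) (hj : SS σ j ≤ a) :
    2 * β * soft β (SS σ) j ≤ 1 - κ0 / 2 := by
  obtain ⟨q0, q3, r0⟩ := qr_pos hq
  have h1 := soft_le_FF (β := β) (by omega) (SS σ) (SS_sum hn σ) j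
  have h2 : FF q β (SS σ j) ≤ FF q β a := by
    rw [FF_lgs hq, FF_lgs hq]
    apply (lgs_strictMono hq).monotone
    gcongr
  have h3 := Dfun_eq q β a
  have h4 : soft β (SS σ) j ≤ a := by linarith
  have h5 : 2 * β * soft β (SS σ) j ≤ 2 * β * a := mul_le_mul_of_nonneg_left h4 (by linarith)
  have h6 : 2 * β * a = 2 * β / q + 2 * β / q * (q * (a - 1 / q)) := by field_simp; ring
  have h7 : 2 * β / q * (q * (a - 1 / q)) ≤ 1 * (q * (a - 1 / q)) := by
    apply mul_le_mul_of_nonneg_right (by linarith)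
    exact mul_nonneg q0.le (by linarith)
  linarith only [h5, h6, h7, ha, hβκ]

lemma PP_WW_gen (hq : 3 ≤ q) (hn : 0 < n) (hβ : 0 ≤ β) (hβq : 2 * β ≤ q) {κ0 a : ℝ} (hβκ : 2 * β / q ≤ 1 - κ0) (ha : q * (a - 1 / q) ≤ κ0 / 2)
    (ha0 : 1 / (q:ℝ) ≤ a) (hκ : 0 < κ0) (hκ1 : κ0 ≤ 1) (hD : Dfun q β a ≤ 0) (σ : Fin n → Fin q) (j l : Fin q) {Bd : ℝ} (hB : 0 ≤ Bd)
    (hB1 : Bd < 1 → SS σ j ≤ a ∧ SS σ l ≤ a) :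
    PP q n β (WW j l) σ ≤ (1 - κ0 / n) * WW j l σ + Cpair q / n ^ 2 + 9 / n * Bd := by
  have hn' : (0:ℝ) < n := by positivity
  by_cases h : Bd < 1
  · obtain ⟨h1, h2⟩ := hB1 h
    have := PP_WW_drift (by omega) hn hβ hβq j l σ (soft_small hq hn hβ hβκ ha ha0 hκ hD σ j h1) (soft_small hq hn hβ hβκ ha ha0 hκ hD σ l h2)
    rw [show 2 * (κ0 / 2) / (n:ℝ) = κ0 / n by ring] at this
    have : 0 ≤ 9 / n * Bd := by positivity
    linarith
  · push Not at h
    have h1 := PP_WW_triv (β := β) (by omega) hn j l σ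
    have h2 := WW_le_one hn j l σ
    have h3 : κ0 / n * WW j l σ ≤ 1 / n * 1 := by gcongr; exact WW_nonneg _ _ _
    have h4 : 9 / (n:ℝ) * 1 ≤ 9 / n * Bd := by gcongr
    have h5 : 0 ≤ Cpair q / n ^ 2 := by have := Cpair_pos (q := q); positivity
    have e : 9 / (n:ℝ) * 1 = 8 / n + 1 / n * 1 := by ring
    linarith only [h1, h3, h4, h5, e]

open Classical in
lemma MU_WW (hq : 3 ≤ q) (hn : 0 < n) (hβ : 0 ≤ β) (hβq : 2 * β ≤ q) {κ0 a : ℝ} (hβκ : 2 * β / q ≤ 1 - κ0) (ha : q * (a - 1 / q) ≤ κ0 / 2)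
    (ha0 : 1 / (q:ℝ) ≤ a) (hκ : 0 < κ0) (hκ1 : κ0 ≤ 1) (hD : Dfun q β a ≤ 0) (j l : Fin q)
    (hR : MU q n β (fun σ => if ∃ k, a < SS σ k then 1 else 0) ≤ 1 / n) :
    MU q n β (WW j l) ≤ (Cpair q + 9) / κ0 / n := by
  have hq0 : 0 < q := by omega
  have hn' : (0:ℝ) < n := by positivity
  have h1 : MU q n β (WW j l) ≤ MU q n β (fun σ => (1 - κ0 / n) * WW j l σ + Cpair q / n ^ 2 + 9 / n * (if ∃ k, a < SS σ k then 1 else 0)) := by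
    rw [← MU_PP hq0 hn (WW j l)]
    apply MU_mono hq0
    intro σ
    apply PP_WW_gen hq hn hβ hβq hβκ ha ha0 hκ hκ1 hD σ j l
    · split_ifs <;> norm_num
    · split_ifs with hk
      · intro h; exact absurd h (lt_irrefl _)
      · push Not at hk
        exact fun _ => ⟨hk j, hk l⟩
  rw [MU_add (fun σ => (1 - κ0 / n) * WW j l σ + Cpair q / n ^ 2) (fun σ => 9 / n * (if ∃ k, a < SS σ k then 1 else 0)),
    MU_add (fun σ => (1 - κ0 / n) * WW j l σ) (fun _ => Cpair q / n ^ 2), MU_smul, MU_smul, MU_const hq0] at h1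
  have h2 : 9 / (n:ℝ) * MU q n β (fun σ => if ∃ k, a < SS σ k then 1 else 0) ≤ 9 / n * (1 / n) := by gcongr
  rw [div_div, le_div_iff₀ (by positivity)]
  have h3 : κ0 / n * MU q n β (WW j l) ≤ (Cpair q + 9) / n ^ 2 := by
    have e : (Cpair q + 9) / (n:ℝ) ^ 2 = Cpair q / n ^ 2 + 9 / n * (1 / n) := by field_simp
    linarith only [h1, h2, e]
  rw [div_mul_eq_mul_div, div_le_div_iff₀ hn' (by positivity)] at h3
  have h4 : (κ0 * MU q n β (WW j l) * n) * n ≤ (Cpair q + 9) * n := by linarith only [h3]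
  have h5 := le_of_mul_le_mul_right h4 hn'
  linarith only [h5]

/-- Expected discrepancy from the monochromatic start. -/
lemma E_WW (hq : 3 ≤ q) (hn : 0 < n) (hβ : 0 ≤ β) (hβq : 2 * β ≤ q) {κ0 a b0 cD θ : ℝ} (hβκ : 2 * β / q ≤ 1 - κ0) (ha : q * (a - 1 / q) ≤ κ0 / 2)
    (ha0 : 1 / (q:ℝ) ≤ a) (hκ : 0 < κ0) (hκ1 : κ0 ≤ 1) (hb0 : 0 ≤ b0) (hab : b0 < a)
    (hθ : 0 < θ) (hθ1 : θ ≤ 1) (hc : 2 * θ ≤ cD) (hnc : 4 * q * Real.exp (2 * q) ≤ cD * n)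
    (hD : ∀ x ∈ Set.Icc b0 a, Dfun q β x ≤ -cD) (hE : 36 * q * (n ^ 5 * Real.exp (-(θ * (a - b0) * n))) ≤ 1)
    (k0 j l : Fin q) (hj : j ≠ k0) (hl : l ≠ k0) (t : ℕ) (ht : (t:ℝ) ≤ n ^ 4) :
    (PP q n β)^[t] (WW j l) (fun _ => k0) ≤ (Cpair q + 1) / κ0 / n := by
  have hq0 : 0 < q := by omega
  have hn' : (0:ℝ) < n := by positivity
  have hn1 : (1:ℝ) ≤ n := by exact_mod_cast hn
  have hDa : Dfun q β a ≤ 0 := by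
    have := hD a ⟨hab.le, le_rfl⟩
    linarith
  have hS : ∀ i, i ≠ k0 → SS (fun _ : Fin n => k0) i = 0 := by
    intro i hi
    unfold SS cn
    simp [hi.symm]
  set E := Real.exp (-(θ * (a - b0) * n)) with hEd
  have hE0 : 0 < E := Real.exp_pos _
  have hbar : ∀ i, i ≠ k0 → ∀ s : ℕ, (s:ℝ) ≤ n ^ 4 → (PP q n β)^[s] (bar θ a i) (fun _ => k0) ≤ 4 * (n ^ 4 * E) := by
    intro i hi s hs
    have h2 := PPt_add_err hq0 hn (fun τ => PP_bar (by omega) hn hβ hβq hθ hθ1 hab hc hnc hD i τ) s (fun _ : Fin n => k0)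
    have h3 := bar_le_exp (b := a) hn hθ.le i (fun _ : Fin n => k0) ((hS i hi).le.trans hb0)
    have e3 : Real.exp 1 ≤ 3 := by have := Real.exp_one_lt_d9; linarith
    have h4 : (s:ℝ) * (Real.exp 1 * E) ≤ n ^ 4 * (3 * E) := by gcongr
    have h5 : 1 * E ≤ n ^ 4 * E := by gcongr; exact one_le_pow₀ hn1
    linarith only [h2, h3, h4, h5]
  have hδ1 : κ0 / n ≤ 1 := by rw [div_le_one hn']; linarith
  have hC := Cpair_pos (q := q)
  have step : ∀ s < t, (PP q n β)^[s + 1] (WW j l) (fun _ => k0) ≤ (1 - κ0 / n) * (PP q n β)^[s] (WW j l) (fun _ => k0) + (Cpair q + 1) / n ^ 2 := by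
    intro s hs
    rw [Function.iterate_succ_apply]
    have h1 := PPt_mono (β := β) hq0 s (f := PP q n β (WW j l)) (g := fun σ => ((1 - κ0 / n) * WW j l σ + Cpair q / n ^ 2) + 9 / n * (bar θ a j σ + bar θ a l σ)) (by
      intro σ
      have b1 := bar_nonneg θ a j σ
      have b2 := bar_nonneg θ a l σ
      apply PP_WW_gen hq hn hβ hβq hβκ ha ha0 hκ hκ1 hDa σ j l (by linarith)
      intro hlt
      constructor
      · by_contra hcon
        push Not at hcon
        have := bar_eq_one hn hθ.le j σ hcon.le
        linarith
      · by_contra hcon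
        push Not at hcon
        have := bar_eq_one hn hθ.le l σ hcon.le
        linarith) (fun _ => k0)
    rw [PPt_add, PPt_add s (fun σ => (1 - κ0 / n) * WW j l σ) (fun _ => Cpair q / n ^ 2), PPt_smul, PPt_const hq0 hn, PPt_smul, PPt_add] at h1
    have hs' : (s:ℝ) ≤ n ^ 4 := le_trans (by exact_mod_cast hs.le) ht
    have b1 := hbar j hj s hs'
    have b2 := hbar l hl s hs'
    have h3 : 9 / (n:ℝ) * ((PP q n β)^[s] (bar θ a j) (fun _ => k0) + (PP q n β)^[s] (bar θ a l) (fun _ => k0)) ≤ 1 / n ^ 2 := by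
      calc _ ≤ 9 / (n:ℝ) * (8 * (n ^ 4 * E)) := by gcongr; linarith only [b1, b2]
        _ = 72 * (n ^ 5 * E) / n ^ 2 := by field_simp; norm_num
        _ ≤ 36 * q * (n ^ 5 * E) / n ^ 2 := by
            have : (3:ℝ) ≤ q := by exact_mod_cast hq
            gcongr
            linarith
        _ ≤ _ := by gcongr
    have e : (Cpair q + 1) / (n:ℝ) ^ 2 = Cpair q / n ^ 2 + 1 / n ^ 2 := by ring
    rw [e]
    linarith only [h1, h3]
  have h := recur_le (a := fun s => (PP q n β)^[s] (WW j l) (fun _ => k0)) (δ := κ0 / n) (e := (Cpair q + 1) / n ^ 2) (by positivity) hδ1 (by positivity) t step t le_rfl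
  have h0 : WW j l (fun _ : Fin n => k0) = 0 := by
    unfold WW; rw [hS j hj, hS l hl]; simp
  simp only [Function.iterate_zero, id] at h
  rw [h0, mul_zero, zero_add] at h
  refine h.trans (le_of_eq ?_)
  field_simp

lemma E_QQ (hq : 3 ≤ q) (hn : 0 < n) (k0 : Fin q) (t : ℕ) {C : ℝ} (hC : 0 ≤ C)
    (h : ∀ j l : Fin q, j ≠ k0 → l ≠ k0 → (PP q n β)^[t] (WW j l) (fun _ => k0) ≤ C) :
    (PP q n β)^[t] (fun σ => QQ q k0 (SS σ)) (fun _ => k0) ≤ q ^ 2 * C := by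
  have hq0 : 0 < q := by omega
  have h1 := PPt_mono (β := β) hq0 t (f := fun σ : Fin n → Fin q => QQ q k0 (SS σ)) (g := fun σ => ∑ l ∈ univ.erase k0, ∑ j ∈ univ.erase k0, WW l j σ)
    (fun σ => QQ_le (by omega) k0 (SS σ) (SS_sum hn σ)) (fun _ => k0)
  rw [PPt_sum] at h1
  refine h1.trans ?_
  have hc : ((univ.erase k0 : Finset (Fin q)).card : ℝ) ≤ q := by
    have := Finset.card_le_univ (univ.erase k0)
    rw [Fintype.card_fin] at this
    exact_mod_cast this
  calc _ ≤ ∑ l ∈ univ.erase k0, (q:ℝ) * C := by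
        apply Finset.sum_le_sum
        intro l hl
        rw [PPt_sum]
        calc _ ≤ ∑ j ∈ univ.erase k0, C := Finset.sum_le_sum fun j hj => h l j (Finset.ne_of_mem_erase hl) (Finset.ne_of_mem_erase hj)
          _ = (univ.erase k0 : Finset (Fin q)).card * C := by rw [Finset.sum_const, nsmul_eq_mul]
          _ ≤ _ := by gcongr
    _ = (univ.erase k0 : Finset (Fin q)).card * (q * C) := by rw [Finset.sum_const, nsmul_eq_mul]
    _ ≤ q * (q * C) := by gcongr
    _ = _ := by ring
end

open Finset Filter
section
variable {q n : ℕ} {β : ℝ}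

lemma drift_low (hq : 3 ≤ q) (hn : 0 < n) (hβ : 0 ≤ β) (hβq : 2 * β ≤ q) (φ ψ : ℝ → ℝ) {L M : ℝ} (k : Fin q)
    (hφ : ∀ x ∈ Set.Icc (0:ℝ) 1, ∀ y ∈ Set.Icc (0:ℝ) 1, |φ y - φ x - ψ x * (y - x)| ≤ L * (y - x) ^ 2)
    (hL : 0 ≤ L) (σ : Fin n → Fin q) (h0 : 0 ≤ ψ (SS σ k)) (hM : ψ (SS σ k) ≤ M) :
    ψ (SS σ k) * Dfun q β (SS σ k) / n - (M * (q ^ 2 * Real.exp (2 * q)) / n * QQ q k (SS σ) + (M * (2 * q * Real.exp (2 * q)) + L) / n ^ 2)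
      ≤ PP q n β (fun τ => φ (SS τ k)) σ - φ (SS σ k) := by
  have hq0 : 0 < q := by omega
  have hn' : (0:ℝ) < n := by positivity
  have h2 := (abs_le.mp (PP_C11 (β := β) hq0 hn φ ψ L k hφ hL σ)).1
  have h3 := (abs_le.mp (PP_SS_drift hq0 hn hβ hβq σ k)).1
  have h4 := soft_ge_FF (β := β) (by omega) hβ hβq (SS σ) (SS_sum hn σ) (SS_nonneg σ) k
  have hD := Dfun_eq q β (SS σ k)
  have hQ := QQ_nonneg k (SS σ)
  set x := SS σ k
  set p := PP q n β (fun τ => SS τ k) σ - x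
  set G := 2 * q * Real.exp (2 * q) with hG
  set G2 := q ^ 2 * Real.exp (2 * q) with hG2
  have hG0 : 0 ≤ G := by positivity
  have hG20 : 0 ≤ G2 := by positivity
  set Q := QQ q k (SS σ)
  have h5 : 1 / (n:ℝ) * (Dfun q β x - G2 * Q) ≤ 1 / (n:ℝ) * (soft β (SS σ) k - x) := by
    apply mul_le_mul_of_nonneg_left _ (by positivity); linarith only [h4, hD]
  have h6 : 1 / (n:ℝ) * (Dfun q β x - G2 * Q) - G / n ^ 2 ≤ p := by linarith only [h5, h3]
  have h7 := mul_le_mul_of_nonneg_left h6 h0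
  have h8 : ψ x * (G2 * Q / n + G / n ^ 2) ≤ M * (G2 * Q / n + G / n ^ 2) := mul_le_mul_of_nonneg_right hM (by positivity)
  have e1 : ψ x * Dfun q β x / n - (M * G2 / n * Q + (M * G + L) / n ^ 2)
    = ψ x * (1 / (n:ℝ) * (Dfun q β x - G2 * Q) - G / n ^ 2) + ψ x * (G2 * Q / n + G / n ^ 2) - M * (G2 * Q / n + G / n ^ 2) - L / n ^ 2 := by ring
  linarith only [h2, h7, h8, e1]

lemma gg_iter (hq : 0 < q) (hn : 0 < n) (Y : ℕ → (Fin n → Fin q) → ℝ) (A B : ℕ → ℝ) (k : Fin q) (σ0 : Fin n → Fin q) {C : ℝ} (T1 T : ℕ)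
    (hA : ∀ t, 0 ≤ A t)
    (hY : ∀ t σ, PP q n β (fun τ => gg (Y (t + 1) τ)) σ ≤ gg (Y t σ) + (A t * QQ q k (SS σ) + B t))
    (hQ : ∀ t < T, (PP q n β)^[T1 + t] (fun σ => QQ q k (SS σ)) σ0 ≤ C) :
    (PP q n β)^[T1 + T] (fun τ => gg (Y T τ)) σ0 ≤ (PP q n β)^[T1] (fun τ => gg (Y 0 τ)) σ0 + ∑ t ∈ range T, (A t * C + B t) := by
  induction T with
  | zero => simp
  | succ T ih =>
    have ih := ih fun t ht => hQ t (by omega)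
    rw [← add_assoc, Function.iterate_succ_apply, Finset.sum_range_succ]
    have h1 := PPt_mono (β := β) hq (T1 + T) (hY T) σ0
    rw [PPt_add (T1 + T) (fun σ => gg (Y T σ)) (fun σ => A T * QQ q k (SS σ) + B T),
      PPt_add (T1 + T) (fun σ => A T * QQ q k (SS σ)) (fun _ => B T), PPt_smul, PPt_const hq hn] at h1
    have h2 := mul_le_mul_of_nonneg_left (hQ T (by omega)) (hA T)
    linarith only [ih, h1, h2]

open Classical in
/-- Phase one lower bound: the monochromatic start stays away from the uniform vector. -/
lemma L1 (hq : 3 ≤ q) {b0 α₂ K CQ ε : ℝ} (hα : 0 < α₂) (hK : 1 ≤ K) (hC : 0 ≤ CQ) (hε : 0 < ε) :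
    ∃ γ : ℝ, 0 < γ ∧ ∀ n : ℕ, 0 < n → ∀ ξ : ℝ, ∀ φ ψ : ℝ → ℝ, 0 < ξ → ξ ≤ 1 → 0 ≤ betaS q - ξ → 1 ≤ n * (ξ * Real.sqrt ξ) →
      PH q b0 K α₂ ξ φ ψ → ∀ (k : Fin q) (T1 : ℕ),
      (∀ t < T1, (PP q n (betaS q - ξ))^[t] (fun σ => QQ q k (SS σ)) (fun _ => k) ≤ CQ / n) →
      (T1:ℝ) ≤ α₂ * n / Real.sqrt ξ - γ * winw n ξ →
      (PP q n (betaS q - ξ))^[T1] (fun σ => if SS σ k < b0 then 1 else 0) (fun _ => k) ≤ ε := by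
  have hq0 : 0 < q := by omega
  set G := 2 * q * Real.exp (2 * q) with hG
  set G2 := q ^ 2 * Real.exp (2 * q) with hG2
  have hG0 : 0 ≤ G := by positivity
  have hG20 : 0 ≤ G2 := by positivity
  set C1 := K * (G2 * CQ + G + 1) + K ^ 2 with hC1
  have hC10 : 0 < C1 := by positivity
  set δ := ε / (4 * α₂ * C1 + ε) with hδ
  have hδ0 : 0 < δ := by positivity
  have hδ1 : δ ≤ 1 := (div_le_one (by positivity)).mpr (le_add_of_nonneg_left (by positivity))
  have hδ2 : 2 * α₂ * δ * C1 ≤ ε / 2 := by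
    rw [hδ]; rw [mul_div_assoc', div_mul_eq_mul_div, div_le_iff₀ (by positivity)]
    nlinarith [sq_nonneg ε]
  refine ⟨K + 1 / (δ * ε), by positivity, ?_⟩
  intro n hn ξ φ ψ hξ hξ1 hβ hN h k T1 hQ hT
  have hβq : 2 * (betaS q - ξ) ≤ q := by linarith [(betaS_facts hq).2]
  obtain ⟨w1, w2, w3, -⟩ := win hn hξ hξ1 hN
  have hn' : (0:ℝ) < n := by positivity
  have hn1 : (1:ℝ) ≤ n := by exact_mod_cast hn
  have hs : 0 < Real.sqrt ξ := Real.sqrt_pos.mpr hξ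
  have hs1 : Real.sqrt ξ ≤ 1 := Real.sqrt_le_one.mpr hξ1
  have hh2 : Real.sqrt ξ * Real.sqrt ξ = ξ := Real.mul_self_sqrt hξ.le
  set hh := Real.sqrt ξ with hhd
  have hw0 : 0 < winw n ξ := by linarith
  set l := (n:ℝ) / winw n ξ with hl
  have l0 : 0 < l := by positivity
  have l1 : l ≤ 1 := (div_le_one hw0).mpr w1
  have lw : l * (winw n ξ / n) = 1 := by rw [hl]; field_simp
  set z := l / (n * ξ ^ 2) with hz
  have z0 : 0 < z := by positivity
  have z1 : z ≤ 1 := by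
    have : z ^ 2 ≤ 1 ^ 2 := by
      rw [one_pow]; exact (le_mul_of_one_le_right (sq_nonneg _) hN).trans w2
    exact le_of_sq_le_sq this zero_le_one
  set lam := δ * l with hlam
  have lam0 : 0 < lam := by positivity
  set A := 2 * lam * (K / ξ * G2 / n) with hA
  set B := 2 * lam * ((K / ξ * G + K / (ξ * hh)) / n ^ 2) + (2 * lam * (K / ξ / n)) ^ 2 / 2 with hB
  have hKξ : 1 ≤ K / ξ := by rw [le_div_iff₀ hξ]; linarith
  have key := gg_iter (β := betaS q - ξ) hq0 hn (fun t τ => lam * (φ (SS τ k) + t / n - T1 / n)) (fun _ => A) (fun _ => B) k (fun _ => k)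
    (C := CQ / n) 0 T1 (fun _ => by positivity) (by
      intro t σ
      have hQ0 := QQ_nonneg k (SS σ)
      have h6 := h.psi (SS σ k)
      have d1 := drift_low hq hn hβ hβq φ ψ k h.c11 (by positivity) σ h6.1.le h6.2
      rw [← hG, ← hG2] at d1
      have d2 : -(1 / (n:ℝ)) ≤ ψ (SS σ k) * Dfun q (betaS q - ξ) (SS σ k) / n := by
        rw [← neg_div]
        apply div_le_div_of_nonneg_right _ hn'.le
        linarith only [h.le1 (SS σ k)]
      have := PP_gg (β := betaS q - ξ) hq0 hn (fun τ => lam * (φ (SS τ k) + ((t + 1 : ℕ) : ℝ) / n - T1 / n)) σ (lam * (φ (SS σ k) + t / n - T1 / n))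
        (η := 2 * lam * (K / ξ / n)) (b := lam * (K / ξ * G2 / n * QQ q k (SS σ) + (K / ξ * G + K / (ξ * hh)) / n ^ 2)) (by positivity) (by
          intro u j
          have e : lam * (φ (SS (Function.update σ u j) k) + ((t + 1 : ℕ) : ℝ) / n - T1 / n) - lam * (φ (SS σ k) + t / n - T1 / n)
            = lam * ((φ (SS (Function.update σ u j) k) - φ (SS σ k)) + 1 / n) := by push_cast; ring
          rw [e, abs_mul, abs_of_pos lam0]
          have s1 : |φ (SS (Function.update σ u j) k) - φ (SS σ k)| ≤ K / ξ * (1 / n) :=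
            (h.step _ _).trans (mul_le_mul_of_nonneg_left (SS_update_abs σ u j k) (by positivity))
          have s2 : |1 / (n:ℝ)| ≤ K / ξ * (1 / n) := by
            rw [abs_of_pos (by positivity)]; exact le_mul_of_one_le_left (by positivity) hKξ
          calc _ ≤ lam * (K / ξ * (1 / n) + K / ξ * (1 / n)) := mul_le_mul_of_nonneg_left ((abs_add_le _ _).trans (add_le_add s1 s2)) lam0.le
            _ = _ := by ring) (by
          have e : (fun τ : Fin n → Fin q => lam * (φ (SS τ k) + ((t + 1 : ℕ) : ℝ) / n - T1 / n)) = fun τ => lam * ((fun τ => φ (SS τ k)) τ + (fun _ => ((t + 1 : ℕ) : ℝ) / n - T1 / n) τ) := by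
            funext τ; simp only []; ring
          rw [e, PP_smul, PP_add, PP_const hq0 hn, ← mul_sub, neg_le, ← mul_neg]
          apply mul_le_mul_of_nonneg_left _ lam0.le
          push_cast
          have e2 : ((t:ℝ) + 1) / n = t / n + 1 / n := by ring
          rw [e2]
          linarith only [d1, d2])
      refine this.trans (le_of_eq ?_)
      rw [hA, hB]; ring) (by
      intro t ht
      rw [zero_add]; exact hQ t ht)
  rw [zero_add, Finset.sum_const, card_range, nsmul_eq_mul] at key
  simp only [Function.iterate_zero, id, Nat.cast_zero, zero_div, add_zero] at key
  have hS1 : SS (fun _ : Fin n => k) k = 1 := by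
    unfold SS cn; simp [hn.ne']
  rw [hS1] at key
  have hmain : (PP q n (betaS q - ξ))^[T1] (fun σ => if SS σ k < b0 then 1 else 0) (fun _ => k) ≤
      (PP q n (betaS q - ξ))^[T1] (fun τ => gg (lam * (φ (SS τ k) + T1 / n - T1 / n))) (fun _ => k) := by
    apply PPt_mono hq0
    intro σ
    split_ifs with hσ
    · apply gg_ge_one
      rw [add_sub_cancel_right]
      have := h.mono hσ.le
      rw [h.zero] at this
      exact mul_nonpos_of_nonneg_of_nonpos lam0.le this
    · exact gg_nonneg _
  refine hmain.trans (key.trans ?_)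
  have hφ := (abs_le.mp h.asym).1
  have g1 : gg (lam * (φ 1 - T1 / n)) ≤ ε / 2 := by
    have k1 : (T1:ℝ) / n ≤ α₂ / hh - (K + 1 / (δ * ε)) * (winw n ξ / n) := by
      rw [div_le_iff₀ hn']
      refine hT.trans (le_of_eq ?_)
      field_simp
    have k2 : 1 / ε ≤ lam * (φ 1 - T1 / n) := by
      have : -K + (K + 1 / (δ * ε)) * (winw n ξ / n) ≤ φ 1 - T1 / n := by linarith only [k1, hφ]
      have := mul_le_mul_of_nonneg_left this lam0.le
      have e : lam * (-K + (K + 1 / (δ * ε)) * (winw n ξ / n)) = δ * (K * (l * (winw n ξ / n) - l)) + δ * (1 / (δ * ε)) * (l * (winw n ξ / n)) := by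
        rw [hlam]; ring
      rw [e, lw, mul_one] at this
      have p : 0 ≤ δ * (K * (1 - l)) := mul_nonneg hδ0.le (mul_nonneg (by linarith) (by linarith))
      have e3 : δ * (1 / (δ * ε)) = 1 / ε := by field_simp
      linarith only [this, p, e3]
    refine (gg_anti k2).trans ((gg_le (by positivity)).trans (le_of_eq ?_))
    field_simp
  have hTle : (T1:ℝ) ≤ α₂ * n / hh := by
    refine hT.trans (sub_le_self _ (by positivity))
  have g2 : (T1:ℝ) * (A * (CQ / n) + B) ≤ ε / 2 := by
    refine le_trans ?_ hδ2
    have a1 : K / ξ * G ≤ K / (ξ * hh) * G := by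
      gcongr; exact mul_le_of_le_one_right hξ.le hs1
    have a2 : K / ξ * G2 * CQ ≤ K / (ξ * hh) * G2 * CQ := by
      gcongr; exact mul_le_of_le_one_right hξ.le hs1
    have a3 : A * (CQ / n) + B ≤ 2 * lam * (K / (ξ * hh) * (G2 * CQ + G + 1) / n ^ 2) + 2 * lam ^ 2 * K ^ 2 / (ξ ^ 2 * n ^ 2) := by
      have e1 : A * (CQ / n) + B = 2 * lam * ((K / ξ * G2 * CQ + K / ξ * G + K / (ξ * hh)) / n ^ 2) + 2 * lam ^ 2 * K ^ 2 / (ξ ^ 2 * n ^ 2) := by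
        rw [hA, hB]; ring
      rw [e1]
      gcongr
      linarith only [a1, a2]
    have a0 : 0 ≤ A * (CQ / n) + B := by positivity
    calc (T1:ℝ) * (A * (CQ / n) + B) ≤ α₂ * n / hh * (2 * lam * (K / (ξ * hh) * (G2 * CQ + G + 1) / n ^ 2) + 2 * lam ^ 2 * K ^ 2 / (ξ ^ 2 * n ^ 2)) :=
          mul_le_mul hTle a3 a0 (by positivity)
      _ = 2 * α₂ * δ * (K * (G2 * CQ + G + 1) * (l / (n * ξ * (hh * hh))) + δ * K ^ 2 * (l ^ 2 / (n * ξ ^ 2 * hh))) := by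
          rw [hlam]; field_simp
      _ ≤ 2 * α₂ * δ * (K * (G2 * CQ + G + 1) * 1 + 1 * K ^ 2 * 1) := by
          have b1 : l / (n * ξ * (hh * hh)) ≤ 1 := by rw [hh2, mul_assoc, ← sq]; exact z1
          have b2 : l ^ 2 / (n * ξ ^ 2 * hh) ≤ 1 := by rw [div_le_one (by positivity)]; exact w3
          gcongr
      _ = _ := by rw [hC1]; ring
  linarith only [g1, g2]
end

open Finset Filter
section
variable {q n : ℕ} {β : ℝ}

lemma lgs_one (hq : 3 ≤ q) : lgs q 1 ≤ 1 - 1 / q := by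
  obtain ⟨q0, q3, r0⟩ := qr_pos hq
  have e1 := Real.exp_one_lt_d9
  have h : 1 ≤ Real.exp (-1) * 3 := by
    have : Real.exp (-1) * Real.exp 1 = 1 := by rw [← Real.exp_add]; simp
    have := Real.exp_pos (-1)
    nlinarith
  have h2 : (q:ℝ) ≤ (q - 1) * (1 + (q - 1) * Real.exp (-1)) := by
    have : (q - 1) * ((q:ℝ) - 1) * (1 / 3) ≤ (q - 1) * (q - 1) * Real.exp (-1) := by
      apply mul_le_mul_of_nonneg_left _ (by positivity); linarith
    nlinarith
  unfold lgs
  rw [inv_eq_one_div, div_le_iff₀ (by positivity), one_sub_div q0.ne', div_mul_eq_mul_div, le_div_iff₀ q0]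
  linarith

lemma D_lin (hq : 3 ≤ q) (hβ : 0 ≤ β) (hβq : 2 * β ≤ q) {x : ℝ} (hx : x - 1 / q ≤ (q - 1) / q ^ 2) :
    -((1 - 2 * β / q) * (x - 1 / q)) ≤ Dfun q β x := by
  obtain ⟨q0, q3, r0⟩ := qr_pos hq
  rw [Dfun_lgs hq]
  set z := 2 * β * (q * x - 1) / ((q:ℝ) - 1) with hz
  have hzc : z * ((1 / q) * (1 - 1 / (q:ℝ))) = 2 * β / q * (x - 1 / q) := by rw [hz]; field_simp
  have hz1 : z ≤ 1 := by
    rw [hz, div_le_one r0]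
    have : q * x - 1 ≤ (q - 1) / q := by
      have := mul_le_mul_of_nonneg_left hx q0.le
      have e : (q:ℝ) * ((q - 1) / q ^ 2) = (q - 1) / q := by field_simp
      have e2 : (q:ℝ) * (x - 1 / q) = q * x - 1 := by field_simp
      linarith
    have h2 : 2 * β * ((q:ℝ) * x - 1) ≤ 2 * β * ((q - 1) / q) := mul_le_mul_of_nonneg_left this (by linarith)
    have h3 : 2 * β * (((q:ℝ) - 1) / q) ≤ q * ((q - 1) / q) := by gcongr
    have e : (q:ℝ) * ((q - 1) / q) = q - 1 := by field_simp
    linarith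
  have hm := (lgs_strictMono hq).monotone
  have h0 := lgs_zero hq
  have hl1 := lgs_one hq
  have key : z * ((1 / q) * (1 - 1 / (q:ℝ))) ≤ lgs q z - 1 / q := by
    rcases lt_trichotomy z 0 with h | h | h
    · obtain ⟨w, hw, e⟩ := exists_hasDerivAt_eq_slope (lgs q) (fun z => lgs q z - lgs q z ^ 2) h (lgs_cont hq).continuousOn (fun w _ => lgs_deriv hq w)
      have e' : (lgs q w - lgs q w ^ 2) * (0 - z) = lgs q 0 - lgs q z := by rw [e]; field_simp [h.ne]
      have h1 : lgs q w ≤ 1 / q := h0 ▸ hm hw.2.le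
      have hc : 1 / (q:ℝ) ≤ 1 / 2 := by gcongr; linarith
      have h2 : (lgs q w - lgs q w ^ 2) ≤ (1 / q) * (1 - 1 / (q:ℝ)) := by
        nlinarith only [h1, hc]
      have := mul_le_mul_of_nonneg_right h2 (show 0 ≤ 0 - z by linarith)
      rw [e', h0] at this
      linarith only [this]
    · rw [h, h0]; simp
    · obtain ⟨w, hw, e⟩ := exists_hasDerivAt_eq_slope (lgs q) (fun z => lgs q z - lgs q z ^ 2) h (lgs_cont hq).continuousOn (fun w _ => lgs_deriv hq w)
      have e' : (lgs q w - lgs q w ^ 2) * (z - 0) = lgs q z - lgs q 0 := by rw [e]; field_simp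
      have h1 : 1 / (q:ℝ) ≤ lgs q w := h0 ▸ hm hw.1.le
      have h3 : lgs q w ≤ 1 - 1 / q := (hm (hw.2.le.trans hz1)).trans hl1
      have h2 : (1 / q) * (1 - 1 / (q:ℝ)) ≤ (lgs q w - lgs q w ^ 2) := by
        nlinarith only [h1, h3]
      have := mul_le_mul_of_nonneg_right h2 (show 0 ≤ z - 0 by linarith)
      rw [e', h0] at this
      linarith only [this]
  rw [hzc] at key
  linarith only [key]

lemma exp_quad (w : ℝ) : |Real.exp w - 1 - w| ≤ w ^ 2 * Real.exp |w| := by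
  have h1 := Real.add_one_le_exp w
  rw [abs_of_nonneg (by linarith)]
  have h2 : Real.exp w - 1 ≤ w * Real.exp w := by
    have := mul_le_mul_of_nonneg_right (Real.add_one_le_exp (-w)) (Real.exp_pos w).le
    rw [← Real.exp_add] at this
    simp at this
    linarith
  have h3 : 1 ≤ Real.exp |w| := Real.one_le_exp (abs_nonneg w)
  rcases le_total 0 w with h | h
  · rw [abs_of_nonneg h]
    have := mul_le_mul_of_nonneg_left h2 h
    linarith only [h2, this]
  · have h4 := mul_le_mul_of_nonpos_left h1 h
    have h5 : w ^ 2 * 1 ≤ w ^ 2 * Real.exp |w| := by gcongr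
    linarith only [h2, h4, h5]

structure MF (q : ℕ) (b1 M : ℝ) (m ψ : ℝ → ℝ) : Prop where
  c11 : ∀ x ∈ Set.Icc (0:ℝ) 1, ∀ y ∈ Set.Icc (0:ℝ) 1, |m y - m x - ψ x * (y - x)| ≤ M * (y - x) ^ 2
  psi : ∀ x ∈ Set.Icc (0:ℝ) 1, 0 ≤ ψ x ∧ ψ x ≤ M
  drift : ∀ β, 0 ≤ β → β ≤ b1 → ∀ x ∈ Set.Icc (0:ℝ) 1, -((1 - 2 * β / q) * m x) ≤ ψ x * Dfun q β x
  le : ∀ x, m x ≤ x - 1 / q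
  mono : StrictMono m
  zero : m (1 / q) = 0
  bd : ∀ x ∈ Set.Icc (0:ℝ) 1, |m x| ≤ M
  lip : ∀ x ∈ Set.Icc (0:ℝ) 1, ∀ y ∈ Set.Icc (0:ℝ) 1, |m y - m x| ≤ M * |y - x|

lemma mf_ex (hq : 3 ≤ q) {b1 : ℝ} (hb1 : 0 ≤ b1) (hb1q : 2 * b1 < q) : ∃ M m ψ, 1 ≤ M ∧ MF q b1 M m ψ := by
  obtain ⟨q0, q3, r0⟩ := qr_pos hq
  set c := 1 / (q:ℝ) with hc
  have c0 : 0 < c := by positivity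
  have c1 : c ≤ 1 := by rw [hc, div_le_one q0]; linarith
  set X0 := ((q:ℝ) - 1) / q ^ 2 with hX0
  have X00 : 0 < X0 := by positivity
  have X01 : X0 ≤ 1 := by rw [hX0, div_le_one (by positivity)]; nlinarith only [q3]
  set κ1 := 1 - 2 * b1 / q with hκ1
  have κ10 : 0 < κ1 := by rw [hκ1, sub_pos, div_lt_one q0]; exact hb1q
  have κ11 : κ1 ≤ 1 := by rw [hκ1]; linarith [show 0 ≤ 2 * b1 / q by positivity]
  set r := 4 / (κ1 * X0) with hr
  have r4 : 4 ≤ r := by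
    rw [hr, le_div_iff₀ (by positivity)]
    have := mul_le_one₀ κ11 X00.le X01
    linarith
  set p := X0 / r with hp
  have p0 : 0 < p := by positivity
  have hrp : r = X0 / p := by rw [hp]; field_simp
  have her : Real.exp (-r) ≤ κ1 * (p * (1 - Real.exp (-r))) := by
    have h1 := Real.quadratic_le_exp_of_nonneg (show 0 ≤ r by linarith)
    have h2 : Real.exp (-r) ≤ 2 / r ^ 2 := by
      rw [Real.exp_neg, inv_eq_one_div, div_le_div_iff₀ (Real.exp_pos _) (by positivity)]
      linarith
    have h3 : 2 / r ^ 2 ≤ 1 / 2 := by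
      rw [div_le_div_iff₀ (by positivity) (by norm_num)]; nlinarith only [r4]
    have h4 : κ1 * (p * (1 / 2)) = 2 / r ^ 2 := by rw [hp, hr]; field_simp; norm_num
    refine h2.trans (h4.symm.le.trans ?_)
    gcongr; linarith
  set m : ℝ → ℝ := fun x => p * (1 - Real.exp (-((x - c) / p))) with hm
  set ψ : ℝ → ℝ := fun x => Real.exp (-((x - c) / p)) with hψ
  have ψb : ∀ x ∈ Set.Icc (0:ℝ) 1, ψ x ≤ Real.exp (1 / p) := by
    intro x hx
    apply Real.exp_le_exp.mpr
    rw [← neg_div]; gcongr; linarith [hx.1]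
  set M := Real.exp (1 / p) * (1 / p) * Real.exp (1 / p) + Real.exp (1 / p) + p + p * Real.exp (1 / p) + Real.exp (1 / p) * (1 + (1 / p) * Real.exp (1 / p)) + 1 with hM
  have E0 := Real.exp_pos (1 / p)
  have E1 : Real.exp (1 / p) ≤ M := by rw [hM]; have : 0 ≤ Real.exp (1 / p) * (1 / p) * Real.exp (1 / p) := by positivity
                                       have : 0 ≤ p * Real.exp (1 / p) + Real.exp (1 / p) * (1 + (1 / p) * Real.exp (1 / p)) := by positivity
                                       linarith
  have c11 : ∀ x ∈ Set.Icc (0:ℝ) 1, ∀ y ∈ Set.Icc (0:ℝ) 1, |m y - m x - ψ x * (y - x)| ≤ Real.exp (1 / p) * (1 / p) * Real.exp (1 / p) * (y - x) ^ 2 := by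
    intro x hx y hy
    set w := -((y - x) / p) with hw
    have e : m y - m x - ψ x * (y - x) = -(p * ψ x) * (Real.exp w - 1 - w) := by
      have : Real.exp (-((y - c) / p)) = Real.exp (-((x - c) / p)) * Real.exp w := by
        rw [← Real.exp_add, hw]; congr 1; ring
      simp only [hm, hψ]
      rw [this, hw]; field_simp; ring
    rw [e, abs_mul, abs_neg, abs_of_nonneg (mul_nonneg p0.le (Real.exp_pos _).le)]
    have hwb : |w| ≤ 1 / p := by
      rw [hw, abs_neg, abs_div, abs_of_pos p0]; gcongr
      rw [abs_le]; constructor <;> linarith [hx.1, hx.2, hy.1, hy.2]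
    calc p * ψ x * |Real.exp w - 1 - w| ≤ p * Real.exp (1 / p) * (w ^ 2 * Real.exp (1 / p)) := by
          have := exp_quad w
          gcongr
          · exact ψb x hx
          · refine this.trans ?_
            gcongr
      _ = _ := by rw [hw]; field_simp
  have lipm : ∀ x ∈ Set.Icc (0:ℝ) 1, ∀ y ∈ Set.Icc (0:ℝ) 1, |m y - m x| ≤ M * |y - x| := by
    intro x hx y hy
    have h1 := c11 x hx y hy
    have h2 : |y - x| ≤ 1 := by rw [abs_le]; constructor <;> linarith [hx.1, hx.2, hy.1, hy.2]
    have h3 : |ψ x * (y - x)| ≤ Real.exp (1 / p) * |y - x| := by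
      rw [abs_mul, abs_of_pos (Real.exp_pos _)]; exact mul_le_mul_of_nonneg_right (ψb x hx) (abs_nonneg _)
    have h4 : (y - x) ^ 2 ≤ |y - x| := by
      rw [← sq_abs, sq]; exact mul_le_of_le_one_left (abs_nonneg _) h2
    calc |m y - m x| = |(m y - m x - ψ x * (y - x)) + ψ x * (y - x)| := by ring_nf
      _ ≤ Real.exp (1 / p) * (1 / p) * Real.exp (1 / p) * |y - x| + Real.exp (1 / p) * |y - x| := by
          refine (abs_add_le _ _).trans (add_le_add (h1.trans ?_) h3)
          gcongr
      _ = (Real.exp (1 / p) * (1 / p) * Real.exp (1 / p) + Real.exp (1 / p)) * |y - x| := by ring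
      _ ≤ _ := by
        gcongr
        rw [hM]
        have : 0 ≤ p + p * Real.exp (1 / p) + Real.exp (1 / p) * (1 + (1 / p) * Real.exp (1 / p)) + 1 := by positivity
        linarith only [this]
  have lem : ∀ x, m x ≤ x - c := by
    intro x
    have h1 := Real.add_one_le_exp (-((x - c) / p))
    have h2 := mul_le_mul_of_nonneg_left (show 1 - Real.exp (-((x - c) / p)) ≤ (x - c) / p by linarith) p0.le
    rwa [mul_div_cancel₀ _ p0.ne'] at h2
  refine ⟨M, m, ψ, ?_, ?_⟩
  · rw [hM]
    have : 0 ≤ Real.exp (1 / p) * (1 / p) * Real.exp (1 / p) + Real.exp (1 / p) + p + p * Real.exp (1 / p) + Real.exp (1 / p) * (1 + (1 / p) * Real.exp (1 / p)) := by positivity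
    linarith only [this]
  refine ⟨?_, fun x hx => ⟨(Real.exp_pos _).le, (ψb x hx).trans E1⟩, ?_, lem, ?_, ?_, ?_, lipm⟩
  · intro x hx y hy
    refine (c11 x hx y hy).trans ?_
    gcongr
    rw [hM]
    have : 0 ≤ Real.exp (1 / p) + p + p * Real.exp (1 / p) + Real.exp (1 / p) * (1 + (1 / p) * Real.exp (1 / p)) + 1 := by positivity
    linarith only [this]
  · intro β hβ hβb x hx
    have hβq : 2 * β ≤ q := by linarith
    have hκ : κ1 ≤ 1 - 2 * β / q := by rw [hκ1]; gcongr
    rcases le_total (x - 1 / q) X0 with h | h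
    · have h1 := D_lin hq hβ hβq h
      have h2 := mul_le_mul_of_nonneg_left h1 (Real.exp_pos (-((x - c) / p))).le
      refine le_trans ?_ h2
      have h3 : ψ x * (x - c) ≤ m x := by
        have a1 := Real.add_one_le_exp ((x - c) / p)
        have a2 := mul_le_mul_of_nonneg_left a1 (Real.exp_pos (-((x - c) / p))).le
        rw [← Real.exp_add, neg_add_cancel, Real.exp_zero] at a2
        have a3 := mul_le_mul_of_nonneg_left a2 p0.le
        simp only [hm, hψ]
        have e : p * (Real.exp (-((x - c) / p)) * ((x - c) / p + 1)) = Real.exp (-((x - c) / p)) * (x - c) + p * Real.exp (-((x - c) / p)) := by field_simp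
        linarith only [a3, e]
      have h4 := mul_le_mul_of_nonneg_left h3 (show 0 ≤ 1 - 2 * β / q by linarith)
      simp only [hψ] at h4
      linarith only [h4]
    · have hD : -1 ≤ Dfun q β x := by
        rw [Dfun_lgs hq]; linarith [lgs_pos hq (2 * β * (q * x - 1) / ((q:ℝ) - 1)), hx.2]
      have h1 := mul_le_mul_of_nonneg_left hD (Real.exp_pos (-((x - c) / p))).le
      refine le_trans ?_ h1
      have h2 : Real.exp (-((x - c) / p)) ≤ Real.exp (-r) := by
        apply Real.exp_le_exp.mpr
        rw [hrp]; gcongr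
      have h3 : p * (1 - Real.exp (-r)) ≤ m x := by
        simp only [hm]; gcongr
      have h5 : Real.exp (-r) ≤ 1 := Real.exp_le_one_iff.mpr (by linarith)
      have h4 : κ1 * (p * (1 - Real.exp (-r))) ≤ (1 - 2 * β / q) * m x := by
        apply mul_le_mul hκ h3 (mul_nonneg p0.le (by linarith)) (by linarith)
      linarith only [h4, her, h2]
  · intro x y hxy
    simp only [hm]
    have : Real.exp (-((y - c) / p)) < Real.exp (-((x - c) / p)) := by
      apply Real.exp_lt_exp.mpr; gcongr
    exact mul_lt_mul_of_pos_left (by linarith) p0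
  · simp [hm, hc]
  · intro x hx
    have h1 : m x ≤ M := by
      have : M = M * 1 := by ring
      refine (lem x).trans ?_
      linarith [hx.2, Real.one_le_exp (show 0 ≤ 1 / p by positivity)]
    have h2 : -M ≤ m x := by
      have := mul_le_mul_of_nonneg_left (ψb x hx) p0.le
      simp only [hψ] at this
      simp only [hm]
      rw [hM]
      have : 0 ≤ Real.exp (1 / p) * (1 / p) * Real.exp (1 / p) + Real.exp (1 / p) + p + Real.exp (1 / p) * (1 + (1 / p) * Real.exp (1 / p)) + 1 := by positivity
      linarith
    exact abs_le.mpr ⟨h2, h1⟩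
end

open Finset Filter
section
variable {q n : ℕ} {β : ℝ}

lemma pow_lower {κ κ0 γ G : ℝ} (hn : 2 ≤ n) (hκ0 : 0 < κ0) (hκ : κ0 ≤ κ) (hκ1 : κ ≤ 1) (hγ : 0 ≤ γ) (hG : 0 < G) (hγG : |Real.log G| + 1 ≤ γ * κ0) (T : ℕ)
    (hT : (T:ℝ) ≤ 1 / (2 * κ) * n * Real.log n - γ * n) : G / Real.sqrt n ≤ (1 - κ / n) ^ T := by
  have hn2 : (2:ℝ) ≤ n := by exact_mod_cast hn
  have hn' : (0:ℝ) < n := by linarith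
  have hκ' : 0 < κ := by linarith
  set x := κ / n with hx
  have x0 : 0 < x := by positivity
  have x1 : x ≤ 1 / 2 := by rw [hx, div_le_div_iff₀ hn' (by norm_num)]; linarith
  have hr : 0 < 1 - x := by linarith
  have h1 : -(x + 2 * x ^ 2) ≤ Real.log (1 - x) := by
    refine le_trans ?_ (Real.one_sub_inv_le_log_of_pos hr)
    have : (1 - x)⁻¹ ≤ 1 + x + 2 * x ^ 2 := by
      rw [inv_eq_one_div, div_le_iff₀ hr]
      have : 0 ≤ x ^ 2 * (1 - 2 * x) := mul_nonneg (sq_nonneg _) (by linarith)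
      linarith only [this]
    linarith only [this]
  have hl0 : 0 ≤ Real.log n := Real.log_nonneg (by linarith)
  have hTx : T * x ≤ Real.log n / 2 - γ * κ := by
    have := mul_le_mul_of_nonneg_right hT x0.le
    refine this.trans (le_of_eq ?_)
    rw [hx]; field_simp
  have hγκ : γ * κ0 ≤ γ * κ := mul_le_mul_of_nonneg_left hκ hγ
  have hTx2 : T * x * (2 * x) ≤ 1 := by
    have a1 : T * x ≤ Real.log n / 2 := by linarith [mul_nonneg hγ hκ'.le]
    have a2 : Real.log n ≤ n := (Real.log_le_sub_one_of_pos hn').trans (by linarith)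
    calc T * x * (2 * x) ≤ Real.log n / 2 * (2 * x) := by gcongr
      _ = Real.log n * x := by ring
      _ ≤ n * x := by gcongr
      _ = κ := by rw [hx]; field_simp
      _ ≤ 1 := hκ1
  have h2 : Real.log (G / Real.sqrt n) ≤ T * Real.log (1 - x) := by
    rw [Real.log_div hG.ne' (Real.sqrt_pos.mpr hn').ne', Real.log_sqrt hn'.le]
    have a := mul_le_mul_of_nonneg_left h1 (Nat.cast_nonneg (α := ℝ) T)
    have b := le_abs_self (Real.log G)
    linarith only [a, b, hTx, hTx2, hγG, hγκ]
  rw [← Real.log_pow] at h2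
  exact (Real.log_le_log_iff (by positivity) (by positivity)).mp h2

lemma geo_sum {r : ℝ} (hr : 0 < r) (hr1 : r < 1) (T : ℕ) : ∑ t ∈ range T, (r⁻¹) ^ (t + 1) ≤ (1 / (1 - r)) * (r⁻¹) ^ T := by
  have : ∑ t ∈ range T, (r⁻¹) ^ (t + 1) = (1 / (1 - r)) * ((r⁻¹) ^ T - 1) := by
    induction T with
    | zero => simp
    | succ T ih =>
      rw [Finset.sum_range_succ, ih, pow_succ]
      have : 1 - r ≠ 0 := by linarith
      field_simp
      ring
  rw [this]
  have : 0 ≤ 1 / (1 - r) := by apply div_nonneg one_pos.le; linarith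
  apply mul_le_mul_of_nonneg_left _ this
  linarith

open Classical in
/-- Phase two lower bound. -/
lemma L2 (hq : 3 ≤ q) {b0 b1 M κ0 CQ B ε : ℝ} {m ψ : ℝ → ℝ} (hM : 1 ≤ M) (hm : MF q b1 M m ψ) (hb0 : 1 / (q:ℝ) < b0)
    (hb1q : 2 * b1 ≤ q)
    (hκ0 : 0 < κ0) (hκ01 : κ0 ≤ 1) (hκb : 2 * b1 / q ≤ 1 - κ0) (hC : 0 ≤ CQ) (hB : 0 < B) (hε : 0 < ε) :
    ∃ γ ε' : ℝ, 0 < γ ∧ 0 < ε' ∧ ∀ n : ℕ, 2 ≤ n → ∀ β : ℝ, 0 ≤ β → β ≤ b1 → ∀ (k : Fin q) (T1 T2 : ℕ),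
      (∀ t < T1 + T2, (PP q n β)^[t] (fun σ => QQ q k (SS σ)) (fun _ => k) ≤ CQ / n) →
      (PP q n β)^[T1] (fun σ => if SS σ k < b0 then 1 else 0) (fun _ => k) ≤ ε' →
      (T2:ℝ) ≤ alpha1 β q * n * Real.log n - γ * n →
      (PP q n β)^[T1 + T2] (fun σ => if m (SS σ k) ≤ B / Real.sqrt n then 1 else 0) (fun _ => k) ≤ ε := by
  have hq0 : 0 < q := by omega
  have hq' : (0:ℝ) < q := by positivity
  set G := 2 * q * Real.exp (2 * q) with hG
  set G2 := q ^ 2 * Real.exp (2 * q) with hG2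
  have hG0 : 0 ≤ G := by positivity
  have hG20 : 0 ≤ G2 := by positivity
  set C4 := 2 * M * (G2 * CQ + G + 1) with hC4
  set C5 := 2 * M ^ 2 with hC5
  have hC40 : 0 < C4 := by positivity
  have hC50 : 0 < C5 := by positivity
  set δ := κ0 * ε / (3 * (C4 + C5) + ε) with hδ
  have hδ0 : 0 < δ := by positivity
  have hδ1 : δ ≤ 1 := by
    rw [hδ, div_le_one (by positivity)]
    have : κ0 * ε ≤ 1 * ε := by gcongr
    linarith
  have hδ2 : δ * (C4 + C5) / κ0 ≤ ε / 3 := by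
    rw [hδ, div_le_iff₀ hκ0, div_mul_eq_mul_div, div_le_iff₀ (by positivity)]
    have : 0 ≤ κ0 * ε ^ 2 := by positivity
    linarith only [this]
  have mb0 : 0 < m b0 := hm.zero ▸ hm.mono hb0
  set y0 := 3 / (2 * ε) with hy0
  have y00 : 0 < y0 := by positivity
  set A := δ * B with hA
  have hA0 : 0 < A := by positivity
  set lam := (y0 + A) / m b0 with hlam
  have lam0 : 0 < lam := by positivity
  set Gm := lam / δ with hGm
  have hGm0 : 0 < Gm := by positivity
  set W := 1 + 2 * (lam * M + A) with hW
  have hW0 : 0 < W := by positivity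
  refine ⟨(|Real.log Gm| + 1) / κ0, ε / (3 * W), by positivity, by positivity, ?_⟩
  intro n hn β hβ hβb k T1 T2 hQ hS hT
  have hn0 : 0 < n := by omega
  have hn' : (0:ℝ) < n := by positivity
  have hn1 : (1:ℝ) ≤ n := by exact_mod_cast hn0
  have hβq : 2 * β ≤ q := by linarith
  set κ := 1 - 2 * β / q with hκd
  have hκ : κ0 ≤ κ := by
    have : 2 * β / q ≤ 2 * b1 / q := by gcongr
    linarith
  have hκ1 : κ ≤ 1 := by rw [hκd]; have : 0 ≤ 2 * β / q := by positivity
                         linarith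
  have hκp : 0 < κ := by linarith
  have hrT := pow_lower (n := n) hn hκ0 hκ hκ1 (γ := (|Real.log Gm| + 1) / κ0) (by positivity) hGm0 (by rw [div_mul_cancel₀ _ hκ0.ne']) T2 hT
  set r := 1 - κ / n with hr
  have x0 : 0 < κ / n := by positivity
  have hr0 : 0 < r := by
    have : κ / n < 1 := by rw [div_lt_one hn']; have : (2:ℝ) ≤ n := by exact_mod_cast hn
                           linarith
    linarith
  have hr1 : r < 1 := by linarith
  set ρ := r⁻¹ with hρ
  have hρ1 : 1 ≤ ρ := (one_le_inv₀ hr0).mpr hr1.le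
  have hρ0 : 0 < ρ := by linarith
  set s := Real.sqrt n with hs
  have hs0 : 0 < s := Real.sqrt_pos.mpr hn'
  have hs1 : 1 ≤ s := Real.one_le_sqrt.mpr hn1
  have hs2 : s * s = n := Real.mul_self_sqrt hn'.le
  set R := lam * ρ ^ T2 with hR
  have hR0 : 0 < R := by positivity
  have hRs : R ≤ δ * s := by
    have h1 : Gm ≤ r ^ T2 * s := (div_le_iff₀ hs0).mp hrT
    have h2 : ρ ^ T2 * r ^ T2 = 1 := by rw [← mul_pow, hρ, inv_mul_cancel₀ hr0.ne', one_pow]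
    have h3 := mul_le_mul_of_nonneg_left h1 (show 0 ≤ δ * ρ ^ T2 by positivity)
    have e1 : δ * ρ ^ T2 * Gm = R := by rw [hGm, hR]; field_simp
    have e2 : δ * ρ ^ T2 * (r ^ T2 * s) = δ * s * (ρ ^ T2 * r ^ T2) := by ring
    rw [e1, e2, h2, mul_one] at h3
    exact h3
  have hI : ∀ τ : Fin n → Fin q, SS τ k ∈ Set.Icc (0:ℝ) 1 := fun τ => ⟨SS_nonneg τ k, SS_le_one hn0 τ k⟩
  have key := gg_iter (β := β) hq0 hn0 (fun t τ => lam * ρ ^ t * m (SS τ k) - A) (fun t => 2 * (lam * ρ ^ (t + 1)) * (M * G2 / n))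
    (fun t => 2 * (lam * ρ ^ (t + 1)) * ((M * G + M) / n ^ 2) + (2 * (lam * ρ ^ (t + 1)) * (M / n)) ^ 2 / 2) k (fun _ => k)
    (C := CQ / n) T1 T2 (fun _ => by positivity) (by
      intro t σ
      have hQ0 := QQ_nonneg k (SS σ)
      have h6 := hm.psi _ (hI σ)
      have d1 := drift_low hq hn0 hβ hβq m ψ k hm.c11 (by linarith) σ h6.1 h6.2
      rw [← hG, ← hG2] at d1
      have d2 : -(κ * m (SS σ k) / n) ≤ ψ (SS σ k) * Dfun q β (SS σ k) / n := by
        rw [← neg_div]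
        exact div_le_div_of_nonneg_right (hm.drift β hβ hβb _ (hI σ)) hn'.le
      set v := lam * ρ ^ (t + 1) with hv
      have v0 : 0 < v := by positivity
      have ev : lam * ρ ^ t = v * (1 - κ / n) := by
        rw [hv, ← hr, pow_succ, ← mul_assoc, mul_assoc _ ρ r, hρ, inv_mul_cancel₀ hr0.ne', mul_one]
      have := PP_gg (β := β) hq0 hn0 (fun τ => v * m (SS τ k) - A) σ (lam * ρ ^ t * m (SS σ k) - A)
        (η := 2 * v * (M / n)) (b := v * (M * G2 / n * QQ q k (SS σ) + (M * G + M) / n ^ 2)) (by positivity) (by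
          intro u j
          have e : v * m (SS (Function.update σ u j) k) - A - (lam * ρ ^ t * m (SS σ k) - A)
            = v * ((m (SS (Function.update σ u j) k) - m (SS σ k)) + κ / n * m (SS σ k)) := by rw [ev]; ring
          rw [e, abs_mul, abs_of_pos v0]
          have s1 : |m (SS (Function.update σ u j) k) - m (SS σ k)| ≤ M * (1 / n) :=
            (hm.lip _ (hI σ) _ (hI _)).trans (mul_le_mul_of_nonneg_left (SS_update_abs σ u j k) (by linarith))
          have s2 : |κ / n * m (SS σ k)| ≤ 1 / n * M := by
            rw [abs_mul, abs_of_pos x0]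
            have := hm.bd _ (hI σ)
            gcongr
          calc _ ≤ v * (M * (1 / n) + 1 / n * M) := mul_le_mul_of_nonneg_left ((abs_add_le _ _).trans (add_le_add s1 s2)) v0.le
            _ = _ := by ring) (by
          rw [PP_sub (fun τ => v * m (SS τ k)) (fun _ => A), PP_smul, PP_const hq0 hn0]
          have e : v * PP q n β (fun τ => m (SS τ k)) σ - A - (lam * ρ ^ t * m (SS σ k) - A)
            = v * (PP q n β (fun τ => m (SS τ k)) σ - m (SS σ k) + κ * m (SS σ k) / n) := by rw [ev]; ring
          rw [e, neg_le, ← mul_neg]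
          apply mul_le_mul_of_nonneg_left _ v0.le
          linarith only [d1, d2])
      refine this.trans (le_of_eq ?_)
      ring) (fun t ht => hQ (T1 + t) (by omega))
  have hmain : (PP q n β)^[T1 + T2] (fun σ => if m (SS σ k) ≤ B / s then 1 else 0) (fun _ => k) ≤
      (PP q n β)^[T1 + T2] (fun τ => gg (lam * ρ ^ T2 * m (SS τ k) - A)) (fun _ => k) := by
    apply PPt_mono hq0
    intro σ
    split_ifs with hσ
    · apply gg_ge_one
      have h1 := mul_le_mul_of_nonneg_left hσ hR0.le
      have h2 : R * (B / s) ≤ δ * s * (B / s) := mul_le_mul_of_nonneg_right hRs (by positivity)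
      have e : δ * s * (B / s) = A := by rw [hA]; field_simp
      rw [← hR]
      linarith only [h1, h2, e]
    · exact gg_nonneg _
  refine hmain.trans (key.trans ?_)
  have g1 : (PP q n β)^[T1] (fun τ => gg (lam * ρ ^ 0 * m (SS τ k) - A)) (fun _ => k) ≤ ε / 3 + ε / 3 := by
    have h1 := PPt_mono (β := β) hq0 T1 (f := fun τ => gg (lam * ρ ^ 0 * m (SS τ k) - A)) (g := fun τ => ε / 3 + W * (if SS τ k < b0 then 1 else 0)) (by
      intro τ
      simp only [pow_zero, mul_one]
      split_ifs with hτ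
      · refine (gg_le_abs _).trans ?_
        have : |lam * m (SS τ k) - A| ≤ lam * M + A := by
          refine (abs_sub _ _).trans ?_
          rw [abs_mul, abs_of_pos lam0, abs_of_pos hA0]
          have := hm.bd _ (hI τ)
          gcongr
        rw [hW]; linarith
      · push Not at hτ
        have h1 := mul_le_mul_of_nonneg_left (hm.mono.monotone hτ) lam0.le
        have e : lam * m b0 = y0 + A := by rw [hlam]; field_simp
        have h2 : y0 ≤ lam * m (SS τ k) - A := by linarith
        refine (gg_anti h2).trans ((gg_le y00).trans (le_of_eq ?_))
        rw [hy0]; field_simp; simp) (fun _ => k)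
    rw [PPt_add T1 (fun _ => ε / 3) (fun τ => W * (if SS τ k < b0 then 1 else 0)), PPt_const hq0 hn0, PPt_smul] at h1
    have h2 := mul_le_mul_of_nonneg_left hS hW0.le
    have e : W * (ε / (3 * W)) = ε / 3 := by field_simp
    linarith only [h1, h2, e]
  have g2 : ∑ t ∈ range T2, (2 * (lam * ρ ^ (t + 1)) * (M * G2 / n) * (CQ / n) + (2 * (lam * ρ ^ (t + 1)) * ((M * G + M) / n ^ 2) + (2 * (lam * ρ ^ (t + 1)) * (M / n)) ^ 2 / 2)) ≤ ε / 3 := by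
    refine le_trans ?_ hδ2
    have h1 : ∀ t ∈ range T2, (2 * (lam * ρ ^ (t + 1)) * (M * G2 / n) * (CQ / n) + (2 * (lam * ρ ^ (t + 1)) * ((M * G + M) / n ^ 2) + (2 * (lam * ρ ^ (t + 1)) * (M / n)) ^ 2 / 2))
        ≤ (C4 + C5 * R) / n ^ 2 * lam * ρ ^ (t + 1) := by
      intro t ht
      have ht' : t + 1 ≤ T2 := by simpa using ht
      have : lam * ρ ^ (t + 1) ≤ R := by rw [hR]; gcongr
      have p : C5 * (lam * ρ ^ (t + 1)) * (lam * ρ ^ (t + 1)) / n ^ 2 ≤ C5 * R * (lam * ρ ^ (t + 1)) / n ^ 2 := by gcongr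
      rw [hC4]
      rw [hC5] at p ⊢
      linear_combination p
    refine (Finset.sum_le_sum h1).trans ?_
    rw [← Finset.mul_sum]
    have h2 := geo_sum hr0 hr1 T2
    have e1 : 1 - r = κ / n := by rw [hr]; ring
    rw [e1] at h2
    have hRn : R / n ≤ δ / s := by
      rw [div_le_div_iff₀ hn' hs0, ← hs2]
      have := mul_le_mul_of_nonneg_right hRs hs0.le
      linarith only [this]
    calc (C4 + C5 * R) / n ^ 2 * lam * ∑ t ∈ range T2, ρ ^ (t + 1) ≤ (C4 + C5 * R) / n ^ 2 * lam * (1 / (κ / n) * ρ ^ T2) := by gcongr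
      _ = (C4 * (R / n) + C5 * (R * (R / n))) / κ := by rw [hR]; field_simp
      _ ≤ (C4 * δ + C5 * δ) / κ0 := by
          have a1 : R / n ≤ δ := hRn.trans (div_le_self hδ0.le hs1)
          have a2 : R * (R / n) ≤ δ := by
            calc R * (R / n) ≤ (δ * s) * (δ / s) := by gcongr
              _ = δ * δ := by field_simp
              _ ≤ δ := mul_le_of_le_one_left hδ0.le hδ1
          gcongr
      _ = _ := by ring
  linarith only [g1, g2]
end

open Finset Filter
section
variable {q n : ℕ} {β : ℝ}

open Classical in
lemma MU_dev (hq : 0 < q) (hn : 0 < n) (k : Fin q) {C B : ℝ} (hB : 0 < B) (h : ∀ j, MU q n β (WW k j) ≤ C / n) :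
    MU q n β (fun σ => if B / Real.sqrt n < SS σ k - 1 / q then 1 else 0) ≤ C / B ^ 2 := by
  have hn' : (0:ℝ) < n := by positivity
  have hq' : (0:ℝ) < q := by positivity
  have h1 : ∀ σ : Fin n → Fin q, (if B / Real.sqrt n < SS σ k - 1 / q then (1:ℝ) else 0) ≤ n / B ^ 2 * (1 / q) * ∑ j, WW k j σ := by
    intro σ
    have hX : (SS σ k - 1 / q) ^ 2 ≤ 1 / q * ∑ j, WW k j σ := by
      have e : SS σ k - 1 / q = (1 / q) * ∑ j, (SS σ k - SS σ j) := by
        rw [Finset.sum_sub_distrib, SS_sum hn σ]; simp; field_simp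
      have cs := sq_sum_le_card_mul_sum_sq (s := (univ : Finset (Fin q))) (f := fun j => SS σ k - SS σ j)
      rw [card_univ, Fintype.card_fin] at cs
      rw [e, mul_pow]
      calc (1 / (q:ℝ)) ^ 2 * (∑ j, (SS σ k - SS σ j)) ^ 2 ≤ (1 / (q:ℝ)) ^ 2 * (q * ∑ j, (SS σ k - SS σ j) ^ 2) := by gcongr
        _ = _ := by unfold WW; field_simp
    split_ifs with hs
    · have h2 : (B / Real.sqrt n) ^ 2 ≤ (SS σ k - 1 / q) ^ 2 := by gcongr
      rw [div_pow, Real.sq_sqrt hn'.le] at h2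
      have h3 := mul_le_mul_of_nonneg_left (h2.trans hX) (show 0 ≤ (n:ℝ) / B ^ 2 by positivity)
      have e : (n:ℝ) / B ^ 2 * (B ^ 2 / n) = 1 := by field_simp
      rw [e] at h3
      linarith only [h3]
    · exact mul_nonneg (by positivity) (Finset.sum_nonneg fun j _ => WW_nonneg _ _ _)
  refine (MU_mono hq h1).trans ?_
  rw [MU_smul]
  have e : MU q n β (fun σ => ∑ j, WW k j σ) = ∑ j, MU q n β (WW k j) := by
    unfold MU; rw [Finset.sum_comm]; simp only [Finset.mul_sum]
  rw [e]
  calc (n:ℝ) / B ^ 2 * (1 / q) * ∑ j, MU q n β (WW k j) ≤ n / B ^ 2 * (1 / q) * ∑ _j : Fin q, C / n := by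
        gcongr with j; exact h j
    _ = _ := by simp; field_simp

lemma lin_small (C : ℝ) {d : ℝ} (hd : 0 < d) : ∀ᶠ ρ in nhdsWithin (0:ℝ) (Set.Ioi 0), C * ρ < d := by
  have h : Tendsto (fun ρ : ℝ => C * ρ) (nhds 0) (nhds (C * 0)) := tendsto_id.const_mul C
  rw [mul_zero] at h
  exact (h.mono_left nhdsWithin_le_nhds).eventually_lt_const hd

lemma setup (hq : 3 ≤ q) : ∃ κ0 ρ cD : ℝ, 0 < κ0 ∧ κ0 ≤ 1 ∧ 2 * betaS q / q = 1 - κ0 ∧ rhoOK q κ0 ρ ∧ 1 / (q:ℝ) + ρ < 1 / 2 ∧ q * ρ ≤ κ0 ∧ 0 < cD ∧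
    ∀ ξ : ℝ, 0 < ξ → ∀ x ∈ Set.Icc (1 / (q:ℝ) + ρ / 4) (1 / q + ρ), Dfun q (betaS q - ξ) x ≤ -cD := by
  obtain ⟨q0, q3, r0⟩ := qr_pos hq
  obtain ⟨bs1, bsq⟩ := betaS_facts hq
  obtain ⟨s, hs, -, -, -, hD⟩ := crit hq
  set κ0 := 1 - 2 * betaS q / q with hκ
  have hκ0 : 0 < κ0 := by rw [hκ, sub_pos, div_lt_one q0]; exact bsq
  have hκ1 : κ0 ≤ 1 := by rw [hκ]; linarith [show 0 ≤ 2 * betaS q / q by positivity]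
  have hc : 1 / (q:ℝ) < 1 / 2 := by
    rw [div_lt_div_iff₀ q0 (by norm_num)]; linarith
  obtain ⟨ρ, ⟨⟨⟨⟨⟨h1, h2⟩, h3⟩, h4⟩, h5⟩, h6⟩⟩ := ((((((lin_small q one_pos).and (lin_small (q ^ 2 * Real.exp q) (half_pos hκ0))).and
    (lin_small (Aq q κ0 * q ^ 3) (half_pos one_pos))).and (lin_small 1 (sub_pos.mpr hc))).and (lin_small q hκ0)).and self_mem_nhdsWithin).exists
  have hρ0 : 0 < ρ := h6
  obtain ⟨x0, hx0, hmax⟩ := (isCompact_Icc (a := 1 / (q:ℝ) + ρ / 4) (b := 1 / (q:ℝ) + ρ)).exists_isMaxOn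
    (Set.nonempty_Icc.mpr (by linarith)) (Dfun_cont hq (betaS q)).continuousOn
  refine ⟨κ0, ρ, - Dfun q (betaS q) x0, hκ0, hκ1, by rw [hκ]; ring, ⟨h6, h1.le, h2.le, by rw [← mul_assoc]; exact h3.le⟩, by linarith, h5.le, ?_, ?_⟩
  · have := hD x0 (by linarith [hx0.1]) (by linarith [hx0.2]) (by intro e; linarith [hx0.2])
    linarith
  · intro ξ hξ x hx
    have a1 := Dfun_mono hq (β := betaS q - ξ) (β' := betaS q) (x := x) (by linarith) (by linarith [hx.1])
    have a2 : Dfun q (betaS q) x ≤ Dfun q (betaS q) x0 := hmax hx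
    linarith

lemma log_small (C : ℝ) : ∀ᶠ n : ℕ in atTop, C * (Real.log n + 1) ≤ Real.sqrt n := by
  have h1 := (isLittleO_log_rpow_atTop (r := 1 / 2) (by norm_num)).def (c := 1 / (2 * (|C| + 1))) (by positivity)
  have h2 := tendsto_natCast_atTop_atTop (R := ℝ) |>.eventually h1
  have h3 : ∀ᶠ n : ℕ in atTop, (2 * (|C| + 1)) ^ 2 + 1 ≤ (n:ℝ) := tendsto_natCast_atTop_atTop.eventually_ge_atTop _
  filter_upwards [h2, h3] with n h2 h3
  have hn : (1:ℝ) ≤ n := by nlinarith [abs_nonneg C]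
  rw [← Real.sqrt_eq_rpow, Real.norm_of_nonneg (Real.log_nonneg hn), Real.norm_of_nonneg (Real.sqrt_nonneg _)] at h2
  have h4 : 2 * (|C| + 1) ≤ Real.sqrt n := Real.le_sqrt_of_sq_le (by linarith)
  have hC := abs_nonneg C
  have hl := Real.log_nonneg hn
  rw [one_div_mul_eq_div, le_div_iff₀ (by positivity)] at h2
  have h5 : C * (Real.log n + 1) ≤ |C| * (Real.log n + 1) := mul_le_mul_of_nonneg_right (le_abs_self C) (by linarith)
  linarith only [h2, h4, h5, hl]

open Classical in
lemma Upper (hq : 3 ≤ q) {κ0 ρ cD α₂ K : ℝ} (hκ : 0 < κ0) (hκ1 : κ0 ≤ 1) (hκb : 2 * betaS q / q = 1 - κ0) (hρ : rhoOK q κ0 ρ) (hcD : 0 < cD)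
    (hD : ∀ ξ : ℝ, 0 < ξ → ∀ x ∈ Set.Icc (1 / (q:ℝ) + ρ / 4) (1 / q + ρ), Dfun q (betaS q - ξ) x ≤ -cD)
    (hα : 0 < α₂) (hK : 1 ≤ K) (H : ∀ ξ : ℝ, 0 < ξ → ξ ≤ 1 → ∃ φ ψ : ℝ → ℝ, PH q (1 / q + ρ / 4) K α₂ ξ φ ψ) {ε : ℝ} (hε : 0 < ε) :
    ∃ γ : ℝ, 0 < γ ∧ ∃ N0 : ℝ, 1 ≤ N0 ∧ ∀ᶠ n : ℕ in atTop, ∀ ξ : ℝ, 0 < ξ → ξ ≤ 1 → N0 ≤ n * (ξ * Real.sqrt ξ) →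
      ∃ T : ℕ, (T:ℝ) ≤ alpha1 (betaS q - ξ) q * n * Real.log n + α₂ * n / Real.sqrt ξ + γ * winw n ξ ∧ glauberDist q n (betaS q - ξ) T ≤ ε := by
  have hρ0 := hρ.1
  have hq0 : 0 < q := by omega
  have hq' : (0:ℝ) < q := by positivity
  obtain ⟨bs1, bsq⟩ := betaS_facts hq
  obtain ⟨γ1, hγ1, N0, hN0, ev1⟩ := U1 hq (b0 := 1 / q + ρ / 4) (a := 1 / q + ρ / 2) hα hK H (by linarith) hcD
    (fun ξ hξ x hx => hD ξ hξ x ⟨hx.1, by linarith [hx.2]⟩) (ε := ε / 4) (by positivity)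
  obtain ⟨γ2, hγ2, ev2⟩ := U2 (q := q) (by omega) hκ hκ1 hρ (a := 1 / q + ρ / 2) (b := 1 / q + ρ) (by linarith) le_rfl hcD (ε := ε / 4) (by positivity)
  refine ⟨γ1 + γ2 + 2, by positivity, N0, hN0, ?_⟩
  have ev3 : ∀ᶠ n : ℕ in atTop, 4 / ε + α₂ + 2 * γ1 + 1 ≤ (n:ℝ) := tendsto_natCast_atTop_atTop.eventually_ge_atTop _
  filter_upwards [ev1, ev2, ev3, log_small (1 / (2 * κ0) + γ2 + 1)] with n ev1 ev2 ev3 ev4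
  intro ξ hξ hξ1 hN
  have hβ : 0 ≤ betaS q - ξ := by linarith
  obtain ⟨u1, u2⟩ := ev1 ξ hξ hξ1 hβ hN
  have e0 : 0 < 4 / ε := by positivity
  have hn1 : (1:ℝ) ≤ n := by linarith
  have hn' : (0:ℝ) < n := by linarith
  have hn : 0 < n := by exact_mod_cast hn'
  obtain ⟨w1, -, -, w4⟩ := win hn hξ hξ1 (hN0.trans hN)
  have hw0 : 0 < winw n ξ := by linarith
  have hs : 0 < Real.sqrt ξ := Real.sqrt_pos.mpr hξ
  have hlog := Real.log_nonneg hn1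
  have hκβ : 2 * (betaS q - ξ) / q ≤ 1 - κ0 := by rw [← hκb]; gcongr; linarith
  have ha0 : 0 ≤ alpha1 (betaS q - ξ) q := by unfold alpha1; apply div_nonneg one_pos.le; linarith
  have ha1 : alpha1 (betaS q - ξ) q ≤ 1 / (2 * κ0) := by unfold alpha1; gcongr; linarith
  set al := alpha1 (betaS q - ξ) q
  set t1 := α₂ * n / Real.sqrt ξ + γ1 * winw n ξ with ht1
  set t2 := al * n * Real.log n + γ2 * n with ht2
  have ht10 : 0 ≤ t1 := by positivity
  have ht20 : 0 ≤ t2 := by positivity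
  have c1 := (Nat.ceil_lt_add_one ht10).le
  have c2 := (Nat.ceil_lt_add_one ht20).le
  set T1 := ⌈t1⌉₊
  set T2 := ⌈t2⌉₊
  have hT1 : (T1:ℝ) ≤ n ^ 4 := by
    refine c1.trans ?_
    have k1 : 1 / Real.sqrt ξ ≤ n := by
      rw [div_le_iff₀ hs]
      refine (hN0.trans hN).trans ?_
      gcongr; exact mul_le_of_le_one_left hs.le hξ1
    have k2 : α₂ * n / Real.sqrt ξ ≤ α₂ * n * n := by rw [← mul_one_div]; gcongr
    have k3 : γ1 * winw n ξ ≤ γ1 * (2 * n ^ 2) := by gcongr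
    have k4 : (1:ℝ) ≤ n ^ 2 := one_le_pow₀ hn1
    calc t1 + 1 ≤ (α₂ + 2 * γ1 + 1) * n ^ 2 := by rw [ht1]; linarith only [k2, k3, k4]
      _ ≤ n * n ^ 2 := by gcongr; linarith
      _ ≤ n ^ 4 := by have : (n:ℝ) * n ^ 2 = n ^ 3 := by ring
                      rw [this]; exact pow_le_pow_right₀ hn1 (by norm_num)
  have hT2 : (T2:ℝ) ≤ n * Real.sqrt n := by
    refine c2.trans ?_
    have k1 : al * n * Real.log n ≤ 1 / (2 * κ0) * n * Real.log n := by gcongr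
    have k2 : t2 + 1 ≤ n * ((1 / (2 * κ0) + γ2 + 1) * (Real.log n + 1)) := by
      have p1 : 0 ≤ (γ2 + 1) * Real.log n * n := by positivity
      have p2 : 0 ≤ 1 / (2 * κ0) * n := by positivity
      rw [ht2]; linarith only [k1, p1, p2, hn1]
    exact k2.trans (mul_le_mul_of_nonneg_left ev4 hn'.le)
  refine ⟨T1 + T2, ?_, ?_⟩
  · push_cast
    have : γ2 * n ≤ γ2 * winw n ξ := by gcongr
    rw [ht1] at c1
    rw [ht2] at c2
    linarith only [this, c1, c2, w1, hn1]
  · apply glauberDist_le hq0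
    intro f hf0 hf1 σ
    have hn4 : 1 / (n:ℝ) ≤ ε / 4 := by
      rw [div_le_div_iff₀ hn' (by norm_num)]
      have : 4 / ε ≤ n := by linarith
      rw [div_le_iff₀ hε] at this
      linarith
    have hMU0 : 0 ≤ MU q n (betaS q - ξ) f := by
      have := MU_mono (β := betaS q - ξ) hq0 hf0
      rwa [MU_const hq0] at this
    have hMU1 : MU q n (betaS q - ξ) f ≤ 1 := by
      have := MU_mono (β := betaS q - ξ) hq0 hf1
      rwa [MU_const hq0] at this
    have hg : ∀ τ, |(PP q n (betaS q - ξ))^[T2] f τ - MU q n (betaS q - ξ) f| ≤ ε / 2 + (if ∃ k, 1 / (q:ℝ) + ρ / 2 < SS τ k then 1 else 0) := by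
      intro τ
      split_ifs with hτ
      · have g0 := PPt_nonneg (β := betaS q - ξ) hq0 hn T2 hf0 τ
        have g1 := PPt_le_const (β := betaS q - ξ) hq0 hn T2 hf1 τ
        rw [abs_le]; constructor <;> linarith only [g0, g1, hMU0, hMU1, hε]
      · push Not at hτ
        have := ev2 (betaS q - ξ) hβ hκβ (fun x hx => hD ξ hξ x ⟨by linarith [hx.1], hx.2⟩) f hf0 hf1 τ hτ T2 (Nat.le_ceil _) hT2
        linarith only [this, u2, hn4]
    have hU := u1 T1 σ (Nat.le_ceil _) hT1
    rw [Function.iterate_add_apply]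
    set g := (PP q n (betaS q - ξ))^[T2] f
    set μ := MU q n (betaS q - ξ) f
    have up := PPt_mono (β := betaS q - ξ) hq0 T1 (f := g) (g := fun τ => (μ + ε / 2) + (if ∃ k, 1 / (q:ℝ) + ρ / 2 < SS τ k then 1 else 0))
      (fun τ => by have := (abs_le.mp (hg τ)).2; linarith only [this]) σ
    have lo := PPt_mono (β := betaS q - ξ) hq0 T1 (f := fun _ => μ - ε / 2) (g := fun τ => g τ + (if ∃ k, 1 / (q:ℝ) + ρ / 2 < SS τ k then 1 else 0))
      (fun τ => by have := (abs_le.mp (hg τ)).1; linarith only [this]) σ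
    rw [PPt_add T1 (fun _ => μ + ε / 2), PPt_const hq0 hn] at up
    rw [PPt_add T1 g, PPt_const hq0 hn] at lo
    rw [abs_le]
    constructor
    · linarith only [lo, hU, hε]
    · linarith only [up, hU, hε]
end

open Finset Filter

section
variable {q n : ℕ} {β : ℝ}

open Classical in
lemma Lower (hq : 3 ≤ q) {κ0 ρ cD α₂ K : ℝ} (hκ : 0 < κ0) (hκ1 : κ0 ≤ 1) (hκb : 2 * betaS q / q = 1 - κ0) (hρ : 0 < ρ) (hρ2 : 1 / (q:ℝ) + ρ < 1 / 2)
    (hqρ : q * ρ ≤ κ0) (hcD : 0 < cD)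
    (hD : ∀ ξ : ℝ, 0 < ξ → ∀ x ∈ Set.Icc (1 / (q:ℝ) + ρ / 4) (1 / q + ρ), Dfun q (betaS q - ξ) x ≤ -cD)
    (hα : 0 < α₂) (hK : 1 ≤ K) (H : ∀ ξ : ℝ, 0 < ξ → ξ ≤ 1 → ∃ φ ψ : ℝ → ℝ, PH q (1 / q + ρ / 4) K α₂ ξ φ ψ) {ε : ℝ} (hε : 0 < ε) :
    ∃ γ : ℝ, 0 < γ ∧ ∃ N0 : ℝ, 1 ≤ N0 ∧ ∀ᶠ n : ℕ in atTop, ∀ ξ : ℝ, 0 < ξ → ξ ≤ 1 → N0 ≤ n * (ξ * Real.sqrt ξ) →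
      ∀ T1 T2 : ℕ, (T1 = 0 ∨ (T1:ℝ) ≤ α₂ * n / Real.sqrt ξ - γ * winw n ξ) →
        (T2:ℝ) ≤ alpha1 (betaS q - ξ) q * n * Real.log n - γ * n →
        1 - ε ≤ glauberDist q n (betaS q - ξ) (T1 + T2) := by
  have hq0 : 0 < q := by omega
  have hq' : (0:ℝ) < q := by positivity
  have hqi : 0 < 1 / (q:ℝ) := by positivity
  obtain ⟨bs1, bsq⟩ := betaS_facts hq
  have hCp : 0 ≤ Cpair q := (Cpair_pos (q := q)).le
  obtain ⟨M, m, ψm, hM, hm⟩ := mf_ex hq (b1 := betaS q) (by linarith) bsq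
  set a := 1 / (q:ℝ) + ρ / 2 with ha_def
  set b0 := 1 / (q:ℝ) + ρ / 4 with hb_def
  set CQ := (q:ℝ) ^ 2 * ((Cpair q + 1) / κ0) with hCQ
  set CW := (Cpair q + 9) / κ0 with hCW
  have hCQ0 : 0 ≤ CQ := by positivity
  have hCW0 : 0 < CW := by positivity
  set B := Real.sqrt (2 * CW / ε) with hB
  have hB0 : 0 < B := Real.sqrt_pos.mpr (by positivity)
  have hBe : CW / B ^ 2 = ε / 2 := by
    rw [hB, Real.sq_sqrt (by positivity)]; field_simp
  obtain ⟨γ2, ε', hγ2, hε', l2⟩ := L2 hq (b0 := b0) (κ0 := κ0) (CQ := CQ) hM hm (by linarith) bsq.le hκ hκ1 hκb.le hCQ0 hB0 (half_pos hε)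
  obtain ⟨γ1, hγ1, l1⟩ := L1 hq (b0 := b0) hα hK hCQ0 hε'
  obtain ⟨γ3, hγ3, N0, hN0, ev1⟩ := U1 hq (b0 := b0) (a := a) hα hK H (by linarith) hcD
    (fun ξ hξ x hx => hD ξ hξ x ⟨hx.1, by linarith [hx.2]⟩) (ε := 1) one_pos
  refine ⟨γ1 + γ2, by positivity, N0, hN0, ?_⟩
  set θ := min 1 (cD / 2) with hθ
  have hθ0 : 0 < θ := lt_min one_pos (by positivity)
  have hθ1 : θ ≤ 1 := min_le_left _ _
  have hθc : 2 * θ ≤ cD := by linarith [min_le_right 1 (cD / 2)]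
  have hd : 0 < θ * (a - b0) := mul_pos hθ0 (by linarith)
  have ev2 := ev_small 5 0 (θ * (a - b0)) (36 * q) hd one_pos
  have ev3 : ∀ᶠ n : ℕ in atTop, 2 + α₂ + 1 / (2 * κ0) + 4 * q * Real.exp (2 * q) / cD ≤ (n:ℝ) := tendsto_natCast_atTop_atTop.eventually_ge_atTop _
  filter_upwards [ev1, ev2, ev3] with n ev1 ev2 ev3
  rw [zero_mul, zero_sub] at ev2
  intro ξ hξ hξ1 hN T1 T2 hT1 hT2
  have hβ : 0 ≤ betaS q - ξ := by linarith
  have u2 := (ev1 ξ hξ hξ1 hβ hN).2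
  obtain ⟨φ, ψ, hPH⟩ := H ξ hξ hξ1
  have p1 : 0 < 1 / (2 * κ0) := by positivity
  have p2 : 0 < 4 * q * Real.exp (2 * q) / cD := by positivity
  have hn2 : (2:ℝ) ≤ n := by linarith
  have hn1 : (1:ℝ) ≤ n := by linarith
  have hn' : (0:ℝ) < n := by linarith
  have hn2' : 2 ≤ n := by exact_mod_cast hn2
  have hn : 0 < n := by omega
  have hnc : 4 * q * Real.exp (2 * q) ≤ cD * n := by
    have : 4 * q * Real.exp (2 * q) / cD ≤ n := by linarith
    rwa [div_le_iff₀ hcD, mul_comm (n:ℝ)] at this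
  obtain ⟨w1, -, -, w4⟩ := win hn hξ hξ1 (hN0.trans hN)
  have hw0 : 0 < winw n ξ := by linarith
  have hs : 0 < Real.sqrt ξ := Real.sqrt_pos.mpr hξ
  have hlog := Real.log_nonneg hn1
  have hκβ : 2 * (betaS q - ξ) / q ≤ 1 - κ0 := by rw [← hκb]; gcongr; linarith
  have ha1 : alpha1 (betaS q - ξ) q ≤ 1 / (2 * κ0) := by unfold alpha1; gcongr; linarith
  have hβq : 2 * (betaS q - ξ) ≤ q := by linarith
  have haκ : q * (a - 1 / q) ≤ κ0 / 2 := by rw [ha_def]; linarith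
  have ha0 : 1 / (q:ℝ) ≤ a := by rw [ha_def]; linarith
  have hb00 : 0 ≤ b0 := by rw [hb_def]; linarith
  have hab : b0 < a := by rw [hb_def, ha_def]; linarith
  have hTT1 : (T1:ℝ) ≤ α₂ * n ^ 2 := by
    rcases hT1 with h | h
    · rw [h]; push_cast; positivity
    · have k1 : 1 / Real.sqrt ξ ≤ n := by
        rw [div_le_iff₀ hs]
        refine (hN0.trans hN).trans ?_
        gcongr; exact mul_le_of_le_one_left hs.le hξ1
      have k2 : α₂ * n / Real.sqrt ξ ≤ α₂ * n * n := by rw [← mul_one_div]; gcongr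
      have k3 : 0 ≤ (γ1 + γ2) * winw n ξ := by positivity
      linarith only [h, k2, k3]
  have hTT2 : (T2:ℝ) ≤ 1 / (2 * κ0) * n ^ 2 := by
    have k1 : alpha1 (betaS q - ξ) q * n * Real.log n ≤ 1 / (2 * κ0) * n * n := by
      have : Real.log n ≤ n := by linarith [Real.log_le_sub_one_of_pos hn']
      have : alpha1 (betaS q - ξ) q * n * Real.log n ≤ 1 / (2 * κ0) * n * Real.log n := by gcongr
      refine this.trans ?_
      gcongr
    have k3 : 0 ≤ (γ1 + γ2) * n := by positivity
    linarith only [hT2, k1, k3]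
  have hTT : ((T1 + T2 : ℕ):ℝ) ≤ n ^ 4 := by
    push_cast
    calc (T1:ℝ) + T2 ≤ (α₂ + 1 / (2 * κ0)) * n ^ 2 := by linarith only [hTT1, hTT2]
      _ ≤ n * n ^ 2 := by gcongr; linarith
      _ ≤ n ^ 4 := by have : (n:ℝ) * n ^ 2 = n ^ 3 := by ring
                      rw [this]; exact pow_le_pow_right₀ hn1 (by norm_num)
  set k : Fin q := ⟨0, hq0⟩ with hk
  have hQ : ∀ t < T1 + T2, (PP q n (betaS q - ξ))^[t] (fun σ => QQ q k (SS σ)) (fun _ => k) ≤ CQ / n := by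
    intro t ht
    have ht' : (t:ℝ) ≤ n ^ 4 := le_trans (by exact_mod_cast ht.le) hTT
    have := E_QQ (β := betaS q - ξ) hq hn k t (C := (Cpair q + 1) / κ0 / n) (by positivity) (fun j l hj hl =>
      E_WW hq hn hβ hβq hκβ haκ ha0 hκ hκ1 hb00 hab hθ0 hθ1 hθc hnc (fun x hx => hD ξ hξ x ⟨hx.1, by linarith [hx.2]⟩) ev2 k j l hj hl t ht')
    refine this.trans (le_of_eq ?_)
    rw [hCQ]; ring
  have hstart : (PP q n (betaS q - ξ))^[T1] (fun σ => if SS σ k < b0 then 1 else 0) (fun _ => k) ≤ ε' := by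
    rcases hT1 with h | h
    · have hS : SS (fun _ : Fin n => k) k = 1 := by unfold SS cn; simp [hn.ne']
      rw [h, Function.iterate_zero, id, hS, if_neg (by linarith)]
      exact hε'.le
    · refine l1 n hn ξ φ ψ hξ hξ1 hβ (hN0.trans hN) hPH k T1 (fun t ht => hQ t (by omega)) (h.trans ?_)
      have : 0 ≤ γ2 * winw n ξ := by positivity
      linarith only [this]
  have hfin := l2 n hn2' (betaS q - ξ) hβ (by linarith) k T1 T2 hQ hstart (hT2.trans (by
    have : 0 ≤ γ1 * n := by positivity
    linarith only [this]))
  have hdev := MU_dev (β := betaS q - ξ) hq0 hn k hB0 (C := CW) (fun j =>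
    MU_WW hq hn hβ hβq hκβ haκ ha0 hκ hκ1 ((hD ξ hξ a ⟨hab.le, by linarith⟩).trans (by linarith)) k j u2)
  rw [hBe] at hdev
  have hg := abs_le_glauberDist (β := betaS q - ξ) hq0 (T1 + T2) (univ.filter fun τ : Fin n → Fin q => m (SS τ k) ≤ B / Real.sqrt n) (fun _ => k)
  have hA : (fun τ : Fin n → Fin q => if τ ∈ (univ.filter fun τ : Fin n → Fin q => m (SS τ k) ≤ B / Real.sqrt n) then (1:ℝ) else 0)
      = fun τ => if m (SS τ k) ≤ B / Real.sqrt n then 1 else 0 := by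
    funext τ; simp
  rw [hA] at hg
  have hMU : 1 ≤ MU q n (betaS q - ξ) (fun σ => if m (SS σ k) ≤ B / Real.sqrt n then 1 else 0)
      + MU q n (betaS q - ξ) (fun σ => if B / Real.sqrt n < SS σ k - 1 / q then 1 else 0) := by
    rw [← MU_add]
    refine (MU_const (q := q) (n := n) (β := betaS q - ξ) hq0 1).symm.le.trans ?_
    apply MU_mono hq0
    intro σ
    have := hm.le (SS σ k)
    show (1:ℝ) ≤ (if m (SS σ k) ≤ B / Real.sqrt n then 1 else 0) + (if B / Real.sqrt n < SS σ k - 1 / q then 1 else 0)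
    by_cases h : m (SS σ k) ≤ B / Real.sqrt n
    · rw [if_pos h]; split_ifs <;> norm_num
    · rw [if_neg h, if_pos (by linarith), zero_add]
  have := (abs_le.mp hg).1
  linarith only [this, hMU, hdev, hfin]

end

theorem near_critical_cutoff (q : ℕ) (hq : 3 ≤ q) (ξ : ℕ → ℝ)
    (hξpos : ∀ n, 0 < ξ n)
    (hξ0 : Tendsto ξ atTop (nhds 0))
    (hξslow : Tendsto (fun n : ℕ => (n : ℝ) ^ ((2 : ℝ) / 3) * ξ n) atTop atTop) :
    ∃ α₂ : ℝ, 0 < α₂ ∧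
      ∀ ε ∈ Set.Ioo (0 : ℝ) (1 / 2), ∃ γ : ℝ, 0 < γ ∧
        ∀ᶠ n : ℕ in atTop,
          (mixingTime q n (betaS q - ξ n) ε : ℝ) ≤
              alpha1 (betaS q - ξ n) q * n * Real.log n + α₂ * n / Real.sqrt (ξ n)
                + γ * ((n : ℝ) + (n : ℝ) ^ ((1 : ℝ) / 2) * ξ n ^ (-(5 : ℝ) / 4)) ∧
          alpha1 (betaS q - ξ n) q * n * Real.log n + α₂ * n / Real.sqrt (ξ n)
              - γ * ((n : ℝ) + (n : ℝ) ^ ((1 : ℝ) / 2) * ξ n ^ (-(5 : ℝ) / 4)) ≤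
            (mixingTime q n (betaS q - ξ n) (1 - ε) : ℝ) := by
  have hq0 : 0 < q := by omega
  have hq' : (0:ℝ) < q := by positivity
  obtain ⟨κ0, ρ, cD, hκ, hκ1, hκb, hρ, hρ2, hqρ, hcD, hD⟩ := setup hq
  obtain ⟨bs1, bsq⟩ := betaS_facts hq
  obtain ⟨α₂, hα, HH⟩ := phase_PH hq
  have hρ0 := hρ.1
  obtain ⟨K, hK, H⟩ := HH (1 / q + ρ / 4) (by linarith) (by linarith)
  refine ⟨α₂, hα, ?_⟩
  rintro ε ⟨hε, hε2⟩
  obtain ⟨γU, hγU, NU, hNU, evU⟩ := Upper hq hκ hκ1 hκb hρ hcD hD hα hK H hε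
  obtain ⟨γL, hγL, NL, hNL, evL⟩ := Lower hq hκ hκ1 hκb hρ0 hρ2 hqρ hcD hD hα hK H (half_pos hε)
  refine ⟨γU + 2 * γL + 2, by positivity, ?_⟩
  have e1 : ∀ᶠ n : ℕ in atTop, ξ n ≤ 1 := by
    filter_upwards [hξ0.eventually (gt_mem_nhds one_pos)] with n h using h.le
  have e2 : ∀ᶠ n : ℕ in atTop, max NU NL ≤ ((n : ℝ) ^ ((2 : ℝ) / 3) * ξ n) ^ ((3:ℝ) / 2) :=
    ((tendsto_rpow_atTop (by norm_num : (0:ℝ) < 3 / 2)).comp hξslow).eventually_ge_atTop _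
  have e3 : ∀ᶠ n : ℕ in atTop, 2 * γL ≤ Real.log n :=
    (Real.tendsto_log_atTop.comp tendsto_natCast_atTop_atTop).eventually_ge_atTop _
  filter_upwards [e1, e2, e3, evU, evL, eventually_ge_atTop 1] with n e1 e2 e3 evU evL hn
  have hn1 : (1:ℝ) ≤ n := by exact_mod_cast hn
  have hn' : (0:ℝ) < n := by linarith
  have hξn := hξpos n
  have hN : max NU NL ≤ n * (ξ n * Real.sqrt (ξ n)) := by
    refine e2.trans (le_of_eq ?_)
    rw [Real.mul_rpow (by positivity) hξn.le, ← Real.rpow_mul hn'.le]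
    norm_num
    left
    rw [show (3:ℝ) / 2 = 1 + 1 / 2 by norm_num, Real.rpow_add hξn, Real.rpow_one, Real.sqrt_eq_rpow]
  have hNU' := (le_max_left _ _).trans hN
  have hNL' := (le_max_right _ _).trans hN
  obtain ⟨w1, -, -, -⟩ := win (by omega) hξn e1 (hNU.trans hNU')
  have evU := evU (ξ n) hξn e1 hNU'
  have evL := evL (ξ n) hξn e1 hNL'
  change _ ≤ _ + (γU + 2 * γL + 2) * winw n (ξ n) ∧ _ - (γU + 2 * γL + 2) * winw n (ξ n) ≤ _
  set w := winw n (ξ n)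
  have hw0 : 0 < w := by linarith
  have hκβ : 2 * (betaS q - ξ n) / q ≤ 1 - κ0 := by rw [← hκb]; gcongr; linarith
  have hβ : 0 ≤ 2 * (betaS q - ξ n) / q := div_nonneg (by linarith) hq'.le
  have ha1 : 1 / 2 ≤ alpha1 (betaS q - ξ n) q := by
    unfold alpha1
    apply one_div_le_one_div_of_le <;> linarith
  obtain ⟨T, hT, hTg⟩ := evU
  constructor
  · have h1 : mixingTime q n (betaS q - ξ n) ε ≤ T := Nat.sInf_le hTg
    have h2 : (mixingTime q n (betaS q - ξ n) ε : ℝ) ≤ T := by exact_mod_cast h1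
    have h3 : 0 ≤ (2 * γL + 2) * w := by positivity
    linarith only [h2, h3, hT]
  · have hmem : mixingTime q n (betaS q - ξ n) (1 - ε) ∈ {t : ℕ | glauberDist q n (betaS q - ξ n) t ≤ 1 - ε} :=
      Nat.sInf_mem ⟨T, hTg.trans (by linarith)⟩
    have hmem' : glauberDist q n (betaS q - ξ n) (mixingTime q n (betaS q - ξ n) (1 - ε)) ≤ 1 - ε := hmem
    set x1 := α₂ * n / Real.sqrt (ξ n) - γL * w with hx1
    set x2 := alpha1 (betaS q - ξ n) q * n * Real.log n - γL * n with hx2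
    have hx20 : 0 ≤ x2 := by
      have h1 : 1 / 2 * n * Real.log n ≤ alpha1 (betaS q - ξ n) q * n * Real.log n := by
        have := Real.log_nonneg hn1
        gcongr
      have h2 : 2 * γL * n ≤ Real.log n * n := by gcongr
      linarith only [h1, h2, hx2]
    have hL := evL ⌊x1⌋₊ ⌊x2⌋₊ (by
      rcases le_or_gt 0 x1 with h | h
      · right; exact Nat.floor_le h
      · left; exact Nat.floor_of_nonpos h.le) (Nat.floor_le hx20)
    have hlt : ⌊x1⌋₊ + ⌊x2⌋₊ < mixingTime q n (betaS q - ξ n) (1 - ε) := by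
      by_contra hcon
      push Not at hcon
      have := glauberDist_anti (β := betaS q - ξ n) hq0 (n := n) (by omega) hcon
      linarith only [this, hL, hmem', hε]
    have hlt' : ((⌊x1⌋₊ : ℝ) + ⌊x2⌋₊) ≤ mixingTime q n (betaS q - ξ n) (1 - ε) := by exact_mod_cast hlt.le
    have f1 := (Nat.lt_floor_add_one x1).le
    have f2 := (Nat.lt_floor_add_one x2).le
    have h3 : 0 ≤ γU * w := by positivity
    have h4 : γL * n ≤ γL * w := by gcongr
    linarith only [hlt', f1, f2, h3, h4, hx1, hx2, w1, hn1]
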